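/- Let u_n be a blowing-up sequence as in the hypotheses of the main theorem, with blow-up point p = (1,0) ∈ ∂𝔻, and set Φ(p) = h(p) + √(h(p)² + K(p)). Then the principal value identity p.v. ∫_{∂𝔻} (h(p) − h(z)) / (2(1 − x)) dσ(z) = −(π/2) · K_x(p)/Φ(p) holds, where z = (x,y) ∈ ∂𝔻 and K_x denotes the partial derivative of K in the x-direction (the outward normal direction at p). Equivalently, 2(−Δ)^{1/2} h(p) + K_x(p)/Φ(p) = 0, where (−Δ)^{1/2} h(p) := (1/π) p.v. ∫_{∂𝔻} (h(p) − h(z))/(2(1−x)) dσ(z), i.e. Φ_ν(p) = 0. -/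

import Mathlib

open MeasureTheory Filter

noncomputable section

/-- The open unit disk in ℝ² ≅ ℂ. -/
def unitDisk : Set ℂ := Metric.ball 0 1

/-- The closed unit disk. -/
def unitClosedDisk : Set ℂ := Metric.closedBall 0 1

/-- The unit circle ∂𝔻. -/
def unitCircle : Set ℂ := Metric.sphere 0 1

/-- Arc-length measure: the 1-dimensional Hausdorff measure on ℂ. -/
def arcMeasure : Measure ℂ := μH[1]

/-- Directional derivative of `u` at `z` in direction `v`. -/
def dirDeriv (v : ℂ) (u : ℂ → ℝ) (z : ℂ) : ℝ := fderiv ℝ u z v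

/-- Euclidean gradient of `u` at `z`, realized as a complex number. -/
def grad (u : ℂ → ℝ) (z : ℂ) : ℂ := ⟨dirDeriv 1 u z, dirDeriv Complex.I u z⟩

/-- Euclidean Laplacian. -/
def lap (u : ℂ → ℝ) (z : ℂ) : ℝ :=
  dirDeriv 1 (dirDeriv 1 u) z + dirDeriv Complex.I (dirDeriv Complex.I u) z

/-- Outward normal derivative on the unit circle: ν(z) = z. -/
def normalDeriv (u : ℂ → ℝ) (z : ℂ) : ℝ := fderiv ℝ u z z

/-- Tangential derivative on the unit circle: τ(z) = iz. -/
def tangentialDeriv (u : ℂ → ℝ) (z : ℂ) : ℝ := fderiv ℝ u z (Complex.I * z)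

/-- Euclidean dot product on ℂ ≅ ℝ². -/
def dot (z w : ℂ) : ℝ := z.re * w.re + z.im * w.im

/-- `u` solves `-Δu = 2K e^u` in 𝔻, `∂u/∂ν + 2 = 2h e^{u/2}` on ∂𝔻. -/
def SolvesLiouville (K h u : ℂ → ℝ) : Prop :=
  (∀ z ∈ unitDisk, -lap u z = 2 * K z * Real.exp (u z)) ∧
  (∀ z ∈ unitCircle, normalDeriv u z + 2 = 2 * h z * Real.exp (u z / 2))

/-- Convergence in C² on a set: uniform convergence of the derivatives up to order 2. -/
def TendstoC2On (F : ℕ → ℂ → ℝ) (G : ℂ → ℝ) (s : Set ℂ) : Prop :=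
  ∀ i : ℕ, i ≤ 2 →
    TendstoUniformlyOn (fun n => iteratedFDeriv ℝ i (F n)) (iteratedFDeriv ℝ i G)
      Filter.atTop s

/-- `sup u_n → +∞` on the closed disk. -/
def BlowsUp (u : ℕ → ℂ → ℝ) : Prop :=
  ∀ M : ℝ, ∀ᶠ n in Filter.atTop, ∃ z ∈ unitClosedDisk, M < u n z

/-- `u_n → -∞` locally uniformly on `s`. -/
def TendstoLocallyUniformlyBotOn (u : ℕ → ℂ → ℝ) (s : Set ℂ) : Prop :=
  ∀ (M : ℝ) (S : Set ℂ), IsCompact S → S ⊆ s →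
    ∀ᶠ n in Filter.atTop, ∀ z ∈ S, u n z < M

/-- Bounded total mass: area plus boundary length. -/
def MassBound (u : ℕ → ℂ → ℝ) (C : ℝ) : Prop :=
  ∀ n, (∫ z in unitDisk, Real.exp (u n z)) +
       (∫ z in unitCircle, Real.exp (u n z / 2) ∂arcMeasure) ≤ C

open Set Topology
open scoped ComplexConjugate Real ENNReal

/-! ### The disk in polar coordinates and the Gauss–Green formula -/

/-- The point of the unit circle with argument `θ`. -/
def cis (θ : ℝ) : ℂ := Complex.exp (θ * Complex.I)

lemma hasDerivAt_cis (θ : ℝ) : HasDerivAt cis (Complex.I * cis θ) θ := by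
  have h1 : HasDerivAt (fun t : ℝ => (t : ℂ) * Complex.I) Complex.I θ := by
    simpa using (Complex.ofRealCLM.hasDerivAt (x := θ)).mul_const Complex.I
  have := h1.cexp
  rw [mul_comm] at this
  exact this

lemma continuous_cis : Continuous cis := by unfold cis; fun_prop

lemma norm_cis (θ : ℝ) : ‖cis θ‖ = 1 := Complex.norm_exp_ofReal_mul_I θ

lemma cis_mul_conj (θ : ℝ) : cis θ * conj (cis θ) = 1 := by
  rw [Complex.mul_conj, Complex.normSq_eq_norm_sq, norm_cis]; simp

lemma cis_eq (θ : ℝ) : cis θ = Real.cos θ + Real.sin θ * Complex.I := by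
  rw [cis, Complex.exp_mul_I]; simp

lemma cis_re (θ : ℝ) : (cis θ).re = Real.cos θ := Complex.exp_ofReal_mul_I_re θ

lemma cis_im (θ : ℝ) : (cis θ).im = Real.sin θ := Complex.exp_ofReal_mul_I_im θ

lemma cis_pi : cis π = -1 := by simp [cis]
lemma cis_neg_pi : cis (-π) = -1 := by simp [cis_eq]

lemma cis_neg (θ : ℝ) : cis (-θ) = conj (cis θ) := by
  simp [cis_eq, Complex.ext_iff]

lemma cis_add (a b : ℝ) : cis (a + b) = cis a * cis b := by
  simp [cis, ← Complex.exp_add, add_mul]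

lemma polar_hasFDerivAt (x : ℝ × ℝ) :
    HasFDerivAt (fun x : ℝ × ℝ => (x.1 : ℂ) * cis x.2)
      ((ContinuousLinearMap.fst ℝ ℝ ℝ).smulRight (cis x.2) +
        (ContinuousLinearMap.snd ℝ ℝ ℝ).smulRight (x.1 * (Complex.I * cis x.2))) x := by
  have h1 : HasFDerivAt (fun x : ℝ × ℝ => (x.1 : ℂ))
      (Complex.ofRealCLM.comp (ContinuousLinearMap.fst ℝ ℝ ℝ)) x :=
    Complex.ofRealCLM.hasFDerivAt.comp x hasFDerivAt_fst
  have h2 : HasFDerivAt (fun x : ℝ × ℝ => cis x.2) _ x :=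
    (hasDerivAt_cis x.2).hasFDerivAt.comp x hasFDerivAt_snd
  refine (h1.mul h2).congr_fderiv ?_
  ext <;> simp

lemma integral_disk_polar (f : ℂ → ℂ) :
    ∫ z in Metric.ball (0 : ℂ) 1, f z =
      ∫ x in Icc ((0 : ℝ), -π) (1, π), (x.1 : ℂ) * f (x.1 * cis x.2) := by
  rw [← integral_indicator Metric.isOpen_ball.measurableSet,
    ← Complex.integral_comp_polarCoord_symm]
  rw [polarCoord_target, show Icc ((0 : ℝ), -π) (1, π) = Icc (0 : ℝ) 1 ×ˢ Icc (-π) π from Icc_prod_eq _ _]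
  rw [setIntegral_congr_set (s := Icc (0 : ℝ) 1 ×ˢ Icc (-π) π) (t := Ioo (0 : ℝ) 1 ×ˢ Ioo (-π) π)]
  · rw [← integral_indicator (measurableSet_Ioi.prod measurableSet_Ioo),
      ← integral_indicator (measurableSet_Ioo.prod measurableSet_Ioo)]
    congr 1
    ext x
    by_cases hx : x ∈ Ioi (0 : ℝ) ×ˢ Ioo (-π) π
    · rw [indicator_of_mem hx]
      have e1 : Complex.polarCoord.symm x = x.1 * cis x.2 := by
        rw [Complex.polarCoord_symm_apply, cis_eq]
      have e2 : ‖(x.1 : ℂ) * cis x.2‖ = x.1 := by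
        rw [norm_mul, norm_cis, mul_one, Complex.norm_real, Real.norm_of_nonneg (le_of_lt hx.1)]
      rw [e1]
      by_cases h1 : x.1 < 1
      · rw [indicator_of_mem (by simpa [norm_cis] using (e2.trans_lt h1)),
          indicator_of_mem (by exact ⟨⟨hx.1, h1⟩, hx.2⟩)]
        simp
      · rw [indicator_of_notMem (by rw [mem_ball_zero_iff, e2]; exact h1),
          indicator_of_notMem (by rintro ⟨⟨_, h⟩, _⟩; exact h1 h)]
        simp
    · rw [indicator_of_notMem hx, indicator_of_notMem]
      rintro ⟨⟨h, _⟩, h'⟩; exact hx ⟨h, h'⟩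
  · rw [Measure.volume_eq_prod]
    exact (Measure.set_prod_ae_eq Ioo_ae_eq_Icc Ioo_ae_eq_Icc).symm

/-- Gauss–Green formula on the unit disk. -/
lemma integral_disk_fderiv {F : ℂ → ℂ} {U : Set ℂ} (hU : IsOpen U)
    (hUD : Metric.closedBall 0 1 ⊆ U) (hF : ContDiffOn ℝ 1 F U) (v : ℂ) :
    ∫ z in Metric.ball (0 : ℂ) 1, fderiv ℝ F z v =
      ∫ θ in (-π)..π, ((conj v * cis θ).re : ℂ) * F (cis θ) := by
  have hcd : ContinuousOn (fun z => fderiv ℝ F z v) U :=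
    (hF.continuousOn_fderiv_of_isOpen hU le_rfl).clm_apply continuousOn_const
  rw [integral_disk_polar]
  set P : ℝ × ℝ → ℂ := fun x => (x.1 : ℂ) * cis x.2 with hP
  have hPc : Continuous P := by
    have := continuous_cis
    fun_prop
  have hmem : ∀ x ∈ Icc ((0 : ℝ), -π) (1, π), P x ∈ U := by
    intro x hx
    apply hUD
    rw [mem_closedBall_zero_iff, hP]
    simp only [norm_mul, norm_cis, mul_one, Complex.norm_real]
    rw [Real.norm_of_nonneg hx.1.1]
    exact hx.2.1
  let c : ℝ → ℝ := fun θ => (conj v * cis θ).re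
  let s : ℝ → ℝ := fun θ => (conj v * (Complex.I * cis θ)).re
  have hc : ∀ θ, HasDerivAt c (s θ) θ := fun θ =>
    Complex.reCLM.hasFDerivAt.comp_hasDerivAt θ ((hasDerivAt_cis θ).const_mul (conj v))
  have hs : ∀ θ, HasDerivAt s (- c θ) θ := fun θ => by
    have := Complex.reCLM.hasFDerivAt.comp_hasDerivAt θ
      (((hasDerivAt_cis θ).const_mul Complex.I).const_mul (conj v))
    refine this.congr_deriv ?_
    rw [Complex.reCLM_apply, ← mul_assoc Complex.I, Complex.I_mul_I]
    simp [c]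
  have hcc : Continuous c := continuous_iff_continuousAt.2 fun θ => (hc θ).continuousAt
  have hsc : Continuous s := continuous_iff_continuousAt.2 fun θ => (hs θ).continuousAt
  let f : ℝ × ℝ → ℂ := fun x => (x.1 * c x.2) • F (P x)
  let g : ℝ × ℝ → ℂ := fun x => (s x.2) • F (P x)
  have hFc : ContinuousOn (fun x => F (P x)) (Icc ((0 : ℝ), -π) (1, π)) :=
    hF.continuousOn.comp hPc.continuousOn hmem
  have hdF : ∀ x ∈ Ioo (0 : ℝ) 1 ×ˢ Ioo (-π) π, HasFDerivAt (fun x => F (P x))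
      ((fderiv ℝ F (P x)).comp ((ContinuousLinearMap.fst ℝ ℝ ℝ).smulRight (cis x.2) +
        (ContinuousLinearMap.snd ℝ ℝ ℝ).smulRight (x.1 * (Complex.I * cis x.2)))) x := by
    intro x hx
    have hPU : P x ∈ U := hmem x ⟨⟨hx.1.1.le, hx.2.1.le⟩, ⟨hx.1.2.le, hx.2.2.le⟩⟩
    have := ((hF.differentiableOn one_ne_zero).differentiableAt (hU.mem_nhds hPU)).hasFDerivAt
    exact this.comp x (polar_hasFDerivAt x)
  have hdc : ∀ x : ℝ × ℝ, HasFDerivAt (fun x : ℝ × ℝ => x.1 * c x.2) _ x := fun x =>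
    (hasFDerivAt_fst (𝕜 := ℝ) (p := x)).mul
      ((hc x.2).hasFDerivAt.comp x (hasFDerivAt_snd (𝕜 := ℝ) (p := x)))
  have hds : ∀ x : ℝ × ℝ, HasFDerivAt (fun x : ℝ × ℝ => s x.2) _ x := fun x =>
    ((hs x.2).hasFDerivAt.comp x (hasFDerivAt_snd (𝕜 := ℝ) (p := x)))
  have key : ∀ x : ℝ × ℝ, ∀ L : ℂ →L[ℝ] ℂ,
      ((x.1 : ℂ) * c x.2) * L (cis x.2) + s x.2 * L (x.1 * (Complex.I * cis x.2)) =
        x.1 * L v := by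
    intro x L
    have h1 : L (x.1 * (Complex.I * cis x.2)) = x.1 * L (Complex.I * cis x.2) := by
      rw [← Complex.real_smul, map_smul, Complex.real_smul]
    have h2 : v = (c x.2) • cis x.2 + (s x.2) • (Complex.I * cis x.2) := by
      have := Real.sin_sq_add_cos_sq x.2
      apply Complex.ext
      · simp only [c, s, cis_re, cis_im, Complex.add_re, Complex.smul_re, Complex.mul_re,
          Complex.mul_im, Complex.conj_re, Complex.conj_im, Complex.I_re, Complex.I_im,
          smul_eq_mul]
        linear_combination (-v.re) * this
      · simp only [c, s, cis_re, cis_im, Complex.add_im, Complex.smul_im, Complex.mul_re,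
          Complex.mul_im, Complex.conj_re, Complex.conj_im, Complex.I_re, Complex.I_im,
          smul_eq_mul]
        linear_combination (-v.im) * this
    conv_rhs => rw [h2]
    rw [h1, map_add, map_smul, map_smul, Complex.real_smul, Complex.real_smul]
    ring
  have hdiv := integral_divergence_prod_Icc_of_hasFDerivAt_of_le f g
    (fun x => (x.1 * c x.2) • ((fderiv ℝ F (P x)).comp ((ContinuousLinearMap.fst ℝ ℝ ℝ).smulRight (cis x.2) +
        (ContinuousLinearMap.snd ℝ ℝ ℝ).smulRight (x.1 * (Complex.I * cis x.2)))) + 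
        (x.1 • (ContinuousLinearMap.toSpanSingleton ℝ (s x.2)).comp (ContinuousLinearMap.snd ℝ ℝ ℝ) + c x.2 • ContinuousLinearMap.fst ℝ ℝ ℝ).smulRight (F (P x)))
    (fun x => (s x.2) • ((fderiv ℝ F (P x)).comp ((ContinuousLinearMap.fst ℝ ℝ ℝ).smulRight (cis x.2) +
        (ContinuousLinearMap.snd ℝ ℝ ℝ).smulRight (x.1 * (Complex.I * cis x.2)))) + 
        ((ContinuousLinearMap.toSpanSingleton ℝ (- c x.2)).comp (ContinuousLinearMap.snd ℝ ℝ ℝ)).smulRight (F (P x)))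
    (0, -π) (1, π) ⟨zero_le_one, by simp; linarith [Real.pi_pos]⟩
    (ContinuousOn.smul (f := fun x : ℝ × ℝ => x.1 * c x.2) (by fun_prop) hFc)
    (ContinuousOn.smul (f := fun x : ℝ × ℝ => s x.2) (by fun_prop) hFc)
    (fun x hx => by
      refine ((hdc x).smul (hdF x hx)).congr_fderiv ?_
      rfl)
    (fun x hx => by
      refine ((hds x).smul (hdF x hx)).congr_fderiv ?_
      rfl) ?_
  · have e1 : ∀ x : ℝ × ℝ, (x.1 : ℂ) * (fderiv ℝ F (x.1 * cis x.2) v) =  _ := fun x => (key x (fderiv ℝ F (P x))).symm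
    simp only [e1]
    simp [g, f, P, cis_pi, cis_neg_pi, s, c] at hdiv
    convert hdiv using 2
    · ext x
      simp [c, s, P]
      ring
    · ext x
      simp
  · have hI : ContinuousOn (fun x : ℝ × ℝ => (x.1 : ℂ) * fderiv ℝ F (P x) v) (Icc ((0 : ℝ), -π) (1, π)) :=
      ContinuousOn.mul (by fun_prop) (hcd.comp hPc.continuousOn hmem)
    refine (hI.integrableOn_compact isCompact_Icc).congr_fun (fun x _ => ?_) measurableSet_Icc
    simp only []
    rw [← key]
    simp
    ring

/-! ### Wirtinger derivatives -/

/-- The real-linear map `v ↦ a v + b v̄`. -/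
def wL (a b : ℂ) : ℂ →L[ℝ] ℂ :=
  a • ContinuousLinearMap.id ℝ ℂ + b • (Complex.conjCLE : ℂ →L[ℝ] ℂ)

@[simp] lemma wL_apply (a b v : ℂ) : wL a b v = a * v + b * conj v := by
  simp [wL]

/-- `F` is real differentiable at `z` with Wirtinger derivatives `a` and `b`. -/
def HasW (F : ℂ → ℂ) (a b z : ℂ) : Prop := HasFDerivAt F (wL a b) z

/-- The Wirtinger derivative with respect to `z`. -/
def dz (F : ℂ → ℂ) (z : ℂ) : ℂ := (fderiv ℝ F z 1 - Complex.I * fderiv ℝ F z Complex.I) / 2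

/-- The Wirtinger derivative with respect to the conjugate variable. -/
def dzb (F : ℂ → ℂ) (z : ℂ) : ℂ := (fderiv ℝ F z 1 + Complex.I * fderiv ℝ F z Complex.I) / 2

lemma clm_eq_wL (L : ℂ →L[ℝ] ℂ) :
    L = wL ((L 1 - Complex.I * L Complex.I) / 2) ((L 1 + Complex.I * L Complex.I) / 2) := by
  ext v
  conv_lhs => rw [show v = v.re • (1 : ℂ) + v.im • Complex.I by
    apply Complex.ext <;> simp]
  have hI := Complex.I_mul_I
  have h1 : v = v.re + v.im * Complex.I := (Complex.re_add_im v).symm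
  have h2 : conj v = v.re - v.im * Complex.I := by
    apply Complex.ext <;> simp
  rw [map_add, map_smul, map_smul, Complex.real_smul, Complex.real_smul, wL_apply, h2]
  conv_rhs => rw [h1]
  simp only [Complex.add_re, Complex.ofReal_re, Complex.mul_re, Complex.add_im, Complex.mul_im,
    Complex.ofReal_im, Complex.I_re, Complex.I_im]
  push_cast
  linear_combination (L Complex.I * v.im) * hI

lemma DifferentiableAt.hasW {F : ℂ → ℂ} {z : ℂ} (h : DifferentiableAt ℝ F z) :
    HasW F (dz F z) (dzb F z) z := by
  unfold HasW dz dzb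
  rw [← clm_eq_wL]
  exact h.hasFDerivAt

namespace HasW

variable {F G : ℂ → ℂ} {a b c d z : ℂ}

lemma dz_eq (h : HasW F a b z) : dz F z = a := by
  unfold dz; rw [HasFDerivAt.fderiv h]; simp
  linear_combination (-1 / 2 * (a - b)) * Complex.I_mul_I

lemma dzb_eq (h : HasW F a b z) : dzb F z = b := by
  unfold dzb; rw [HasFDerivAt.fderiv h]; simp
  linear_combination (1 / 2 * (a - b)) * Complex.I_mul_I

lemma congr (h : HasW F a b z) (ha : a = c) (hb : b = d) : HasW F c d z := by
  subst ha hb; exact h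

lemma add (hF : HasW F a b z) (hG : HasW G c d z) :
    HasW (fun z => F z + G z) (a + c) (b + d) z := by
  refine (HasFDerivAt.add hF hG).congr_fderiv ?_
  ext v; simp; ring

lemma sub (hF : HasW F a b z) (hG : HasW G c d z) :
    HasW (fun z => F z - G z) (a - c) (b - d) z := by
  refine (HasFDerivAt.sub hF hG).congr_fderiv ?_
  ext v; simp; ring

lemma mul (hF : HasW F a b z) (hG : HasW G c d z) :
    HasW (fun z => F z * G z) (a * G z + F z * c) (b * G z + F z * d) z := by
  refine (HasFDerivAt.mul hF hG).congr_fderiv ?_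
  ext v; simp; ring

lemma const_mul (k : ℂ) (hF : HasW F a b z) :
    HasW (fun z => k * F z) (k * a) (k * b) z := by
  refine (HasFDerivAt.const_mul hF k).congr_fderiv ?_
  ext v; simp; ring

lemma comp_holo {f : ℂ → ℂ} {f' : ℂ} (hf : HasDerivAt f f' (F z)) (hF : HasW F a b z) :
    HasW (fun z => f (F z)) (f' * a) (f' * b) z := by
  refine ((hf.hasFDerivAt.restrictScalars ℝ).comp z hF).congr_fderiv ?_
  ext v; simp; ring

lemma star (hF : HasW F a b z) :
    HasW (fun z => (starRingEnd ℂ) (F z)) ((starRingEnd ℂ) b) ((starRingEnd ℂ) a) z := by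
  have hc : HasFDerivAt (fun z : ℂ => (starRingEnd ℂ) z) (Complex.conjCLE : ℂ →L[ℝ] ℂ) (F z) :=
    Complex.conjCLE.hasFDerivAt
  refine (hc.comp z hF).congr_fderiv ?_
  ext v; simp; ring

lemma comp_curve {γ : ℝ → ℂ} {γ' : ℂ} {t : ℝ} (hF : HasW F a b (γ t)) (hγ : HasDerivAt γ γ' t) :
    HasDerivAt (fun t => F (γ t)) (a * γ' + b * (starRingEnd ℂ) γ') t := by
  refine (HasFDerivAt.comp_hasDerivAt t hF hγ).congr_deriv ?_
  simp

end HasW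

lemma hasW_const (c z : ℂ) : HasW (fun _ => c) 0 0 z := by
  refine (hasFDerivAt_const c z).congr_fderiv ?_
  ext v; simp

lemma hasW_id (z : ℂ) : HasW (fun z => z) 1 0 z := by
  refine (hasFDerivAt_id z).congr_fderiv ?_
  ext v; simp

lemma hasW_conj (z : ℂ) : HasW (fun z => conj z) 0 1 z := by
  simpa using (hasW_id z).star

lemma HasDerivAt.hasW {f : ℂ → ℂ} {f' z : ℂ} (h : HasDerivAt f f' z) : HasW f f' 0 z := by
  simpa using HasW.comp_holo h (hasW_id z)

lemma dzb_ofReal (f : ℂ → ℝ) (z : ℂ) (hf : DifferentiableAt ℝ f z) :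
    dzb (fun z => (f z : ℂ)) z = conj (dz (fun z => (f z : ℂ)) z) := by
  have h : DifferentiableAt ℝ (fun z => (f z : ℂ)) z :=
    Complex.ofRealCLM.differentiableAt.comp z hf
  have h1 := h.hasW.star
  simp only [Complex.conj_ofReal] at h1
  exact h1.dzb_eq

lemma fderiv_ofReal (f : ℂ → ℝ) (z v : ℂ) (hf : DifferentiableAt ℝ f z) :
    fderiv ℝ (fun z => (f z : ℂ)) z v = (fderiv ℝ f z v : ℂ) := by
  have : HasFDerivAt (fun z => (f z : ℂ)) (Complex.ofRealCLM.comp (fderiv ℝ f z)) z :=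
    Complex.ofRealCLM.hasFDerivAt.comp z hf.hasFDerivAt
  rw [this.fderiv]; rfl

lemma fderiv_eq_re_dz (f : ℂ → ℝ) (z v : ℂ) (hf : DifferentiableAt ℝ f z) :
    fderiv ℝ f z v = 2 * (dz (fun z => (f z : ℂ)) z * v).re := by
  rw [dz, fderiv_ofReal f z _ hf, fderiv_ofReal f z _ hf]
  have h1 : v = v.re • (1 : ℂ) + v.im • Complex.I := by
    apply Complex.ext <;> simp
  conv_lhs => rw [h1]
  rw [map_add, map_smul, map_smul]
  simp; ring

section smooth
variable {F : ℂ → ℂ} {U : Set ℂ} {n : ℕ∞}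

lemma contDiffOn_dz (hU : IsOpen U) (hF : ContDiffOn ℝ 2 F U) : ContDiffOn ℝ 1 (dz F) U := by
  have h := hF.fderiv_of_isOpen hU (m := 1) (by norm_num)
  unfold dz
  fun_prop

lemma contDiffOn_dzb (hU : IsOpen U) (hF : ContDiffOn ℝ 2 F U) : ContDiffOn ℝ 1 (dzb F) U := by
  have h := hF.fderiv_of_isOpen hU (m := 1) (by norm_num)
  unfold dzb
  fun_prop

lemma contDiff_dz (hF : ContDiff ℝ 2 F) : ContDiff ℝ 1 (dz F) := by
  rw [← contDiffOn_univ] at *; exact contDiffOn_dz isOpen_univ hF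

lemma continuousOn_dz (hU : IsOpen U) (hF : ContDiffOn ℝ 1 F U) : ContinuousOn (dz F) U := by
  have h := hF.continuousOn_fderiv_of_isOpen hU le_rfl
  unfold dz
  fun_prop

lemma continuousOn_dzb (hU : IsOpen U) (hF : ContDiffOn ℝ 1 F U) : ContinuousOn (dzb F) U := by
  have h := hF.continuousOn_fderiv_of_isOpen hU le_rfl
  unfold dzb
  fun_prop

lemma fderiv_fderiv_apply (hU : IsOpen U) (hF : ContDiffOn ℝ 2 F U) {z : ℂ} (hz : z ∈ U) (v : ℂ) :
    HasFDerivAt (fun z => fderiv ℝ F z v) ((fderiv ℝ (fderiv ℝ F) z).flip v) z := by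
  have h := hF.fderiv_of_isOpen hU (m := 1) (by norm_num)
  have h1 := (h.differentiableOn one_ne_zero).differentiableAt (hU.mem_nhds hz)
  have := h1.hasFDerivAt.clm_apply (hasFDerivAt_const v z)
  refine this.congr_fderiv ?_
  ext w; simp

lemma dz_dzb_comm (hU : IsOpen U) (hF : ContDiffOn ℝ 2 F U) {z : ℂ} (hz : z ∈ U) :
    dz (dzb F) z = dzb (dz F) z := by
  have hs : fderiv ℝ (fderiv ℝ F) z 1 Complex.I = fderiv ℝ (fderiv ℝ F) z Complex.I 1 :=
    ((hF.contDiffAt (hU.mem_nhds hz)).isSymmSndFDerivAt (by simp)).eq _ _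
  have h1 := fderiv_fderiv_apply hU hF hz 1
  have h2 := fderiv_fderiv_apply hU hF hz Complex.I
  have e1 : HasFDerivAt (dzb F) _ z := (h1.add (h2.const_mul Complex.I)).mul_const (1 / 2 : ℂ)
    |>.congr_of_eventuallyEq (Eventually.of_forall fun z => by simp [dzb, div_eq_mul_inv])
  have e2 : HasFDerivAt (dz F) _ z := (h1.sub (h2.const_mul Complex.I)).mul_const (1 / 2 : ℂ)
    |>.congr_of_eventuallyEq (Eventually.of_forall fun z => by simp [dz, div_eq_mul_inv])
  rw [dz, dzb, e1.fderiv, e2.fderiv]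
  simp [hs]
  ring

end smooth

/-- `∂_z u` for a real function `u`. -/
def pU (u : ℂ → ℝ) : ℂ → ℂ := dz (fun z => (u z : ℂ))

lemma contDiff_ofReal_comp {n : WithTop ℕ∞} {u : ℂ → ℝ} (hu : ContDiff ℝ n u) :
    ContDiff ℝ n (fun z => (u z : ℂ)) :=
  Complex.ofRealCLM.contDiff.comp hu

lemma hasW_ofReal {u : ℂ → ℝ} {z : ℂ} (hu : DifferentiableAt ℝ u z) :
    HasW (fun z => (u z : ℂ)) (pU u z) (conj (pU u z)) z := by
  have h : DifferentiableAt ℝ (fun z => (u z : ℂ)) z :=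
    Complex.ofRealCLM.differentiableAt.comp z hu
  exact h.hasW.congr rfl (dzb_ofReal u z hu)

lemma dzb_pU {u : ℂ → ℝ} (hu : ContDiff ℝ 2 u) (z : ℂ) : dzb (pU u) z = (lap u z / 4 : ℝ) := by
  have hd : Differentiable ℝ u := hu.differentiable (by norm_num)
  have e0 : pU u = fun z => ((dirDeriv 1 u z : ℂ) - Complex.I * dirDeriv Complex.I u z) / 2 := by
    ext z
    rw [pU, dz, fderiv_ofReal _ _ _ (hd z), fderiv_ofReal _ _ _ (hd z)]; rfl
  have hD : ∀ v, Differentiable ℝ (dirDeriv v u) := by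
    intro v
    have := hu.fderiv_right (m := 1) (by norm_num)
    exact (this.clm_apply contDiff_const).differentiable one_ne_zero
  have hs : dirDeriv 1 (dirDeriv Complex.I u) z = dirDeriv Complex.I (dirDeriv 1 u) z := by
    have h := hu.fderiv_right (m := 1) (by norm_num)
    have h1 := (h.differentiable one_ne_zero z).hasFDerivAt
    have h2 : ∀ v w, dirDeriv w (dirDeriv v u) z = fderiv ℝ (fderiv ℝ u) z w v := by
      intro v w
      have := (h1.clm_apply (hasFDerivAt_const v z)).fderiv
      unfold dirDeriv
      rw [this]; simp
    rw [h2, h2]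
    exact (hu.contDiffAt.isSymmSndFDerivAt (by simp)).eq _ _
  have h1 := hasW_ofReal (hD 1 z)
  have h2 := hasW_ofReal (hD Complex.I z)
  have h3 := (h1.sub (h2.const_mul Complex.I)).const_mul (1 / 2)
  rw [e0, show (fun z => ((dirDeriv 1 u z : ℂ) - Complex.I * dirDeriv Complex.I u z) / 2) =
    fun z => 1 / 2 * ((dirDeriv 1 u z : ℂ) - Complex.I * dirDeriv Complex.I u z) by ext; ring,
    h3.dzb_eq]
  unfold lap
  simp only [pU, dz, fderiv_ofReal _ _ _ (hD 1 z), fderiv_ofReal _ _ _ (hD Complex.I z)]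
  change 1 / 2 * (conj (((dirDeriv 1 (dirDeriv 1 u) z : ℂ) - Complex.I * (dirDeriv Complex.I (dirDeriv 1 u) z : ℂ)) / 2)
    - Complex.I * conj (((dirDeriv 1 (dirDeriv Complex.I u) z : ℂ) - Complex.I * (dirDeriv Complex.I (dirDeriv Complex.I u) z : ℂ)) / 2)) = _
  rw [hs]
  have h2 : (starRingEnd ℂ) 2 = 2 := Complex.conj_ofNat 2
  simp [h2]
  linear_combination (-1 / 4 * (dirDeriv Complex.I (dirDeriv Complex.I u) z : ℂ)) * Complex.I_mul_I

/-! ### The Hopf differential of a solution -/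

/-- The Hopf coefficient `u_zz - u_z² / 2`. -/
def hopf (u : ℂ → ℝ) (z : ℂ) : ℂ := dz (pU u) z - pU u z ^ 2 / 2

/-- The boundary density dual to test fields in the weak form of the Hopf identity. -/
def bdryDensity (K u : ℂ → ℝ) (θ : ℝ) : ℂ :=
  -(Complex.I / 2) * fderiv ℝ (pU u) (cis θ) (Complex.I * cis θ) -
    1 / 4 * (pU u (cis θ) ^ 2 * cis θ + K (cis θ) * Real.exp (u (cis θ)) * conj (cis θ))

lemma contDiff_pU {u : ℂ → ℝ} (hu : ContDiff ℝ 2 u) : ContDiff ℝ 1 (pU u) :=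
  contDiff_dz (contDiff_ofReal_comp hu)

lemma continuous_hopf {u : ℂ → ℝ} (hu : ContDiff ℝ 2 u) : Continuous (hopf u) := by
  have h1 := contDiff_pU hu
  have h2 : Continuous (dz (pU u)) := by
    rw [← continuousOn_univ]; exact continuousOn_dz isOpen_univ (contDiffOn_univ.2 h1)
  have h3 := h1.continuous
  unfold hopf
  fun_prop

lemma continuous_bdryDensity {K u : ℂ → ℝ} (hK : ContDiff ℝ 2 K) (hu : ContDiff ℝ 2 u) :
    Continuous (bdryDensity K u) := by
  have h1 := contDiff_pU hu
  have h2 := h1.continuous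
  have h3 := (h1.continuous_fderiv one_ne_zero)
  have := hK.continuous
  have := hu.continuous
  have := continuous_cis
  unfold bdryDensity
  have h4 : Continuous fun θ => fderiv ℝ (pU u) (cis θ) (Complex.I * cis θ) :=
    (h3.comp continuous_cis).clm_apply (by fun_prop)
  have h5 : Continuous fun θ => conj (cis θ) := Complex.continuous_conj.comp continuous_cis
  fun_prop

lemma SolvesLiouville.dzb_pU {K h u : ℂ → ℝ} (hu : ContDiff ℝ 2 u) (hs : SolvesLiouville K h u)
    {z : ℂ} (hz : z ∈ unitDisk) : dzb (pU u) z = -(1 / 2) * (K z * Real.exp (u z)) := by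
  have := hs.1 z hz
  rw [_root_.dzb_pU hu, show lap u z = -(2 * K z * Real.exp (u z)) by linarith]
  push_cast; ring

lemma continuous_re_mul_cis (v : ℂ) : Continuous fun θ => ((v * cis θ).re : ℂ) :=
  Complex.continuous_ofReal.comp (Complex.continuous_re.comp (continuous_const.mul continuous_cis))

lemma integral_disk_dz {F : ℂ → ℂ} {U : Set ℂ} (hU : IsOpen U)
    (hUD : Metric.closedBall 0 1 ⊆ U) (hF : ContDiffOn ℝ 1 F U) :
    ∫ z in Metric.ball (0 : ℂ) 1, dz F z =
      ∫ θ in (-π)..π, 1 / 2 * (conj (cis θ) * F (cis θ)) := by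
  have hc := hF.continuousOn_fderiv_of_isOpen hU le_rfl
  have hi : ∀ v, IntegrableOn (fun z => fderiv ℝ F z v) (Metric.ball (0 : ℂ) 1) := fun v =>
    (((hc.clm_apply continuousOn_const).mono hUD).integrableOn_compact
      (isCompact_closedBall 0 1)).mono_set Metric.ball_subset_closedBall
  have hFc : Continuous fun θ => F (cis θ) :=
    hF.continuousOn.comp_continuous continuous_cis fun θ => hUD (by simp [norm_cis])
  have hcis := continuous_cis
  have hcc : Continuous fun θ => conj (cis θ) := Complex.continuous_conj.comp continuous_cis
  unfold dz
  rw [integral_div, integral_sub (hi 1) ((hi _).const_mul _), integral_const_mul,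
    integral_disk_fderiv hU hUD hF, integral_disk_fderiv hU hUD hF,
    ← intervalIntegral.integral_const_mul, ← intervalIntegral.integral_sub,
    div_eq_inv_mul, ← intervalIntegral.integral_const_mul]
  · congr 1
    ext θ
    have : conj (cis θ) = Real.cos θ - Real.sin θ * Complex.I := by
      rw [← cis_neg, cis_eq]; simp [sub_eq_add_neg]
    rw [this]
    simp [cis_re, cis_im]
    ring
  · exact ((continuous_re_mul_cis _).mul hFc).intervalIntegrable _ _
  · exact (continuous_const.mul ((continuous_re_mul_cis _).mul hFc)).intervalIntegrable _ _

lemma integral_disk_dzb {F : ℂ → ℂ} {U : Set ℂ} (hU : IsOpen U)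
    (hUD : Metric.closedBall 0 1 ⊆ U) (hF : ContDiffOn ℝ 1 F U) :
    ∫ z in Metric.ball (0 : ℂ) 1, dzb F z =
      ∫ θ in (-π)..π, 1 / 2 * (cis θ * F (cis θ)) := by
  have hc := hF.continuousOn_fderiv_of_isOpen hU le_rfl
  have hi : ∀ v, IntegrableOn (fun z => fderiv ℝ F z v) (Metric.ball (0 : ℂ) 1) := fun v =>
    (((hc.clm_apply continuousOn_const).mono hUD).integrableOn_compact
      (isCompact_closedBall 0 1)).mono_set Metric.ball_subset_closedBall
  have hFc : Continuous fun θ => F (cis θ) :=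
    hF.continuousOn.comp_continuous continuous_cis fun θ => hUD (by simp [norm_cis])
  have hcis := continuous_cis
  unfold dzb
  rw [integral_div, integral_add (hi 1) ((hi _).const_mul _), integral_const_mul,
    integral_disk_fderiv hU hUD hF, integral_disk_fderiv hU hUD hF,
    ← intervalIntegral.integral_const_mul, ← intervalIntegral.integral_add,
    div_eq_inv_mul, ← intervalIntegral.integral_const_mul]
  · congr 1
    ext θ
    have : cis θ = Real.cos θ + Real.sin θ * Complex.I := cis_eq θ
    generalize F (cis θ) = y
    rw [this]
    simp
    ring
  · exact ((continuous_re_mul_cis _).mul hFc).intervalIntegrable _ _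
  · exact (continuous_const.mul ((continuous_re_mul_cis _).mul hFc)).intervalIntegrable _ _

lemma weak_hopf {K h u : ℂ → ℝ} (hK : ContDiff ℝ 2 K) (hu : ContDiff ℝ 2 u)
    (hs : SolvesLiouville K h u) {U : Set ℂ} (hU : IsOpen U)
    (hUD : Metric.closedBall 0 1 ⊆ U) {φ : ℂ → ℂ} (hφ : ContDiffOn ℝ 2 φ U) :
    ∫ z in Metric.ball (0 : ℂ) 1,
        (hopf u z * dzb φ z - 1 / 2 * pU K z * Real.exp (u z) * φ z) =
      ∫ θ in (-π)..π, φ (cis θ) * bdryDensity K u θ := by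
  have hp := contDiff_pU hu
  have hpd : Differentiable ℝ (pU u) := hp.differentiable one_ne_zero
  have hφ1 : ContDiffOn ℝ 1 φ U := hφ.of_le (by norm_num)
  have hφz := contDiffOn_dz hU hφ
  have hφzb := contDiffOn_dzb hU hφ
  have hKc : ContDiff ℝ 1 (fun z => (K z : ℂ)) := (contDiff_ofReal_comp hK).of_le (by norm_num)
  have huc : ContDiff ℝ 1 (fun z => (u z : ℂ)) := (contDiff_ofReal_comp hu).of_le (by norm_num)
  set A : ℂ → ℂ := fun z => pU u z * dzb φ z - 1 / 2 * ((K z : ℂ) * (Complex.exp (u z) * φ z))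
    with hA
  set B : ℂ → ℂ := fun z => pU u z * dz φ z + 1 / 2 * (pU u z * (pU u z * φ z)) with hB
  have hA1 : ContDiffOn ℝ 1 A U := by
    have h1 := hp.contDiffOn (s := U)
    have h2 := hKc.contDiffOn (s := U)
    have h3 : ContDiffOn ℝ 1 (fun z => Complex.exp (u z)) U := (huc.cexp).contDiffOn
    exact (h1.mul hφzb).sub (contDiffOn_const.mul (h2.mul (h3.mul hφ1)))
  have hB1 : ContDiffOn ℝ 1 B U := by
    have h1 := hp.contDiffOn (s := U)
    exact (h1.mul hφz).add (contDiffOn_const.mul (h1.mul (h1.mul hφ1)))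
  have hpt : ∀ z ∈ Metric.ball (0 : ℂ) 1,
      hopf u z * dzb φ z - 1 / 2 * pU K z * Real.exp (u z) * φ z = dz A z - dzb B z := by
    intro z hz
    have hzU : z ∈ U := hUD (Metric.ball_subset_closedBall hz)
    have hn := hU.mem_nhds hzU
    have w1 := (hpd z).hasW
    have w2 := ((hφ1.differentiableOn one_ne_zero).differentiableAt hn).hasW
    have w3 := ((hφz.differentiableOn one_ne_zero).differentiableAt hn).hasW
    have w4 := ((hφzb.differentiableOn one_ne_zero).differentiableAt hn).hasW
    have w5 := hasW_ofReal (hK.differentiable (by norm_num) z)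
    have w6 := HasW.comp_holo (Complex.hasDerivAt_exp (u z)) (hasW_ofReal (hu.differentiable (by norm_num) z))
    have e1 : dz A z = _ :=
      ((w1.mul w4).sub ((w5.mul (w6.mul w2)).const_mul (1 / 2))).dz_eq
    have e2 : dzb B z = _ := ((w1.mul w3).add ((w1.mul (w1.mul w2)).const_mul (1 / 2))).dzb_eq
    rw [e1, e2, dz_dzb_comm hU hφ hzU, hs.dzb_pU hu hz, hopf]
    push_cast
    ring
  rw [setIntegral_congr_fun Metric.isOpen_ball.measurableSet hpt, integral_sub,
    integral_disk_dz hU hUD hA1, integral_disk_dzb hU hUD hB1]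
  rotate_left
  · exact ((continuousOn_dz hU hA1).mono hUD).integrableOn_compact (isCompact_closedBall 0 1)
      |>.mono_set Metric.ball_subset_closedBall
  · exact ((continuousOn_dzb hU hB1).mono hUD).integrableOn_compact (isCompact_closedBall 0 1)
      |>.mono_set Metric.ball_subset_closedBall
  have hm : ∀ θ, cis θ ∈ U := fun θ => hUD (by simp [norm_cis])
  have cA : Continuous fun θ => A (cis θ) := hA1.continuousOn.comp_continuous continuous_cis hm
  have cB : Continuous fun θ => B (cis θ) := hB1.continuousOn.comp_continuous continuous_cis hm
  have hcis := continuous_cis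
  have cc : Continuous fun θ => conj (cis θ) := Complex.continuous_conj.comp continuous_cis
  have hdp : ∀ θ, HasDerivAt (fun θ => pU u (cis θ))
      (fderiv ℝ (pU u) (cis θ) (Complex.I * cis θ)) θ := fun θ =>
    (hpd (cis θ)).hasFDerivAt.comp_hasDerivAt θ (hasDerivAt_cis θ)
  have hdφ : ∀ θ, HasDerivAt (fun θ => φ (cis θ))
      (dz φ (cis θ) * (Complex.I * cis θ) + dzb φ (cis θ) * conj (Complex.I * cis θ)) θ := fun θ =>
    ((hφ1.differentiableOn one_ne_zero).differentiableAt (hU.mem_nhds (hm θ))).hasW.comp_curve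
      (hasDerivAt_cis θ)
  have cdp : Continuous fun θ => fderiv ℝ (pU u) (cis θ) (Complex.I * cis θ) :=
    ((hp.continuous_fderiv one_ne_zero).comp continuous_cis).clm_apply (by fun_prop)
  have cdφ : Continuous fun θ =>
      dz φ (cis θ) * (Complex.I * cis θ) + dzb φ (cis θ) * conj (Complex.I * cis θ) := by
    have h1 := hφz.continuousOn.comp_continuous continuous_cis hm
    have h2 := hφzb.continuousOn.comp_continuous continuous_cis hm
    simp only [map_mul]
    fun_prop
  have hparts := intervalIntegral.integral_mul_deriv_eq_deriv_mul (a := -π) (b := π)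
    (fun θ _ => hdp θ) (fun θ _ => hdφ θ) (cdp.intervalIntegrable _ _) (cdφ.intervalIntegrable _ _)
  simp only [cis_pi, cis_neg_pi, sub_self, zero_sub] at hparts
  have cpφ : Continuous fun θ => pU u (cis θ) *
      (dz φ (cis θ) * (Complex.I * cis θ) + dzb φ (cis θ) * conj (Complex.I * cis θ)) :=
    (hp.continuous.comp continuous_cis).mul cdφ
  have cφ : Continuous fun θ => φ (cis θ) := hφ1.continuousOn.comp_continuous continuous_cis hm
  have cp : Continuous fun θ => pU u (cis θ) := hp.continuous.comp continuous_cis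
  have cR : Continuous fun θ => -(1 / 4) * φ (cis θ) *
    (pU u (cis θ) ^ 2 * cis θ + K (cis θ) * Real.exp (u (cis θ)) * conj (cis θ)) := by
    have h1 := hK.continuous.comp continuous_cis
    have h2 := Real.continuous_exp.comp (hu.continuous.comp continuous_cis)
    exact (continuous_const.mul cφ).mul (((cp.pow 2).mul hcis).add
      (((Complex.continuous_ofReal.comp h1).mul (Complex.continuous_ofReal.comp h2)).mul cc))
  rw [← intervalIntegral.integral_sub]
  rotate_left
  · exact (continuous_const.mul (cc.mul cA)).intervalIntegrable _ _
  · exact (continuous_const.mul (hcis.mul cB)).intervalIntegrable _ _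
  have l1 : ∀ θ, 1 / 2 * (conj (cis θ) * A (cis θ)) - 1 / 2 * (cis θ * B (cis θ)) =
      Complex.I / 2 * (pU u (cis θ) *
      (dz φ (cis θ) * (Complex.I * cis θ) + dzb φ (cis θ) * conj (Complex.I * cis θ))) +
      -(1 / 4) * φ (cis θ) *
    (pU u (cis θ) ^ 2 * cis θ + K (cis θ) * Real.exp (u (cis θ)) * conj (cis θ)) := by
    intro θ
    simp only [hA, hB, map_mul, Complex.conj_I]
    push_cast
    linear_combination (pU u (cis θ) / 2 * (dzb φ (cis θ) * conj (cis θ) - dz φ (cis θ) * cis θ)) *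
      Complex.I_mul_I
  have l2 : ∀ θ, φ (cis θ) * bdryDensity K u θ =
      -(Complex.I / 2) * (fderiv ℝ (pU u) (cis θ) (Complex.I * cis θ) * φ (cis θ)) +
      -(1 / 4) * φ (cis θ) *
    (pU u (cis θ) ^ 2 * cis θ + K (cis θ) * Real.exp (u (cis θ)) * conj (cis θ)) := by
    intro θ
    unfold bdryDensity
    ring
  simp only [l1, l2]
  rw [intervalIntegral.integral_add, intervalIntegral.integral_add,
    intervalIntegral.integral_const_mul, intervalIntegral.integral_const_mul, hparts]
  · ring
  · exact (continuous_const.mul (cdp.mul cφ)).intervalIntegrable _ _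
  · exact cR.intervalIntegrable _ _
  · exact (continuous_const.mul cpφ).intervalIntegrable _ _
  · exact cR.intervalIntegrable _ _

/-- For a test field tangent to the circle the boundary density reduces to `h_θ e^{u/2} / 2`. -/
lemma re_bdryDensity {K h u : ℂ → ℝ} (hu : ContDiff ℝ 2 u)
    (hh : ContDiff ℝ 2 h) (hs : SolvesLiouville K h u) (θ ψ : ℝ) :
    (Complex.I * cis θ * ψ * bdryDensity K u θ).re =
      1 / 2 * (ψ * fderiv ℝ h (cis θ) (Complex.I * cis θ) * Real.exp (u (cis θ) / 2)) := by
  have hp := contDiff_pU hu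
  have hpd : Differentiable ℝ (pU u) := hp.differentiable one_ne_zero
  have hud : Differentiable ℝ u := hu.differentiable (by norm_num)
  have hdp : HasDerivAt (fun θ => pU u (cis θ))
      (fderiv ℝ (pU u) (cis θ) (Complex.I * cis θ)) θ :=
    (hpd (cis θ)).hasFDerivAt.comp_hasDerivAt θ (hasDerivAt_cis θ)
  have hdu : HasDerivAt (fun θ => u (cis θ)) (fderiv ℝ u (cis θ) (Complex.I * cis θ)) θ :=
    (hud (cis θ)).hasFDerivAt.comp_hasDerivAt θ (hasDerivAt_cis θ)
  have hdh : HasDerivAt (fun θ => h (cis θ)) (fderiv ℝ h (cis θ) (Complex.I * cis θ)) θ :=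
    (hh.differentiable (by norm_num) (cis θ)).hasFDerivAt.comp_hasDerivAt θ (hasDerivAt_cis θ)
  have hre : ∀ t, (cis t * pU u (cis t)).re = h (cis t) * Real.exp (u (cis t) / 2) - 1 := by
    intro t
    have h1 := hs.2 (cis t) (by simp [unitCircle, norm_cis])
    rw [normalDeriv, fderiv_eq_re_dz u _ _ (hud _)] at h1
    change 2 * (pU u (cis t) * cis t).re + 2 = _ at h1
    rw [mul_comm (cis t)]
    linarith
  have hN := Complex.reCLM.hasFDerivAt.comp_hasDerivAt θ ((hasDerivAt_cis θ).mul hdp)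
  have hN2 := (hdh.mul ((hdu.div_const 2).exp)).sub_const 1
  have hN3 : HasDerivAt (fun t => h (cis t) * Real.exp (u (cis t) / 2) - 1) _ θ :=
    hN.congr_of_eventuallyEq (Eventually.of_forall fun t => (hre t).symm)
  have hder := hN3.unique hN2
  simp only [Complex.reCLM_apply] at hder
  have him : fderiv ℝ u (cis θ) (Complex.I * cis θ) = -2 * (cis θ * pU u (cis θ)).im := by
    rw [fderiv_eq_re_dz u _ _ (hud _)]
    change 2 * (pU u (cis θ) * (Complex.I * cis θ)).re = _
    simp; ring
  have hre0 := hre θ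
  have hcc := cis_mul_conj θ
  set p := pU u (cis θ)
  set p' := fderiv ℝ (pU u) (cis θ) (Complex.I * cis θ)
  have e0 : Complex.I * cis θ * ψ * bdryDensity K u θ = ψ * (1 / 2 * (cis θ * p') -
      Complex.I / 4 * ((cis θ * p) ^ 2 + K (cis θ) * Real.exp (u (cis θ)))) := by
    unfold bdryDensity
    linear_combination (-ψ / 2 * (cis θ * p')) * Complex.I_mul_I -
      (ψ * Complex.I / 4 * (K (cis θ) * Real.exp (u (cis θ)))) * hcc
  rw [e0]
  have e1 : (ψ * (1 / 2 * (cis θ * p') -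
      Complex.I / 4 * ((cis θ * p) ^ 2 + K (cis θ) * Real.exp (u (cis θ)))) : ℂ).re =
      ψ * (1 / 2 * (cis θ * p').re + 1 / 2 * (cis θ * p).re * (cis θ * p).im) := by
    generalize cis θ * p' = A
    generalize cis θ * p = B
    rw [Complex.re_ofReal_mul, ← Complex.ofReal_mul]
    generalize K (cis θ) * Real.exp (u (cis θ)) = c
    have i4 : (Complex.I / 4 : ℂ) = (1 / 4 : ℝ) * Complex.I := by push_cast; ring
    have i2 : (1 / 2 : ℂ) = ((1 / 2 : ℝ) : ℂ) := by push_cast; ring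
    rw [i4, i2]
    simp [pow_two, -one_div, -Complex.ofReal_div]
    left
    ring
  rw [e1, hre0]
  have e2 : (Complex.I * cis θ * p + cis θ * p').re = (cis θ * p').re - (cis θ * p).im := by
    rw [mul_assoc]; simp; ring
  rw [e2, him] at hder
  linear_combination (ψ / 2) * hder

/-! ### Radial kernels and the regularised Cauchy kernel -/

lemma lintegral_norm_radial {f : ℝ → ℝ≥0∞} (hf : Measurable f) :
    ∫⁻ x : ℂ, f ‖x‖ = 2 * ENNReal.ofReal π * ∫⁻ y in Ioi (0 : ℝ), ENNReal.ofReal y * f y := by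
  rw [← Complex.lintegral_comp_polarCoord_symm]
  have h1 : ∀ p ∈ polarCoord.target, ENNReal.ofReal p.1 • f ‖Complex.polarCoord.symm p‖ =
      ENNReal.ofReal p.1 * f p.1 := by
    intro p hp
    rw [polarCoord_target] at hp
    rw [Complex.norm_polarCoord_symm, abs_of_pos hp.1, smul_eq_mul]
  rw [setLIntegral_congr_fun polarCoord.open_target.measurableSet h1, polarCoord_target,
    Measure.volume_eq_prod, ← Measure.prod_restrict, lintegral_prod _ (by fun_prop)]
  simp only [lintegral_const, Measure.restrict_apply_univ, Real.volume_Ioo]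
  rw [lintegral_mul_const _ (by fun_prop), mul_comm, ← ENNReal.ofReal_ofNat 2,
    ← ENNReal.ofReal_mul (by norm_num)]
  congr 2
  ring

lemma lintegral_ball_rpow {s r : ℝ} (hs : s < 2) (hr : 0 ≤ r) :
    ∫⁻ x in Metric.ball (0 : ℂ) r, ENNReal.ofReal (‖x‖ ^ (-s)) =
      ENNReal.ofReal (2 * π / (2 - s) * r ^ (2 - s)) := by
  have h1 : ∀ x : ℂ, (Metric.ball (0 : ℂ) r).indicator (fun x => ENNReal.ofReal (‖x‖ ^ (-s))) x =
      (Iio r).indicator (fun y => ENNReal.ofReal (y ^ (-s))) ‖x‖ := by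
    intro x
    simp [indicator]
  rw [← lintegral_indicator Metric.isOpen_ball.measurableSet]
  simp only [h1]
  rw [lintegral_norm_radial (by
    refine Measurable.indicator ?_ measurableSet_Iio
    fun_prop)]
  have h2 : ∫⁻ y in Ioi (0 : ℝ), ENNReal.ofReal y *
      (Iio r).indicator (fun y => ENNReal.ofReal (y ^ (-s))) y =
      ENNReal.ofReal (r ^ (2 - s) / (2 - s)) := by
    have h3 : ∀ y ∈ Ioi (0 : ℝ), ENNReal.ofReal y *
      (Iio r).indicator (fun y => ENNReal.ofReal (y ^ (-s))) y =
      (Iio r).indicator (fun y => ENNReal.ofReal (y ^ (1 - s))) y := by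
      intro y hy
      simp only [indicator]
      split_ifs
      · rw [← ENNReal.ofReal_mul (le_of_lt hy), sub_eq_add_neg, Real.rpow_add hy, Real.rpow_one]
      · simp
    rw [setLIntegral_congr_fun measurableSet_Ioi h3, lintegral_indicator measurableSet_Iio,
      Measure.restrict_restrict measurableSet_Iio, Iio_inter_Ioi,
      ← ofReal_integral_eq_lintegral_ofReal]
    · rw [← integral_Ioc_eq_integral_Ioo, ← intervalIntegral.integral_of_le hr, integral_rpow]
      · rw [show 1 - s + 1 = 2 - s by ring, Real.zero_rpow (by linarith)]; simp
      · left; linarith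
    · exact ((intervalIntegral.intervalIntegrable_rpow' (a := 0) (b := r) (by linarith)).1).mono_set Ioo_subset_Ioc_self
    · refine (ae_restrict_iff' measurableSet_Ioo).2 (Eventually.of_forall fun y hy => ?_)
      exact Real.rpow_nonneg hy.1.le _
  rw [h2, ← ENNReal.ofReal_ofNat 2, ← ENNReal.ofReal_mul (by norm_num),
    ← ENNReal.ofReal_mul (by positivity)]
  congr 1
  ring

/-- Bound for the integral of `|x - ζ|^(-s)` over a disk, uniform in `ζ`. -/
lemma lintegral_ball_kernel_le {s r : ℝ} (hs0 : 0 ≤ s) (hs : s < 2) (hr : 0 < r) (z ζ : ℂ) :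
    ∫⁻ x in Metric.ball z r, ENNReal.ofReal (‖x - ζ‖ ^ (-s)) ≤
      ENNReal.ofReal (4 * π / (2 - s) * r ^ (2 - s)) := by
  have hm : Measurable fun x : ℂ => ENNReal.ofReal (‖x - ζ‖ ^ (-s)) := by fun_prop
  have h1 : ∫⁻ x in Metric.ball ζ r, ENNReal.ofReal (‖x - ζ‖ ^ (-s)) =
      ENNReal.ofReal (2 * π / (2 - s) * r ^ (2 - s)) := by
    rw [← lintegral_ball_rpow hs hr.le, ← lintegral_indicator Metric.isOpen_ball.measurableSet,
      ← lintegral_indicator Metric.isOpen_ball.measurableSet,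
      ← lintegral_add_right_eq_self _ ζ]
    congr 1
    ext x
    simp [indicator, dist_eq_norm]
  have h2 : ∫⁻ x in Metric.ball z r \ Metric.ball ζ r, ENNReal.ofReal (‖x - ζ‖ ^ (-s)) ≤
      ENNReal.ofReal (2 * π / (2 - s) * r ^ (2 - s)) := by
    calc _ ≤ ∫⁻ x in Metric.ball z r \ Metric.ball ζ r, ENNReal.ofReal (r ^ (-s)) := by
          refine setLIntegral_mono' (Metric.isOpen_ball.measurableSet.diff
            Metric.isOpen_ball.measurableSet) fun x hx => ?_
          apply ENNReal.ofReal_le_ofReal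
          refine Real.rpow_le_rpow_of_nonpos hr ?_ (by linarith)
          have := hx.2
          simpa [dist_eq_norm] using this
      _ ≤ ∫⁻ x in Metric.ball z r, ENNReal.ofReal (r ^ (-s)) :=
          lintegral_mono_set sdiff_subset
      _ = ENNReal.ofReal (π * r ^ (2 - s)) := by
          rw [setLIntegral_const, Complex.volume_ball]
          rw [show (NNReal.pi : ℝ≥0∞) = ENNReal.ofReal π by
              rw [← NNReal.coe_real_pi, ENNReal.ofReal_coe_nnreal],
            ← ENNReal.ofReal_pow hr.le, ← ENNReal.ofReal_mul (by positivity),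
            ← ENNReal.ofReal_mul (by positivity)]
          congr 1
          rw [sub_eq_add_neg, Real.rpow_add hr, Real.rpow_two]; ring
      _ ≤ _ := by
          apply ENNReal.ofReal_le_ofReal
          have : π ≤ 2 * π / (2 - s) := by
            rw [le_div_iff₀ (by linarith)]; nlinarith [Real.pi_pos]
          gcongr
  calc _ ≤ ∫⁻ x in Metric.ball ζ r ∪ (Metric.ball z r \ Metric.ball ζ r),
        ENNReal.ofReal (‖x - ζ‖ ^ (-s)) := by
        apply lintegral_mono_set; rw [union_sdiff_self]; exact subset_union_right
    _ ≤ _ := lintegral_union_le _ _ _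
    _ ≤ ENNReal.ofReal (2 * π / (2 - s) * r ^ (2 - s)) + ENNReal.ofReal (2 * π / (2 - s) * r ^ (2 - s)) := add_le_add h1.le h2
    _ = _ := by
        have : 0 ≤ 2 * π / (2 - s) * r ^ (2 - s) := by
          have : 0 < 2 - s := by linarith
          positivity
        rw [← ENNReal.ofReal_add this this]
        congr 1; ring

lemma integral_approx_kernel : ∫ x : ℂ, 1 / π * (1 / (1 + ‖x‖ ^ 2) ^ 2) = 1 := by
  have h := integral_fun_norm_addHaar (volume : Measure ℂ) (fun y : ℝ => 1 / (1 + y ^ 2) ^ 2)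
  have h2 : ∫ y in Ioi (0 : ℝ), y ^ (2 - 1) • (1 / (1 + y ^ 2) ^ 2) = 1 / 2 := by
    have := integral_Ioi_of_hasDerivAt_of_nonneg' (a := 0) (l := 0)
      (g := fun y : ℝ => -(1 / 2) * (1 + y ^ 2)⁻¹) (g' := fun y => y ^ (2 - 1) • (1 / (1 + y ^ 2) ^ 2))
      (fun y _ => by
        have h1 : (1 + y ^ 2) ≠ 0 := by positivity
        have := ((((hasDerivAt_id y).pow 2).const_add 1).inv h1).const_mul (-(1 / 2))
        refine this.congr_deriv ?_
        simp; field_simp)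
      (fun y hy => by have : (0:ℝ) < y := hy; simp; positivity) (by
        have h1 : Tendsto (fun y : ℝ => 1 + y ^ 2) atTop atTop :=
          tendsto_atTop_add_const_left _ _ (tendsto_pow_atTop two_ne_zero)
        simpa [-one_div] using (h1.inv_tendsto_atTop).const_mul (-(1 / 2)))
    rw [this]; simp
  rw [integral_const_mul, h, Complex.finrank_real_complex, h2]
  simp [Measure.real, Complex.volume_ball]
  field_simp

/-- The kernels `r² / (r² + |z - z₀|²)²`, with `r = 1 / c`, concentrate at `z₀`. -/
lemma tendsto_approx_kernel {g : ℂ → ℂ} (hg : Integrable g) {z₀ : ℂ} (hc : ContinuousAt g z₀) :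
    Tendsto (fun c : ℝ => ∫ z, ((c ^ 2)⁻¹ / (‖z - z₀‖ ^ 2 + (c ^ 2)⁻¹) ^ 2 : ℝ) * g z) atTop
      (𝓝 (π * g z₀)) := by
  have := tendsto_integral_comp_smul_smul_of_integrable' (μ := (volume : Measure ℂ))
    (φ := fun x => 1 / π * (1 / (1 + ‖x‖ ^ 2) ^ 2)) (fun x => by positivity)
    integral_approx_kernel (by
      rw [Complex.finrank_real_complex]
      have h1 : Tendsto (fun x : ℂ => (1 + ‖x‖ ^ 2)) (Bornology.cobounded ℂ) atTop :=
        tendsto_atTop_add_const_left _ _ ((tendsto_pow_atTop two_ne_zero).comp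
          tendsto_norm_cobounded_atTop)
      have h2 : Tendsto (fun x : ℂ => 1 / π * (1 + ‖x‖ ^ 2)⁻¹) (Bornology.cobounded ℂ) (𝓝 0) := by
        simpa using h1.inv_tendsto_atTop.const_mul (1 / π)
      refine squeeze_zero (fun x => by positivity) (fun x => ?_) h2
      have : (0:ℝ) < 1 + ‖x‖ ^ 2 := by positivity
      have hp := Real.pi_pos
      rw [mul_left_comm]
      gcongr
      field_simp
      linarith) hg hc
  have h3 := this.const_mul (π : ℂ)
  refine h3.congr' ?_
  filter_upwards [eventually_gt_atTop 0] with c hc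
  rw [← integral_const_mul]
  congr 1
  ext z
  rw [Complex.finrank_real_complex, Complex.real_smul, ← mul_assoc, norm_smul, norm_sub_rev]
  congr 1
  rw [← Complex.ofReal_mul]
  congr 1
  rw [Real.norm_of_nonneg hc.le]
  have := Real.pi_ne_zero
  field_simp
  ring_nf

/-- The regularised Cauchy kernel. -/
def regCauchy (z₀ : ℂ) (ρ : ℝ) (z : ℂ) : ℂ :=
  conj (z - z₀) * ((z - z₀) * conj (z - z₀) + ρ)⁻¹

lemma regCauchy_ne {z₀ z : ℂ} {ρ : ℝ} (hρ : 0 < ρ) : (z - z₀) * conj (z - z₀) + ρ ≠ 0 := by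
  rw [Complex.mul_conj, ← Complex.ofReal_add]
  exact_mod_cast (by have := Complex.normSq_nonneg (z - z₀); positivity)

lemma contDiff_regCauchy (z₀ : ℂ) {ρ : ℝ} (hρ : 0 < ρ) : ContDiff ℝ 2 (regCauchy z₀ ρ) := by
  have h1 : ContDiff ℝ 2 (fun z : ℂ => z - z₀) := contDiff_id.sub contDiff_const
  have h2 : ContDiff ℝ 2 (fun z : ℂ => conj (z - z₀)) := Complex.conjCLE.contDiff.comp h1
  exact h2.mul (((h1.mul h2).add contDiff_const).inv fun z => regCauchy_ne hρ)

lemma dzb_regCauchy (z₀ z : ℂ) {ρ : ℝ} (hρ : 0 < ρ) :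
    dzb (regCauchy z₀ ρ) z = (ρ / (‖z - z₀‖ ^ 2 + ρ) ^ 2 : ℝ) := by
  have hne := regCauchy_ne (z₀ := z₀) (z := z) hρ
  have w1 := (hasW_id z).sub (hasW_const z₀ z)
  have w2 := w1.star
  have w3 := HasW.comp_holo (F := fun z => (z - z₀) * conj (z - z₀) + ρ) (hasDerivAt_inv hne)
    ((w1.mul w2).add (hasW_const (ρ : ℂ) z))
  have : dzb (regCauchy z₀ ρ) z = _ := (w2.mul w3).dzb_eq
  rw [this]
  have e : ((‖z - z₀‖ ^ 2 : ℝ) : ℂ) = (z - z₀) * conj (z - z₀) := by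
    rw [Complex.mul_conj, Complex.normSq_eq_norm_sq]
  push_cast at e ⊢
  rw [e]
  simp only [sub_zero, map_one, zero_mul, zero_add, mul_one, one_mul, add_zero]
  field_simp
  ring

lemma norm_regCauchy_le (z₀ z : ℂ) {ρ : ℝ} (hρ : 0 < ρ) : ‖regCauchy z₀ ρ z‖ ≤ ‖z - z₀‖⁻¹ := by
  rcases eq_or_ne z z₀ with rfl | h
  · simp [regCauchy]
  have h1 : 0 < ‖z - z₀‖ := norm_pos_iff.2 (sub_ne_zero.2 h)
  rw [regCauchy, norm_mul, RCLike.norm_conj, norm_inv, Complex.mul_conj, ← Complex.ofReal_add,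
    Complex.norm_real, Complex.normSq_eq_norm_sq, Real.norm_of_nonneg (by positivity)]
  rw [← div_eq_mul_inv, div_le_iff₀ (by positivity), mul_add, pow_two, inv_mul_cancel_left₀ h1.ne']
  have : 0 ≤ ‖z - z₀‖⁻¹ * ρ := by positivity
  linarith

lemma tendsto_regCauchy (z₀ z : ℂ) :
    Tendsto (fun c : ℝ => regCauchy z₀ (c ^ 2)⁻¹ z) atTop (𝓝 (z - z₀)⁻¹) := by
  rcases eq_or_ne z z₀ with rfl | h
  · simp [regCauchy]
  have h1 : z - z₀ ≠ 0 := sub_ne_zero.2 h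
  have h2 : conj (z - z₀) ≠ 0 := (map_ne_zero _).2 h1
  have h3 : Tendsto (fun c : ℝ => (((c ^ 2)⁻¹ : ℝ) : ℂ)) atTop (𝓝 0) := by
    have : Tendsto (fun c : ℝ => (c ^ 2)⁻¹) atTop (𝓝 0) :=
      (tendsto_pow_atTop two_ne_zero).inv_tendsto_atTop
    exact (Complex.continuous_ofReal.tendsto' 0 0 (by simp)).comp this
  have h4 : (z - z₀)⁻¹ = conj (z - z₀) * ((z - z₀) * conj (z - z₀) + 0)⁻¹ := by
    rw [add_zero, mul_inv, mul_left_comm, mul_inv_cancel₀ h2, mul_one]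
  rw [h4]
  exact ((h3.const_add _).inv₀ (by rw [add_zero]; exact mul_ne_zero h1 h2)).const_mul _

lemma integrable_ball_inv (z₀ : ℂ) : IntegrableOn (fun z => ‖z - z₀‖⁻¹) (Metric.ball 0 1) := by
  refine ⟨by fun_prop, ?_⟩
  have := lintegral_ball_kernel_le (s := 1) (r := 1) zero_le_one (by norm_num) one_pos 0 z₀
  simp only [Real.rpow_neg_one] at this
  refine lt_of_le_of_lt (le_of_eq ?_) (this.trans_lt ENNReal.ofReal_lt_top)
  refine lintegral_congr fun z => ?_
  rw [Real.enorm_of_nonneg (by positivity)]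

/-- Cauchy representation of the Hopf coefficient. -/
lemma cauchy_hopf {K h u : ℂ → ℝ} (hK : ContDiff ℝ 2 K) (hu : ContDiff ℝ 2 u)
    (hs : SolvesLiouville K h u) {z₀ : ℂ} (hz₀ : z₀ ∈ Metric.ball (0 : ℂ) 1) :
    π * hopf u z₀ - ∫ z in Metric.ball (0 : ℂ) 1, 1 / 2 * pU K z * Real.exp (u z) * (z - z₀)⁻¹ =
      ∫ θ in (-π)..π, (cis θ - z₀)⁻¹ * bdryDensity K u θ := by
  have hmB : MeasurableSet (Metric.ball (0 : ℂ) 1) := Metric.isOpen_ball.measurableSet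
  have hco := continuous_hopf hu
  have hpK : Continuous (pU K) := (contDiff_pU hK).continuous
  have hG : Continuous fun z => 1 / 2 * pU K z * Real.exp (u z) := by
    have := hu.continuous
    fun_prop
  have hρ : ∀ᶠ c : ℝ in atTop, 0 < (c ^ 2)⁻¹ := by
    filter_upwards [eventually_gt_atTop 0] with c hc
    positivity
  have hreg : ∀ c : ℝ, 0 < (c ^ 2)⁻¹ → ContDiff ℝ 2 (regCauchy z₀ (c ^ 2)⁻¹) :=
    fun c hc => contDiff_regCauchy z₀ hc
  obtain ⟨CG, hCG⟩ := (isCompact_closedBall (0 : ℂ) 1).exists_bound_of_continuousOn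
    hG.continuousOn
  have t1 : Tendsto (fun c : ℝ => ∫ z in Metric.ball (0 : ℂ) 1,
      hopf u z * dzb (regCauchy z₀ (c ^ 2)⁻¹) z) atTop (𝓝 (π * hopf u z₀)) := by
    have := tendsto_approx_kernel (g := (Metric.ball (0 : ℂ) 1).indicator (hopf u)) (z₀ := z₀)
      ((integrable_indicator_iff hmB).2 ((hco.continuousOn.integrableOn_compact
        (isCompact_closedBall 0 1)).mono_set Metric.ball_subset_closedBall))
      (hco.continuousAt.congr (by
        filter_upwards [Metric.isOpen_ball.mem_nhds hz₀] with z hz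
        rw [indicator_of_mem hz]))
    rw [indicator_of_mem hz₀] at this
    refine this.congr' ?_
    filter_upwards [hρ] with c hc
    rw [← integral_indicator hmB]
    congr 1
    ext z
    by_cases hz : z ∈ Metric.ball (0 : ℂ) 1
    · rw [indicator_of_mem hz, indicator_of_mem hz, dzb_regCauchy _ _ hc, mul_comm]
    · rw [indicator_of_notMem hz, indicator_of_notMem hz, mul_zero]
  have t2 : Tendsto (fun c : ℝ => ∫ z in Metric.ball (0 : ℂ) 1,
      1 / 2 * pU K z * Real.exp (u z) * regCauchy z₀ (c ^ 2)⁻¹ z) atTop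
      (𝓝 (∫ z in Metric.ball (0 : ℂ) 1, 1 / 2 * pU K z * Real.exp (u z) * (z - z₀)⁻¹)) := by
    refine tendsto_integral_filter_of_dominated_convergence (fun z => CG * ‖z - z₀‖⁻¹) ?_ ?_
      ((integrable_ball_inv z₀).const_mul _) ?_
    · filter_upwards [hρ] with c hc
      exact (hG.mul (hreg c hc).continuous).aestronglyMeasurable
    · filter_upwards [hρ] with c hc
      refine (ae_restrict_iff' hmB).2 (Eventually.of_forall fun z hz => ?_)
      rw [norm_mul]
      have := hCG z (Metric.ball_subset_closedBall hz)
      exact mul_le_mul this (norm_regCauchy_le _ _ hc) (norm_nonneg _)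
        ((norm_nonneg _).trans this)
    · exact Eventually.of_forall fun z => (tendsto_regCauchy z₀ z).const_mul _
  have hz1 : ‖z₀‖ < 1 := by simpa using hz₀
  have hB := continuous_bdryDensity hK hu
  have hdist : ∀ θ, 1 - ‖z₀‖ ≤ ‖cis θ - z₀‖ := fun θ => by
    have := norm_sub_norm_le (cis θ) z₀
    rwa [norm_cis] at this
  have t3 : Tendsto (fun c : ℝ => ∫ θ in (-π)..π,
      regCauchy z₀ (c ^ 2)⁻¹ (cis θ) * bdryDensity K u θ) atTop
      (𝓝 (∫ θ in (-π)..π, (cis θ - z₀)⁻¹ * bdryDensity K u θ)) := by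
    refine intervalIntegral.tendsto_integral_filter_of_dominated_convergence
      (fun θ => (1 - ‖z₀‖)⁻¹ * ‖bdryDensity K u θ‖) ?_ ?_
      ((continuous_const.mul hB.norm).intervalIntegrable _ _) ?_
    · filter_upwards [hρ] with c hc
      exact (((hreg c hc).continuous.comp continuous_cis).mul hB).aestronglyMeasurable
    · filter_upwards [hρ] with c hc
      refine Eventually.of_forall fun θ _ => ?_
      rw [norm_mul]
      gcongr
      exact (norm_regCauchy_le _ _ hc).trans (inv_anti₀ (by linarith) (hdist θ))
    · exact Eventually.of_forall fun θ _ => (tendsto_regCauchy z₀ _).mul_const _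
  refine tendsto_nhds_unique (t1.sub t2) (t3.congr' ?_)
  filter_upwards [hρ] with c hc
  have := weak_hopf hK hu hs isOpen_univ (subset_univ _) (hreg c hc).contDiffOn
  rw [← this, integral_sub]
  · refine (Continuous.continuousOn ?_).integrableOn_compact (isCompact_closedBall (0:ℂ) 1)
      |>.mono_set Metric.ball_subset_closedBall
    have : Continuous (dzb (regCauchy z₀ (c ^ 2)⁻¹)) := by
      rw [← continuousOn_univ]
      exact continuousOn_dzb isOpen_univ (((hreg c hc).of_le (by norm_num)).contDiffOn)
    exact hco.mul this
  · exact ((hG.mul (hreg c hc).continuous).continuousOn).integrableOn_compact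
      (isCompact_closedBall (0:ℂ) 1) |>.mono_set Metric.ball_subset_closedBall

/-! ### The mass measure and pointwise bounds for the Hopf differential -/

lemma measurable_cis : Measurable cis := continuous_cis.measurable

/-- Arc length on the unit circle, as a push-forward. -/
def circMeas : Measure ℂ := (volume.restrict (Ioc (-π) π)).map cis

/-- The measure `e^u dA + e^(u/2) dσ` on the closed disk. -/
def massMeasure (u : ℂ → ℝ) : Measure ℂ :=
  (volume.restrict (Metric.ball 0 1)).withDensity (fun z => ENNReal.ofReal (Real.exp (u z))) +
    circMeas.withDensity (fun z => ENNReal.ofReal (Real.exp (u z / 2)))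

lemma lintegral_circMeas {f : ℂ → ℝ≥0∞} (hf : Measurable f) :
    ∫⁻ z, f z ∂circMeas = ∫⁻ θ in Ioc (-π) π, f (cis θ) := by
  rw [circMeas, lintegral_map hf measurable_cis]

lemma lintegral_massMeasure {u : ℂ → ℝ} (hu : Continuous u) {f : ℂ → ℝ≥0∞} (hf : Measurable f) :
    ∫⁻ z, f z ∂(massMeasure u) =
      (∫⁻ z in Metric.ball 0 1, ENNReal.ofReal (Real.exp (u z)) * f z) +
        ∫⁻ θ in Ioc (-π) π, ENNReal.ofReal (Real.exp (u (cis θ) / 2)) * f (cis θ) := by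
  have := hu.measurable
  rw [massMeasure, lintegral_add_measure,
    lintegral_withDensity_eq_lintegral_mul _ (by fun_prop) hf,
    lintegral_withDensity_eq_lintegral_mul _ (by fun_prop) hf,
    lintegral_circMeas (by fun_prop)]
  rfl

lemma massMeasure_compl_closedBall (u : ℂ → ℝ) :
    massMeasure u (Metric.closedBall 0 1)ᶜ = 0 := by
  have hm : MeasurableSet (Metric.closedBall (0 : ℂ) 1)ᶜ :=
    Metric.isClosed_closedBall.measurableSet.compl
  have h1 : (volume.restrict (Metric.ball (0 : ℂ) 1)) (Metric.closedBall 0 1)ᶜ = 0 := by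
    rw [Measure.restrict_apply hm]
    refine measure_mono_null (fun z hz => ?_) (measure_empty (μ := volume))
    exact hz.1 (Metric.ball_subset_closedBall hz.2)
  have h2 : circMeas (Metric.closedBall (0 : ℂ) 1)ᶜ = 0 := by
    rw [circMeas, Measure.map_apply measurable_cis hm]
    have : cis ⁻¹' (Metric.closedBall (0 : ℂ) 1)ᶜ = ∅ := by
      ext θ; simp [norm_cis]
    rw [this, measure_empty]
  rw [massMeasure, Measure.add_apply, withDensity_absolutelyContinuous _ _ h1,
    withDensity_absolutelyContinuous _ _ h2, add_zero]

lemma ae_massMeasure (u : ℂ → ℝ) : ∀ᵐ z ∂(massMeasure u), ‖z‖ ≤ 1 := by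
  refine (mem_ae_iff.2 ?_ : {z : ℂ | ‖z‖ ≤ 1} ∈ ae (massMeasure u))
  convert massMeasure_compl_closedBall u using 2
  ext z; simp

/-- The weak Hopf identity for holomorphic test fields. -/
lemma weak_hopf_holo {K h u : ℂ → ℝ} (hK : ContDiff ℝ 2 K) (hu : ContDiff ℝ 2 u)
    (hs : SolvesLiouville K h u) {U : Set ℂ} (hU : IsOpen U)
    (hUD : Metric.closedBall 0 1 ⊆ U) {φ : ℂ → ℂ} (hφ : DifferentiableOn ℂ φ U) :
    - ∫ z in Metric.ball (0 : ℂ) 1, 1 / 2 * pU K z * Real.exp (u z) * φ z =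
      ∫ θ in (-π)..π, φ (cis θ) * bdryDensity K u θ := by
  rw [← weak_hopf hK hu hs hU hUD ((hφ.contDiffOn hU).restrict_scalars ℝ), ← integral_neg]
  refine setIntegral_congr_fun Metric.isOpen_ball.measurableSet fun z hz => ?_
  have : dzb φ z = 0 := (HasDerivAt.hasW ((hφ.differentiableAt
    (hU.mem_nhds (hUD (Metric.ball_subset_closedBall hz)))).hasDerivAt)).dzb_eq
  simp only [this]
  ring

/-- A test field with a pole at `z₀`, tangent to the unit circle. -/
def poleField (c z₀ : ℂ) (s : ℝ) (z : ℂ) : ℂ :=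
  c * (z - z₀)⁻¹ - conj c * (z ^ 3 / (1 - conj z₀ * z)) - s * (Complex.I * z)

lemma one_sub_conj_mul_ne {z₀ z : ℂ} (hz₀ : ‖z₀‖ < 1) (hz : ‖z‖ ≤ 1) : 1 - conj z₀ * z ≠ 0 := by
  intro h0
  have h1 : ‖conj z₀ * z‖ = 1 := by rw [← sub_eq_zero.1 h0]; simp
  rw [norm_mul, RCLike.norm_conj] at h1
  nlinarith [norm_nonneg z₀, norm_nonneg z]

lemma norm_sub_le_norm_one_sub {z₀ z : ℂ} (hz₀ : ‖z₀‖ < 1) (hz : ‖z‖ ≤ 1) :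
    ‖z - z₀‖ ≤ ‖1 - conj z₀ * z‖ := by
  refine le_of_sq_le_sq ?_ (norm_nonneg _)
  have h1 : ‖z₀‖ ^ 2 ≤ 1 := pow_le_one₀ (norm_nonneg _) hz₀.le
  have h2 : ‖z‖ ^ 2 ≤ 1 := pow_le_one₀ (norm_nonneg _) hz
  rw [← Complex.normSq_eq_norm_sq, Complex.normSq_apply] at h1 h2 ⊢
  rw [← Complex.normSq_eq_norm_sq, Complex.normSq_apply]
  simp
  nlinarith [mul_nonneg (sub_nonneg.2 h1) (sub_nonneg.2 h2)]

lemma poleField_cis (c : ℂ) {z₀ : ℂ} (hz₀ : ‖z₀‖ < 1) (s θ : ℝ) :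
    poleField c z₀ s (cis θ) = Complex.I * cis θ *
      ((2 * (c * conj (cis θ) * (cis θ - z₀)⁻¹).im - s : ℝ) : ℂ) := by
  have hcc := cis_mul_conj θ
  have hne : cis θ - z₀ ≠ 0 := by
    intro h0
    have := norm_cis θ
    rw [sub_eq_zero.1 h0] at this
    linarith
  have hne2 : conj (cis θ - z₀) ≠ 0 := (map_ne_zero _).2 hne
  have hc0 : cis θ ≠ 0 := left_ne_zero_of_mul_eq_one hcc
  have e1 : 1 - conj z₀ * cis θ = cis θ * conj (cis θ - z₀) := by
    rw [map_sub, mul_sub, hcc]; ring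
  set A := c * conj (cis θ) * (cis θ - z₀)⁻¹ with hA
  have e2 : c * (cis θ - z₀)⁻¹ = cis θ * A := by
    rw [hA]; linear_combination (-(c * (cis θ - z₀)⁻¹)) * hcc
  have e3 : conj c * (cis θ ^ 3 / (1 - conj z₀ * cis θ)) = cis θ * conj A := by
    rw [hA, e1, map_mul, map_mul, map_inv₀, Complex.conj_conj]
    field_simp
  rw [poleField, e2, e3]
  have e4 : A - conj A = 2 * Complex.I * A.im := by
    apply Complex.ext <;> simp; ring
  push_cast
  linear_combination (cis θ) * e4

lemma poleField_identity {K h u : ℂ → ℝ} (hK : ContDiff ℝ 2 K) (hu : ContDiff ℝ 2 u)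
    (hs : SolvesLiouville K h u) {z₀ : ℂ} (hz₀ : z₀ ∈ Metric.ball (0 : ℂ) 1) (c : ℂ) (s : ℝ) :
    π * (c * hopf u z₀) = (∫ z in Metric.ball (0 : ℂ) 1,
        1 / 2 * pU K z * Real.exp (u z) * poleField c z₀ s z) +
      ∫ θ in (-π)..π, poleField c z₀ s (cis θ) * bdryDensity K u θ := by
  have hz1 : ‖z₀‖ < 1 := by simpa using hz₀
  have h1 := cauchy_hopf hK hu hs hz₀
  set U : Set ℂ := {z | 1 - conj z₀ * z ≠ 0} with hUdef
  have hU : IsOpen U := isOpen_ne_fun (by fun_prop) continuous_const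
  have hUD : Metric.closedBall 0 1 ⊆ U := fun z hz =>
    one_sub_conj_mul_ne hz1 (by simpa using hz)
  set φ : ℂ → ℂ := fun z => conj c * (z ^ 3 / (1 - conj z₀ * z)) + s * (Complex.I * z) with hφ
  have hφd : DifferentiableOn ℂ φ U := by
    intro z hz
    apply DifferentiableAt.differentiableWithinAt
    have : 1 - conj z₀ * z ≠ 0 := hz
    fun_prop (disch := exact this)
  have h2 := weak_hopf_holo hK hu hs hU hUD hφd
  have hpf : ∀ z, poleField c z₀ s z = c * (z - z₀)⁻¹ - φ z := fun z => by
    simp only [poleField, hφ]; ring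
  have hpK : Continuous (pU K) := (contDiff_pU hK).continuous
  have hG : Continuous fun z => 1 / 2 * pU K z * Real.exp (u z) := by
    have := hu.continuous
    fun_prop
  have hB := continuous_bdryDensity hK hu
  have i1 : IntegrableOn (fun z => 1 / 2 * pU K z * Real.exp (u z) * (z - z₀)⁻¹)
      (Metric.ball 0 1) := by
    obtain ⟨CG, hCG⟩ := (isCompact_closedBall (0 : ℂ) 1).exists_bound_of_continuousOn
      hG.continuousOn
    refine ((integrable_ball_inv z₀).const_mul CG).mono'
      (hG.measurable.mul (by fun_prop)).aestronglyMeasurable ?_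
    refine (ae_restrict_iff' Metric.isOpen_ball.measurableSet).2 (Eventually.of_forall fun z hz => ?_)
    rw [norm_mul, norm_inv]
    gcongr
    exact hCG z (Metric.ball_subset_closedBall hz)
  have i2 : IntegrableOn (fun z => 1 / 2 * pU K z * Real.exp (u z) * φ z) (Metric.ball 0 1) :=
    (((hG.continuousOn).mul (hφd.continuousOn.mono hUD)).integrableOn_compact
      (isCompact_closedBall (0:ℂ) 1)).mono_set Metric.ball_subset_closedBall
  have hne : ∀ θ, cis θ - z₀ ≠ 0 := fun θ h0 => by
    have := norm_cis θ
    rw [sub_eq_zero.1 h0] at this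
    linarith
  have c1 : Continuous fun θ => (cis θ - z₀)⁻¹ * bdryDensity K u θ :=
    ((continuous_cis.sub continuous_const).inv₀ hne).mul hB
  have c2 : Continuous fun θ => φ (cis θ) * bdryDensity K u θ :=
    (hφd.continuousOn.comp_continuous continuous_cis
      (fun θ => hUD (by simp [norm_cis]))).mul hB
  have e1 : ∀ z, 1 / 2 * pU K z * Real.exp (u z) * poleField c z₀ s z =
      c * (1 / 2 * pU K z * Real.exp (u z) * (z - z₀)⁻¹) -
        1 / 2 * pU K z * Real.exp (u z) * φ z := fun z => by rw [hpf]; ring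
  have e2 : ∀ θ, poleField c z₀ s (cis θ) * bdryDensity K u θ =
      c * ((cis θ - z₀)⁻¹ * bdryDensity K u θ) - φ (cis θ) * bdryDensity K u θ := fun z => by
    rw [hpf]; ring
  simp only [e1, e2]
  rw [integral_sub (i1.const_mul c) i2, integral_const_mul,
    intervalIntegral.integral_sub ((c1.intervalIntegrable _ _).const_mul c)
      (c2.intervalIntegrable _ _), intervalIntegral.integral_const_mul]
  linear_combination c * h1 - h2

lemma hopf_bound {K h u : ℂ → ℝ} (hK : ContDiff ℝ 2 K) (hu : ContDiff ℝ 2 u)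
    (hh : ContDiff ℝ 2 h) (hs : SolvesLiouville K h u) {z₀ : ℂ}
    (hz₀ : z₀ ∈ Metric.ball (0 : ℂ) 1) {k : ℝ}
    (hKk : ∀ z ∈ Metric.ball (0 : ℂ) 1, ‖pU K z‖ ≤ k)
    (hhk : ∀ θ, |fderiv ℝ h (cis θ) (Complex.I * cis θ)| ≤ k) :
    ∃ c : ℂ, ‖c‖ = 1 ∧ ∀ s : ℝ, ENNReal.ofReal (π * ‖hopf u z₀‖) ≤
      ENNReal.ofReal (k / 2) * ∫⁻ z, ‖poleField c z₀ s z‖ₑ ∂(massMeasure u) := by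
  have hz1 : ‖z₀‖ < 1 := by simpa using hz₀
  have hk : 0 ≤ k := (abs_nonneg _).trans (hhk 0)
  obtain ⟨c, hc1, hc2⟩ : ∃ c : ℂ, ‖c‖ = 1 ∧ c * hopf u z₀ = ‖hopf u z₀‖ := by
    rcases eq_or_ne (hopf u z₀) 0 with h0 | h0
    · exact ⟨1, by simp, by simp [h0]⟩
    · refine ⟨‖hopf u z₀‖ / hopf u z₀, ?_, by field_simp⟩
      rw [norm_div, Complex.norm_real, norm_norm, div_self (norm_ne_zero_iff.2 h0)]
  refine ⟨c, hc1, fun s => ?_⟩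
  have hid := poleField_identity hK hu hs hz₀ c s
  rw [hc2] at hid
  have hm : Measurable (poleField c z₀ s) := by unfold poleField; fun_prop
  set ψ : ℝ → ℝ := fun θ => 2 * (c * conj (cis θ) * (cis θ - z₀)⁻¹).im - s with hψ
  have hne : ∀ θ, cis θ - z₀ ≠ 0 := fun θ h0 => by
    have := norm_cis θ
    rw [sub_eq_zero.1 h0] at this
    linarith
  have cψ : Continuous ψ := by
    have h1 : Continuous fun θ => c * conj (cis θ) * (cis θ - z₀)⁻¹ :=
      (continuous_const.mul (Complex.continuous_conj.comp continuous_cis)).mul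
        ((continuous_cis.sub continuous_const).inv₀ hne)
    exact (continuous_const.mul (Complex.continuous_im.comp h1)).sub continuous_const
  have hnψ : ∀ θ, ‖poleField c z₀ s (cis θ)‖ = |ψ θ| := fun θ => by
    rw [poleField_cis c hz1, norm_mul, norm_mul, norm_cis, Complex.norm_I, Complex.norm_real]
    simp [hψ]
  have hb : (∫ θ in (-π)..π, poleField c z₀ s (cis θ) * bdryDensity K u θ).re =
      ∫ θ in (-π)..π, 1 / 2 * (ψ θ * fderiv ℝ h (cis θ) (Complex.I * cis θ) *
        Real.exp (u (cis θ) / 2)) := by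
    have hci : Continuous fun θ => poleField c z₀ s (cis θ) * bdryDensity K u θ := by
      have : ∀ θ, poleField c z₀ s (cis θ) = Complex.I * cis θ * (ψ θ : ℂ) := fun θ =>
        poleField_cis c hz1 s θ
      simp only [this]
      exact ((continuous_const.mul continuous_cis).mul (Complex.continuous_ofReal.comp cψ)).mul
        (continuous_bdryDensity hK hu)
    have := Complex.reCLM.intervalIntegral_comp_comm (hci.intervalIntegrable (μ := volume) (-π) π)
    simp only [Complex.reCLM_apply] at this
    rw [← this]
    refine intervalIntegral.integral_congr fun θ _ => ?_
    rw [poleField_cis c hz1, re_bdryDensity hu hh hs]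
  have hre := congrArg Complex.re hid
  rw [← Complex.ofReal_mul, Complex.ofReal_re, Complex.add_re, hb] at hre
  set I1 := ∫ z in Metric.ball (0 : ℂ) 1, 1 / 2 * pU K z * Real.exp (u z) * poleField c z₀ s z
  set I2 := ∫ θ in (-π)..π, 1 / 2 * (ψ θ * fderiv ℝ h (cis θ) (Complex.I * cis θ) *
        Real.exp (u (cis θ) / 2))
  rw [lintegral_massMeasure hu.continuous (by fun_prop), mul_add]
  calc ENNReal.ofReal (π * ‖hopf u z₀‖) ≤ ENNReal.ofReal (‖I1‖ + ‖I2‖) := by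
        apply ENNReal.ofReal_le_ofReal
        rw [hre]
        exact add_le_add (Complex.re_le_norm _) (Real.le_norm_self _)
    _ ≤ ENNReal.ofReal ‖I1‖ + ENNReal.ofReal ‖I2‖ := ENNReal.ofReal_add_le
    _ ≤ _ := by
        rw [ofReal_norm, ofReal_norm]
        refine add_le_add ?_ ?_
        · refine (enorm_integral_le_lintegral_enorm _).trans ?_
          have := hu.continuous.measurable
          rw [← lintegral_const_mul _ (by fun_prop)]
          refine setLIntegral_mono' Metric.isOpen_ball.measurableSet fun z hz => ?_
          simp only [← ofReal_norm]
          rw [← ENNReal.ofReal_mul (by positivity), ← ENNReal.ofReal_mul (by positivity)]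
          apply ENNReal.ofReal_le_ofReal
          rw [norm_mul, norm_mul, norm_mul, Complex.norm_real, Real.norm_of_nonneg (by positivity)]
          have := hKk z hz
          have e : ‖(1 / 2 : ℂ)‖ = 1 / 2 := by norm_num
          rw [e]
          calc _ = ‖pU K z‖ * (1 / 2 * Real.exp (u z) * ‖poleField c z₀ s z‖) := by ring
            _ ≤ k * (1 / 2 * Real.exp (u z) * ‖poleField c z₀ s z‖) := by gcongr
            _ = _ := by ring
        · simp only [I2]
          rw [intervalIntegral.integral_of_le (by linarith [Real.pi_pos])]
          refine (enorm_integral_le_lintegral_enorm _).trans ?_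
          have h1 := hu.continuous.measurable
          have h2 := measurable_cis
          rw [← lintegral_const_mul _ (by fun_prop)]
          refine lintegral_mono fun θ => ?_
          simp only [← ofReal_norm]
          rw [← ENNReal.ofReal_mul (by positivity), ← ENNReal.ofReal_mul (by positivity)]
          apply ENNReal.ofReal_le_ofReal
          rw [hnψ, norm_mul, norm_mul, norm_mul, Real.norm_of_nonneg (Real.exp_pos _).le]
          simp only [Real.norm_eq_abs]
          have := hhk θ
          rw [abs_of_pos (by norm_num : (0:ℝ) < 1 / 2)]
          calc _ = |fderiv ℝ h (cis θ) (Complex.I * cis θ)| *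
                (1 / 2 * |ψ θ| * Real.exp (u (cis θ) / 2)) := by ring
            _ ≤ k * (1 / 2 * |ψ θ| * Real.exp (u (cis θ) / 2)) := by gcongr
            _ = _ := by ring

lemma norm_cis_sub_cis (θ α : ℝ) : ‖cis θ - cis α‖ = 2 * |Real.sin ((θ - α) / 2)| := by
  have h : ‖cis θ - cis α‖ ^ 2 = (2 * |Real.sin ((θ - α) / 2)|) ^ 2 := by
    rw [Complex.sq_norm, Complex.normSq_apply, Complex.sub_re, Complex.sub_im, cis_re, cis_re,
      cis_im, cis_im, mul_pow, sq_abs]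
    have h1 : Real.cos (θ - α) = 1 - 2 * Real.sin ((θ - α) / 2) ^ 2 := by
      have := Real.cos_two_mul ((θ - α) / 2)
      rw [show 2 * ((θ - α) / 2) = θ - α by ring] at this
      rw [this, Real.cos_sq']; ring
    rw [Real.cos_sub] at h1
    nlinarith [Real.sin_sq_add_cos_sq θ, Real.sin_sq_add_cos_sq α]
  exact (pow_left_inj₀ (norm_nonneg _) (by positivity) two_ne_zero).1 h

lemma cis_injOn : InjOn cis (Ioc (-π) π) := by
  intro θ hθ α hα h
  have h0 := norm_cis_sub_cis θ α
  rw [h, sub_self, norm_zero] at h0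
  have h1 : Real.sin ((θ - α) / 2) = 0 := by
    rw [← abs_eq_zero]; linarith
  have h2 := (Real.sin_eq_zero_iff_of_lt_of_lt (by linarith [hθ.1, hα.2])
    (by linarith [hθ.2, hα.1])).1 h1
  linarith

lemma ae_massMeasure_ne (u : ℂ → ℝ) (z₀ : ℂ) :
    ∀ᵐ z ∂(massMeasure u), z ≠ z₀ := by
  have h2 : circMeas {z₀} = 0 := by
    rw [circMeas, Measure.map_apply measurable_cis (measurableSet_singleton _),
      Measure.restrict_apply (measurable_cis (measurableSet_singleton _))]
    refine Subsingleton.measure_zero ?_ _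
    rintro θ ⟨h, hθ⟩ α ⟨h', hα⟩
    exact cis_injOn hθ hα (h.trans h'.symm)
  have : massMeasure u {z₀} = 0 := by
    rw [massMeasure, Measure.add_apply, withDensity_absolutelyContinuous _ _ (by simp),
      withDensity_absolutelyContinuous _ _ h2, add_zero]
  refine (mem_ae_iff.2 ?_ : {z : ℂ | z ≠ z₀} ∈ ae (massMeasure u))
  convert this using 2
  ext z; simp

lemma norm_poleField_le {c z₀ z : ℂ} (hc : ‖c‖ = 1) (hz₀ : ‖z₀‖ < 1) (hz : ‖z‖ ≤ 1) (hne : z ≠ z₀) (s : ℝ) :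
    ‖poleField c z₀ s z‖ ≤ 2 * ‖z - z₀‖⁻¹ + |s| := by
  have h1 := norm_sub_le_norm_one_sub hz₀ hz
  have h0 : 0 < ‖z - z₀‖ := norm_pos_iff.2 (sub_ne_zero.2 hne)
  unfold poleField
  refine (norm_sub_le _ _).trans (add_le_add ((norm_sub_le _ _).trans ?_) ?_)
  · rw [two_mul]
    refine add_le_add ?_ ?_
    · rw [norm_mul, hc, one_mul, norm_inv]
    · rw [norm_mul, RCLike.norm_conj, hc, one_mul, norm_div, norm_pow, ← one_div]
      exact div_le_div₀ zero_le_one (pow_le_one₀ (norm_nonneg _) hz) h0 h1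
  · rw [norm_mul, norm_mul, Complex.norm_I, one_mul, Complex.norm_real, Real.norm_eq_abs]
    exact mul_le_of_le_one_right (abs_nonneg _) hz

/-- With the rotation chosen so that the field vanishes at `1`, it is small near `1`. -/
lemma norm_poleField_near_le {c z₀ z : ℂ} (hc : ‖c‖ = 1) (hz₀ : ‖z₀‖ < 1) (hz : ‖z‖ ≤ 1)
    {ε : ℝ} (hε : 0 < ε) (hε2 : ε ≤ 2) (h0 : ε ≤ ‖z₀ - 1‖) (h1 : ‖z - 1‖ ≤ ε / 2) :
    ‖poleField c z₀ (2 * (c * (1 - z₀)⁻¹).im) z‖ ≤ 20 / ε ^ 2 * ‖z - 1‖ := by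
  have e1 : ε ≤ ‖1 - z₀‖ := by rwa [norm_sub_rev]
  have e2 : ε / 2 ≤ ‖z - z₀‖ := by
    have := norm_sub_norm_le (1 - z₀) (1 - z)
    rw [norm_sub_rev 1 z, show 1 - z₀ - (1 - z) = z - z₀ by ring] at this
    linarith
  have e3 := norm_sub_le_norm_one_sub hz₀ hz
  have e4 : ‖1 - conj z₀‖ = ‖1 - z₀‖ := by
    rw [← RCLike.norm_conj (1 - z₀)]; simp
  have n1 : 1 - z₀ ≠ 0 := norm_pos_iff.1 (by linarith)
  have n2 : z - z₀ ≠ 0 := norm_pos_iff.1 (by linarith)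
  have n3 : 1 - conj z₀ ≠ 0 := norm_pos_iff.1 (by linarith)
  have n4 : 1 - conj z₀ * z ≠ 0 := norm_pos_iff.1 (by linarith)
  have e5 : ((2 * (c * (1 - z₀)⁻¹).im : ℝ) : ℂ) * Complex.I =
      c * (1 - z₀)⁻¹ - conj c * (1 - conj z₀)⁻¹ := by
    have : conj (c * (1 - z₀)⁻¹) = conj c * (1 - conj z₀)⁻¹ := by simp
    rw [← this]
    generalize c * (1 - z₀)⁻¹ = A
    apply Complex.ext <;> simp; ring
  have e6 : poleField c z₀ (2 * (c * (1 - z₀)⁻¹).im) z =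
      (1 - z) * (c * ((z - z₀)⁻¹ * (1 - z₀)⁻¹) +
        conj c * ((z ^ 2 + z + 1) / (1 - conj z₀ * z) + conj z₀ / ((1 - conj z₀ * z) * (1 - conj z₀)))
        + ((2 * (c * (1 - z₀)⁻¹).im : ℝ) : ℂ) * Complex.I) := by
    unfold poleField
    rw [show ((2 * (c * (1 - z₀)⁻¹).im : ℝ) : ℂ) * (Complex.I * z) =
      ((2 * (c * (1 - z₀)⁻¹).im : ℝ) : ℂ) * Complex.I * z by ring, e5]
    clear e5 e4 e3
    generalize conj z₀ = w at *
    generalize conj c = d at *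
    have n5 : 1 - z * w ≠ 0 := by rwa [mul_comm]
    field_simp
    ring
  have hz0' : 0 < ‖z - z₀‖ := by linarith
  have b1 : ‖c * ((z - z₀)⁻¹ * (1 - z₀)⁻¹)‖ ≤ 2 / ε ^ 2 := by
    rw [norm_mul, hc, one_mul, norm_mul, norm_inv, norm_inv]
    calc _ ≤ (ε / 2)⁻¹ * ε⁻¹ := by gcongr
      _ = _ := by field_simp
  have b2 : ‖conj c * ((z ^ 2 + z + 1) / (1 - conj z₀ * z) -
      -conj z₀ / ((1 - conj z₀ * z) * (1 - conj z₀)))‖ ≤ 14 / ε ^ 2 := by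
    rw [norm_mul, RCLike.norm_conj, hc, one_mul]
    have t1 : ‖z ^ 2 + z + 1‖ ≤ 3 := by
      have := pow_le_one₀ (n := 2) (norm_nonneg z) hz
      calc _ ≤ ‖z ^ 2‖ + ‖z‖ + ‖(1 : ℂ)‖ := norm_add₃_le
        _ ≤ _ := by rw [norm_pow, norm_one]; linarith
    calc _ ≤ ‖(z ^ 2 + z + 1) / (1 - conj z₀ * z)‖ +
          ‖-conj z₀ / ((1 - conj z₀ * z) * (1 - conj z₀))‖ := norm_sub_le _ _
      _ ≤ 3 / (ε / 2) + 1 / (ε / 2 * ε) := by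
        rw [norm_div, norm_div, norm_mul, norm_neg, RCLike.norm_conj, e4]
        gcongr
        · exact e2.trans e3
        · exact e2.trans e3
      _ ≤ _ := by
        rw [div_add_div _ _ (by positivity) (by positivity), div_le_div_iff₀ (by positivity) (by positivity)]
        nlinarith [pow_pos hε 3, pow_pos hε 4, mul_le_mul_of_nonneg_right hε2 (pow_pos hε 4).le,
          mul_le_mul_of_nonneg_right hε2 (pow_pos hε 3).le]
  have b3 : ‖((2 * (c * (1 - z₀)⁻¹).im : ℝ) : ℂ) * Complex.I‖ ≤ 4 / ε ^ 2 := by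
    rw [e5]
    calc _ ≤ ‖c * (1 - z₀)⁻¹‖ + ‖conj c * (1 - conj z₀)⁻¹‖ := norm_sub_le _ _
      _ ≤ ε⁻¹ + ε⁻¹ := by
        rw [norm_mul, norm_mul, RCLike.norm_conj, hc, one_mul, one_mul, norm_inv, norm_inv, e4]
        gcongr
      _ = (2 * ε) / ε ^ 2 := by field_simp; ring
      _ ≤ _ := by gcongr; linarith
  rw [e6, norm_mul, norm_sub_rev, mul_comm]
  gcongr
  calc _ ≤ 2 / ε ^ 2 + 14 / ε ^ 2 + 4 / ε ^ 2 :=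
        norm_add₃_le.trans (add_le_add (add_le_add b1 (by rwa [neg_div, sub_neg_eq_add] at b2)) b3)
    _ = _ := by ring

lemma ofReal_hopf_le {K h u : ℂ → ℝ} (hK : ContDiff ℝ 2 K) (hu : ContDiff ℝ 2 u)
    (hh : ContDiff ℝ 2 h) (hs : SolvesLiouville K h u) {z₀ : ℂ}
    (hz₀ : z₀ ∈ Metric.ball (0 : ℂ) 1) {k : ℝ}
    (hKk : ∀ z ∈ Metric.ball (0 : ℂ) 1, ‖pU K z‖ ≤ k)
    (hhk : ∀ θ, |fderiv ℝ h (cis θ) (Complex.I * cis θ)| ≤ k) :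
    ENNReal.ofReal ‖hopf u z₀‖ ≤
      ENNReal.ofReal k * ∫⁻ z, ENNReal.ofReal ‖z - z₀‖⁻¹ ∂(massMeasure u) := by
  have hz1 : ‖z₀‖ < 1 := by simpa using hz₀
  have hk : 0 ≤ k := (abs_nonneg _).trans (hhk 0)
  obtain ⟨c, hc, hcs⟩ := hopf_bound hK hu hh hs hz₀ hKk hhk
  calc ENNReal.ofReal ‖hopf u z₀‖ ≤ ENNReal.ofReal (π * ‖hopf u z₀‖) := by
        apply ENNReal.ofReal_le_ofReal
        nlinarith [Real.pi_gt_three, norm_nonneg (hopf u z₀)]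
    _ ≤ _ := hcs 0
    _ ≤ ENNReal.ofReal (k / 2) * ∫⁻ z, ENNReal.ofReal 2 * ENNReal.ofReal ‖z - z₀‖⁻¹ ∂(massMeasure u) := by
        refine mul_le_mul' le_rfl (lintegral_mono_ae ?_)
        filter_upwards [ae_massMeasure u, ae_massMeasure_ne u z₀] with z hz hzne
        rw [← ofReal_norm, ← ENNReal.ofReal_mul zero_le_two]
        apply ENNReal.ofReal_le_ofReal
        simpa using norm_poleField_le hc hz1 hz hzne 0
    _ = _ := by
        rw [lintegral_const_mul _ (by fun_prop), ← mul_assoc, ← ENNReal.ofReal_mul (by positivity)]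
        congr 2
        ring

lemma ofReal_hopf_away_le {K h u : ℂ → ℝ} (hK : ContDiff ℝ 2 K) (hu : ContDiff ℝ 2 u)
    (hh : ContDiff ℝ 2 h) (hs : SolvesLiouville K h u) {z₀ : ℂ}
    (hz₀ : z₀ ∈ Metric.ball (0 : ℂ) 1) {k : ℝ}
    (hKk : ∀ z ∈ Metric.ball (0 : ℂ) 1, ‖pU K z‖ ≤ k)
    (hhk : ∀ θ, |fderiv ℝ h (cis θ) (Complex.I * cis θ)| ≤ k)
    {ε η : ℝ} (hε : 0 < ε) (hε2 : ε ≤ 2) (h0 : ε ≤ ‖z₀ - 1‖) (hη : η ≤ ε / 2) :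
    ENNReal.ofReal ‖hopf u z₀‖ ≤ ENNReal.ofReal k *
      (ENNReal.ofReal (20 / ε ^ 2 * η) * massMeasure u univ +
       ∫⁻ z in (Metric.ball 1 η)ᶜ, (ENNReal.ofReal (2 * ‖z - z₀‖⁻¹) + ENNReal.ofReal (2 / ε))
        ∂(massMeasure u)) := by
  have hz1 : ‖z₀‖ < 1 := by simpa using hz₀
  have hk : 0 ≤ k := (abs_nonneg _).trans (hhk 0)
  have e1 : ε ≤ ‖1 - z₀‖ := by rwa [norm_sub_rev]
  obtain ⟨c, hc, hcs⟩ := hopf_bound hK hu hh hs hz₀ hKk hhk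
  set s := 2 * (c * (1 - z₀)⁻¹).im
  have hs2 : |s| ≤ 2 / ε := by
    have h1 := Complex.abs_im_le_norm (c * (1 - z₀)⁻¹)
    rw [norm_mul, hc, one_mul, norm_inv] at h1
    rw [abs_mul, abs_two, div_eq_mul_inv]
    gcongr
    exact h1.trans (inv_anti₀ hε e1)
  calc ENNReal.ofReal ‖hopf u z₀‖ ≤ ENNReal.ofReal (π * ‖hopf u z₀‖) := by
        apply ENNReal.ofReal_le_ofReal
        nlinarith [Real.pi_gt_three, norm_nonneg (hopf u z₀)]
    _ ≤ _ := hcs s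
    _ ≤ ENNReal.ofReal k * ∫⁻ z, ‖poleField c z₀ s z‖ₑ ∂(massMeasure u) := by
        gcongr; linarith
    _ ≤ _ := by
        gcongr
        rw [← lintegral_add_compl _ (Metric.isOpen_ball.measurableSet : MeasurableSet (Metric.ball (1:ℂ) η))]
        refine add_le_add ?_ ?_
        · calc _ ≤ ∫⁻ z in Metric.ball 1 η, ENNReal.ofReal (20 / ε ^ 2 * η) ∂(massMeasure u) := by
                refine lintegral_mono_ae ?_
                filter_upwards [ae_restrict_of_ae (ae_massMeasure u),
                  ae_restrict_mem Metric.isOpen_ball.measurableSet] with z hz hz2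
                have hz3 : ‖z - 1‖ < η := by simpa [dist_eq_norm] using hz2
                rw [← ofReal_norm]
                apply ENNReal.ofReal_le_ofReal
                refine (norm_poleField_near_le hc hz1 hz hε hε2 h0 (by linarith)).trans ?_
                gcongr
            _ ≤ _ := by
                rw [setLIntegral_const]
                gcongr
                exact subset_univ _
        · refine lintegral_mono_ae ?_
          filter_upwards [ae_restrict_of_ae (ae_massMeasure u),
            ae_restrict_of_ae (ae_massMeasure_ne u z₀)] with z hz hzne
          rw [← ofReal_norm, ← ENNReal.ofReal_add (by positivity) (by positivity)]
          apply ENNReal.ofReal_le_ofReal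
          exact (norm_poleField_le hc hz1 hz hzne s).trans (by gcongr)

lemma gauss_bonnet {K h u : ℂ → ℝ} (hu : ContDiff ℝ 2 u)
    (hh : ContDiff ℝ 2 h) (hs : SolvesLiouville K h u) :
    (∫ z in Metric.ball (0 : ℂ) 1, K z * Real.exp (u z)) +
      ∫ θ in (-π)..π, h (cis θ) * Real.exp (u (cis θ) / 2) = 2 * π := by
  have hp := contDiff_pU hu
  have h1 := integral_disk_dzb isOpen_univ (subset_univ _) hp.contDiffOn
  have hud : Differentiable ℝ u := hu.differentiable (by norm_num)
  have hre : ∀ t, (cis t * pU u (cis t)).re = h (cis t) * Real.exp (u (cis t) / 2) - 1 := by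
    intro t
    have h1 := hs.2 (cis t) (by simp [unitCircle, norm_cis])
    rw [normalDeriv, fderiv_eq_re_dz u _ _ (hud _)] at h1
    change 2 * (pU u (cis t) * cis t).re + 2 = _ at h1
    rw [mul_comm (cis t)]
    linarith
  have h2 : ∫ z in Metric.ball (0 : ℂ) 1, dzb (pU u) z =
      ((-(1 / 2) * ∫ z in Metric.ball (0 : ℂ) 1, K z * Real.exp (u z) : ℝ) : ℂ) := by
    rw [← integral_const_mul, ← integral_complex_ofReal]
    refine setIntegral_congr_fun Metric.isOpen_ball.measurableSet fun z hz => ?_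
    rw [hs.dzb_pU hu hz]; push_cast; ring
  have h3 := congrArg Complex.re h1
  rw [h2, Complex.ofReal_re] at h3
  have hci : Continuous fun θ => 1 / 2 * (cis θ * pU u (cis θ)) :=
    continuous_const.mul (continuous_cis.mul (hp.continuous.comp continuous_cis))
  have h4 := Complex.reCLM.intervalIntegral_comp_comm (hci.intervalIntegrable (μ := volume) (-π) π)
  simp only [Complex.reCLM_apply] at h4
  rw [← h4] at h3
  have h5 : ∀ θ, (1 / 2 * (cis θ * pU u (cis θ))).re =
      1 / 2 * (h (cis θ) * Real.exp (u (cis θ) / 2)) - 1 / 2 := fun θ => by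
    rw [show (1 / 2 : ℂ) = ((1 / 2 : ℝ) : ℂ) by push_cast; ring, Complex.re_ofReal_mul, hre]; ring
  simp only [h5] at h3
  have ci : Continuous fun θ => h (cis θ) * Real.exp (u (cis θ) / 2) :=
    (hh.continuous.comp continuous_cis).mul
      (Real.continuous_exp.comp ((hu.continuous.comp continuous_cis).div_const 2))
  rw [intervalIntegral.integral_sub ((ci.intervalIntegrable _ _).const_mul _)
    (continuous_const.intervalIntegrable _ _), intervalIntegral.integral_const_mul,
    intervalIntegral.integral_const, smul_eq_mul] at h3
  linarith

/-- Kazdan-Warner type identity for the conformal field `e - ē z²`, `e = cis α`. -/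
lemma kazdan_warner {K h u : ℂ → ℝ} (hK : ContDiff ℝ 2 K) (hu : ContDiff ℝ 2 u)
    (hh : ContDiff ℝ 2 h) (hs : SolvesLiouville K h u) (α : ℝ) :
    ∫ z in Metric.ball (0 : ℂ) 1, Real.exp (u z) * fderiv ℝ K z (cis α - conj (cis α) * z ^ 2) =
      4 * ∫ θ in (-π)..π, Real.exp (u (cis θ) / 2) *
        fderiv ℝ h (cis θ) (Complex.I * cis θ) * Real.sin (θ - α) := by
  set φ : ℂ → ℂ := fun z => cis α - conj (cis α) * z ^ 2 with hφ
  have hφd : Differentiable ℂ φ := by fun_prop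
  have h1 := weak_hopf_holo hK hu hs isOpen_univ (subset_univ _) hφd.differentiableOn
  have hKd : Differentiable ℝ K := hK.differentiable (by norm_num)
  have hpK : Continuous (pU K) := (contDiff_pU hK).continuous
  have hG : Continuous fun z => 1 / 2 * pU K z * Real.exp (u z) * φ z := by
    have := hu.continuous
    have := hφd.continuous
    fun_prop
  have hφc : ∀ θ, φ (cis θ) = Complex.I * cis θ * ((-2 * Real.sin (θ - α) : ℝ) : ℂ) := by
    intro θ
    have e1 : cis α = cis θ * conj (cis (θ - α)) := by
      rw [← cis_neg, ← cis_add]; congr 1; ring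
    have e2 : conj (cis α) * cis θ = cis (θ - α) := by
      rw [← cis_neg, ← cis_add]; congr 1; ring
    have e3 : cis (θ - α) - conj (cis (θ - α)) = 2 * Complex.I * (Real.sin (θ - α) : ℝ) := by
      apply Complex.ext
      · simp only [Complex.sub_re, Complex.conj_re, sub_self]
        rw [mul_comm, Complex.re_ofReal_mul]; simp
      · simp only [Complex.sub_im, Complex.conj_im, cis_im]
        rw [mul_comm, Complex.im_ofReal_mul]; simp; ring
    simp only [hφ]
    push_cast at e3 ⊢
    linear_combination e1 - cis θ * e2 - cis θ * e3
  have h2 := congrArg Complex.re h1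
  have hci : Continuous fun θ => φ (cis θ) * bdryDensity K u θ :=
    (hφd.continuous.comp continuous_cis).mul (continuous_bdryDensity hK hu)
  have h4 := Complex.reCLM.intervalIntegral_comp_comm (hci.intervalIntegrable (μ := volume) (-π) π)
  simp only [Complex.reCLM_apply] at h4
  rw [← h4, ← integral_neg] at h2
  have hGi : IntegrableOn (fun z => -(1 / 2 * pU K z * Real.exp (u z) * φ z))
      (Metric.ball 0 1) := ((hG.neg.continuousOn).integrableOn_compact
      (isCompact_closedBall (0:ℂ) 1)).mono_set Metric.ball_subset_closedBall
  have h5 := integral_re hGi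
  simp only [RCLike.re_to_complex] at h5
  rw [← h5] at h2
  have h6 : ∀ z, (-(1 / 2 * pU K z * Real.exp (u z) * φ z)).re =
      -(1 / 4) * (Real.exp (u z) * fderiv ℝ K z (φ z)) := fun z => by
    rw [fderiv_eq_re_dz K _ _ (hKd z)]
    change _ = -(1 / 4) * (Real.exp (u z) * (2 * (pU K z * φ z).re))
    rw [show -(1 / 2 * pU K z * Real.exp (u z) * φ z) =
      ((-(1 / 2) * Real.exp (u z) : ℝ) : ℂ) * (pU K z * φ z) by push_cast; ring,
      Complex.re_ofReal_mul]
    ring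
  have h7 : ∀ θ, (φ (cis θ) * bdryDensity K u θ).re = -(Real.exp (u (cis θ) / 2) *
        fderiv ℝ h (cis θ) (Complex.I * cis θ) * Real.sin (θ - α)) := fun θ => by
    rw [hφc, re_bdryDensity hu hh hs]; ring
  simp only [h6, h7] at h2
  rw [integral_const_mul, intervalIntegral.integral_neg] at h2
  linarith

/-! ### Transport of the inverse metric along segments -/

/-- The system satisfied by `w = e^{-u/2}`, `g = w_z`, `a = w_{z\bar z}` along a segment with
velocity `v`, where `q` is a multiple of the Hopf coefficient and `κ = K_z`. -/
structure IsTransport (v : ℂ) (w : ℝ → ℝ) (g : ℝ → ℂ) (a : ℝ → ℝ) (q κ : ℝ → ℂ) : Prop where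
  hw : ∀ t ∈ Icc (0 : ℝ) 1, HasDerivAt w (2 * (g t * v).re) t
  hg : ∀ t ∈ Icc (0 : ℝ) 1, HasDerivAt g (q t * w t * v + a t * conj v) t
  ha : ∀ t ∈ Icc (0 : ℝ) 1,
    HasDerivAt a (2 * ((κ t / (4 * w t) + q t * conj (g t)) * v).re) t
  pos : ∀ t, 0 < w t

namespace IsTransport

variable {v : ℂ} {w : ℝ → ℝ} {g : ℝ → ℂ} {a : ℝ → ℝ} {q κ : ℝ → ℂ}

/-- The derivative of `a`. -/
def aDeriv (v : ℂ) (w : ℝ → ℝ) (g q κ : ℝ → ℂ) (t : ℝ) : ℝ :=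
  2 * ((κ t / (4 * w t) + q t * conj (g t)) * v).re

lemma hasDerivAt_gHat (h : IsTransport v w g a q κ) {t : ℝ} (ht : t ∈ Icc (0 : ℝ) 1) :
    HasDerivAt (fun t => g t - a t * conj (t * v))
      (q t * w t * v - aDeriv v w g q κ t * conj (t * v)) t := by
  have h1 := h.hg t ht
  have h2 := (h.ha t ht).ofReal_comp
  have h3 : HasDerivAt (fun t : ℝ => conj ((t : ℂ) * v)) (conj v) t := by
    have : HasDerivAt (fun t : ℝ => (t : ℂ) * conj v) (1 * conj v) t :=
      (hasDerivAt_id t).ofReal_comp.mul_const _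
    simpa using this
  refine (h1.sub (h2.mul h3)).congr_deriv ?_
  simp only [aDeriv]
  ring

lemma hasDerivAt_wHat (h : IsTransport v w g a q κ) {t : ℝ} (ht : t ∈ Icc (0 : ℝ) 1) :
    HasDerivAt (fun t => w t - 2 * (g t * (t * v)).re + a t * (t ^ 2 * ‖v‖ ^ 2))
      (-2 * (t * v * (q t * w t * v)).re + t ^ 2 * ‖v‖ ^ 2 * aDeriv v w g q κ t) t := by
  have h1 := h.hg t ht
  have h2 := h.ha t ht
  have h0 := h.hw t ht
  have h3 : HasDerivAt (fun t : ℝ => (t : ℂ) * v) (1 * v) t :=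
    (hasDerivAt_id t).ofReal_comp.mul_const _
  have h4 := h1.mul h3
  have h5 : HasDerivAt (fun t => (g t * (t * v)).re)
      (((q t * w t * v + a t * conj v) * (t * v) + g t * (1 * v))).re t :=
    (Complex.reCLM.hasFDerivAt.comp_hasDerivAt t h4)
  have h6 : HasDerivAt (fun t : ℝ => t ^ 2 * ‖v‖ ^ 2) (2 * t * ‖v‖ ^ 2) t := by
    simpa using ((hasDerivAt_pow 2 t).mul_const (‖v‖ ^ 2))
  refine ((h0.sub (h5.const_mul 2)).add (h2.mul h6)).congr_deriv ?_
  have h7 : ‖v‖ ^ 2 = v.re ^ 2 + v.im ^ 2 := by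
    rw [Complex.sq_norm, Complex.normSq_apply]; ring
  simp only [aDeriv]
  rw [h7]
  simp
  ring

lemma abs_aDeriv_le (h : IsTransport v w g a q κ) {t k G d : ℝ}
    (hκ : ‖κ t‖ ≤ k) (hg : ‖g t‖ ≤ G) (hv : ‖v‖ ≤ d) :
    |aDeriv v w g q κ t| ≤ 2 * d * (k / 4 * (w t)⁻¹ + ‖q t‖ * G) := by
  have hw := h.pos t
  have hd : 0 ≤ d := (norm_nonneg v).trans hv
  have hk : 0 ≤ k := (norm_nonneg _).trans hκ
  unfold aDeriv
  rw [abs_mul, abs_two, mul_assoc]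
  gcongr
  refine (Complex.abs_re_le_norm _).trans ?_
  rw [norm_mul, mul_comm]
  gcongr
  refine (norm_add_le _ _).trans ?_
  rw [norm_div, norm_mul, norm_mul, Complex.norm_conj, Complex.norm_real, Real.norm_of_nonneg hw.le]
  gcongr
  rw [div_mul_eq_mul_div, div_eq_mul_inv, mul_inv]
  norm_num
  have : 0 < (w t)⁻¹ := inv_pos.2 hw
  nlinarith

end IsTransport

/-- A mean value inequality with variable bound. -/
lemma norm_sub_le_integral {E : Type*} [NormedAddCommGroup E] [NormedSpace ℝ E] {f f' : ℝ → E}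
    {b : ℝ → ℝ} {s t c : ℝ} (hst : s ≤ t)
    (hf : ∀ r ∈ Icc s t, HasDerivAt f (f' r) r)
    (hb : Continuous b) (hle : ∀ r ∈ Icc s t, ‖f' r‖ ≤ c * b r)  :
    ‖f t - f s‖ ≤ c * ∫ r in s..t, b r := by
  have hB : ∀ x, HasDerivAt (fun x => c * ∫ r in s..x, b r) (c * b x) x := fun x =>
    (intervalIntegral.integral_hasDerivAt_right (hb.intervalIntegrable _ _)
      (hb.stronglyMeasurableAtFilter _ _) hb.continuousAt).const_mul c
  have := image_norm_le_of_norm_deriv_right_le_deriv_boundary (f := fun x => f x - f s)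
    (f' := f') (a := s) (b := t) (B := fun x => c * ∫ r in s..x, b r) (B' := fun x => c * b x)
    (fun x hx => ((hf x hx).continuousAt.sub continuousAt_const).continuousWithinAt)
    (fun x hx => ((hf x ⟨hx.1, hx.2.le⟩).sub_const _).hasDerivWithinAt)
    (by simp) hB (fun x hx => hle x ⟨hx.1, hx.2.le⟩)
  exact this ⟨hst, le_rfl⟩

namespace IsTransport

variable {v : ℂ} {w : ℝ → ℝ} {g : ℝ → ℂ} {a : ℝ → ℝ} {q κ : ℝ → ℂ}

lemma size_g {v gx g0 : ℂ} {a a0 t δ d k N : ℝ} (hδ : 0 < δ) (hd : 0 ≤ d) (ht : 0 ≤ t)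
    (hk : 1 ≤ k) (hv : ‖v‖ ≤ d) (hg0 : 2 * ‖g0‖ ≤ k) (ha0 : δ * |a0| ≤ k ^ 2 / 2)
    (hα : δ * |a - a0| ≤ N) (hβ : δ * ‖gx - a * conj (t * v) - g0‖ ≤ N * (δ + t * d)) :
    δ * ‖gx‖ ≤ (k ^ 2 + 2 * N) * (δ + t * d) := by
  have htd : 0 ≤ t * d := by positivity
  have e1 : ‖gx‖ ≤ ‖gx - a * conj (t * v) - g0‖ + ‖g0‖ + |a| * (t * d) := by
    have : gx = (gx - a * conj (t * v) - g0) + g0 + a * conj (t * v) := by ring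
    conv_lhs => rw [this]
    refine (norm_add₃_le).trans ?_
    gcongr
    rw [norm_mul, Complex.norm_real, Real.norm_eq_abs, Complex.norm_conj, norm_mul,
      Complex.norm_real, Real.norm_of_nonneg ht]
    gcongr
  have e2 : δ * |a| ≤ N + k ^ 2 / 2 := by
    have : |a| ≤ |a - a0| + |a0| := by
      have := abs_add_le (a - a0) a0; simpa using this
    nlinarith
  have e3 : δ * ‖g0‖ ≤ k ^ 2 / 2 * (δ + t * d) := by
    have : ‖g0‖ ≤ k ^ 2 / 2 := by nlinarith
    nlinarith [mul_nonneg (sq_nonneg k) htd]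
  have e4 : δ * |a| * (t * d) ≤ (N + k ^ 2 / 2) * (δ + t * d) := by
    have : 0 ≤ δ * |a| := by positivity
    nlinarith
  nlinarith

lemma size_w {v gx g0 : ℂ} {w a a0 t δ d k N : ℝ} (hδ : 0 < δ) (hd : 0 ≤ d) (ht : 0 ≤ t)
    (hk : 1 ≤ k) (hv : ‖v‖ ≤ d) (hg0 : 2 * ‖g0‖ ≤ k) (ha0 : δ * |a0| ≤ k ^ 2 / 2)
    (hα : δ * |a - a0| ≤ N) (hβ : δ * ‖gx - a * conj (t * v) - g0‖ ≤ N * (δ + t * d))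
    (hω : δ * |w - 2 * (gx * (t * v)).re + a * (t ^ 2 * ‖v‖ ^ 2) - δ| ≤ N * (δ + t * d) ^ 2) :
    δ * w ≤ (5 * k ^ 2 + 4 * N) * (δ + t * d) ^ 2 := by
  have htd : 0 ≤ t * d := by positivity
  have hN : 0 ≤ N := le_trans (by positivity) hα
  have e2 : δ * |a| ≤ N + k ^ 2 / 2 := by
    have : |a| ≤ |a - a0| + |a0| := by
      have := abs_add_le (a - a0) a0; simpa using this
    nlinarith
  set β := gx - a * conj (t * v) - g0 with hβd
  set ω := w - 2 * (gx * (t * v)).re + a * (t ^ 2 * ‖v‖ ^ 2) - δ with hωd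
  have hx : ‖(t : ℂ) * v‖ ≤ t * d := by
    rw [norm_mul, Complex.norm_real, Real.norm_of_nonneg ht]; gcongr
  have e0 : w = δ + ω + 2 * ((β + g0) * (t * v)).re + a * ‖(t : ℂ) * v‖ ^ 2 := by
    have : gx * (t * v) = (β + g0) * (t * v) + a * ‖(t : ℂ) * v‖ ^ 2 := by
      rw [hβd, ← Complex.ofReal_pow, Complex.sq_norm, Complex.normSq_eq_conj_mul_self]; ring
    rw [hωd, this, Complex.add_re, norm_mul, Complex.norm_real, Real.norm_eq_abs]
    have : ((a : ℂ) * ((((|t| * ‖v‖ : ℝ)) : ℂ)) ^ 2).re = a * (t ^ 2 * ‖v‖ ^ 2) := by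
      rw [← Complex.ofReal_pow, Complex.re_ofReal_mul, Complex.ofReal_re, mul_pow, sq_abs]
    rw [this, mul_pow, sq_abs]
    ring
  have e1 : w ≤ δ + |ω| + 2 * ((‖β‖ + ‖g0‖) * (t * d)) + |a| * (t * d) ^ 2 := by
    have h1 : ((β + g0) * (t * v)).re ≤ (‖β‖ + ‖g0‖) * (t * d) := by
      refine (Complex.re_le_norm _).trans ?_
      rw [norm_mul]
      gcongr
      exact norm_add_le _ _
    have h2 : a * ‖(t : ℂ) * v‖ ^ 2 ≤ |a| * (t * d) ^ 2 := by
      gcongr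
      exact le_abs_self a
    have := le_abs_self ω
    linarith
  set s := δ + t * d with hs
  have hs1 : t * d ≤ s := by linarith
  have hs2 : δ ≤ s := by linarith
  have hs0 : 0 ≤ s := by linarith
  have f1 : δ * ‖β‖ * (t * d) ≤ N * s ^ 2 := by
    calc _ ≤ (N * s) * s := by gcongr
      _ = _ := by ring
  have f2 : δ * ‖g0‖ * (t * d) ≤ k ^ 2 / 2 * s ^ 2 := by
    have h3 : ‖g0‖ ≤ k ^ 2 / 2 := by nlinarith
    calc _ ≤ s * (k ^ 2 / 2) * s := by gcongr
      _ = _ := by ring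
  have f3 : δ * |a| * (t * d) ^ 2 ≤ (N + k ^ 2 / 2) * s ^ 2 := by gcongr
  have f4 : δ * δ ≤ s ^ 2 := by nlinarith
  have f5 : (1 + k ^ 2 / 2 + k ^ 2) * s ^ 2 ≤ 5 * k ^ 2 * s ^ 2 := by
    gcongr
    nlinarith
  nlinarith

/-- Outgoing transport estimate: along a segment from the minimum point the solution stays close
to its Taylor polynomial if the weighted integral of `Θ` is small. -/
lemma leg_out (h : IsTransport v w g a q κ) {k δ d : ℝ} (hk : 1 ≤ k) (hδ : 0 < δ) (hd : 0 ≤ d)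
    (hv : ‖v‖ ≤ d) (hw0 : w 0 = δ) (hg0 : 2 * ‖g 0‖ ≤ k) (ha0 : δ * |a 0| ≤ k ^ 2 / 2)
    (hκ : ∀ t ∈ Icc (0 : ℝ) 1, ‖κ t‖ ≤ k) {Θ : ℝ → ℝ} (hΘc : Continuous Θ) (hΘ : ∀ t, Θ t = ‖q t‖ + (w t)⁻¹)
    (hI : 32 * k * (∫ t in (0 : ℝ)..1, Θ t * ((δ + t * d) * d)) ≤ 1) :
    ∃ N, N ≤ 40 * k ^ 3 * (∫ t in (0 : ℝ)..1, Θ t * ((δ + t * d) * d)) ∧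
      δ * |a 1 - a 0| ≤ N ∧ δ * ‖g 1 - a 1 * conj v - g 0‖ ≤ N * (δ + d) ∧
      δ * |w 1 - 2 * (g 1 * v).re + a 1 * ‖v‖ ^ 2 - δ| ≤ N * (δ + d) ^ 2 := by
  set I := ∫ t in (0 : ℝ)..1, Θ t * ((δ + t * d) * d) with hIdef
  have hga : ContinuousOn a (Icc 0 1) := fun t ht => (h.ha t ht).continuousAt.continuousWithinAt
  have hgH : ContinuousOn (fun t => g t - a t * conj ((t : ℂ) * v)) (Icc 0 1) := fun t ht =>
    (h.hasDerivAt_gHat ht).continuousAt.continuousWithinAt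
  have hwH : ContinuousOn (fun t => w t - 2 * (g t * (t * v)).re + a t * (t ^ 2 * ‖v‖ ^ 2))
    (Icc 0 1) := fun t ht => (h.hasDerivAt_wHat ht).continuousAt.continuousWithinAt
  have hs0 : ∀ t ∈ Icc (0 : ℝ) 1, 0 < δ + t * d := fun t ht => by
    have := mul_nonneg ht.1 hd; linarith
  set m : ℝ → ℝ := fun t => max (δ * |a t - a 0|)
    (max (δ * ‖g t - a t * conj (t * v) - g 0‖ / (δ + t * d))
      (δ * |w t - 2 * (g t * (t * v)).re + a t * (t ^ 2 * ‖v‖ ^ 2) - δ| / (δ + t * d) ^ 2))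
    with hm
  have hmc : ContinuousOn m (Icc 0 1) := by
    have hsc : ContinuousOn (fun t : ℝ => δ + t * d) (Icc 0 1) := by fun_prop
    refine ContinuousOn.sup (continuousOn_const.mul (hga.sub continuousOn_const).abs) ?_
    refine ContinuousOn.sup ?_ ?_
    · exact (continuousOn_const.mul (hgH.sub continuousOn_const).norm).div hsc
        fun t ht => (hs0 t ht).ne'
    · exact (continuousOn_const.mul (hwH.sub continuousOn_const).abs).div (hsc.pow 2)
        fun t ht => (pow_pos (hs0 t ht) 2).ne'
  obtain ⟨t₀, ht₀, hmax⟩ := isCompact_Icc.exists_isMaxOn ⟨0, by simp⟩ hmc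
  set N := m t₀ with hN
  have hmN : ∀ t ∈ Icc (0 : ℝ) 1, m t ≤ N := fun t ht => hmax ht
  have hα : ∀ t ∈ Icc (0 : ℝ) 1, δ * |a t - a 0| ≤ N := fun t ht =>
    (le_max_left _ _).trans (hmN t ht)
  have hβ : ∀ t ∈ Icc (0 : ℝ) 1, δ * ‖g t - a t * conj (t * v) - g 0‖ ≤ N * (δ + t * d) := by
    intro t ht
    rw [← div_le_iff₀ (hs0 t ht)]
    exact ((le_max_left _ _).trans (le_max_right _ _)).trans (hmN t ht)
  have hω : ∀ t ∈ Icc (0 : ℝ) 1,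
      δ * |w t - 2 * (g t * (t * v)).re + a t * (t ^ 2 * ‖v‖ ^ 2) - δ| ≤ N * (δ + t * d) ^ 2 := by
    intro t ht
    rw [← div_le_iff₀ (pow_pos (hs0 t ht) 2)]
    exact ((le_max_right _ _).trans (le_max_right _ _)).trans (hmN t ht)
  have hN0 : 0 ≤ N := le_trans (by positivity) (hα 0 (by simp))
  set L := 5 * k ^ 2 + 4 * N with hL
  have hL1 : 1 ≤ L := by nlinarith
  have hgL : ∀ t ∈ Icc (0 : ℝ) 1, ‖g t‖ ≤ L * (δ + t * d) / δ := by
    intro t ht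
    have := size_g hδ hd ht.1 hk hv hg0 ha0 (hα t ht) (hβ t ht)
    rw [le_div_iff₀ hδ, mul_comm]
    refine this.trans ?_
    have := hs0 t ht
    gcongr
    nlinarith
  have hwL : ∀ t ∈ Icc (0 : ℝ) 1, w t ≤ L * (δ + t * d) ^ 2 / δ := by
    intro t ht
    have := size_w hδ hd ht.1 hk hv hg0 ha0 (hα t ht) (hβ t ht) (hω t ht)
    rw [le_div_iff₀ hδ, mul_comm]
    exact this
  set b : ℝ → ℝ := fun t => Θ t * ((δ + t * d) * d) with hb
  have hbc : Continuous b := by fun_prop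
  have hΘ0 : ∀ t, 0 ≤ Θ t := fun t => by
    rw [hΘ]; have := inv_pos.2 (h.pos t); positivity
  have hb0 : ∀ t ∈ Icc (0 : ℝ) 1, 0 ≤ b t := fun t ht =>
    mul_nonneg (hΘ0 t) (mul_nonneg (hs0 t ht).le hd)
  have hIb : ∀ t ∈ Icc (0 : ℝ) 1, ∫ r in (0 : ℝ)..t, b r ≤ I := by
    intro t ht
    refine intervalIntegral.integral_mono_interval le_rfl ht.1 ht.2 ?_
      (hbc.intervalIntegrable _ _)
    exact (ae_restrict_iff' measurableSet_Ioc).2 (Eventually.of_forall fun r hr =>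
      hb0 r ⟨hr.1.le, hr.2⟩)
  have hq : ∀ t, ‖q t‖ ≤ Θ t := fun t => by
    rw [hΘ]; have := inv_pos.2 (h.pos t); linarith
  have hda : ∀ t ∈ Icc (0 : ℝ) 1, |aDeriv v w g q κ t| ≤ 2 * k * L / δ * b t := by
    intro t ht
    refine (h.abs_aDeriv_le (hκ t ht) (hgL t ht) hv).trans ?_
    have h1 : k / 4 * (w t)⁻¹ ≤ k * (L * (δ + t * d) / δ) * (w t)⁻¹ := by
      have := inv_pos.2 (h.pos t)
      gcongr
      have : 1 ≤ L * (δ + t * d) / δ := by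
        rw [le_div_iff₀ hδ]
        have := mul_nonneg ht.1 hd
        nlinarith
      nlinarith
    have h2 : ‖q t‖ * (L * (δ + t * d) / δ) ≤ k * (L * (δ + t * d) / δ) * ‖q t‖ := by
      have : 0 ≤ L * (δ + t * d) / δ := by have := hs0 t ht; positivity
      nlinarith [mul_nonneg (norm_nonneg (q t)) this]
    calc _ ≤ 2 * d * (k * (L * (δ + t * d) / δ) * (w t)⁻¹ +
            k * (L * (δ + t * d) / δ) * ‖q t‖) := by gcongr
      _ = 2 * k * L / δ * b t := by rw [hb]; simp only [hΘ]; ring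
  have hxr : ∀ t ∈ Icc (0 : ℝ) 1, ‖(t : ℂ) * v‖ ≤ δ + t * d := by
    intro t ht
    rw [norm_mul, Complex.norm_real, Real.norm_of_nonneg ht.1]
    have := mul_le_mul_of_nonneg_left hv ht.1
    linarith
  have hqwv : ∀ t ∈ Icc (0 : ℝ) 1, ‖q t * w t * v‖ ≤ L / δ * (δ + t * d) * b t := by
    intro t ht
    have := hs0 t ht
    rw [norm_mul, norm_mul, Complex.norm_real, Real.norm_of_nonneg (h.pos t).le]
    calc _ ≤ Θ t * (L * (δ + t * d) ^ 2 / δ) * d := by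
          gcongr
          · exact mul_nonneg (hΘ0 t) (by positivity)
          · exact (h.pos t).le
          · exact hΘ0 t
          · exact hq t
          · exact hwL t ht
      _ = _ := by rw [hb]; ring
  have sα : ∀ t ∈ Icc (0 : ℝ) 1, δ * |a t - a 0| ≤ 4 * k * L * I := by
    intro t ht
    have := norm_sub_le_integral (c := 2 * k * L / δ) ht.1
      (fun r hr => h.ha r ⟨hr.1, hr.2.trans ht.2⟩) hbc
      (fun r hr => hda r ⟨hr.1, hr.2.trans ht.2⟩)
    rw [Real.norm_eq_abs] at this
    have h2 := hIb t ht
    have h3 : 0 ≤ I := (intervalIntegral.integral_nonneg ht.1 fun r hr =>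
      hb0 r ⟨hr.1, hr.2.trans ht.2⟩).trans h2
    calc _ ≤ δ * (2 * k * L / δ * I) := by
          gcongr
          exact this.trans (by gcongr)
      _ = 2 * k * L * I := by field_simp
      _ ≤ _ := by gcongr; norm_num
  have hsm : ∀ {r t : ℝ}, r ≤ t → δ + r * d ≤ δ + t * d := fun h => by gcongr
  have sβ : ∀ t ∈ Icc (0 : ℝ) 1, δ * ‖g t - a t * conj (t * v) - g 0‖ / (δ + t * d) ≤
      4 * k * L * I := by
    intro t ht
    have hst := hs0 t ht
    have := norm_sub_le_integral (c := 4 * k * L / δ * (δ + t * d)) ht.1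
      (fun r hr => h.hasDerivAt_gHat (t := r) ⟨hr.1, hr.2.trans ht.2⟩) hbc
      (fun r hr => by
        have hr' : r ∈ Icc (0 : ℝ) 1 := ⟨hr.1, hr.2.trans ht.2⟩
        have hsr := hs0 r hr'
        have hb0r := hb0 r hr'
        refine (norm_sub_le _ _).trans ?_
        have h1 := hqwv r hr'
        have h2 : ‖(aDeriv v w g q κ r : ℂ) * conj ((r : ℂ) * v)‖ ≤
            2 * k * L / δ * b r * (δ + r * d) := by
          rw [norm_mul, Complex.norm_conj, Complex.norm_real]
          exact mul_le_mul (hda r hr') (hxr r hr') (norm_nonneg _) (by positivity)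
        calc _ ≤ L / δ * (δ + r * d) * b r + 2 * k * L / δ * b r * (δ + r * d) := add_le_add h1 h2
          _ = (1 + 2 * k) * L / δ * (δ + r * d) * b r := by ring
          _ ≤ 4 * k * L / δ * (δ + t * d) * b r := by
            gcongr
            · linarith
            · exact hr.2)
    simp only [Complex.ofReal_zero, zero_mul, map_zero, mul_zero, sub_zero] at this
    rw [div_le_iff₀ hst]
    calc _ ≤ δ * (4 * k * L / δ * (δ + t * d) * I) := by
          gcongr
          exact this.trans (by gcongr; exact hIb t ht)
      _ = _ := by field_simp
  have sω : ∀ t ∈ Icc (0 : ℝ) 1,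
      δ * |w t - 2 * (g t * (t * v)).re + a t * (t ^ 2 * ‖v‖ ^ 2) - δ| / (δ + t * d) ^ 2 ≤
      4 * k * L * I := by
    intro t ht
    have hst := hs0 t ht
    have := norm_sub_le_integral (c := 4 * k * L / δ * (δ + t * d) ^ 2) ht.1
      (fun r hr => h.hasDerivAt_wHat (t := r) ⟨hr.1, hr.2.trans ht.2⟩) hbc
      (fun r hr => by
        have hr' : r ∈ Icc (0 : ℝ) 1 := ⟨hr.1, hr.2.trans ht.2⟩
        have hsr := hs0 r hr'
        have hb0r := hb0 r hr'
        refine (norm_add_le _ _).trans ?_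
        have h1 : ‖-2 * ((r : ℂ) * v * (q r * w r * v)).re‖ ≤
            2 * ((δ + r * d) * (L / δ * (δ + r * d) * b r)) := by
          rw [norm_mul, norm_neg, Real.norm_ofNat]
          gcongr
          refine (Complex.abs_re_le_norm _).trans ?_
          rw [norm_mul]
          exact mul_le_mul (hxr r hr') (hqwv r hr') (norm_nonneg _) hsr.le
        have h2 : ‖r ^ 2 * ‖v‖ ^ 2 * aDeriv v w g q κ r‖ ≤
            (δ + r * d) ^ 2 * (2 * k * L / δ * b r) := by
          rw [norm_mul]
          refine mul_le_mul ?_ (hda r hr') (norm_nonneg _) (by positivity)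
          rw [← mul_pow, norm_pow]
          have := hxr r hr'
          rw [norm_mul, Complex.norm_real] at this
          rw [norm_mul, norm_norm]
          gcongr
        calc _ ≤ 2 * ((δ + r * d) * (L / δ * (δ + r * d) * b r)) +
              (δ + r * d) ^ 2 * (2 * k * L / δ * b r) := add_le_add h1 h2
          _ = (2 + 2 * k) * L / δ * (δ + r * d) ^ 2 * b r := by ring
          _ ≤ 4 * k * L / δ * (δ + t * d) ^ 2 * b r := by
            gcongr
            · linarith
            · exact hr.2)
    simp only [Complex.ofReal_zero, zero_mul, mul_zero, sub_zero, Complex.zero_re,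
      zero_pow two_ne_zero, add_zero, hw0, Real.norm_eq_abs] at this
    rw [div_le_iff₀ (by positivity)]
    calc _ ≤ δ * (4 * k * L / δ * (δ + t * d) ^ 2 * I) := by
          gcongr
          exact this.trans (by gcongr; exact hIb t ht)
      _ = _ := by field_simp
  have hNI : N ≤ 4 * k * L * I := by
    rw [hN]
    exact max_le (sα t₀ ht₀) (max_le (sβ t₀ ht₀) (sω t₀ ht₀))
  have h1 : (1 : ℝ) ∈ Icc (0 : ℝ) 1 := by simp
  refine ⟨N, ?_, hα 1 h1, by simpa using hβ 1 h1, by simpa using hω 1 h1⟩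
  rw [hL] at hNI
  nlinarith

end IsTransport

namespace IsTransport

variable {v : ℂ} {w : ℝ → ℝ} {g : ℝ → ℂ} {a : ℝ → ℝ} {q κ : ℝ → ℂ}

/-- Incoming transport estimate: the value of `w` at the base point of the segment is the value
there of the Taylor polynomial at the other end point, up to a small error. -/
lemma leg_in (h : IsTransport v w g a q κ) {k d N₁ : ℝ} (hk : 1 ≤ k) (hd : 0 ≤ d)
    (hv : ‖v‖ ≤ d) (hκ : ∀ t ∈ Icc (0 : ℝ) 1, ‖κ t‖ ≤ k) {Θ : ℝ → ℝ} (hΘc : Continuous Θ)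
    (hΘ : ∀ t, Θ t = ‖q t‖ + (w t)⁻¹)
    (hw1 : |w 1 - 2 * (g 1 * v).re + a 1 * ‖v‖ ^ 2| ≤ N₁)
    (hg1 : d * ‖g 1 - a 1 * conj v‖ ≤ N₁) (ha1 : d ^ 2 * |a 1| ≤ N₁)
    (hI : 24 * (∫ t in (0 : ℝ)..1, Θ t * (t * d * d)) ≤ 1) :
    |w 0 - (w 1 - 2 * (g 1 * v).re + a 1 * ‖v‖ ^ 2)| ≤
      (24 * N₁ + 2 * k * d) * (∫ t in (0 : ℝ)..1, Θ t * (t * d * d)) := by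
  set I := ∫ t in (0 : ℝ)..1, Θ t * (t * d * d) with hIdef
  set wh : ℝ → ℝ := fun t => w t - 2 * (g t * (t * v)).re + a t * (t ^ 2 * ‖v‖ ^ 2) with hwh
  set gh : ℝ → ℂ := fun t => g t - a t * conj ((t : ℂ) * v) with hgh
  have hga : ContinuousOn a (Icc 0 1) := fun t ht => (h.ha t ht).continuousAt.continuousWithinAt
  have hgH : ContinuousOn gh (Icc 0 1) := fun t ht =>
    (h.hasDerivAt_gHat ht).continuousAt.continuousWithinAt
  have hwH : ContinuousOn wh (Icc 0 1) := fun t ht =>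
    (h.hasDerivAt_wHat ht).continuousAt.continuousWithinAt
  set m : ℝ → ℝ := fun t => max |wh t| (max (t * d * ‖gh t‖) ((t * d) ^ 2 * |a t|)) with hm
  have hmc : ContinuousOn m (Icc 0 1) := by
    have hsc : ContinuousOn (fun t : ℝ => t * d) (Icc 0 1) := by fun_prop
    exact ContinuousOn.sup hwH.abs (ContinuousOn.sup (hsc.mul hgH.norm) ((hsc.pow 2).mul hga.abs))
  obtain ⟨t₀, ht₀, hmax⟩ := isCompact_Icc.exists_isMaxOn ⟨0, by simp⟩ hmc
  set N := m t₀ with hN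
  have hmN : ∀ t ∈ Icc (0 : ℝ) 1, m t ≤ N := fun t ht => hmax ht
  have hω : ∀ t ∈ Icc (0 : ℝ) 1, |wh t| ≤ N := fun t ht => (le_max_left _ _).trans (hmN t ht)
  have hβ : ∀ t ∈ Icc (0 : ℝ) 1, t * d * ‖gh t‖ ≤ N := fun t ht =>
    ((le_max_left _ _).trans (le_max_right _ _)).trans (hmN t ht)
  have hα : ∀ t ∈ Icc (0 : ℝ) 1, (t * d) ^ 2 * |a t| ≤ N := fun t ht =>
    ((le_max_right _ _).trans (le_max_right _ _)).trans (hmN t ht)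
  have hN0 : 0 ≤ N := (abs_nonneg _).trans (hω 0 (by simp))
  have hx : ∀ t ∈ Icc (0 : ℝ) 1, ‖(t : ℂ) * v‖ ≤ t * d := by
    intro t ht
    rw [norm_mul, Complex.norm_real, Real.norm_of_nonneg ht.1]
    exact mul_le_mul_of_nonneg_left hv ht.1
  have hgN : ∀ t ∈ Icc (0 : ℝ) 1, t * d * ‖g t‖ ≤ 2 * N := by
    intro t ht
    have htd := mul_nonneg ht.1 hd
    have e1 : ‖g t‖ ≤ ‖gh t‖ + |a t| * (t * d) := by
      have : g t = gh t + a t * conj ((t : ℂ) * v) := by rw [hgh]; ring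
      conv_lhs => rw [this]
      refine (norm_add_le _ _).trans ?_
      gcongr
      rw [norm_mul, Complex.norm_real, Real.norm_eq_abs, Complex.norm_conj]
      gcongr
      exact hx t ht
    have := hβ t ht
    have := hα t ht
    nlinarith
  have hwN : ∀ t ∈ Icc (0 : ℝ) 1, w t ≤ 4 * N := by
    intro t ht
    have htd := mul_nonneg ht.1 hd
    have e0 : w t = wh t + 2 * (gh t * (t * v)).re + a t * ‖(t : ℂ) * v‖ ^ 2 := by
      have : gh t * (t * v) = g t * (t * v) - a t * ‖(t : ℂ) * v‖ ^ 2 := by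
        rw [hgh, ← Complex.ofReal_pow, Complex.sq_norm, Complex.normSq_eq_conj_mul_self]; ring
      rw [this, Complex.sub_re, norm_mul, Complex.norm_real, Real.norm_eq_abs]
      have : ((a t : ℂ) * ((((|t| * ‖v‖ : ℝ)) : ℂ)) ^ 2).re = a t * (t ^ 2 * ‖v‖ ^ 2) := by
        rw [← Complex.ofReal_pow, Complex.re_ofReal_mul, Complex.ofReal_re, mul_pow, sq_abs]
      rw [this, mul_pow, sq_abs, hwh]
      ring
    have h1 : (gh t * (t * v)).re ≤ ‖gh t‖ * (t * d) := by
      refine (Complex.re_le_norm _).trans ?_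
      rw [norm_mul]
      gcongr
      exact hx t ht
    have h2 : a t * ‖(t : ℂ) * v‖ ^ 2 ≤ |a t| * (t * d) ^ 2 := by
      gcongr
      · exact le_abs_self _
      · exact hx t ht
    have := le_abs_self (wh t)
    have := hβ t ht
    have := hα t ht
    have := hω t ht
    nlinarith
  set b : ℝ → ℝ := fun t => Θ t * (t * d * d) with hb
  have hbc : Continuous b := by fun_prop
  have hwi : ∀ t, 0 < (w t)⁻¹ := fun t => inv_pos.2 (h.pos t)
  have hΘ0 : ∀ t, 0 ≤ Θ t := fun t => by
    rw [hΘ]; have := hwi t; positivity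
  have hb0 : ∀ t ∈ Icc (0 : ℝ) 1, 0 ≤ b t := fun t ht =>
    mul_nonneg (hΘ0 t) (mul_nonneg (mul_nonneg ht.1 hd) hd)
  have hIb : ∀ t ∈ Icc (0 : ℝ) 1, ∫ r in t..1, b r ≤ I := by
    intro t ht
    refine intervalIntegral.integral_mono_interval ht.1 ht.2 le_rfl ?_
      (hbc.intervalIntegrable _ _)
    exact (ae_restrict_iff' measurableSet_Ioc).2 (Eventually.of_forall fun r hr =>
      hb0 r ⟨hr.1.le, hr.2⟩)
  have hq : ∀ t, ‖q t‖ ≤ Θ t := fun t => by rw [hΘ]; have := hwi t; linarith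
  have hwΘ : ∀ t, (w t)⁻¹ ≤ Θ t := fun t => by rw [hΘ]; have := norm_nonneg (q t); linarith
  have hda : ∀ t ∈ Icc (0 : ℝ) 1, (t * d) ^ 2 * |aDeriv v w g q κ t| ≤ (4 * N + k * d) * b t := by
    intro t ht
    have htd := mul_nonneg ht.1 hd
    have h1 := h.abs_aDeriv_le (hκ t ht) (le_refl ‖g t‖) hv
    have htd1 : t * d ≤ d := mul_le_of_le_one_left hd ht.2
    calc _ ≤ (t * d) ^ 2 * (2 * d * (k / 4 * (w t)⁻¹ + ‖q t‖ * ‖g t‖)) := by gcongr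
      _ = 2 * d * (t * d) * (k / 4 * (t * d) * (w t)⁻¹ + ‖q t‖ * (t * d * ‖g t‖)) := by ring
      _ ≤ 2 * d * (t * d) * (k / 4 * d * Θ t + Θ t * (2 * N)) := by
        have := hwi t
        have := hΘ0 t
        exact mul_le_mul_of_nonneg_left (add_le_add (by gcongr; exact hwΘ t)
          (mul_le_mul (hq t) (hgN t ht) (by positivity) (hΘ0 t))) (by positivity)
      _ = (4 * N + k * d / 2) * b t := by rw [hb]; ring
      _ ≤ _ := by
        have := hb0 t ht
        gcongr
        nlinarith
  have hqwv : ∀ t ∈ Icc (0 : ℝ) 1, t * d * ‖q t * w t * v‖ ≤ 4 * N * b t := by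
    intro t ht
    have htd := mul_nonneg ht.1 hd
    rw [norm_mul, norm_mul, Complex.norm_real, Real.norm_of_nonneg (h.pos t).le]
    calc _ ≤ t * d * (Θ t * (4 * N) * d) := by
          have := hΘ0 t
          have := (h.pos t).le
          gcongr
          · exact hq t
          · exact hwN t ht
      _ = _ := by rw [hb]; ring
  have sω : ∀ t ∈ Icc (0 : ℝ) 1, |wh 1 - wh t| ≤ (12 * N + k * d) * I := by
    intro t ht
    have := norm_sub_le_integral (c := 12 * N + k * d) ht.2
      (fun r hr => h.hasDerivAt_wHat (t := r) ⟨ht.1.trans hr.1, hr.2⟩) hbc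
      (fun r hr => by
        have hr' : r ∈ Icc (0 : ℝ) 1 := ⟨ht.1.trans hr.1, hr.2⟩
        refine (norm_add_le _ _).trans ?_
        have h1 : ‖-2 * ((r : ℂ) * v * (q r * w r * v)).re‖ ≤ 2 * (4 * N * b r) := by
          rw [norm_mul, norm_neg, Real.norm_ofNat]
          gcongr
          refine (Complex.abs_re_le_norm _).trans ?_
          rw [norm_mul]
          exact (mul_le_mul_of_nonneg_right (hx r hr') (norm_nonneg _)).trans (hqwv r hr')
        have h2 : ‖r ^ 2 * ‖v‖ ^ 2 * aDeriv v w g q κ r‖ ≤ (4 * N + k * d) * b r := by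
          rw [norm_mul]
          refine (mul_le_mul_of_nonneg_right ?_ (norm_nonneg _)).trans (hda r hr')
          rw [← mul_pow, norm_pow]
          have := hx r hr'
          rw [norm_mul, Complex.norm_real] at this
          rw [norm_mul, norm_norm]
          gcongr
        linarith)
    have hkd : 0 ≤ k * d := by positivity
    exact this.trans (mul_le_mul_of_nonneg_left (hIb t ht) (by positivity))
  have sα : ∀ t ∈ Icc (0 : ℝ) 1, (t * d) ^ 2 * |a t| ≤ N₁ + (12 * N + k * d) * I := by
    intro t ht
    have htd := mul_nonneg ht.1 hd
    have hkd : 0 ≤ k * d := by positivity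
    have := norm_sub_le_integral (c := 12 * N + k * d) ht.2
      (fun r hr => (h.ha r ⟨ht.1.trans hr.1, hr.2⟩).const_mul ((t * d) ^ 2)) hbc
      (fun r hr => by
        have hr' : r ∈ Icc (0 : ℝ) 1 := ⟨ht.1.trans hr.1, hr.2⟩
        rw [norm_mul, Real.norm_of_nonneg (by positivity)]
        refine (mul_le_mul_of_nonneg_right ?_ (norm_nonneg _)).trans ((hda r hr').trans ?_)
        · have := hr.1; gcongr
        · have := hb0 r hr'
          gcongr
          norm_num)
    rw [← mul_sub, norm_mul, Real.norm_of_nonneg (by positivity)] at this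
    have h3 := this.trans (mul_le_mul_of_nonneg_left (hIb t ht) (by positivity))
    have h4 : (t * d) ^ 2 * |a 1| ≤ N₁ := by
      refine le_trans ?_ ha1
      gcongr
      exact mul_le_of_le_one_left hd ht.2
    have h5 : |a t| ≤ |a 1| + ‖a 1 - a t‖ := by
      rw [Real.norm_eq_abs, abs_sub_comm]
      have := abs_add_le (a 1) (a t - a 1); simpa using this
    nlinarith [sq_nonneg (t * d)]
  have sβ : ∀ t ∈ Icc (0 : ℝ) 1, t * d * ‖gh t‖ ≤ N₁ + (12 * N + k * d) * I := by
    intro t ht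
    have htd := mul_nonneg ht.1 hd
    have hkd : 0 ≤ k * d := by positivity
    have := norm_sub_le_integral (c := 12 * N + k * d) ht.2
      (fun r hr => (h.hasDerivAt_gHat (t := r) ⟨ht.1.trans hr.1, hr.2⟩).const_mul
        ((t * d : ℝ) : ℂ)) hbc
      (fun r hr => by
        have hr' : r ∈ Icc (0 : ℝ) 1 := ⟨ht.1.trans hr.1, hr.2⟩
        have hrt : t * d ≤ r * d := by have := hr.1; gcongr
        rw [norm_mul, Complex.norm_real, Real.norm_of_nonneg htd]
        refine (mul_le_mul_of_nonneg_right hrt (norm_nonneg _)).trans ?_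
        have hrd := mul_nonneg hr'.1 hd
        refine (mul_le_mul_of_nonneg_left (norm_sub_le _ _) hrd).trans ?_
        have h1 := hqwv r hr'
        have h2 : r * d * ‖(aDeriv v w g q κ r : ℂ) * conj ((r : ℂ) * v)‖ ≤
            (4 * N + k * d) * b r := by
          rw [norm_mul, Complex.norm_conj, Complex.norm_real, Real.norm_eq_abs]
          refine le_trans ?_ (hda r hr')
          have := hx r hr'
          calc _ ≤ r * d * (|aDeriv v w g q κ r| * (r * d)) := by gcongr
            _ = _ := by ring
        have := mul_nonneg hN0 (hb0 r hr')
        linarith)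
    rw [← mul_sub, norm_mul, Complex.norm_real, Real.norm_of_nonneg htd] at this
    have h3 := this.trans (mul_le_mul_of_nonneg_left (hIb t ht) (by positivity))
    have hg1' : gh 1 = g 1 - a 1 * conj v := by simp [hgh]
    have h4 : t * d * ‖gh 1‖ ≤ N₁ := by
      rw [hg1']
      refine le_trans ?_ hg1
      gcongr
      exact mul_le_of_le_one_left hd ht.2
    have h5 : ‖gh t‖ ≤ ‖gh 1‖ + ‖gh 1 - gh t‖ := by
      have := norm_le_norm_add_norm_sub' (gh t) (gh 1)
      rwa [norm_sub_rev (gh t)] at this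
    simp only [hgh] at h3 h4 h5 ⊢
    nlinarith
  have hwh1 : wh 1 = w 1 - 2 * (g 1 * v).re + a 1 * ‖v‖ ^ 2 := by simp [hwh]
  have hwh0 : wh 0 = w 0 := by simp [hwh]
  have hNI : N ≤ N₁ + (12 * N + k * d) * I := by
    rw [hN]
    refine max_le ?_ (max_le (sβ t₀ ht₀) (sα t₀ ht₀))
    have h1 := sω t₀ ht₀
    rw [hwh1] at h1
    have := abs_sub_comm (wh t₀) (w 1 - 2 * (g 1 * v).re + a 1 * ‖v‖ ^ 2)
    have := abs_sub_abs_le_abs_sub (wh t₀) (w 1 - 2 * (g 1 * v).re + a 1 * ‖v‖ ^ 2)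
    linarith
  have hI0 : 0 ≤ I := (intervalIntegral.integral_nonneg zero_le_one fun r hr => hb0 r hr)
  have hkd : 0 ≤ k * d := by positivity
  have h0 := sω 0 (by simp)
  rw [hwh0, hwh1, abs_sub_comm] at h0
  refine h0.trans (mul_le_mul_of_nonneg_right ?_ hI0)
  have h2 := mul_le_mul_of_nonneg_left hI hN0
  have h3 := mul_le_mul_of_nonneg_left hI hkd
  linarith

end IsTransport

/-! ### The inverse metric factor `exp (-u / 2)` along segments -/

/-- The conformal weight `e^{-u/2}`. -/
def wF (u : ℂ → ℝ) (z : ℂ) : ℝ := Real.exp (-u z / 2)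

/-- The Wirtinger derivative of `wF u`. -/
def gF (u : ℂ → ℝ) (z : ℂ) : ℂ := -(wF u z * pU u z) / 2

/-- The mixed second Wirtinger derivative of `wF u`, as prescribed by the equation. -/
def aF (K u : ℂ → ℝ) (z : ℂ) : ℝ := (K z + 4 * ‖gF u z‖ ^ 2) / (4 * wF u z)

/-- The coefficient in `w_zz = q w`. -/
def qF (u : ℂ → ℝ) (z : ℂ) : ℂ := -hopf u z / 2

/-- The density controlling the transport system. -/
def thetaF (u : ℂ → ℝ) (z : ℂ) : ℝ := ‖qF u z‖ + (wF u z)⁻¹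

lemma wF_pos (u : ℂ → ℝ) (z : ℂ) : 0 < wF u z := Real.exp_pos _

lemma wF_inv (u : ℂ → ℝ) (z : ℂ) : (wF u z)⁻¹ = Real.exp (u z / 2) := by
  rw [wF, ← Real.exp_neg]; congr 1; ring

lemma wF_inv_sq (u : ℂ → ℝ) (z : ℂ) : ((wF u z)⁻¹) ^ 2 = Real.exp (u z) := by
  rw [wF_inv, ← Real.exp_nat_mul]; congr 1; push_cast; ring

section Pohozaev

variable {K h u : ℂ → ℝ}

lemma contDiff_wF (hu : ContDiff ℝ 2 u) : ContDiff ℝ 2 (wF u) := by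
  unfold wF; fun_prop

lemma continuous_wF (hu : ContDiff ℝ 2 u) : Continuous (wF u) := (contDiff_wF hu).continuous

lemma contDiff_gF (hu : ContDiff ℝ 2 u) : ContDiff ℝ 1 (gF u) := by
  have h1 := contDiff_pU hu
  have h2 : ContDiff ℝ 1 fun z => (wF u z : ℂ) :=
    contDiff_ofReal_comp ((contDiff_wF hu).of_le (by norm_num))
  unfold gF
  exact (h2.mul h1).neg.div_const 2

lemma continuous_qF (hu : ContDiff ℝ 2 u) : Continuous (qF u) := by
  have := continuous_hopf hu
  unfold qF; fun_prop

lemma continuous_thetaF (hu : ContDiff ℝ 2 u) : Continuous (thetaF u) :=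
  (continuous_qF hu).norm.add ((continuous_wF hu).inv₀ fun z => (wF_pos u z).ne')

lemma thetaF_nonneg (u : ℂ → ℝ) (z : ℂ) : 0 ≤ thetaF u z :=
  add_nonneg (norm_nonneg _) (inv_pos.2 (wF_pos u z)).le

lemma hasW_wF (hu : ContDiff ℝ 2 u) (z : ℂ) :
    HasW (fun z => (wF u z : ℂ)) (gF u z) (conj (gF u z)) z := by
  have h1 := hasW_ofReal (hu.differentiable (by norm_num) z)
  have h2 : HasDerivAt (fun x : ℂ => Complex.exp (-x / 2))
      (Complex.exp (-(u z : ℂ) / 2) * (-1 / 2)) (u z : ℂ) :=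
    (((hasDerivAt_id (u z : ℂ)).neg.div_const 2)).cexp
  have h3 := HasW.comp_holo (F := fun z => (u z : ℂ)) h2 h1
  have e : (fun z => (wF u z : ℂ)) = fun z => Complex.exp (-(u z : ℂ) / 2) := by
    ext z; simp [wF, Complex.ofReal_exp]
  have e' : Complex.exp (-(u z : ℂ) / 2) = wF u z := (congrFun e z).symm
  rw [e]
  refine h3.congr ?_ ?_
  · rw [e', gF]; ring
  · rw [e', gF, map_div₀, map_neg, map_mul, Complex.conj_ofReal, Complex.conj_ofNat]; ring

lemma hasW_gF_mul (hu : ContDiff ℝ 2 u) (z : ℂ) :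
    dz (gF u) z = qF u z * wF u z ∧
    dzb (gF u) z = wF u z * ‖pU u z‖ ^ 2 / 4 - wF u z * dzb (pU u) z / 2 := by
  have h1 := hasW_wF hu z
  have h2 := ((contDiff_pU hu).differentiable one_ne_zero z).hasW
  have h3 := (h1.mul h2).const_mul (-1 / 2)
  have e : gF u = fun z => -1 / 2 * ((wF u z : ℂ) * pU u z) := by ext z; rw [gF]; ring
  rw [e]
  refine ⟨?_, ?_⟩
  · rw [h3.dz_eq, gF, qF, hopf]; ring
  · rw [h3.dzb_eq, gF, map_div₀, map_neg, map_mul, Complex.conj_ofReal, Complex.conj_ofNat,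
      ← Complex.ofReal_pow, Complex.sq_norm, Complex.normSq_eq_conj_mul_self]
    ring

lemma continuous_aF (hK : ContDiff ℝ 2 K) (hu : ContDiff ℝ 2 u) : Continuous (aF K u) := by
  have h1 := (contDiff_gF hu).continuous
  have h2 := continuous_wF hu
  have h3 := hK.continuous
  unfold aF
  exact (h3.add (continuous_const.mul (h1.norm.pow 2))).div (continuous_const.mul h2)
    fun z => by have := wF_pos u z; positivity

lemma dzb_gF (hK : ContDiff ℝ 2 K) (hu : ContDiff ℝ 2 u) (hs : SolvesLiouville K h u) {z : ℂ}
    (hz : z ∈ Metric.closedBall (0 : ℂ) 1) : dzb (gF u) z = aF K u z := by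
  have hcl : closure (Metric.ball (0 : ℂ) 1) = Metric.closedBall 0 1 :=
    closure_ball _ one_ne_zero
  have hc1 : Continuous (dzb (gF u)) := by
    rw [← continuousOn_univ]
    exact continuousOn_dzb isOpen_univ (contDiffOn_univ.2 (contDiff_gF hu))
  have hc2 : Continuous fun z => (aF K u z : ℂ) :=
    Complex.continuous_ofReal.comp (continuous_aF hK hu)
  have : EqOn (dzb (gF u)) (fun z => (aF K u z : ℂ)) (closure (Metric.ball (0 : ℂ) 1)) := by
    refine EqOn.closure ?_ hc1 hc2
    intro z hz
    have hw := wF_pos u z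
    have hw' : (wF u z : ℂ) ≠ 0 := by exact_mod_cast hw.ne'
    have he : (Real.exp (u z) : ℂ) = ((wF u z : ℂ)⁻¹) ^ 2 := by
      rw [← wF_inv_sq]; push_cast; ring
    simp only [(hasW_gF_mul hu z).2, SolvesLiouville.dzb_pU hu hs hz, aF, he]
    have hg : ‖gF u z‖ = wF u z * ‖pU u z‖ / 2 := by
      rw [gF, norm_div, norm_neg, norm_mul, Complex.norm_real, Real.norm_of_nonneg hw.le]; simp
    rw [hg]
    push_cast
    field_simp
    ring
  exact this (hcl ▸ hz)

lemma hasW_gF (hK : ContDiff ℝ 2 K) (hu : ContDiff ℝ 2 u) (hs : SolvesLiouville K h u) {z : ℂ}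
    (hz : z ∈ Metric.closedBall (0 : ℂ) 1) :
    HasW (gF u) (qF u z * wF u z) (aF K u z) z :=
  (((contDiff_gF hu).differentiable one_ne_zero z).hasW).congr (hasW_gF_mul hu z).1
    (dzb_gF hK hu hs hz)

lemma hasW_aF (hK : ContDiff ℝ 2 K) (hu : ContDiff ℝ 2 u) (hs : SolvesLiouville K h u) {z : ℂ}
    (hz : z ∈ Metric.closedBall (0 : ℂ) 1) :
    HasW (fun z => (aF K u z : ℂ)) (pU K z / (4 * wF u z) + qF u z * conj (gF u z))
      (conj (pU K z / (4 * wF u z) + qF u z * conj (gF u z))) z := by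
  have hw := hasW_wF hu z
  have hw0 : ∀ z, (wF u z : ℂ) ≠ 0 := fun z => by exact_mod_cast (wF_pos u z).ne'
  have hi := HasW.comp_holo (F := fun z => (wF u z : ℂ)) (hasDerivAt_inv (hw0 z)) hw
  have hg := hasW_gF hK hu hs hz
  have hk := hasW_ofReal (hK.differentiable (by norm_num) z)
  have h1 := (hk.add ((hg.mul hg.star).const_mul 4)).mul (hi.const_mul (1 / 4))
  have e : (fun z => (aF K u z : ℂ)) = fun z => ((K z : ℂ) + 4 * (gF u z * conj (gF u z))) *
      (1 / 4 * (wF u z : ℂ)⁻¹) := by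
    ext z
    have := hw0 z
    rw [aF, Complex.sq_norm, Complex.normSq_apply, Complex.mul_conj, Complex.normSq_apply]
    push_cast
    field_simp
  have e' : (aF K u z : ℂ) = ((K z : ℂ) + 4 * (gF u z * conj (gF u z))) *
      (1 / 4 * (wF u z : ℂ)⁻¹) := congrFun e z
  rw [e]
  have := hw0 z
  refine h1.congr ?_ ?_ <;>
  · simp only [map_add, map_mul, map_div₀, map_one, map_inv₀, Complex.conj_ofReal, Complex.conj_ofNat,
      Complex.conj_conj, e']
    field_simp
    ring

/-- Along a segment in the closed disk the solution satisfies the transport system. -/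
lemma isTransport_segment (hK : ContDiff ℝ 2 K) (hu : ContDiff ℝ 2 u)
    (hs : SolvesLiouville K h u) {z y : ℂ} (hz : z ∈ Metric.closedBall (0 : ℂ) 1)
    (hy : y ∈ Metric.closedBall (0 : ℂ) 1) :
    IsTransport (y - z) (fun t => wF u (z + t * (y - z))) (fun t => gF u (z + t * (y - z)))
      (fun t => aF K u (z + t * (y - z))) (fun t => qF u (z + t * (y - z)))
      (fun t => pU K (z + t * (y - z))) := by
  have hγ : ∀ t : ℝ, HasDerivAt (fun t : ℝ => z + t * (y - z)) (y - z) t := fun t => by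
    have := ((hasDerivAt_id t).ofReal_comp.mul_const (y - z)).const_add z
    simpa using this
  have hmem : ∀ t ∈ Icc (0 : ℝ) 1, z + t * (y - z) ∈ Metric.closedBall (0 : ℂ) 1 := by
    intro t ht
    have := (convex_closedBall (0 : ℂ) 1).add_smul_sub_mem hz hy ht
    simpa using this
  have key : ∀ {f : ℝ → ℝ} {A v : ℂ} {t : ℝ},
      HasDerivAt (fun t => (f t : ℂ)) (A * v + conj A * conj v) t →
      HasDerivAt f (2 * (A * v).re) t := by
    intro f A v t hf
    have := Complex.reCLM.hasFDerivAt.comp_hasDerivAt t hf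
    refine this.congr_deriv ?_
    simp
    ring
  refine ⟨fun t ht => ?_, fun t ht => ?_, fun t ht => ?_, fun t => wF_pos _ _⟩
  · exact key ((hasW_wF hu _).comp_curve (hγ t))
  · exact HasW.comp_curve (γ := fun t : ℝ => z + t * (y - z)) (hasW_gF hK hu hs (hmem t ht)) (hγ t)
  · exact key (HasW.comp_curve (γ := fun t : ℝ => z + t * (y - z)) (hasW_aF hK hu hs (hmem t ht))
      (hγ t))

lemma taylor_start_le {gx g0 v : ℂ} {w a a0 δ d k N : ℝ} (hδ : 0 < δ) (hd : 0 ≤ d)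
    (hk : 1 ≤ k) (hv : ‖v‖ ≤ d) (hg0 : 2 * ‖g0‖ ≤ k) (ha0 : δ * |a0| ≤ k ^ 2 / 2)
    (hN : N ≤ 2 * k ^ 2)
    (hα : δ * |a - a0| ≤ N) (hβ : δ * ‖gx - a * conj v - g0‖ ≤ N * (δ + d))
    (hω : δ * |w - 2 * (gx * v).re + a * ‖v‖ ^ 2 - δ| ≤ N * (δ + d) ^ 2) (hw : 0 < w) {v' : ℂ}
    (hv' : ‖v'‖ ≤ d) :
    |w - 2 * (gx * v').re + a * ‖v'‖ ^ 2| ≤ 30 * k ^ 2 * (δ + d) ^ 2 / δ ∧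
    d * ‖gx - a * conj v'‖ ≤ 30 * k ^ 2 * (δ + d) ^ 2 / δ ∧
    d ^ 2 * |a| ≤ 30 * k ^ 2 * (δ + d) ^ 2 / δ := by
  have hk2 : 0 ≤ k ^ 2 := sq_nonneg k
  have h1 := IsTransport.size_g (t := 1) (gx := gx) hδ hd zero_le_one hk hv hg0 ha0 hα
    (by simpa using hβ)
  have h2 := IsTransport.size_w (t := 1) (gx := gx) hδ hd zero_le_one hk hv hg0 ha0 hα
    (by simpa using hβ) (by simpa using hω)
  rw [one_mul] at h1 h2
  set s := δ + d with hs
  have hs0 : 0 < s := by linarith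
  have hds : d ≤ s := by linarith
  have h1' : δ * ‖gx‖ ≤ 5 * k ^ 2 * s := h1.trans (by gcongr; linarith)
  have h2' : δ * w ≤ 13 * k ^ 2 * s ^ 2 := h2.trans (by gcongr; linarith)
  have h3 : δ * |a| ≤ 3 * k ^ 2 := by
    have : |a| ≤ |a - a0| + |a0| := by
      have := abs_add_le (a - a0) a0; simpa using this
    nlinarith
  have h4 : δ * (d * ‖gx‖) ≤ 5 * k ^ 2 * s ^ 2 := by
    calc δ * (d * ‖gx‖) = d * (δ * ‖gx‖) := by ring
      _ ≤ s * (5 * k ^ 2 * s) := by gcongr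
      _ = _ := by ring
  have h5 : δ * (d ^ 2 * |a|) ≤ 3 * k ^ 2 * s ^ 2 := by
    calc δ * (d ^ 2 * |a|) = d ^ 2 * (δ * |a|) := by ring
      _ ≤ s ^ 2 * (3 * k ^ 2) := by gcongr
      _ = _ := by ring
  have hks : 0 ≤ k ^ 2 * s ^ 2 := by positivity
  refine ⟨?_, ?_, ?_⟩
  · rw [le_div_iff₀ hδ]
    have e1 : |w - 2 * (gx * v').re + a * ‖v'‖ ^ 2| ≤ w + 2 * (d * ‖gx‖) + d ^ 2 * |a| := by
      have f1 : |(gx * v').re| ≤ d * ‖gx‖ := by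
        refine (Complex.abs_re_le_norm _).trans ?_
        rw [norm_mul, mul_comm]; gcongr
      have f2 : |a * ‖v'‖ ^ 2| ≤ d ^ 2 * |a| := by
        rw [abs_mul, abs_of_nonneg (sq_nonneg ‖v'‖), mul_comm]; gcongr
      have := abs_le.1 f1
      have := abs_le.1 f2
      rw [abs_le]; constructor <;> linarith
    nlinarith
  · rw [le_div_iff₀ hδ]
    have e1 : d * ‖gx - a * conj v'‖ ≤ d * ‖gx‖ + d ^ 2 * |a| := by
      have : ‖gx - a * conj v'‖ ≤ ‖gx‖ + |a| * d := by
        refine (norm_sub_le _ _).trans ?_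
        rw [norm_mul, Complex.norm_conj, Complex.norm_real, Real.norm_eq_abs]
        gcongr
      nlinarith
    nlinarith
  · rw [le_div_iff₀ hδ]; nlinarith

/-- Closeness of `w` to its Taylor polynomial at `z₁`, in terms of the weighted integrals of
`thetaF` along the two legs of a broken segment from `z₁` to `z` through `y`. -/
lemma two_legs (hK : ContDiff ℝ 2 K) (hu : ContDiff ℝ 2 u)
    (hs : SolvesLiouville K h u) {z₁ z y : ℂ} (hz₁ : z₁ ∈ Metric.closedBall (0 : ℂ) 1)
    (hz : z ∈ Metric.closedBall (0 : ℂ) 1) (hy : y ∈ Metric.closedBall (0 : ℂ) 1)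
    {k δ d : ℝ} (hk : 1 ≤ k) (hKk : ∀ z ∈ Metric.closedBall (0 : ℂ) 1, ‖pU K z‖ ≤ k)
    (hδ : wF u z₁ = δ) (hg : 2 * ‖gF u z₁‖ ≤ k) (ha : δ * |aF K u z₁| ≤ k ^ 2 / 2)
    (hd1 : ‖y - z₁‖ ≤ d) (hd2 : ‖y - z‖ ≤ d) (hd3 : ‖z - z₁‖ ≤ d) {I₁ I₂ : ℝ}
    (hI₁ : ∫ t in (0 : ℝ)..1, thetaF u (z₁ + t * (y - z₁)) * ((δ + t * d) * d) ≤ I₁)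
    (hI₂ : ∫ t in (0 : ℝ)..1, thetaF u (z + t * (y - z)) * (t * d * d) ≤ I₂)
    (hI : 32 * k * (I₁ + I₂) ≤ 1) :
    |wF u z - (δ + 2 * (gF u z₁ * (z - z₁)).re + aF K u z₁ * ‖z - z₁‖ ^ 2)| ≤
      2000 * k ^ 3 * (I₁ + I₂) * (δ + d) ^ 2 / δ := by
  have hδ0 : 0 < δ := hδ ▸ wF_pos u z₁
  have hd0 : 0 ≤ d := (norm_nonneg _).trans hd1
  have hθ := continuous_thetaF hu
  have hΘ0 := thetaF_nonneg u
  have hmem : ∀ {z y : ℂ}, z ∈ Metric.closedBall (0 : ℂ) 1 → y ∈ Metric.closedBall (0 : ℂ) 1 →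
      ∀ t ∈ Icc (0 : ℝ) 1, z + t * (y - z) ∈ Metric.closedBall (0 : ℂ) 1 := by
    intro z y hz hy t ht
    have := (convex_closedBall (0 : ℂ) 1).add_smul_sub_mem hz hy ht
    simpa using this
  have hI₁0 : 0 ≤ ∫ t in (0 : ℝ)..1, thetaF u (z₁ + t * (y - z₁)) * ((δ + t * d) * d) :=
    intervalIntegral.integral_nonneg zero_le_one fun t ht => by
      have := hΘ0 (z₁ + t * (y - z₁)); have := ht.1; positivity
  have hI₂0 : 0 ≤ ∫ t in (0 : ℝ)..1, thetaF u (z + t * (y - z)) * (t * d * d) :=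
    intervalIntegral.integral_nonneg zero_le_one fun t ht => by
      have := hΘ0 (z + t * (y - z)); have := ht.1; positivity
  set J₁ := ∫ t in (0 : ℝ)..1, thetaF u (z₁ + t * (y - z₁)) * ((δ + t * d) * d) with hJ₁
  set J₂ := ∫ t in (0 : ℝ)..1, thetaF u (z + t * (y - z)) * (t * d * d) with hJ₂
  have hk0 : 0 < k := by linarith
  obtain ⟨N, hN, hα, hβ, hω⟩ := (isTransport_segment hK hu hs hz₁ hy).leg_out hk hδ0 hd0 hd1
    (by simpa using hδ) (by simpa using hg) (by simpa using ha)
    (fun t ht => hKk _ (hmem hz₁ hy t ht))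
    (Θ := fun t => thetaF u (z₁ + t * (y - z₁))) (by fun_prop) (fun t => rfl)
    (by refine le_trans ?_ hI; gcongr; linarith)
  simp only [Complex.ofReal_one, one_mul, Complex.ofReal_zero, zero_mul, add_zero,
    add_sub_cancel] at hα hβ hω
  rw [← hJ₁] at hN
  have hJI : J₁ ≤ I₁ + I₂ := by linarith
  have hJI2 : J₂ ≤ I₁ + I₂ := by linarith
  have hN2 : N ≤ 2 * k ^ 2 := by
    have h1 : k * J₁ ≤ 1 / 32 := by
      have := mul_le_mul_of_nonneg_left hJI hk0.le
      linarith
    have h2 := mul_le_mul_of_nonneg_left h1 (sq_nonneg k)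
    have h3 : 40 * k ^ 3 * J₁ = 40 * (k ^ 2 * (k * J₁)) := by ring
    have := sq_nonneg k
    linarith
  have hN0 : 0 ≤ N := le_trans (by positivity) hα
  obtain ⟨a1, a2, a3⟩ := taylor_start_le hδ0 hd0 hk hd1 hg ha hN2 hα hβ hω (wF_pos u y) hd2
  have hin := (isTransport_segment hK hu hs hz hy).leg_in (N₁ := 30 * k ^ 2 * (δ + d) ^ 2 / δ)
    hk hd0 hd2 (fun t ht => hKk _ (hmem hz hy t ht))
    (Θ := fun t => thetaF u (z + t * (y - z))) (by fun_prop) (fun t => rfl)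
    (by simpa using a1) (by simpa using a2) (by simpa using a3)
    (by simp only [← hJ₂]; nlinarith)
  simp only [Complex.ofReal_one, one_mul, Complex.ofReal_zero, zero_mul, add_zero,
    add_sub_cancel] at hin
  rw [← hJ₂] at hin
  set s := δ + d with hsd
  have hs0 : 0 < s := by linarith
  have hds : d ≤ s := by linarith
  have e1 : (24 * (30 * k ^ 2 * s ^ 2 / δ) + 2 * k * d) * J₂ ≤
      (722 * k ^ 3 * s ^ 2 / δ) * (I₁ + I₂) := by
    gcongr
    have f1 : 2 * k * d ≤ 2 * k ^ 3 * s ^ 2 / δ := by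
      rw [le_div_iff₀ hδ0]
      have : d * δ ≤ s ^ 2 := by nlinarith
      have h3 : k ≤ k ^ 3 := le_self_pow₀ hk (by norm_num)
      calc 2 * k * d * δ = 2 * k * (d * δ) := by ring
        _ ≤ _ := by gcongr
    have f2 : 24 * (30 * k ^ 2 * s ^ 2 / δ) ≤ 720 * k ^ 3 * s ^ 2 / δ := by
      have h3 : k ^ 2 ≤ k ^ 3 := pow_le_pow_right₀ hk (by norm_num)
      calc 24 * (30 * k ^ 2 * s ^ 2 / δ) = 720 * k ^ 2 * s ^ 2 / δ := by ring
        _ ≤ _ := by gcongr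
    calc _ ≤ 720 * k ^ 3 * s ^ 2 / δ + 2 * k ^ 3 * s ^ 2 / δ := add_le_add f2 f1
      _ = _ := by ring
  have e2 : |wF u y - 2 * (gF u y * (y - z)).re + aF K u y * ‖y - z‖ ^ 2 -
      (δ + 2 * (gF u z₁ * (z - z₁)).re + aF K u z₁ * ‖z - z₁‖ ^ 2)| ≤ 4 * N * s ^ 2 / δ := by
    have hid : wF u y - 2 * (gF u y * (y - z)).re + aF K u y * ‖y - z‖ ^ 2 -
        (δ + 2 * (gF u z₁ * (z - z₁)).re + aF K u z₁ * ‖z - z₁‖ ^ 2) =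
        (wF u y - 2 * (gF u y * (y - z₁)).re + aF K u y * ‖y - z₁‖ ^ 2 - δ) +
        2 * ((gF u y - aF K u y * conj (y - z₁) - gF u z₁) * (z - z₁)).re +
        (aF K u y - aF K u z₁) * ‖z - z₁‖ ^ 2 := by
      simp only [Complex.sq_norm, Complex.normSq_apply]
      simp
      ring
    rw [hid, le_div_iff₀ hδ0]
    set A := wF u y - 2 * (gF u y * (y - z₁)).re + aF K u y * ‖y - z₁‖ ^ 2 - δ
    set B := gF u y - aF K u y * conj (y - z₁) - gF u z₁
    set D := aF K u y - aF K u z₁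
    have f1 : |(B * (z - z₁)).re| ≤ ‖B‖ * d := by
      refine (Complex.abs_re_le_norm _).trans ?_
      rw [norm_mul]; gcongr
    have f2 : |D * ‖z - z₁‖ ^ 2| ≤ |D| * d ^ 2 := by
      rw [abs_mul, abs_of_nonneg (sq_nonneg ‖z - z₁‖)]; gcongr
    have f3 : |A + 2 * (B * (z - z₁)).re + D * ‖z - z₁‖ ^ 2| ≤
        |A| + 2 * (‖B‖ * d) + |D| * d ^ 2 := by
      refine (abs_add_three _ _ _).trans ?_
      rw [abs_mul, abs_two]
      gcongr
    have f4 : δ * ‖B‖ * d ≤ N * s ^ 2 := by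
      calc _ ≤ N * s * s := by gcongr
        _ = _ := by ring
    have f5 : δ * |D| * d ^ 2 ≤ N * s ^ 2 := by gcongr
    have f6 := mul_le_mul_of_nonneg_right f3 hδ0.le
    linarith
  have e3 : 4 * N * s ^ 2 / δ ≤ 160 * k ^ 3 * (I₁ + I₂) * s ^ 2 / δ := by
    have : N ≤ 40 * k ^ 3 * (I₁ + I₂) := hN.trans (by gcongr)
    calc 4 * N * s ^ 2 / δ ≤ 4 * (40 * k ^ 3 * (I₁ + I₂)) * s ^ 2 / δ := by gcongr
      _ = _ := by ring
  have hI0 : 0 ≤ I₁ + I₂ := hI₂0.trans hJI2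
  calc _ ≤ _ := abs_sub_le _ (wF u y - 2 * (gF u y * (y - z)).re + aF K u y * ‖y - z‖ ^ 2) _
    _ ≤ (722 * k ^ 3 * s ^ 2 / δ) * (I₁ + I₂) + 160 * k ^ 3 * (I₁ + I₂) * s ^ 2 / δ :=
      add_le_add (hin.trans e1) (e2.trans e3)
    _ = 882 * k ^ 3 * (I₁ + I₂) * s ^ 2 / δ := by ring
    _ ≤ _ := by gcongr; norm_num

end Pohozaev

/-! ### Broken paths with small averages -/

lemma lintegral_comp_homothety {F : ℂ → ℝ≥0∞} (hF : Measurable F) (x₀ : ℂ) {t : ℝ}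
    (ht : 0 < t) :
    ∫⁻ y, F (x₀ + t * (y - x₀)) = ENNReal.ofReal (t ^ (-2 : ℤ)) * ∫⁻ x, F x := by
  have h1 : ∫⁻ y, F (x₀ + t * (y - x₀)) = ∫⁻ y, F (x₀ + t * y) :=
    lintegral_sub_right_eq_self (fun y => F (x₀ + t * y)) x₀
  have h2 : ∫⁻ x, F x = ∫⁻ x, F (x₀ + x) := (lintegral_add_left_eq_self F x₀).symm
  have h3 : ∫⁻ y : ℂ, F (x₀ + t * y)
      = ∫⁻ x, F (x₀ + x) ∂(Measure.map (t • ·) (volume : Measure ℂ)) := by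
    rw [lintegral_map (by fun_prop) (by fun_prop)]
    simp
  rw [h1, h2, h3, Measure.map_addHaar_smul _ ht.ne']
  rw [lintegral_smul_measure, smul_eq_mul]
  congr 2
  simp [Complex.finrank_real_complex, abs_of_pos ht]

lemma lintegral_segment_le {F : ℂ → ℝ≥0∞} (hF : Measurable F) {x₀ : ℂ} {B : Set ℂ}
    (hB : MeasurableSet B) {d δ : ℝ} (hd : 0 < d) (hδ : 0 ≤ δ)
    (hBd : ∀ y ∈ B, d / 4 ≤ ‖y - x₀‖ ∧ ‖y - x₀‖ ≤ d) :
    ∫⁻ y in B, ∫⁻ t in Ioc (0:ℝ) 1, F (x₀ + t * (y - x₀)) * ENNReal.ofReal ((δ + t * d) * d)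
      ≤ ENNReal.ofReal (3 * d ^ 2) *
        ∫⁻ x, F x * ENNReal.ofReal ((δ + 4 * ‖x - x₀‖) / ‖x - x₀‖) := by
  set S : Set (ℝ × ℂ) := {p | p.1 * d / 4 ≤ ‖p.2 - x₀‖ ∧ ‖p.2 - x₀‖ ≤ p.1 * d} with hS
  have hSm : MeasurableSet S := by
    apply MeasurableSet.inter
    · exact measurableSet_le (f := fun p : ℝ × ℂ => p.1 * d / 4)
        (g := fun p : ℝ × ℂ => ‖p.2 - x₀‖) (by fun_prop) (by fun_prop)
    · exact measurableSet_le (f := fun p : ℝ × ℂ => ‖p.2 - x₀‖)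
        (g := fun p : ℝ × ℂ => p.1 * d) (by fun_prop) (by fun_prop)
  set G : ℝ × ℂ → ℝ≥0∞ := S.indicator
    (fun p => F p.2 * ENNReal.ofReal ((δ + p.1 * d) * d)) with hG
  have hGm : Measurable G := by
    apply Measurable.indicator _ hSm
    fun_prop
  calc ∫⁻ y in B, ∫⁻ t in Ioc (0:ℝ) 1,
        F (x₀ + t * (y - x₀)) * ENNReal.ofReal ((δ + t * d) * d)
      ≤ ∫⁻ y, ∫⁻ t in Ioc (0:ℝ) 1, G (t, x₀ + t * (y - x₀)) := by
        rw [← lintegral_indicator hB]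
        refine lintegral_mono fun y => ?_
        by_cases hy : y ∈ B
        · rw [indicator_of_mem hy]
          refine setLIntegral_mono' measurableSet_Ioc fun t ht => ?_
          have hn : ‖x₀ + (t:ℂ) * (y - x₀) - x₀‖ = t * ‖y - x₀‖ := by
            rw [add_sub_cancel_left, norm_mul, Complex.norm_real, Real.norm_of_nonneg ht.1.le]
          have hmem : (t, x₀ + (t:ℂ) * (y - x₀)) ∈ S := by
            obtain ⟨h1, h2⟩ := hBd y hy
            simp only [hS, mem_ofPred_eq, hn]
            constructor
            · have := mul_le_mul_of_nonneg_left h1 ht.1.le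
              linarith
            · exact mul_le_mul_of_nonneg_left h2 ht.1.le
          rw [hG, indicator_of_mem hmem]
        · rw [indicator_of_notMem hy]; exact zero_le
    _ = ∫⁻ t in Ioc (0:ℝ) 1, ∫⁻ y, G (t, x₀ + t * (y - x₀)) := by
        rw [lintegral_lintegral_swap]
        apply Measurable.aemeasurable
        apply hGm.comp
        fun_prop
    _ = ∫⁻ t in Ioc (0:ℝ) 1, ∫⁻ x, ENNReal.ofReal (t ^ (-2 : ℤ)) * G (t, x) := by
        refine setLIntegral_congr_fun measurableSet_Ioc fun t ht => ?_
        have := lintegral_comp_homothety (F := fun x => G (t, x))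
          (hGm.comp measurable_prodMk_left) x₀ ht.1
        simp only [this]
        rw [lintegral_const_mul (f := fun x => G (t, x)) _ (hGm.comp measurable_prodMk_left)]
    _ = ∫⁻ x, ∫⁻ t in Ioc (0:ℝ) 1, ENNReal.ofReal (t ^ (-2 : ℤ)) * G (t, x) := by
        rw [lintegral_lintegral_swap]
        apply Measurable.aemeasurable
        apply Measurable.mul
        · have : Measurable fun t : ℝ => t ^ (-2 : ℤ) := by fun_prop
          exact (this.comp measurable_fst).ennreal_ofReal
        · exact hGm
    _ ≤ ∫⁻ x, ENNReal.ofReal (3 * d ^ 2) *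
          (F x * ENNReal.ofReal ((δ + 4 * ‖x - x₀‖) / ‖x - x₀‖)) := by
        refine lintegral_mono fun x => ?_
        set r := ‖x - x₀‖ with hr
        have hr0 : 0 ≤ r := norm_nonneg _
        set Cx := F x * ENNReal.ofReal (d ^ 2 / r ^ 2 * ((δ + 4 * r) * d)) with hCx
        calc ∫⁻ t in Ioc (0:ℝ) 1, ENNReal.ofReal (t ^ (-2 : ℤ)) * G (t, x)
            ≤ ∫⁻ t in Ioc (0:ℝ) 1, (Icc (r / d) (4 * r / d)).indicator (fun _ => Cx) t := by
              refine setLIntegral_mono' measurableSet_Ioc fun t ht => ?_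
              by_cases hm : (t, x) ∈ S
              · obtain ⟨h1, h2⟩ := hm
                simp only at h1 h2
                have ht1 : r / d ≤ t := by rw [div_le_iff₀ hd]; exact h2
                have ht2 : t ≤ 4 * r / d := by rw [le_div_iff₀ hd]; linarith
                have hrp : 0 < r := by
                  have := mul_pos ht.1 hd
                  linarith
                rw [indicator_of_mem (show t ∈ Icc _ _ from ⟨ht1, ht2⟩), hG,
                  indicator_of_mem (show (t, x) ∈ S from ⟨h1, h2⟩), hCx, mul_left_comm]
                refine mul_le_mul' le_rfl ?_
                rw [← ENNReal.ofReal_mul (by have := ht.1; positivity)]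
                apply ENNReal.ofReal_le_ofReal
                have e1 : t ^ (-2 : ℤ) ≤ d ^ 2 / r ^ 2 := by
                  rw [zpow_neg, show (t ^ (2:ℤ)) = t ^ 2 by norm_cast, ← div_pow,
                    ← inv_pow]
                  have : t⁻¹ ≤ d / r := by
                    rw [inv_le_comm₀ ht.1 (by positivity), inv_div]; exact ht1
                  exact pow_le_pow_left₀ (inv_nonneg.2 ht.1.le) this 2
                have e2 : (δ + t * d) * d ≤ (δ + 4 * r) * d := by
                  apply mul_le_mul_of_nonneg_right _ hd.le
                  linarith
                have := ht.1
                exact mul_le_mul e1 e2 (by positivity) (by positivity)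
              · rw [hG, indicator_of_notMem hm, mul_zero]; exact zero_le
          _ ≤ ∫⁻ t, (Icc (r / d) (4 * r / d)).indicator (fun _ => Cx) t :=
              setLIntegral_le_lintegral _ _
          _ = Cx * ENNReal.ofReal (4 * r / d - r / d) := by
              rw [lintegral_indicator measurableSet_Icc, setLIntegral_const, Real.volume_Icc]
          _ = ENNReal.ofReal (3 * d ^ 2) * (F x * ENNReal.ofReal ((δ + 4 * r) / r)) := by
              rw [hCx, mul_assoc, mul_left_comm (ENNReal.ofReal _) (F x),
                ← ENNReal.ofReal_mul (by positivity), ← ENNReal.ofReal_mul (by positivity)]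
              congr 2
              rcases hr0.eq_or_lt with h | h
              · simp [← h]
              · field_simp; ring
    _ = _ := by
        rw [lintegral_const_mul]
        fun_prop

/-- Averaging over a small disk of auxiliary points produces a broken path along which both
weighted line integrals are controlled by area integrals. -/
lemma exists_broken_path {Θ : ℂ → ℝ} (hΘ : Continuous Θ) (hΘ0 : ∀ x, 0 ≤ Θ x) {z₁ z : ℂ}
    {d δ : ℝ} (hz₁ : z₁ ∈ Metric.closedBall (0:ℂ) 1) (hz : z ∈ Metric.closedBall (0:ℂ) 1)
    (hd : ‖z - z₁‖ = d) (hd0 : 0 < d) (hδ : 0 ≤ δ) :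
    ∃ y ∈ Metric.closedBall (0:ℂ) 1, ‖y - z₁‖ ≤ d ∧ ‖y - z‖ ≤ d ∧
      ENNReal.ofReal (∫ t in (0:ℝ)..1, Θ (z₁ + t * (y - z₁)) * ((δ + t * d) * d)) +
      ENNReal.ofReal (∫ t in (0:ℝ)..1, Θ (z + t * (y - z)) * (t * d * d)) ≤
      64 * (∫⁻ x in Metric.ball 0 1 ∩ Metric.closedBall z₁ d,
          ENNReal.ofReal (Θ x) * ENNReal.ofReal ((δ + 4 * ‖x - z₁‖) / ‖x - z₁‖)) +
      256 * ∫⁻ x in Metric.ball 0 1 ∩ Metric.closedBall z d, ENNReal.ofReal (Θ x) := by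
  rw [mem_closedBall_zero_iff] at hz₁ hz
  have hd2 : d ≤ 2 := by
    rw [← hd]; exact (norm_sub_le _ _).trans (by linarith)
  set m : ℂ := (1 - d / 8 : ℝ) * ((z₁ + z) / 2) with hm
  have hmid : ‖(z₁ + z) / 2‖ ≤ 1 := by
    rw [norm_div]
    have := norm_add_le z₁ z
    simp only [Complex.norm_ofNat]
    linarith
  have hmn : ‖m‖ ≤ 1 - d / 8 := by
    rw [hm, norm_mul, Complex.norm_real, Real.norm_of_nonneg (by linarith)]
    exact mul_le_of_le_one_right (by linarith) hmid
  have hmm : ‖m - (z₁ + z) / 2‖ ≤ d / 8 := by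
    have : m - (z₁ + z) / 2 = ((-(d / 8) : ℝ) : ℂ) * ((z₁ + z) / 2) := by
      rw [hm]; push_cast; ring
    rw [this, norm_mul, Complex.norm_real, norm_neg, Real.norm_of_nonneg (by linarith)]
    exact mul_le_of_le_one_right (by linarith) hmid
  set B := Metric.ball m (d / 8) with hB
  have hymid : ∀ y ∈ B, ‖y - (z₁ + z) / 2‖ ≤ d / 4 := by
    intro y hy
    rw [hB, mem_ball_iff_norm] at hy
    calc ‖y - (z₁ + z) / 2‖ = ‖(y - m) + (m - (z₁ + z) / 2)‖ := by congr 1; ring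
      _ ≤ ‖y - m‖ + ‖m - (z₁ + z) / 2‖ := norm_add_le _ _
      _ ≤ d / 4 := by linarith
  have hyD : ∀ y ∈ B, ‖y‖ < 1 := by
    intro y hy
    rw [hB, mem_ball_iff_norm] at hy
    calc ‖y‖ = ‖(y - m) + m‖ := by congr 1; ring
      _ ≤ ‖y - m‖ + ‖m‖ := norm_add_le _ _
      _ < 1 := by linarith
  have hhalf : ∀ {p q : ℂ}, ‖q - p‖ = d → ‖(p + q) / 2 - p‖ = d / 2 := by
    intro p q h
    rw [show (p + q) / 2 - p = (q - p) / 2 by ring, norm_div, h]; simp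
  have hbd : ∀ {p q : ℂ}, ‖q - p‖ = d → (p + q) / 2 = (z₁ + z) / 2 →
      ∀ y ∈ B, d / 4 ≤ ‖y - p‖ ∧ ‖y - p‖ ≤ d := by
    intro p q h hpq y hy
    have h1 := hhalf h
    rw [hpq] at h1
    have h2 := hymid y hy
    have h3 : y - p = (y - (z₁ + z) / 2) + ((z₁ + z) / 2 - p) := by ring
    constructor
    · have := norm_sub_norm_le ((z₁ + z) / 2 - p) (-(y - (z₁ + z) / 2))
      rw [norm_neg] at this
      rw [h3, add_comm]
      rw [sub_neg_eq_add] at this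
      linarith
    · rw [h3]
      exact (norm_add_le _ _).trans (by linarith)
  have hbd1 := hbd hd rfl
  have hbd2 := hbd (p := z) (q := z₁) (by rw [norm_sub_rev]; exact hd) (by ring)
  have hseg : ∀ {p y : ℂ} {t : ℝ}, ‖p‖ ≤ 1 → y ∈ B → ‖y - p‖ ≤ d → t ∈ Ioc (0:ℝ) 1 →
      p + t * (y - p) ∈ Metric.ball (0:ℂ) 1 ∩ Metric.closedBall p d := by
    intro p y t hp hy hyp ht
    constructor
    · rw [mem_ball_zero_iff]
      have h1 : p + t * (y - p) = ((1 - t : ℝ) : ℂ) * p + (t : ℝ) * y := by push_cast; ring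
      rw [h1]
      refine (norm_add_le _ _).trans_lt ?_
      rw [norm_mul, norm_mul, Complex.norm_real, Complex.norm_real,
        Real.norm_of_nonneg ht.1.le, Real.norm_of_nonneg (by linarith [ht.2])]
      have e1 := mul_le_mul_of_nonneg_left hp (by linarith [ht.2] : 0 ≤ 1 - t)
      have e2 := mul_lt_mul_of_pos_left (hyD y hy) ht.1
      linarith
    · rw [mem_closedBall_iff_norm, add_sub_cancel_left, norm_mul, Complex.norm_real,
        Real.norm_of_nonneg ht.1.le]
      exact (mul_le_of_le_one_left (norm_nonneg _) ht.2).trans hyp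
  have hball : ∀ p : ℂ, MeasurableSet (Metric.ball (0:ℂ) 1 ∩ Metric.closedBall p d) :=
    fun p => measurableSet_ball.inter Metric.isClosed_closedBall.measurableSet
  have hΘm : Measurable fun x => ENNReal.ofReal (Θ x) := hΘ.measurable.ennreal_ofReal
  have leg : ∀ {p : ℂ} {δ' : ℝ}, 0 ≤ δ' → ‖p‖ ≤ 1 →
      (∀ y ∈ B, d / 4 ≤ ‖y - p‖ ∧ ‖y - p‖ ≤ d) →
      ∫⁻ y in B, ENNReal.ofReal
        (∫ t in (0:ℝ)..1, Θ (p + t * (y - p)) * ((δ' + t * d) * d)) ≤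
      ENNReal.ofReal (3 * d ^ 2) * ∫⁻ x in Metric.ball 0 1 ∩ Metric.closedBall p d,
          ENNReal.ofReal (Θ x) * ENNReal.ofReal ((δ' + 4 * ‖x - p‖) / ‖x - p‖) := by
    intro p δ' hδ' hp hbdp
    set F : ℂ → ℝ≥0∞ := (Metric.ball (0:ℂ) 1 ∩ Metric.closedBall p d).indicator
      fun x => ENNReal.ofReal (Θ x) with hF
    have hFm : Measurable F := hΘm.indicator (hball p)
    have key := lintegral_segment_le hFm (B := B) measurableSet_ball hd0 hδ' hbdp
    have e : ∫⁻ x, F x * ENNReal.ofReal ((δ' + 4 * ‖x - p‖) / ‖x - p‖)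
        = ∫⁻ x in Metric.ball 0 1 ∩ Metric.closedBall p d,
          ENNReal.ofReal (Θ x) * ENNReal.ofReal ((δ' + 4 * ‖x - p‖) / ‖x - p‖) := by
      rw [← lintegral_indicator (hball p)]
      refine lintegral_congr fun x => ?_
      rw [hF, indicator_mul_left]
    rw [e] at key
    refine le_trans (setLIntegral_mono' measurableSet_ball fun y hy => ?_) key
    rw [intervalIntegral.integral_of_le zero_le_one,
      ofReal_integral_eq_lintegral_ofReal]
    · refine setLIntegral_mono' measurableSet_Ioc fun t ht => ?_
      rw [hF, indicator_of_mem (hseg hp hy (hbdp y hy).2 ht), ENNReal.ofReal_mul (hΘ0 _)]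
    · refine Continuous.integrableOn_Ioc ?_
      fun_prop
    · filter_upwards [ae_restrict_mem measurableSet_Ioc] with t ht
      have := ht.1
      exact mul_nonneg (hΘ0 _) (by positivity)
  set L₁ := ∫⁻ x in Metric.ball 0 1 ∩ Metric.closedBall z₁ d,
          ENNReal.ofReal (Θ x) * ENNReal.ofReal ((δ + 4 * ‖x - z₁‖) / ‖x - z₁‖) with hL₁
  set L₂ := ∫⁻ x in Metric.ball 0 1 ∩ Metric.closedBall z d, ENNReal.ofReal (Θ x) with hL₂
  have l1 := leg hδ hz₁ hbd1
  have l2 := leg (δ' := 0) le_rfl hz hbd2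
  have l2' : ∫⁻ y in B, ENNReal.ofReal
        (∫ t in (0:ℝ)..1, Θ (z + t * (y - z)) * ((0 + t * d) * d)) ≤
      ENNReal.ofReal (3 * d ^ 2) * (4 * L₂) := by
    refine l2.trans (mul_le_mul' le_rfl ?_)
    rw [hL₂, ← lintegral_const_mul _ hΘm]
    refine lintegral_mono fun x => ?_
    rw [mul_comm]
    refine mul_le_mul' ?_ le_rfl
    have : (0 + 4 * ‖x - z‖) / ‖x - z‖ ≤ 4 := by
      rcases (norm_nonneg (x - z)).eq_or_lt with h | h
      · rw [← h]; norm_num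
      · rw [div_le_iff₀ h]; linarith
    refine (ENNReal.ofReal_le_ofReal this).trans ?_
    simp
  set f : ℂ → ℝ≥0∞ := fun y => ENNReal.ofReal
        (∫ t in (0:ℝ)..1, Θ (z₁ + t * (y - z₁)) * ((δ + t * d) * d)) + ENNReal.ofReal
        (∫ t in (0:ℝ)..1, Θ (z + t * (y - z)) * ((0 + t * d) * d)) with hf
  have hc : ∀ (p : ℂ) (δ' : ℝ), Continuous fun y : ℂ =>
      ∫ t in (0:ℝ)..1, Θ (p + t * (y - p)) * ((δ' + t * d) * d) := by
    intro p δ'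
    apply intervalIntegral.continuous_parametric_intervalIntegral_of_continuous'
    fun_prop
  have hfm : Measurable f := (hc z₁ δ).measurable.ennreal_ofReal.add
    (hc z 0).measurable.ennreal_ofReal
  have hBv : volume B = ENNReal.ofReal (d / 8) ^ 2 * NNReal.pi := by
    rw [hB, Complex.volume_ball]
  have hB0 : volume B ≠ 0 := (Metric.measure_ball_pos _ _ (by linarith)).ne'
  have hBt : volume B ≠ ∞ := measure_ball_lt_top.ne
  obtain ⟨y, hyB, hy⟩ := exists_le_setLAverage hB0 hBt hfm.aemeasurable
  refine ⟨y, ?_, (hbd1 y hyB).2, (hbd2 y hyB).2, ?_⟩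
  · rw [mem_closedBall_zero_iff]; exact (hyD y hyB).le
  · have h0 : f y = ENNReal.ofReal
        (∫ t in (0:ℝ)..1, Θ (z₁ + t * (y - z₁)) * ((δ + t * d) * d)) + ENNReal.ofReal
        (∫ t in (0:ℝ)..1, Θ (z + t * (y - z)) * (t * d * d)) := by
      simp only [hf, zero_add]
    rw [← h0]
    refine hy.trans ?_
    rw [setLAverage_eq]
    have h1 : ∫⁻ y in B, f y ≤ ENNReal.ofReal (3 * d ^ 2) * (L₁ + 4 * L₂) := by
      rw [hf, lintegral_add_left (hc z₁ δ).measurable.ennreal_ofReal, mul_add]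
      exact add_le_add l1 l2'
    have h2 : ENNReal.ofReal (3 * d ^ 2) ≤ 64 * volume B := by
      rw [hBv, ← ENNReal.ofReal_pow (by linarith), show ((NNReal.pi : ℝ≥0∞)) = ENNReal.ofReal π by
        rw [ENNReal.ofReal, ← NNReal.coe_real_pi, Real.toNNReal_coe], show (64 : ℝ≥0∞) = ENNReal.ofReal 64 by simp,
        ← ENNReal.ofReal_mul (by positivity), ← ENNReal.ofReal_mul (by positivity)]
      apply ENNReal.ofReal_le_ofReal
      have := Real.pi_gt_three
      have := mul_le_mul_of_nonneg_left this.le (sq_nonneg d)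
      linarith
    rw [ENNReal.div_le_iff hB0 hBt]
    refine h1.trans ((mul_le_mul' h2 le_rfl).trans (le_of_eq ?_))
    ring

/-! ### Quantitative blow-up data -/

/-- A solution with controlled data, together with a maximum point `z₁` of `u` on the closed
disk and the concentration scale `δ = exp (-u z₁ / 2)`. -/
structure BubbleData (k M : ℝ) (K h u : ℂ → ℝ) (z₁ : ℂ) (δ : ℝ) : Prop where
  hK : ContDiff ℝ 2 K
  hh : ContDiff ℝ 2 h
  hu : ContDiff ℝ 2 u
  hs : SolvesLiouville K h u
  hk : 1 ≤ k
  hM : 0 ≤ M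
  hKb : ∀ z ∈ Metric.closedBall (0:ℂ) 1, |K z| ≤ k
  hKd : ∀ z ∈ Metric.closedBall (0:ℂ) 1, ‖pU K z‖ ≤ k
  hhb : ∀ θ, |h (cis θ)| ≤ k
  hhd : ∀ θ, |fderiv ℝ h (cis θ) (Complex.I * cis θ)| ≤ k
  hmass : massMeasure u univ ≤ ENNReal.ofReal M
  hz₁ : z₁ ∈ Metric.closedBall (0:ℂ) 1
  hδ : wF u z₁ = δ
  hmin : ∀ z ∈ Metric.closedBall (0:ℂ) 1, δ ≤ wF u z

lemma BubbleData.pos {k M : ℝ} {K h u : ℂ → ℝ} {z₁ : ℂ} {δ : ℝ}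
    (b : BubbleData k M K h u z₁ δ) : 0 < δ := b.hδ ▸ wF_pos u z₁

lemma BubbleData.wF_inv_le {k M : ℝ} {K h u : ℂ → ℝ} {z₁ : ℂ} {δ : ℝ}
    (b : BubbleData k M K h u z₁ δ) {z : ℂ} (hz : z ∈ Metric.closedBall (0:ℂ) 1) :
    (wF u z)⁻¹ ≤ δ⁻¹ := inv_anti₀ b.pos (b.hmin z hz)

lemma BubbleData.exp_le {k M : ℝ} {K h u : ℂ → ℝ} {z₁ : ℂ} {δ : ℝ}
    (b : BubbleData k M K h u z₁ δ) {z : ℂ} (hz : z ∈ Metric.closedBall (0:ℂ) 1) :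
    Real.exp (u z) ≤ δ⁻¹ ^ 2 := by
  rw [← wF_inv_sq]
  exact pow_le_pow_left₀ (inv_nonneg.2 (wF_pos u z).le) (b.wF_inv_le hz) 2

lemma BubbleData.exp_half_le {k M : ℝ} {K h u : ℂ → ℝ} {z₁ : ℂ} {δ : ℝ}
    (b : BubbleData k M K h u z₁ δ) {z : ℂ} (hz : z ∈ Metric.closedBall (0:ℂ) 1) :
    Real.exp (u z / 2) ≤ δ⁻¹ := by
  rw [← wF_inv]
  exact b.wF_inv_le hz

/-- Integrals of `‖hopf u‖` reduce to integrals of the kernel `‖ζ - x‖⁻¹`. -/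
lemma BubbleData.lintegral_qF_le {k M : ℝ} {K h u : ℂ → ℝ} {z₁ : ℂ} {δ : ℝ}
    (b : BubbleData k M K h u z₁ δ) {S : Set ℂ} (hS : MeasurableSet S)
    (hSD : S ⊆ Metric.ball 0 1) {F : ℂ → ℝ≥0∞} (hF : Measurable F) :
    ∫⁻ x in S, ENNReal.ofReal ‖qF u x‖ * F x ≤
      ENNReal.ofReal k * ∫⁻ ζ, (∫⁻ x in S, ENNReal.ofReal ‖x - ζ‖⁻¹ * F x) ∂(massMeasure u) := by
  have hsf : SFinite (massMeasure u) := by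
    have : IsFiniteMeasure (massMeasure u) := ⟨b.hmass.trans_lt ENNReal.ofReal_lt_top⟩
    infer_instance
  calc ∫⁻ x in S, ENNReal.ofReal ‖qF u x‖ * F x
      ≤ ∫⁻ x in S, (ENNReal.ofReal k *
          ∫⁻ ζ, ENNReal.ofReal ‖ζ - x‖⁻¹ ∂(massMeasure u)) * F x := by
        refine setLIntegral_mono' hS fun x hx => mul_le_mul' ?_ le_rfl
        refine le_trans (ENNReal.ofReal_le_ofReal ?_)
          (ofReal_hopf_le b.hK b.hu b.hh b.hs (hSD hx)
            (fun z hz => b.hKd z (Metric.ball_subset_closedBall hz)) b.hhd)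
        rw [qF, norm_div, norm_neg]
        have := norm_nonneg (hopf u x)
        simp only [Complex.norm_ofNat]
        linarith
    _ = ∫⁻ x in S, ENNReal.ofReal k *
          ∫⁻ ζ, ENNReal.ofReal ‖x - ζ‖⁻¹ * F x ∂(massMeasure u) := by
        refine lintegral_congr fun x => ?_
        rw [mul_assoc, lintegral_mul_const _ (by fun_prop)]
        simp only [norm_sub_rev x]
    _ = ENNReal.ofReal k * ∫⁻ x in S,
          ∫⁻ ζ, ENNReal.ofReal ‖x - ζ‖⁻¹ * F x ∂(massMeasure u) := by
        rw [lintegral_const_mul']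
        exact ENNReal.ofReal_ne_top
    _ = _ := by
        rw [lintegral_lintegral_swap]
        apply Measurable.aemeasurable
        fun_prop

/-- Growth of the area integral of `thetaF` on small disks. -/
lemma BubbleData.lintegral_thetaF_ball_le {k M : ℝ} {K h u : ℂ → ℝ} {z₁ : ℂ} {δ : ℝ}
    (b : BubbleData k M K h u z₁ δ) (z : ℂ) {r : ℝ} (hr : 0 < r) :
    ∫⁻ x in Metric.ball 0 1 ∩ Metric.closedBall z r, ENNReal.ofReal (thetaF u x) ≤
      ENNReal.ofReal ((26 * k * M + M + 8) * r) := by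
  set S := Metric.ball (0:ℂ) 1 ∩ Metric.closedBall z r with hS
  have hSm : MeasurableSet S := measurableSet_ball.inter Metric.isClosed_closedBall.measurableSet
  have hk := b.hk
  have hM := b.hM
  have hq := b.lintegral_qF_le hSm inter_subset_left (F := fun _ => 1) measurable_const
  simp only [mul_one] at hq
  have hsub : S ⊆ Metric.ball z (2 * r) := by
    refine inter_subset_right.trans (Metric.closedBall_subset_ball (by linarith))
  have h1 : ∀ ζ, ∫⁻ x in S, ENNReal.ofReal ‖x - ζ‖⁻¹ ≤ ENNReal.ofReal (26 * r) := by
    intro ζ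
    have := lintegral_ball_kernel_le (s := 1) zero_le_one (by norm_num)
      (show 0 < 2 * r by linarith) z ζ
    refine (lintegral_mono_set hsub).trans ?_
    simp only [Real.rpow_neg_one] at this
    refine this.trans (ENNReal.ofReal_le_ofReal ?_)
    have hpi := Real.pi_lt_d2
    norm_num
    nlinarith
  have hQ : ∫⁻ x in S, ENNReal.ofReal ‖qF u x‖ ≤ ENNReal.ofReal (26 * k * M * r) := by
    refine hq.trans ?_
    calc ENNReal.ofReal k * ∫⁻ ζ, (∫⁻ x in S, ENNReal.ofReal ‖x - ζ‖⁻¹) ∂(massMeasure u)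
        ≤ ENNReal.ofReal k * ∫⁻ ζ, ENNReal.ofReal (26 * r) ∂(massMeasure u) :=
          mul_le_mul' le_rfl (lintegral_mono h1)
      _ = ENNReal.ofReal k * (ENNReal.ofReal (26 * r) * massMeasure u univ) := by
          rw [lintegral_const]
      _ ≤ ENNReal.ofReal k * (ENNReal.ofReal (26 * r) * ENNReal.ofReal M) :=
          mul_le_mul' le_rfl (mul_le_mul' le_rfl b.hmass)
      _ = _ := by
          rw [← ENNReal.ofReal_mul (by positivity), ← ENNReal.ofReal_mul (by positivity)]
          congr 1; ring
  have hE : ∫⁻ x in S, ENNReal.ofReal (wF u x)⁻¹ ≤ ENNReal.ofReal ((M + 8) * r) := by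
    calc ∫⁻ x in S, ENNReal.ofReal (wF u x)⁻¹
        ≤ ∫⁻ x in S, (ENNReal.ofReal r * ENNReal.ofReal (Real.exp (u x)) +
            ENNReal.ofReal r⁻¹) := by
          refine lintegral_mono fun x => ?_
          rw [← ENNReal.ofReal_mul hr.le, ← ENNReal.ofReal_add (by positivity) (by positivity)]
          apply ENNReal.ofReal_le_ofReal
          rw [← wF_inv_sq]
          have hri : r * r⁻¹ = 1 := mul_inv_cancel₀ hr.ne'
          set e := (wF u x)⁻¹
          have hri0 : 0 < r⁻¹ := inv_pos.2 hr
          have h3 : 0 ≤ r * (e - r⁻¹) ^ 2 := by positivity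
          have h4 : r * (e - r⁻¹) ^ 2 = r * e ^ 2 - 2 * (r * r⁻¹) * e + (r * r⁻¹) * r⁻¹ := by ring
          have h5 : 0 ≤ e := inv_nonneg.2 (wF_pos u x).le
          rw [h4, hri] at h3
          linarith
      _ = ENNReal.ofReal r * (∫⁻ x in S, ENNReal.ofReal (Real.exp (u x))) +
            ENNReal.ofReal r⁻¹ * volume S := by
          have hum := b.hu.continuous.measurable
          rw [lintegral_add_right _ measurable_const, lintegral_const_mul _ (by fun_prop),
            setLIntegral_const]
      _ ≤ ENNReal.ofReal r * ENNReal.ofReal M +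
            ENNReal.ofReal r⁻¹ * ENNReal.ofReal (π * r ^ 2) := by
          refine add_le_add (mul_le_mul' le_rfl ?_) (mul_le_mul' le_rfl ?_)
          · refine le_trans ?_ b.hmass
            have := lintegral_massMeasure b.hu.continuous (f := fun _ => 1) measurable_const
            simp only [lintegral_one, mul_one] at this
            rw [this]
            exact (lintegral_mono_set inter_subset_left).trans le_self_add
          · refine (measure_mono inter_subset_right).trans ?_
            rw [Complex.volume_closedBall, ← ENNReal.ofReal_pow hr.le,
              show ((NNReal.pi : ℝ≥0∞)) = ENNReal.ofReal π by
                rw [ENNReal.ofReal, ← NNReal.coe_real_pi, Real.toNNReal_coe],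
              ← ENNReal.ofReal_mul (by positivity), mul_comm]
      _ ≤ _ := by
          rw [← ENNReal.ofReal_mul (by positivity), ← ENNReal.ofReal_mul (by positivity),
            ← ENNReal.ofReal_add (by positivity) (by positivity)]
          apply ENNReal.ofReal_le_ofReal
          have : r⁻¹ * (π * r ^ 2) = π * r := by field_simp
          rw [this]
          nlinarith [Real.pi_lt_four]
  calc ∫⁻ x in S, ENNReal.ofReal (thetaF u x)
      = (∫⁻ x in S, ENNReal.ofReal ‖qF u x‖) + ∫⁻ x in S, ENNReal.ofReal (wF u x)⁻¹ := by
        rw [← lintegral_add_left (continuous_qF b.hu).norm.measurable.ennreal_ofReal]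
        refine lintegral_congr fun x => ?_
        rw [thetaF, ENNReal.ofReal_add (norm_nonneg _) (inv_nonneg.2 (wF_pos u x).le)]
    _ ≤ ENNReal.ofReal (26 * k * M * r) + ENNReal.ofReal ((M + 8) * r) := add_le_add hQ hE
    _ = _ := by
        rw [← ENNReal.ofReal_add (by positivity) (by positivity)]
        congr 1; ring

lemma norm_cis_sub_cis_ge {θ α : ℝ} (h : |θ - α| ≤ π) : 2 / π * |θ - α| ≤ ‖cis θ - cis α‖ := by
  rw [norm_cis_sub_cis]
  have := Real.mul_abs_le_abs_sin (x := (θ - α) / 2) (by rw [abs_div, abs_two]; linarith)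
  rw [abs_div, abs_two] at this
  linarith

lemma cis_add_two_pi (θ : ℝ) : cis (θ + 2 * π) = cis θ := by
  rw [cis_eq, cis_eq]
  simp

lemma exists_polar (z : ℂ) : ∃ α ∈ Ioc (-π) π, z = (‖z‖ : ℂ) * cis α := by
  refine ⟨z.arg, ⟨Complex.neg_pi_lt_arg z, Complex.arg_le_pi z⟩, ?_⟩
  exact (Complex.norm_mul_exp_arg_mul_I z).symm

lemma norm_cis_sub_le_two_mul {z : ℂ} (hz : ‖z‖ ≤ 1) {α : ℝ} (hα : z = (‖z‖ : ℂ) * cis α) (θ : ℝ) :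
    ‖cis θ - cis α‖ ≤ 2 * ‖cis θ - z‖ := by
  have h1 : ‖z - cis α‖ = 1 - ‖z‖ := by
    have : z - cis α = ((‖z‖ - 1 : ℝ) : ℂ) * cis α := by
      push_cast; rw [sub_mul, one_mul, ← hα]
    rw [this, norm_mul, norm_cis, mul_one, Complex.norm_real, Real.norm_of_nonpos (by linarith)]
    ring
  have h2 : 1 - ‖z‖ ≤ ‖cis θ - z‖ := by
    have := norm_sub_norm_le (cis θ) z
    rwa [norm_cis] at this
  calc ‖cis θ - cis α‖ = ‖(cis θ - z) + (z - cis α)‖ := by congr 1; ring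
    _ ≤ ‖cis θ - z‖ + ‖z - cis α‖ := norm_add_le _ _
    _ ≤ _ := by linarith

lemma lintegral_Ioo_rpow {R : ℝ} (hR : 0 ≤ R) :
    ∫⁻ t in Ioo 0 R, ENNReal.ofReal (t ^ (-(1/2) : ℝ)) = ENNReal.ofReal (2 * R ^ (1/2 : ℝ)) := by
  rw [restrict_Ioo_eq_restrict_Ioc, ← ofReal_integral_eq_lintegral_ofReal,
    ← intervalIntegral.integral_of_le hR, integral_rpow (by left; norm_num)]
  · congr 1
    rw [show (-(1/2) : ℝ) + 1 = 1/2 by norm_num, Real.zero_rpow (by norm_num)]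
    ring
  · rw [← IntegrableOn, ← intervalIntegrable_iff_integrableOn_Ioc_of_le hR]
    exact intervalIntegral.intervalIntegrable_rpow' (by norm_num)
  · filter_upwards [ae_restrict_mem measurableSet_Ioc] with t ht
    exact Real.rpow_nonneg ht.1.le _

lemma lintegral_circle_rpow_le {z₁ : ℂ} (hz : ‖z₁‖ ≤ 1) {δ : ℝ} (hδ : 0 < δ) :
    ∫⁻ θ in Ioc (-π) π, {ζ | ‖ζ - z₁‖ < δ}.indicator
      (fun ζ => ENNReal.ofReal (‖ζ - z₁‖ ^ (-(1/2) : ℝ))) (cis θ) ≤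
    ENNReal.ofReal (48 * δ ^ (1/2 : ℝ)) := by
  obtain ⟨α, hα, hzα⟩ := exists_polar z₁
  set g : ℝ → ℝ≥0∞ := (Ioo 0 (π * δ)).indicator fun t => ENNReal.ofReal (t ^ (-(1/2) : ℝ)) with hg
  have hgm : Measurable g := by
    apply Measurable.indicator _ measurableSet_Ioo
    fun_prop
  have hgi : ∫⁻ t, g t = ENNReal.ofReal (2 * (π * δ) ^ (1/2 : ℝ)) := by
    rw [hg, lintegral_indicator measurableSet_Ioo, lintegral_Ioo_rpow (by positivity)]
  set G : ℝ → ℝ → ℝ≥0∞ := fun a θ => 2 * (g (θ - a) + g (a - θ)) with hG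
  have hGi : ∀ a, ∫⁻ θ, G a θ = ENNReal.ofReal (8 * (π * δ) ^ (1/2 : ℝ)) := by
    intro a
    rw [hG]
    simp only
    rw [lintegral_const_mul _ (by fun_prop), lintegral_add_left (by fun_prop),
      lintegral_sub_right_eq_self, lintegral_sub_left_eq_self, hgi,
      ← ENNReal.ofReal_add (by positivity) (by positivity),
      show (2 : ℝ≥0∞) = ENNReal.ofReal 2 by simp, ← ENNReal.ofReal_mul (by norm_num)]
    congr 1; ring
  have hpt : ∀ θ a : ℝ, θ ≠ a → cis a = cis α → |θ - a| ≤ π →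
      {ζ | ‖ζ - z₁‖ < δ}.indicator
        (fun ζ => ENNReal.ofReal (‖ζ - z₁‖ ^ (-(1/2) : ℝ))) (cis θ) ≤ G a θ := by
    intro θ a hne ha hle
    by_cases hm : ‖cis θ - z₁‖ < δ
    · rw [indicator_of_mem (by exact hm)]
      have hp := Real.pi_pos
      have h1 : |θ - a| / π ≤ ‖cis θ - z₁‖ := by
        have e1 := norm_cis_sub_cis_ge hle
        have e2 := norm_cis_sub_le_two_mul hz hzα θ
        rw [ha] at e1
        have e3 : 2 / π * |θ - a| = 2 * (|θ - a| / π) := by ring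
        linarith
      have h0 : 0 < |θ - a| := abs_pos.2 (sub_ne_zero.2 hne)
      have hlt : |θ - a| < π * δ := by
        have := h1.trans_lt hm
        rw [div_lt_iff₀ hp] at this
        linarith
      have h2 : ‖cis θ - z₁‖ ^ (-(1/2) : ℝ) ≤ 2 * |θ - a| ^ (-(1/2) : ℝ) := by
        calc ‖cis θ - z₁‖ ^ (-(1/2) : ℝ) ≤ (|θ - a| / π) ^ (-(1/2) : ℝ) :=
              Real.rpow_le_rpow_of_nonpos (by positivity) h1 (by norm_num)
          _ = π ^ (1/2 : ℝ) * |θ - a| ^ (-(1/2) : ℝ) := by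
              rw [Real.div_rpow h0.le hp.le, Real.rpow_neg hp.le, div_inv_eq_mul, mul_comm]
          _ ≤ _ := by
              apply mul_le_mul_of_nonneg_right _ (by positivity)
              rw [← Real.sqrt_eq_rpow, Real.sqrt_le_left (by norm_num)]
              linarith [Real.pi_lt_four]
      have h3 : ENNReal.ofReal (|θ - a| ^ (-(1/2) : ℝ)) ≤ g (θ - a) + g (a - θ) := by
        rcases lt_or_gt_of_ne hne with h | h
        · have e : |θ - a| = a - θ := by rw [abs_of_neg (by linarith)]; ring
          refine le_trans (le_of_eq ?_) le_add_self
          rw [e] at hlt ⊢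
          rw [hg, indicator_of_mem (show a - θ ∈ Ioo 0 (π * δ) from ⟨by linarith, hlt⟩)]
        · have e : |θ - a| = θ - a := abs_of_pos (by linarith)
          refine le_trans (le_of_eq ?_) le_self_add
          rw [e] at hlt ⊢
          rw [hg, indicator_of_mem (show θ - a ∈ Ioo 0 (π * δ) from ⟨by linarith, hlt⟩)]
      refine (ENNReal.ofReal_le_ofReal h2).trans ?_
      rw [ENNReal.ofReal_mul (by norm_num)]
      simp only [hG, ENNReal.ofReal_ofNat]
      exact mul_le_mul' le_rfl h3
    · rw [indicator_of_notMem (by exact hm)]; exact zero_le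
  have hae : ∀ a : ℝ, ∀ᵐ θ : ℝ, θ ≠ a := fun a => by
    simp [ae_iff]
  calc _ ≤ ∫⁻ θ in Ioc (-π) π, (G α θ + (G (α + 2 * π) θ + G (α - 2 * π) θ)) := by
        refine setLIntegral_mono_ae' measurableSet_Ioc ?_
        filter_upwards [hae α, hae (α + 2 * π), hae (α - 2 * π)] with θ h1 h2 h3 hθ
        by_cases c1 : |θ - α| ≤ π
        · exact (hpt θ α h1 rfl c1).trans le_self_add
        by_cases c2 : α ≤ θ
        · rw [abs_of_nonneg (by linarith)] at c1
          refine (hpt θ (α + 2 * π) h2 (cis_add_two_pi α) ?_).trans (le_self_add.trans le_add_self)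
          rw [abs_le]; constructor <;> linarith [hα.1, hθ.2, hα.2, hθ.1]
        · rw [abs_of_neg (by linarith)] at c1
          refine (hpt θ (α - 2 * π) h3 ?_ ?_).trans (le_add_self.trans le_add_self)
          · rw [← cis_add_two_pi (α - 2 * π)]; congr 1; ring
          rw [abs_le]; constructor <;> linarith [hα.1, hθ.2, hα.2, hθ.1]
    _ ≤ ∫⁻ θ, (G α θ + (G (α + 2 * π) θ + G (α - 2 * π) θ)) := setLIntegral_le_lintegral _ _
    _ = ENNReal.ofReal (24 * (π * δ) ^ (1/2 : ℝ)) := by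
        rw [lintegral_add_left (by fun_prop), lintegral_add_left (by fun_prop), hGi, hGi, hGi,
          ← ENNReal.ofReal_add (by positivity) (by positivity),
          ← ENNReal.ofReal_add (by positivity) (by positivity)]
        congr 1; ring
    _ ≤ _ := by
        apply ENNReal.ofReal_le_ofReal
        rw [Real.mul_rpow Real.pi_pos.le hδ.le]
        have : π ^ (1/2 : ℝ) ≤ 2 := by
          rw [← Real.sqrt_eq_rpow, Real.sqrt_le_left (by norm_num)]
          linarith [Real.pi_lt_four]
        have h5 : 0 ≤ δ ^ (1/2 : ℝ) := by positivity
        nlinarith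

/-- The mass distribution integrates the kernel `‖ζ - z₁‖ ^ (-1/2)` at the natural scale. -/
lemma BubbleData.lintegral_sqrt_kernel_le {k M : ℝ} {K h u : ℂ → ℝ} {z₁ : ℂ} {δ : ℝ}
    (b : BubbleData k M K h u z₁ δ) :
    ∫⁻ ζ, ENNReal.ofReal (‖ζ - z₁‖ ^ (-(1/2) : ℝ)) ∂(massMeasure u) ≤
      ENNReal.ofReal ((M + 57) * δ ^ (-(1/2) : ℝ)) := by
  have hδ := b.pos
  have hM := b.hM
  set S : Set ℂ := {ζ | ‖ζ - z₁‖ < δ} with hS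
  have hSm : MeasurableSet S := measurableSet_lt (by fun_prop) (by fun_prop)
  set f : ℂ → ℝ≥0∞ := fun ζ => ENNReal.ofReal (‖ζ - z₁‖ ^ (-(1/2) : ℝ)) with hf
  have hfm : Measurable f := by fun_prop
  have hout : ∫⁻ ζ, Sᶜ.indicator f ζ ∂(massMeasure u) ≤ ENNReal.ofReal (M * δ ^ (-(1/2) : ℝ)) := by
    calc ∫⁻ ζ, Sᶜ.indicator f ζ ∂(massMeasure u)
        ≤ ∫⁻ ζ, ENNReal.ofReal (δ ^ (-(1/2) : ℝ)) ∂(massMeasure u) := by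
          refine lintegral_mono fun ζ => ?_
          by_cases hm : ζ ∈ S
          · rw [indicator_of_notMem (by simpa using hm)]; exact zero_le
          · rw [indicator_of_mem hm]
            apply ENNReal.ofReal_le_ofReal
            exact Real.rpow_le_rpow_of_nonpos hδ (not_lt.1 hm) (by norm_num)
      _ ≤ _ := by
          rw [lintegral_const, mul_comm M, ENNReal.ofReal_mul (by positivity)]
          exact mul_le_mul' le_rfl b.hmass
  have hin : ∫⁻ ζ, S.indicator f ζ ∂(massMeasure u) ≤ ENNReal.ofReal (57 * δ ^ (-(1/2) : ℝ)) := by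
    rw [lintegral_massMeasure b.hu.continuous (hfm.indicator hSm)]
    have e2 : δ⁻¹ * δ ^ (1/2 : ℝ) = δ ^ (-(1/2) : ℝ) := by
      rw [← Real.rpow_neg_one, ← Real.rpow_add hδ]; norm_num
    have harea : ∫⁻ z in Metric.ball 0 1, ENNReal.ofReal (Real.exp (u z)) * S.indicator f z ≤
        ENNReal.ofReal (9 * δ ^ (-(1/2) : ℝ)) := by
      calc _ ≤ ∫⁻ z in Metric.ball (0:ℂ) 1, ENNReal.ofReal (δ⁻¹ ^ 2) * S.indicator f z := by
            refine setLIntegral_mono' measurableSet_ball fun z hz => mul_le_mul' ?_ le_rfl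
            exact ENNReal.ofReal_le_ofReal (b.exp_le (Metric.ball_subset_closedBall hz))
        _ ≤ ∫⁻ z, ENNReal.ofReal (δ⁻¹ ^ 2) * S.indicator f z := setLIntegral_le_lintegral _ _
        _ = ENNReal.ofReal (δ⁻¹ ^ 2) * ∫⁻ z in Metric.ball z₁ δ, f z := by
            rw [lintegral_const_mul _ (hfm.indicator hSm), lintegral_indicator hSm]
            congr 3
            ext z; simp [hS, dist_eq_norm]
        _ ≤ ENNReal.ofReal (δ⁻¹ ^ 2) * ENNReal.ofReal (9 * δ ^ (3/2 : ℝ)) := by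
            refine mul_le_mul' le_rfl ?_
            have := lintegral_ball_kernel_le (s := 1/2) (by norm_num) (by norm_num) hδ z₁ z₁
            refine this.trans (ENNReal.ofReal_le_ofReal ?_)
            rw [show (2 : ℝ) - 1/2 = 3/2 by norm_num]
            apply mul_le_mul_of_nonneg_right _ (by positivity)
            have hpi := Real.pi_lt_d2
            rw [div_le_iff₀ (by norm_num)]; linarith
        _ = _ := by
            rw [← ENNReal.ofReal_mul (by positivity)]
            congr 1
            have : δ ^ (3/2 : ℝ) = δ * δ ^ (1/2 : ℝ) := by
              conv_rhs => rw [← Real.rpow_one_add' hδ.le (by norm_num)]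
              norm_num
            rw [this, ← e2]
            field_simp
    have hbd : ∫⁻ θ in Ioc (-π) π, ENNReal.ofReal (Real.exp (u (cis θ) / 2)) *
        S.indicator f (cis θ) ≤ ENNReal.ofReal (48 * δ ^ (-(1/2) : ℝ)) := by
      calc _ ≤ ∫⁻ θ in Ioc (-π) π, ENNReal.ofReal δ⁻¹ * S.indicator f (cis θ) := by
            refine lintegral_mono fun θ => mul_le_mul' ?_ le_rfl
            exact ENNReal.ofReal_le_ofReal (b.exp_half_le (by simp [norm_cis]))
        _ = ENNReal.ofReal δ⁻¹ * ∫⁻ θ in Ioc (-π) π, S.indicator f (cis θ) :=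
            lintegral_const_mul _ ((hfm.indicator hSm).comp measurable_cis)
        _ ≤ ENNReal.ofReal δ⁻¹ * ENNReal.ofReal (48 * δ ^ (1/2 : ℝ)) :=
            mul_le_mul' le_rfl
              (lintegral_circle_rpow_le (mem_closedBall_zero_iff.1 b.hz₁) hδ)
        _ = _ := by
            rw [← ENNReal.ofReal_mul (by positivity), ← e2]
            congr 1; ring
    refine (add_le_add harea hbd).trans (le_of_eq ?_)
    rw [← ENNReal.ofReal_add (by positivity) (by positivity)]
    congr 1; ring
  calc ∫⁻ ζ, f ζ ∂(massMeasure u)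
      = ∫⁻ ζ, (S.indicator f ζ + Sᶜ.indicator f ζ) ∂(massMeasure u) := by
        refine lintegral_congr fun ζ => ?_
        rw [indicator_self_add_compl_apply]
    _ = _ := lintegral_add_left (hfm.indicator hSm) _
    _ ≤ _ := add_le_add hin hout
    _ = _ := by
        rw [← ENNReal.ofReal_add (by positivity) (by positivity)]
        congr 1; ring

lemma inv_mul_inv_le_rpow {a b c : ℝ} (ha : 0 ≤ a) (hb : 0 ≤ b) (hc : 0 < c) (h : c ≤ a + b) :
    b⁻¹ * a⁻¹ ≤ c ^ (-(1/2) : ℝ) * (a ^ (-(3/2) : ℝ) + b ^ (-(3/2) : ℝ)) := by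
  rcases ha.eq_or_lt with rfl | ha
  · simp; positivity
  rcases hb.eq_or_lt with rfl | hb
  · simp; positivity
  have e1 : ∀ {x : ℝ}, 0 < x → x ^ (-(3/2) : ℝ) = (√x ^ 3)⁻¹ := by
    intro x hx
    rw [Real.sqrt_eq_rpow, ← Real.rpow_natCast, ← Real.rpow_mul hx.le, Real.rpow_neg hx.le]
    norm_num
  have e2 : c ^ (-(1/2) : ℝ) = (√c)⁻¹ := by
    rw [Real.sqrt_eq_rpow, Real.rpow_neg hc.le]
  rw [e1 ha, e1 hb, e2]
  have hα := Real.sqrt_pos.2 ha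
  have hβ := Real.sqrt_pos.2 hb
  have hγ := Real.sqrt_pos.2 hc
  have ha2 := Real.sq_sqrt ha.le
  have hb2 := Real.sq_sqrt hb.le
  have hγle : √c ≤ √a + √b := by
    rw [Real.sqrt_le_left (by positivity)]
    nlinarith
  set α := √a
  set β := √b
  set γ := √c
  rw [← ha2, ← hb2]
  have key : γ * (α * β) ≤ α ^ 3 + β ^ 3 := by
    have h1 := mul_le_mul_of_nonneg_right hγle (mul_pos hα hβ).le
    have h2 : 0 ≤ (α + β) * (α - β) ^ 2 := by positivity
    nlinarith
  have : γ⁻¹ * ((α ^ 3)⁻¹ + (β ^ 3)⁻¹) - (β ^ 2)⁻¹ * (α ^ 2)⁻¹ =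
      (α ^ 3 + β ^ 3 - γ * (α * β)) / (γ * α ^ 3 * β ^ 3) := by
    field_simp; ring
  have h3 : 0 ≤ (α ^ 3 + β ^ 3 - γ * (α * β)) / (γ * α ^ 3 * β ^ 3) := by
    apply div_nonneg <;> [linarith; positivity]
  linarith

/-- The weighted area integral of `thetaF` near the concentration point is of the order of
the radius. -/
lemma BubbleData.lintegral_weight_le {k M : ℝ} {K h u : ℂ → ℝ} {z₁ : ℂ} {δ : ℝ}
    (b : BubbleData k M K h u z₁ δ) {d : ℝ} (hd : 0 < d) :
    ∫⁻ x in Metric.ball 0 1 ∩ Metric.closedBall z₁ d,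
        ENNReal.ofReal (thetaF u x) * ENNReal.ofReal ((δ + 4 * ‖x - z₁‖) / ‖x - z₁‖) ≤
      ENNReal.ofReal (700 * k * (M + 60) * (δ + d)) := by
  have hδ := b.pos
  have hM := b.hM
  have hk := b.hk
  set Θ : ℂ → ℝ≥0∞ := fun x => ENNReal.ofReal (thetaF u x) with hΘ
  have hΘm : Measurable Θ := (continuous_thetaF b.hu).measurable.ennreal_ofReal
  set S := Metric.ball (0:ℂ) 1 ∩ Metric.closedBall z₁ d with hS
  have hSm : MeasurableSet S := measurableSet_ball.inter Metric.isClosed_closedBall.measurableSet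
  set A := Metric.ball (0:ℂ) 1 ∩ Metric.ball z₁ δ with hA
  have hAm : MeasurableSet A := measurableSet_ball.inter measurableSet_ball
  set W : ℂ → ℝ≥0∞ := fun x => ENNReal.ofReal (5 * δ * ‖x - z₁‖⁻¹) with hW
  have hWm : Measurable W := by fun_prop
  have hq : ∫⁻ x in A, ENNReal.ofReal ‖qF u x‖ * W x ≤
      ENNReal.ofReal (255 * k * (M + 57) * δ) := by
    refine (b.lintegral_qF_le hAm inter_subset_left hWm).trans ?_
    have hin : ∀ᵐ ζ ∂(massMeasure u), ∫⁻ x in A, ENNReal.ofReal ‖x - ζ‖⁻¹ * W x ≤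
        ENNReal.ofReal (5 * δ * (51 * δ ^ (1/2 : ℝ))) *
          ENNReal.ofReal (‖ζ - z₁‖ ^ (-(1/2) : ℝ)) := by
      filter_upwards [ae_massMeasure_ne u z₁] with ζ hζ
      set c := ‖ζ - z₁‖ with hc
      have hc0 : 0 < c := norm_pos_iff.2 (sub_ne_zero.2 hζ)
      have e := fun ζ' => lintegral_ball_kernel_le (s := 3/2) (by norm_num) (by norm_num) hδ z₁ ζ'
      have e' : ∀ ζ', ∫⁻ x in A, ENNReal.ofReal (‖x - ζ'‖ ^ (-(3/2) : ℝ)) ≤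
          ENNReal.ofReal (25.5 * δ ^ (1/2 : ℝ)) := by
        intro ζ'
        refine (lintegral_mono_set inter_subset_right).trans ((e ζ').trans ?_)
        apply ENNReal.ofReal_le_ofReal
        rw [show (2 : ℝ) - 3/2 = 1/2 by norm_num]
        apply mul_le_mul_of_nonneg_right _ (by positivity)
        have := Real.pi_lt_d2
        rw [div_le_iff₀ (by norm_num)]; linarith
      calc ∫⁻ x in A, ENNReal.ofReal ‖x - ζ‖⁻¹ * W x
          ≤ ∫⁻ x in A, ENNReal.ofReal (5 * δ * c ^ (-(1/2) : ℝ)) *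
            (ENNReal.ofReal (‖x - z₁‖ ^ (-(3/2) : ℝ)) +
              ENNReal.ofReal (‖x - ζ‖ ^ (-(3/2) : ℝ))) := by
            refine lintegral_mono fun x => ?_
            simp only [hW]
            rw [← ENNReal.ofReal_mul (by positivity), ← ENNReal.ofReal_add (by positivity)
              (by positivity), ← ENNReal.ofReal_mul (by positivity)]
            apply ENNReal.ofReal_le_ofReal
            have h1 : c ≤ ‖x - z₁‖ + ‖x - ζ‖ := by
              calc c = ‖(x - z₁) - (x - ζ)‖ := by rw [hc]; congr 1; ring
                _ ≤ _ := norm_sub_le _ _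
            have h2 := inv_mul_inv_le_rpow (norm_nonneg (x - z₁)) (norm_nonneg (x - ζ)) hc0 h1
            have h3 := mul_le_mul_of_nonneg_left h2 (show 0 ≤ 5 * δ by positivity)
            calc ‖x - ζ‖⁻¹ * (5 * δ * ‖x - z₁‖⁻¹) = 5 * δ * (‖x - ζ‖⁻¹ * ‖x - z₁‖⁻¹) := by ring
              _ ≤ _ := h3
              _ = _ := by ring
        _ = ENNReal.ofReal (5 * δ * c ^ (-(1/2) : ℝ)) *
            ((∫⁻ x in A, ENNReal.ofReal (‖x - z₁‖ ^ (-(3/2) : ℝ))) +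
              ∫⁻ x in A, ENNReal.ofReal (‖x - ζ‖ ^ (-(3/2) : ℝ))) := by
            rw [lintegral_const_mul _ (by fun_prop), lintegral_add_left (by fun_prop)]
        _ ≤ ENNReal.ofReal (5 * δ * c ^ (-(1/2) : ℝ)) *
            (ENNReal.ofReal (25.5 * δ ^ (1/2 : ℝ)) + ENNReal.ofReal (25.5 * δ ^ (1/2 : ℝ))) :=
            mul_le_mul' le_rfl (add_le_add (e' _) (e' _))
        _ = _ := by
            rw [← ENNReal.ofReal_add (by positivity) (by positivity),
              ← ENNReal.ofReal_mul (by positivity), ← ENNReal.ofReal_mul (by positivity)]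
            congr 1; ring
    calc ENNReal.ofReal k * ∫⁻ ζ, (∫⁻ x in A, ENNReal.ofReal ‖x - ζ‖⁻¹ * W x) ∂(massMeasure u)
        ≤ ENNReal.ofReal k * ∫⁻ ζ, ENNReal.ofReal (5 * δ * (51 * δ ^ (1/2 : ℝ))) *
          ENNReal.ofReal (‖ζ - z₁‖ ^ (-(1/2) : ℝ)) ∂(massMeasure u) :=
          mul_le_mul' le_rfl (lintegral_mono_ae hin)
      _ = ENNReal.ofReal k * (ENNReal.ofReal (5 * δ * (51 * δ ^ (1/2 : ℝ))) *
          ∫⁻ ζ, ENNReal.ofReal (‖ζ - z₁‖ ^ (-(1/2) : ℝ)) ∂(massMeasure u)) := by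
          rw [lintegral_const_mul _ (by fun_prop)]
      _ ≤ ENNReal.ofReal k * (ENNReal.ofReal (5 * δ * (51 * δ ^ (1/2 : ℝ))) *
          ENNReal.ofReal ((M + 57) * δ ^ (-(1/2) : ℝ))) :=
          mul_le_mul' le_rfl (mul_le_mul' le_rfl b.lintegral_sqrt_kernel_le)
      _ = _ := by
          rw [← ENNReal.ofReal_mul (by positivity), ← ENNReal.ofReal_mul (by positivity)]
          congr 1
          have : δ ^ (1/2 : ℝ) * δ ^ (-(1/2) : ℝ) = 1 := by
            rw [← Real.rpow_add hδ]; norm_num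
          calc _ = 255 * k * (M + 57) * δ * (δ ^ (1/2 : ℝ) * δ ^ (-(1/2) : ℝ)) := by ring
            _ = _ := by rw [this, mul_one]
  have hE : ∫⁻ x in A, ENNReal.ofReal (wF u x)⁻¹ * W x ≤ ENNReal.ofReal (65 * δ) := by
    calc ∫⁻ x in A, ENNReal.ofReal (wF u x)⁻¹ * W x
        ≤ ∫⁻ x in A, ENNReal.ofReal 5 * ENNReal.ofReal ‖x - z₁‖⁻¹ := by
          refine setLIntegral_mono' hAm fun x hx => ?_
          simp only [hW]
          rw [← ENNReal.ofReal_mul (inv_nonneg.2 (wF_pos u x).le), ← ENNReal.ofReal_mul (by norm_num)]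
          apply ENNReal.ofReal_le_ofReal
          have h1 := b.wF_inv_le (Metric.ball_subset_closedBall hx.1)
          calc (wF u x)⁻¹ * (5 * δ * ‖x - z₁‖⁻¹) ≤ δ⁻¹ * (5 * δ * ‖x - z₁‖⁻¹) :=
                mul_le_mul_of_nonneg_right h1 (by positivity)
            _ = _ := by field_simp
      _ = ENNReal.ofReal 5 * ∫⁻ x in A, ENNReal.ofReal ‖x - z₁‖⁻¹ :=
          lintegral_const_mul _ (by fun_prop)
      _ ≤ ENNReal.ofReal 5 * ENNReal.ofReal (13 * δ) := by
          refine mul_le_mul' le_rfl ?_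
          have := lintegral_ball_kernel_le (s := 1) (by norm_num) (by norm_num) hδ z₁ z₁
          simp only [Real.rpow_neg_one] at this
          refine (lintegral_mono_set inter_subset_right).trans (this.trans ?_)
          apply ENNReal.ofReal_le_ofReal
          have := Real.pi_lt_d2
          norm_num
          nlinarith
      _ = _ := by
          rw [← ENNReal.ofReal_mul (by norm_num)]
          congr 1; ring
  have hnear : ∫⁻ x in A, Θ x * W x ≤ ENNReal.ofReal (255 * k * (M + 57) * δ + 65 * δ) := by
    rw [ENNReal.ofReal_add (by positivity) (by positivity)]
    refine le_trans (le_of_eq ?_) (add_le_add hq hE)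
    rw [← lintegral_add_left (by
      have := (continuous_qF b.hu).measurable
      fun_prop)]
    refine lintegral_congr fun x => ?_
    simp only [hΘ]
    rw [thetaF, ENNReal.ofReal_add (norm_nonneg _) (inv_nonneg.2 (wF_pos u x).le), add_mul]
  calc ∫⁻ x in S, Θ x * ENNReal.ofReal ((δ + 4 * ‖x - z₁‖) / ‖x - z₁‖)
      ≤ ∫⁻ x in S, (5 * Θ x + (Metric.ball z₁ δ).indicator (fun x => Θ x * W x) x) := by
        refine lintegral_mono fun x => ?_
        by_cases hx : x ∈ Metric.ball z₁ δ
        · rw [indicator_of_mem hx]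
          refine le_trans (mul_le_mul' le_rfl (ENNReal.ofReal_le_ofReal ?_)) le_add_self
          rw [mem_ball_iff_norm] at hx
          rw [div_eq_mul_inv]
          exact mul_le_mul_of_nonneg_right (by linarith) (by positivity)
        · rw [mem_ball_iff_norm, not_lt] at hx
          refine le_trans ?_ le_self_add
          rw [mul_comm]
          refine mul_le_mul' ?_ le_rfl
          rw [← ENNReal.ofReal_ofNat]
          apply ENNReal.ofReal_le_ofReal
          rw [div_le_iff₀ (hδ.trans_le hx)]
          linarith
    _ = 5 * (∫⁻ x in S, Θ x) + ∫⁻ x in S ∩ Metric.ball z₁ δ, Θ x * W x := by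
        rw [lintegral_add_left (by fun_prop), lintegral_const_mul _ hΘm,
          setLIntegral_indicator measurableSet_ball, inter_comm]
    _ ≤ 5 * ENNReal.ofReal ((26 * k * M + M + 8) * d) +
          ENNReal.ofReal (255 * k * (M + 57) * δ + 65 * δ) := by
        refine add_le_add (mul_le_mul' le_rfl (b.lintegral_thetaF_ball_le z₁ hd)) ?_
        refine (lintegral_mono_set ?_).trans hnear
        rintro x ⟨hx, hx'⟩
        exact ⟨hx.1, hx'⟩
    _ ≤ _ := by
        rw [show (5 : ℝ≥0∞) = ENNReal.ofReal 5 by simp, ← ENNReal.ofReal_mul (by norm_num),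
          ← ENNReal.ofReal_add (by positivity) (by positivity)]
        apply ENNReal.ofReal_le_ofReal
        have h1 : 0 ≤ (k - 1) * M := mul_nonneg (by linarith) hM
        have h2 : 5 * (26 * k * M + M + 8) ≤ 700 * k * (M + 60) := by nlinarith
        have h3 : 255 * k * (M + 57) + 65 ≤ 700 * k * (M + 60) := by nlinarith
        have h4 := mul_le_mul_of_nonneg_right h2 hd.le
        have h5 := mul_le_mul_of_nonneg_right h3 hδ.le
        linarith

/-! ### Quadratic expansion of the inverse metric factor -/

lemma fderiv_wF {u : ℂ → ℝ} (hu : ContDiff ℝ 2 u) (z v : ℂ) :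
    fderiv ℝ (wF u) z v = 2 * (gF u z * v).re := by
  rw [fderiv_eq_re_dz _ _ _ ((contDiff_wF hu).differentiable (by norm_num) z),
    (hasW_wF hu z).dz_eq]

lemma fderiv_wF' {u : ℂ → ℝ} (hu : ContDiff ℝ 2 u) (z v : ℂ) :
    fderiv ℝ (wF u) z v = -(wF u z * fderiv ℝ u z v) / 2 := by
  rw [fderiv_wF hu, fderiv_eq_re_dz _ _ _ (hu.differentiable (by norm_num) z)]
  simp only [gF, pU]
  rw [show -((wF u z : ℂ) * dz (fun z => (u z : ℂ)) z) / 2 * v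
    = ((-wF u z / 2 : ℝ) : ℂ) * (dz (fun z => (u z : ℂ)) z * v) by push_cast; ring,
    Complex.re_ofReal_mul]
  ring

/-- At the center, the gradient of `wF u` is inward radial, and it vanishes unless the center
lies on the circle, where it is prescribed by the boundary condition. -/
lemma BubbleData.exists_slope {k M : ℝ} {K h u : ℂ → ℝ} {z₁ : ℂ} {δ : ℝ}
    (b : BubbleData k M K h u z₁ δ) :
    ∃ l : ℝ, 0 ≤ l ∧ l ≤ k ∧ gF u z₁ = -(l / 2 : ℝ) * conj z₁ ∧ l * (1 - ‖z₁‖) = 0 ∧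
      (‖z₁‖ = 1 → l = h z₁ - δ) := by
  have hz := mem_closedBall_zero_iff.1 b.hz₁
  have hδ := b.pos
  have hdiff : Differentiable ℝ (wF u) := (contDiff_wF b.hu).differentiable (by norm_num)
  rcases hz.lt_or_eq with hlt | heq
  · have hmin : IsLocalMin (wF u) z₁ := by
      have : Metric.ball (0:ℂ) 1 ∈ 𝓝 z₁ := Metric.isOpen_ball.mem_nhds (by simpa using hlt)
      filter_upwards [this] with z hz
      rw [b.hδ]
      exact b.hmin z (Metric.ball_subset_closedBall hz)
    have h0 := hmin.fderiv_eq_zero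
    have h1 := fderiv_wF b.hu z₁ 1
    have h2 := fderiv_wF b.hu z₁ Complex.I
    rw [h0] at h1 h2
    have hg : gF u z₁ = 0 := by
      apply Complex.ext
      · simpa using h1
      · simpa using h2
    refine ⟨0, le_rfl, by linarith [b.hk], by simp [hg], by simp, fun h => ?_⟩
    exact absurd h hlt.ne
  · obtain ⟨α, -, hα⟩ := exists_polar z₁
    rw [heq] at hα
    simp only [Complex.ofReal_one, one_mul] at hα
    have hnd : fderiv ℝ (wF u) z₁ z₁ = δ - h z₁ := by
      have h1 := b.hs.2 z₁ (by simpa [unitCircle] using heq)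
      rw [normalDeriv] at h1
      rw [fderiv_wF' b.hu, show fderiv ℝ u z₁ z₁ = 2 * h z₁ * Real.exp (u z₁ / 2) - 2 by linarith,
        ← wF_inv, b.hδ]
      field_simp
      ring
    have htd : fderiv ℝ (wF u) z₁ (Complex.I * z₁) = 0 := by
      have hmin : IsLocalMin (fun θ => wF u (cis θ)) α := by
        refine Eventually.of_forall fun θ => ?_
        simp only [← hα, b.hδ]
        exact b.hmin _ (by simp [norm_cis])
      have hd : HasDerivAt (fun θ => wF u (cis θ)) (fderiv ℝ (wF u) z₁ (Complex.I * z₁)) α := by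
        have := (hdiff z₁).hasFDerivAt
        rw [hα] at this ⊢
        exact this.comp_hasDerivAt α (hasDerivAt_cis α)
      exact hmin.hasDerivAt_eq_zero hd
    have hin : 0 ≤ fderiv ℝ (wF u) z₁ (0 - z₁) := by
      have hmin : IsLocalMinOn (wF u) (Metric.closedBall 0 1) z₁ := by
        have : IsMinOn (wF u) (Metric.closedBall 0 1) z₁ := fun z hz => by
          simp only [mem_ofPred_eq, b.hδ]; exact b.hmin z hz
        exact this.localize
      refine hmin.hasFDerivWithinAt_nonneg (hdiff z₁).hasFDerivAt.hasFDerivWithinAt ?_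
      apply sub_mem_posTangentConeAt_of_segment_subset
      exact (convex_closedBall (0:ℂ) 1).segment_subset b.hz₁ (by simp)
    rw [zero_sub, map_neg, hnd] at hin
    refine ⟨h z₁ - δ, by linarith, ?_, ?_, by rw [heq]; ring, fun _ => rfl⟩
    · have := b.hhb α
      rw [← hα] at this
      linarith [le_abs_self (h z₁)]
    · rw [fderiv_wF b.hu] at hnd htd
      have e1 : gF u z₁ * z₁ = ((-(h z₁ - δ) / 2 : ℝ) : ℂ) := by
        apply Complex.ext
        · rw [Complex.ofReal_re]; linarith
        · rw [Complex.ofReal_im]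
          have : (gF u z₁ * (Complex.I * z₁)).re = -(gF u z₁ * z₁).im := by
            rw [show gF u z₁ * (Complex.I * z₁) = Complex.I * (gF u z₁ * z₁) by ring]
            simp
          linarith
      have e2 : z₁ * conj z₁ = 1 := by
        rw [Complex.mul_conj, Complex.normSq_eq_norm_sq, heq]; simp
      calc gF u z₁ = gF u z₁ * (z₁ * conj z₁) := by rw [e2, mul_one]
        _ = gF u z₁ * z₁ * conj z₁ := by ring
        _ = _ := by rw [e1]; push_cast; ring

/-- The quadratic profile approximating `wF u`. -/
def profile (δ l τ : ℝ) (z₁ z : ℂ) : ℝ :=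
  δ - l * (conj z₁ * (z - z₁)).re + τ / (4 * δ) * ‖z - z₁‖ ^ 2

/-- The weighted area integral of `thetaF u` over the disk. -/
def etaF (u : ℂ → ℝ) (z₁ : ℂ) (δ : ℝ) : ℝ≥0∞ :=
  ∫⁻ x in Metric.ball 0 1,
    ENNReal.ofReal (thetaF u x) * ENNReal.ofReal ((δ + 4 * ‖x - z₁‖) / ‖x - z₁‖)

/-- Expansion of `wF u` around the concentration point. -/
lemma BubbleData.expansion {k M : ℝ} {K h u : ℂ → ℝ} {z₁ : ℂ} {δ : ℝ}
    (b : BubbleData k M K h u z₁ δ) {l η : ℝ} (hl0 : 0 ≤ l) (hlk : l ≤ k)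
    (hlg : gF u z₁ = -(l / 2 : ℝ) * conj z₁) (hlz : l * (1 - ‖z₁‖) = 0)
    (hη : etaF u z₁ δ ≤ ENNReal.ofReal η) (hηk : 4096 * k * η ≤ 1) (hη0 : 0 ≤ η)
    {z : ℂ} (hz : z ∈ Metric.closedBall (0:ℂ) 1) :
    |wF u z - profile δ l (K z₁ + l ^ 2) z₁ z| ≤
      10 ^ 9 * k ^ 4 * (M + 60) * min η (δ + ‖z - z₁‖) * (δ + ‖z - z₁‖) ^ 2 / δ := by
  have hδ := b.pos
  have hM := b.hM
  have hk := b.hk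
  have hz1 := mem_closedBall_zero_iff.1 b.hz₁
  have hgn : 4 * ‖gF u z₁‖ ^ 2 = l ^ 2 := by
    rw [hlg, norm_mul, norm_neg, Complex.norm_real, Complex.norm_conj,
      Real.norm_of_nonneg (by positivity)]
    rcases mul_eq_zero.1 hlz with h | h
    · rw [h]; simp
    · rw [show ‖z₁‖ = 1 by linarith]; ring
  have hP : δ + 2 * (gF u z₁ * (z - z₁)).re + aF K u z₁ * ‖z - z₁‖ ^ 2
      = profile δ l (K z₁ + l ^ 2) z₁ z := by
    rw [profile, aF, hgn, b.hδ, hlg, ← Complex.ofReal_neg, mul_assoc, Complex.re_ofReal_mul]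
    ring
  rcases eq_or_ne z z₁ with rfl | hne
  · have : wF u z - profile δ l (K z + l ^ 2) z z = 0 := by
      rw [profile, b.hδ]; simp
    rw [this, abs_zero]
    positivity
  set d := ‖z - z₁‖ with hd
  have hd0 : 0 < d := norm_pos_iff.2 (sub_ne_zero.2 hne)
  obtain ⟨y, hy, hy1, hy2, hsum⟩ := exists_broken_path (continuous_thetaF b.hu) (thetaF_nonneg u)
    b.hz₁ hz hd.symm hd0 hδ.le
  set I₁ := ∫ t in (0:ℝ)..1, thetaF u (z₁ + t * (y - z₁)) * ((δ + t * d) * d) with hI₁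
  set I₂ := ∫ t in (0:ℝ)..1, thetaF u (z + t * (y - z)) * (t * d * d) with hI₂
  have hI₁0 : 0 ≤ I₁ := intervalIntegral.integral_nonneg zero_le_one fun t ht => by
    have := thetaF_nonneg u (z₁ + t * (y - z₁))
    have := ht.1
    positivity
  have hI₂0 : 0 ≤ I₂ := intervalIntegral.integral_nonneg zero_le_one fun t ht => by
    have := thetaF_nonneg u (z + t * (y - z))
    have := ht.1
    positivity
  rw [← ENNReal.ofReal_add hI₁0 hI₂0] at hsum
  have hS1 : I₁ + I₂ ≤ 128 * η := by
    rw [← ENNReal.ofReal_le_ofReal_iff (by positivity)]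
    refine hsum.trans ?_
    have e1 : ∫⁻ x in Metric.ball 0 1 ∩ Metric.closedBall z₁ d,
        ENNReal.ofReal (thetaF u x) * ENNReal.ofReal ((δ + 4 * ‖x - z₁‖) / ‖x - z₁‖) ≤
        etaF u z₁ δ := lintegral_mono_set inter_subset_left
    have e2 : 4 * ∫⁻ x in Metric.ball 0 1 ∩ Metric.closedBall z d, ENNReal.ofReal (thetaF u x) ≤
        etaF u z₁ δ := by
      rw [← lintegral_const_mul _ (continuous_thetaF b.hu).measurable.ennreal_ofReal]
      refine (lintegral_mono_set inter_subset_left).trans ?_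
      have hae : ∀ᵐ x : ℂ, x ≠ z₁ := by simp [ae_iff]
      refine lintegral_mono_ae ?_
      filter_upwards [ae_restrict_of_ae hae] with x hx
      rw [mul_comm]
      refine mul_le_mul' le_rfl ?_
      have hx0 : 0 < ‖x - z₁‖ := norm_pos_iff.2 (sub_ne_zero.2 hx)
      rw [← ENNReal.ofReal_ofNat]
      apply ENNReal.ofReal_le_ofReal
      rw [le_div_iff₀ hx0]; linarith
    calc _ ≤ 64 * etaF u z₁ δ + 64 * etaF u z₁ δ := by
          refine add_le_add (mul_le_mul' le_rfl e1) ?_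
          rw [show (256 : ℝ≥0∞) = 64 * 4 by norm_num, mul_assoc]
          exact mul_le_mul' le_rfl e2
      _ = 128 * etaF u z₁ δ := by rw [← add_mul]; norm_num
      _ ≤ 128 * ENNReal.ofReal η := mul_le_mul' le_rfl hη
      _ = _ := by
          rw [show (128 : ℝ≥0∞) = ENNReal.ofReal 128 by simp, ← ENNReal.ofReal_mul (by norm_num)]
  have hS2 : I₁ + I₂ ≤ 500000 * k * (M + 60) * (δ + d) := by
    rw [← ENNReal.ofReal_le_ofReal_iff (by positivity)]
    refine hsum.trans ?_
    refine (add_le_add (mul_le_mul' le_rfl (b.lintegral_weight_le hd0))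
      (mul_le_mul' le_rfl (b.lintegral_thetaF_ball_le z hd0))).trans ?_
    rw [show (64 : ℝ≥0∞) = ENNReal.ofReal 64 by simp, show (256 : ℝ≥0∞) = ENNReal.ofReal 256 by simp,
      ← ENNReal.ofReal_mul (by norm_num), ← ENNReal.ofReal_mul (by norm_num),
      ← ENNReal.ofReal_add (by positivity) (by positivity)]
    apply ENNReal.ofReal_le_ofReal
    have h1 : 0 ≤ (k - 1) * M := mul_nonneg (by linarith) hM
    have h2 : 26 * k * M + M + 8 ≤ 30 * k * (M + 60) := by nlinarith
    have h3 : (26 * k * M + M + 8) * d ≤ 30 * k * (M + 60) * (δ + d) :=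
      mul_le_mul h2 (by linarith) hd0.le (by positivity)
    have h4 : 0 ≤ k * (M + 60) * (δ + d) := by positivity
    linarith
  have key := two_legs b.hK b.hu b.hs b.hz₁ hz hy hk b.hKd b.hδ (d := d) ?_ ?_ hy1 hy2 le_rfl
    (le_of_eq hI₁.symm) (le_of_eq hI₂.symm) ?_
  · rw [hP] at key
    refine key.trans ?_
    have hmin : I₁ + I₂ ≤ 500000 * k * (M + 60) * min η (δ + d) := by
      rcases min_cases η (δ + d) with ⟨h, -⟩ | ⟨h, -⟩
      · rw [h]
        have : 128 * η ≤ 500000 * k * (M + 60) * η := by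
          apply mul_le_mul_of_nonneg_right _ hη0
          nlinarith [mul_nonneg (by linarith : 0 ≤ k - 1) hM]
        linarith
      · rw [h]; exact hS2
    apply div_le_div_of_nonneg_right _ hδ.le
    apply mul_le_mul_of_nonneg_right _ (by positivity)
    calc 2000 * k ^ 3 * (I₁ + I₂) ≤ 2000 * k ^ 3 * (500000 * k * (M + 60) * min η (δ + d)) :=
          mul_le_mul_of_nonneg_left hmin (by positivity)
      _ = _ := by ring
  · have : (2 * ‖gF u z₁‖) ^ 2 ≤ k ^ 2 := by
      rw [mul_pow, show (2:ℝ) ^ 2 = 4 by norm_num, hgn]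
      exact pow_le_pow_left₀ hl0 hlk 2
    exact (pow_le_pow_iff_left₀ (by positivity) (by positivity) two_ne_zero).1 this
  · rw [aF, hgn, b.hδ, abs_div, abs_of_pos (show 0 < 4 * δ by positivity)]
    have h1 := b.hKb z₁ b.hz₁
    have h2 : |K z₁ + l ^ 2| ≤ k + k ^ 2 := by
      refine (abs_add_le _ _).trans (add_le_add h1 ?_)
      rw [abs_of_nonneg (sq_nonneg _)]
      exact pow_le_pow_left₀ hl0 hlk 2
    have h3 : δ * (|K z₁ + l ^ 2| / (4 * δ)) = |K z₁ + l ^ 2| / 4 := by field_simp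
    rw [h3]
    nlinarith
  · have : 32 * k * (I₁ + I₂) ≤ 32 * k * (128 * η) :=
      mul_le_mul_of_nonneg_left hS1 (by positivity)
    linarith

/-! ### Decay away from the blow-up point -/

/-- The mass carried away from the point `1`, when `exp (u / 2)` is small there. -/
lemma massMeasure_compl_ball_le {u : ℂ → ℝ} (hu : Continuous u) {η s : ℝ} (hs0 : 0 ≤ s)
    (hs1 : s ≤ 1)
    (hs : ∀ z ∈ Metric.closedBall (0:ℂ) 1, η ≤ ‖z - 1‖ → Real.exp (u z / 2) ≤ s) :
    massMeasure u (Metric.ball 1 η)ᶜ ≤ ENNReal.ofReal (12 * s) := by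
  have hm : MeasurableSet (Metric.ball (1:ℂ) η)ᶜ := Metric.isOpen_ball.measurableSet.compl
  have hpi := Real.pi_lt_four
  rw [← lintegral_indicator_one hm, lintegral_massMeasure hu (measurable_one.indicator hm)]
  have h1 : ∫⁻ z in Metric.ball (0:ℂ) 1, ENNReal.ofReal (Real.exp (u z)) *
      (Metric.ball (1:ℂ) η)ᶜ.indicator 1 z ≤ ∫⁻ z in Metric.ball (0:ℂ) 1, ENNReal.ofReal s := by
    refine setLIntegral_mono measurable_const fun z hz => ?_
    by_cases hzη : z ∈ (Metric.ball (1:ℂ) η)ᶜ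
    · rw [indicator_of_mem hzη, Pi.one_apply, mul_one]
      have h2 := hs z (Metric.ball_subset_closedBall hz)
        (by simpa [dist_eq_norm] using hzη)
      refine ENNReal.ofReal_le_ofReal ?_
      rw [show u z = u z / 2 + u z / 2 by ring, Real.exp_add]
      nlinarith [Real.exp_pos (u z / 2)]
    · rw [indicator_of_notMem hzη, mul_zero]; exact zero_le
  have h2 : ∫⁻ θ in Ioc (-π) π, ENNReal.ofReal (Real.exp (u (cis θ) / 2)) *
      (Metric.ball (1:ℂ) η)ᶜ.indicator 1 (cis θ) ≤ ∫⁻ θ in Ioc (-π) π, ENNReal.ofReal s := by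
    refine setLIntegral_mono measurable_const fun θ hθ => ?_
    by_cases hzη : cis θ ∈ (Metric.ball (1:ℂ) η)ᶜ
    · rw [indicator_of_mem hzη, Pi.one_apply, mul_one]
      exact ENNReal.ofReal_le_ofReal (hs _ (by simp [norm_cis])
        (by simpa [dist_eq_norm] using hzη))
    · rw [indicator_of_notMem hzη, mul_zero]; exact zero_le
  refine (add_le_add h1 h2).trans ?_
  rw [setLIntegral_const, setLIntegral_const, Complex.volume_ball, Real.volume_Ioc,
    show ((NNReal.pi : ℝ≥0∞)) = ENNReal.ofReal π by
      rw [ENNReal.ofReal, ← NNReal.coe_real_pi, Real.toNNReal_coe], ENNReal.ofReal_one, one_pow,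
    one_mul, ← ENNReal.ofReal_mul hs0, ← ENNReal.ofReal_mul hs0,
    ← ENNReal.ofReal_add (by positivity) (by nlinarith [Real.pi_pos])]
  refine ENNReal.ofReal_le_ofReal ?_
  nlinarith

/-- The integral of `‖qF u‖` over the part of the disk away from the point `1`. -/
lemma BubbleData.lintegral_qF_away_le {k M : ℝ} {K h u : ℂ → ℝ} {z₁ : ℂ} {δ : ℝ}
    (b : BubbleData k M K h u z₁ δ) {ε η s : ℝ} (hε : 0 < ε) (hε2 : ε ≤ 2) (hη0 : 0 ≤ η)
    (hη : η ≤ ε / 2) (hs0 : 0 ≤ s) (hs1 : s ≤ 1)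
    (hs : ∀ z ∈ Metric.closedBall (0:ℂ) 1, η ≤ ‖z - 1‖ → Real.exp (u z / 2) ≤ s) :
    ∫⁻ x in Metric.ball 0 1 ∩ (Metric.ball 1 ε)ᶜ, ENNReal.ofReal ‖qF u x‖ ≤
      ENNReal.ofReal (k * (80 / ε ^ 2 * η * M + (32 + 8 / ε) * (12 * s))) := by
  have hM := b.hM
  have hk := b.hk
  have hpi := Real.pi_lt_four
  have hpi0 := Real.pi_pos
  have hm : MeasurableSet (Metric.ball (0:ℂ) 1 ∩ (Metric.ball 1 ε)ᶜ) :=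
    Metric.isOpen_ball.measurableSet.inter Metric.isOpen_ball.measurableSet.compl
  have hmass : massMeasure u univ < ∞ := b.hmass.trans_lt ENNReal.ofReal_lt_top
  have : IsFiniteMeasure (massMeasure u) := ⟨hmass⟩
  have hvol : volume (Metric.ball (0:ℂ) 1) ≤ ENNReal.ofReal 4 := by
    rw [Complex.volume_ball, show ((NNReal.pi : ℝ≥0∞)) = ENNReal.ofReal π by
      rw [ENNReal.ofReal, ← NNReal.coe_real_pi, Real.toNNReal_coe], ENNReal.ofReal_one, one_pow,
      one_mul]
    exact ENNReal.ofReal_le_ofReal hpi.le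
  set ν := (massMeasure u).restrict (Metric.ball (1:ℂ) η)ᶜ with hν
  set G : ℂ → ℂ → ℝ≥0∞ := fun x z =>
    ENNReal.ofReal (2 * ‖z - x‖⁻¹) + ENNReal.ofReal (2 / ε) with hG
  have hGm : Measurable (Function.uncurry G) := by
    simp only [hG, Function.uncurry_def]
    fun_prop
  have h1 : ∀ x ∈ Metric.ball (0:ℂ) 1 ∩ (Metric.ball 1 ε)ᶜ, ENNReal.ofReal ‖qF u x‖ ≤
      ENNReal.ofReal k * (ENNReal.ofReal (20 / ε ^ 2 * η * M) + ∫⁻ z, G x z ∂ν) := by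
    intro x hx
    have hx1 : ε ≤ ‖x - 1‖ := by simpa [dist_eq_norm] using hx.2
    have h3 := ofReal_hopf_away_le b.hK b.hu b.hh b.hs hx.1
      (fun z hz => b.hKd z (Metric.ball_subset_closedBall hz)) b.hhd hε hε2 hx1 hη
    have h4 : ‖qF u x‖ ≤ ‖hopf u x‖ := by
      simp only [qF, norm_div, norm_neg]
      simp
    refine (ENNReal.ofReal_le_ofReal h4).trans (h3.trans ?_)
    refine mul_le_mul' le_rfl (add_le_add ?_ le_rfl)
    rw [ENNReal.ofReal_mul (q := M) (by positivity)]
    exact mul_le_mul' le_rfl b.hmass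
  have h2 : ∫⁻ x in Metric.ball 0 1 ∩ (Metric.ball 1 ε)ᶜ, ENNReal.ofReal ‖qF u x‖ ≤
      ∫⁻ x in Metric.ball (0:ℂ) 1,
        ENNReal.ofReal k * (ENNReal.ofReal (20 / ε ^ 2 * η * M) + ∫⁻ z, G x z ∂ν) :=
    (setLIntegral_mono' hm h1).trans (lintegral_mono_set inter_subset_left)
  refine h2.trans ?_
  have hGi : Measurable fun x => ∫⁻ z, G x z ∂ν := hGm.lintegral_prod_right'
  rw [lintegral_const_mul _ (by fun_prop), lintegral_add_left measurable_const, setLIntegral_const,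
    lintegral_lintegral_swap hGm.aemeasurable]
  have h5 : ∀ z, ∫⁻ x in Metric.ball (0:ℂ) 1, G x z ≤ ENNReal.ofReal (32 + 8 / ε) := by
    intro z
    have h6 := lintegral_ball_kernel_le (s := 1) (r := 1) (by norm_num) (by norm_num) (by norm_num)
      0 z
    simp only [hG]
    rw [lintegral_add_right _ measurable_const, setLIntegral_const,
      ENNReal.ofReal_add (by norm_num) (by positivity)]
    refine add_le_add ?_ ?_
    · have h7 : ∀ x : ℂ, ENNReal.ofReal (2 * ‖z - x‖⁻¹) =
          ENNReal.ofReal 2 * ENNReal.ofReal (‖x - z‖ ^ (-(1:ℝ))) := by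
        intro x
        rw [← ENNReal.ofReal_mul (by norm_num), Real.rpow_neg_one, norm_sub_rev]
      simp only [h7]
      rw [lintegral_const_mul _ (by fun_prop)]
      refine (mul_le_mul' le_rfl h6).trans ?_
      rw [← ENNReal.ofReal_mul (by norm_num)]
      refine ENNReal.ofReal_le_ofReal ?_
      norm_num
      linarith
    · refine (mul_le_mul' le_rfl hvol).trans ?_
      rw [← ENNReal.ofReal_mul (by positivity)]
      refine ENNReal.ofReal_le_ofReal (le_of_eq ?_)
      ring
  have h8 : ∫⁻ z, (∫⁻ x in Metric.ball (0:ℂ) 1, G x z) ∂ν ≤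
      ENNReal.ofReal ((32 + 8 / ε) * (12 * s)) := by
    refine (lintegral_mono h5).trans ?_
    rw [lintegral_const, hν, Measure.restrict_apply_univ, ENNReal.ofReal_mul (by positivity)]
    exact mul_le_mul' le_rfl (massMeasure_compl_ball_le b.hu.continuous hs0 hs1 hs)
  rw [ENNReal.ofReal_mul (p := k) (by linarith only [hk]), ENNReal.ofReal_add (by positivity) (by positivity)]
  refine mul_le_mul' le_rfl (add_le_add ?_ h8)
  refine (mul_le_mul' le_rfl hvol).trans ?_
  rw [← ENNReal.ofReal_mul (by positivity)]
  refine ENNReal.ofReal_le_ofReal (le_of_eq ?_)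
  ring

/-- Smallness of `etaF` when the mass concentrates at the point `1`. -/
lemma BubbleData.etaF_le {k M : ℝ} {K h u : ℂ → ℝ} {z₁ : ℂ} {δ : ℝ}
    (b : BubbleData k M K h u z₁ δ) {ε η s : ℝ} (hε : 0 < ε) (hε2 : ε ≤ 2) (hη0 : 0 ≤ η)
    (hη : η ≤ ε / 2) (hs0 : 0 ≤ s) (hs1 : s ≤ 1) (hz : ‖z₁ - 1‖ ≤ ε)
    (hs : ∀ z ∈ Metric.closedBall (0:ℂ) 1, η ≤ ‖z - 1‖ → Real.exp (u z / 2) ≤ s) :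
    etaF u z₁ δ ≤ ENNReal.ofReal (700 * k * (M + 60) * (δ + 2 * ε) +
      (k * (80 / ε ^ 2 * η * M + (32 + 8 / ε) * (12 * s)) + 4 * s) * (δ / (2 * ε) + 4)) := by
  have hM := b.hM
  have hk := b.hk
  have hk0 : 0 ≤ k := by linarith only [hk]
  have hδ := b.pos
  have hpi := Real.pi_lt_four
  have hm : MeasurableSet (Metric.ball (0:ℂ) 1 ∩ (Metric.ball 1 ε)ᶜ) :=
    Metric.isOpen_ball.measurableSet.inter Metric.isOpen_ball.measurableSet.compl
  have hsub : Metric.ball (0:ℂ) 1 ⊆ (Metric.ball 0 1 ∩ Metric.closedBall z₁ (2 * ε)) ∪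
      ((Metric.ball 0 1 ∩ (Metric.ball 1 ε)ᶜ) ∩ (Metric.closedBall z₁ (2 * ε))ᶜ) := by
    intro x hx
    by_cases hx1 : x ∈ Metric.closedBall z₁ (2 * ε)
    · exact Or.inl ⟨hx, hx1⟩
    · refine Or.inr ⟨⟨hx, fun hx2 => hx1 ?_⟩, hx1⟩
      rw [Metric.mem_ball] at hx2
      rw [Metric.mem_closedBall]
      have := dist_triangle x 1 z₁
      rw [dist_comm 1 z₁, dist_eq_norm z₁] at this
      linarith
  have hmc : MeasurableSet ((Metric.ball (0:ℂ) 1 ∩ (Metric.ball 1 ε)ᶜ) ∩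
      (Metric.closedBall z₁ (2 * ε))ᶜ) :=
    hm.inter Metric.isClosed_closedBall.measurableSet.compl
  have h1 : ∫⁻ x in (Metric.ball 0 1 ∩ (Metric.ball 1 ε)ᶜ) ∩ (Metric.closedBall z₁ (2 * ε))ᶜ,
      ENNReal.ofReal (thetaF u x) * ENNReal.ofReal ((δ + 4 * ‖x - z₁‖) / ‖x - z₁‖) ≤
      ENNReal.ofReal ((k * (80 / ε ^ 2 * η * M + (32 + 8 / ε) * (12 * s)) + 4 * s) *
        (δ / (2 * ε) + 4)) := by
    have h2 : ∀ x ∈ (Metric.ball 0 1 ∩ (Metric.ball 1 ε)ᶜ) ∩ (Metric.closedBall z₁ (2 * ε))ᶜ,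
        ENNReal.ofReal (thetaF u x) * ENNReal.ofReal ((δ + 4 * ‖x - z₁‖) / ‖x - z₁‖) ≤
        (ENNReal.ofReal ‖qF u x‖ + ENNReal.ofReal s) * ENNReal.ofReal (δ / (2 * ε) + 4) := by
      intro x hx
      have hx1 : ε ≤ ‖x - 1‖ := by simpa [dist_eq_norm] using hx.1.2
      have hx2 : 2 * ε < ‖x - z₁‖ := by simpa [dist_eq_norm] using hx.2
      refine mul_le_mul' ?_ (ENNReal.ofReal_le_ofReal ?_)
      · rw [← ENNReal.ofReal_add (norm_nonneg _) hs0]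
        refine ENNReal.ofReal_le_ofReal ?_
        rw [thetaF, wF_inv]
        have := hs x (Metric.ball_subset_closedBall hx.1.1) (by linarith)
        linarith
      · have h0 : 0 < ‖x - z₁‖ := by linarith
        rw [add_div, mul_div_assoc, div_self h0.ne']
        have : δ / ‖x - z₁‖ ≤ δ / (2 * ε) :=
          div_le_div_of_nonneg_left hδ.le (by positivity) hx2.le
        linarith
    refine (setLIntegral_mono' hmc h2).trans ((lintegral_mono_set inter_subset_left).trans ?_)
    have hq : Measurable fun x => ENNReal.ofReal ‖qF u x‖ :=
      (continuous_qF b.hu).norm.measurable.ennreal_ofReal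
    rw [lintegral_mul_const _ (by fun_prop), lintegral_add_left hq, setLIntegral_const,
      ENNReal.ofReal_mul (q := δ / (2 * ε) + 4) (by positivity),
      ENNReal.ofReal_add (q := 4 * s) (by positivity) (by positivity)]
    refine mul_le_mul' (add_le_add (b.lintegral_qF_away_le hε hε2 hη0 hη hs0 hs1 hs) ?_) le_rfl
    refine (mul_le_mul' le_rfl (measure_mono inter_subset_left)).trans ?_
    rw [Complex.volume_ball, show ((NNReal.pi : ℝ≥0∞)) = ENNReal.ofReal π by
      rw [ENNReal.ofReal, ← NNReal.coe_real_pi, Real.toNNReal_coe], ENNReal.ofReal_one, one_pow,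
      one_mul, ← ENNReal.ofReal_mul hs0]
    exact ENNReal.ofReal_le_ofReal (by nlinarith)
  rw [etaF, ENNReal.ofReal_add (by positivity) (by positivity)]
  exact (lintegral_mono_set hsub).trans ((lintegral_union_le _ _ _).trans
    (add_le_add (b.lintegral_weight_le (by positivity)) h1))

lemma BubbleData.area_mass_le {k M : ℝ} {K h u : ℂ → ℝ} {z₁ : ℂ} {δ : ℝ}
    (b : BubbleData k M K h u z₁ δ) {S : Set ℂ} (hS : S ⊆ Metric.ball 0 1)
    (hSm : MeasurableSet S) {m : ℝ} (hm : ∀ z ∈ S, m ≤ Real.exp (u z)) :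
    ENNReal.ofReal m * volume S ≤ ENNReal.ofReal M := by
  have h1 := lintegral_massMeasure b.hu.continuous (f := fun _ => 1) measurable_const
  simp only [lintegral_one, mul_one] at h1
  refine le_trans ?_ (h1 ▸ b.hmass)
  refine le_trans ?_ le_self_add
  refine le_trans ?_ (lintegral_mono_set hS)
  rw [← setLIntegral_const]
  exact setLIntegral_mono' hSm fun z hz => ENNReal.ofReal_le_ofReal (hm z hz)

lemma BubbleData.boundary_mass_le {k M : ℝ} {K h u : ℂ → ℝ} {z₁ : ℂ} {δ : ℝ}
    (b : BubbleData k M K h u z₁ δ) {S : Set ℝ} (hS : S ⊆ Ioc (-π) π)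
    (hSm : MeasurableSet S) {m : ℝ} (hm : ∀ θ ∈ S, m ≤ Real.exp (u (cis θ) / 2)) :
    ENNReal.ofReal m * volume S ≤ ENNReal.ofReal M := by
  have h1 := lintegral_massMeasure b.hu.continuous (f := fun _ => 1) measurable_const
  simp only [lintegral_one, mul_one] at h1
  refine le_trans ?_ (h1 ▸ b.hmass)
  refine le_trans ?_ le_add_self
  refine le_trans ?_ (lintegral_mono_set hS)
  rw [← setLIntegral_const]
  exact setLIntegral_mono' hSm fun z hz => ENNReal.ofReal_le_ofReal (hm z hz)

lemma norm_cis_sub_le (θ α : ℝ) : ‖cis θ - cis α‖ ≤ |θ - α| := by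
  rw [norm_cis_sub_cis]
  have := Real.abs_sin_le_abs (x := (θ - α) / 2)
  rw [abs_div, abs_two] at this
  linarith

/-- The mass bound forces a lower bound on the leading coefficient of the profile. -/
lemma BubbleData.le_tau {k M : ℝ} {K h u : ℂ → ℝ} {z₁ : ℂ} {δ : ℝ}
    (b : BubbleData k M K h u z₁ δ) {l σ α R : ℝ} (hlk : l ≤ k)
    (hlz : l * (1 - ‖z₁‖) = 0) (hα : z₁ = ‖z₁‖ * cis α) (hα1 : |α| ≤ 1)
    (hR : R = 8 * (M + 1)) (hRδ : R * δ ≤ 1) (hkR : k * R ^ 2 * δ ≤ 2) (hσ : σ * (1 + R) ^ 2 ≤ 1)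
    (happ : ∀ z ∈ Metric.closedBall (0:ℂ) 1,
      |wF u z - profile δ l (K z₁ + l ^ 2) z₁ z| ≤ σ * (δ + ‖z - z₁‖) ^ 2 / δ) (hσ0 : 0 ≤ σ) :
    4 / R ^ 2 ≤ K z₁ + l ^ 2 := by
  have hM := b.hM
  have hk := b.hk
  have hδ := b.pos
  have hz1 := mem_closedBall_zero_iff.1 b.hz₁
  have hpi := Real.pi_gt_three
  have hR0 : 0 < R := by rw [hR]; positivity
  by_contra hτ
  push Not at hτ
  set τ := K z₁ + l ^ 2 with hτd
  have key : ∀ z ∈ Metric.closedBall (0:ℂ) 1, ‖z - z₁‖ ≤ R * δ →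
      wF u z ≤ 3 * δ - l * (conj z₁ * (z - z₁)).re := by
    intro z hz hd
    have h1 := (abs_le.1 (happ z hz)).2
    have h2 : σ * (δ + ‖z - z₁‖) ^ 2 / δ ≤ δ := by
      rw [div_le_iff₀ hδ]
      have h3 : (δ + ‖z - z₁‖) ^ 2 ≤ (1 + R) ^ 2 * δ ^ 2 := by
        rw [← mul_pow]
        exact pow_le_pow_left₀ (by positivity) (by linarith) 2
      calc σ * (δ + ‖z - z₁‖) ^ 2 ≤ σ * ((1 + R) ^ 2 * δ ^ 2) :=
            mul_le_mul_of_nonneg_left h3 hσ0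
        _ = σ * (1 + R) ^ 2 * δ ^ 2 := by ring
        _ ≤ 1 * δ ^ 2 := mul_le_mul_of_nonneg_right hσ (by positivity)
        _ = δ * δ := by ring
    have h4 : τ / (4 * δ) * ‖z - z₁‖ ^ 2 ≤ δ := by
      have h5 : τ / (4 * δ) ≤ 1 / (R ^ 2 * δ) := by
        rw [div_le_div_iff₀ (by positivity) (by positivity)]
        rw [lt_div_iff₀ (by positivity)] at hτ
        nlinarith
      have h6 : ‖z - z₁‖ ^ 2 ≤ R ^ 2 * δ ^ 2 := by
        rw [← mul_pow]; exact pow_le_pow_left₀ (by positivity) hd 2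
      calc τ / (4 * δ) * ‖z - z₁‖ ^ 2 ≤ 1 / (R ^ 2 * δ) * ‖z - z₁‖ ^ 2 :=
            mul_le_mul_of_nonneg_right h5 (by positivity)
        _ ≤ 1 / (R ^ 2 * δ) * (R ^ 2 * δ ^ 2) := mul_le_mul_of_nonneg_left h6 (by positivity)
        _ = δ := by field_simp
    rw [profile] at h1
    linarith
  rcases mul_eq_zero.1 hlz with hl | hr
  · set S := Metric.ball (((1 - R * δ / 2 : ℝ) : ℂ) * z₁) (R * δ / 2) with hS
    have hRδ0 : 0 < R * δ := by positivity
    have hSd : S ⊆ Metric.ball 0 1 := by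
      intro z hz
      rw [hS, Metric.mem_ball, dist_eq_norm] at hz
      rw [mem_ball_zero_iff]
      have h2 : ‖((1 - R * δ / 2 : ℝ) : ℂ) * z₁‖ ≤ 1 - R * δ / 2 := by
        rw [norm_mul, Complex.norm_real, Real.norm_of_nonneg (by linarith)]
        nlinarith
      have h3 := norm_sub_norm_le z (((1 - R * δ / 2 : ℝ) : ℂ) * z₁)
      linarith
    have h1 := b.area_mass_le hSd Metric.isOpen_ball.measurableSet (m := ((3 * δ)⁻¹) ^ 2) ?_
    · rw [hS, Complex.volume_ball, show ((NNReal.pi : ℝ≥0∞)) = ENNReal.ofReal π by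
        rw [ENNReal.ofReal, ← NNReal.coe_real_pi, Real.toNNReal_coe],
        ← ENNReal.ofReal_pow (by positivity), ← ENNReal.ofReal_mul (by positivity),
        ← ENNReal.ofReal_mul (by positivity), ENNReal.ofReal_le_ofReal_iff hM] at h1
      have h2 : ((3 * δ)⁻¹) ^ 2 * ((R * δ / 2) ^ 2 * π) = R ^ 2 * π / 36 := by
        field_simp; norm_num
      rw [h2, hR] at h1
      nlinarith
    · intro z hz
      rw [← wF_inv_sq]
      refine pow_le_pow_left₀ (by positivity) ?_ 2
      refine inv_anti₀ (wF_pos u z) ?_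
      have h3 := key z (Metric.ball_subset_closedBall (hSd hz)) ?_
      · rw [hl] at h3; linarith
      · rw [hS, Metric.mem_ball, dist_eq_norm] at hz
        have h4 : z - z₁ = (z - ((1 - R * δ / 2 : ℝ) : ℂ) * z₁) + ((-(R * δ / 2) : ℝ) : ℂ) * z₁ := by
          push_cast; ring
        rw [h4]
        refine (norm_add_le _ _).trans ?_
        have h5 : ‖((-(R * δ / 2) : ℝ) : ℂ) * z₁‖ ≤ R * δ / 2 := by
          rw [norm_mul, Complex.norm_real, norm_neg, Real.norm_of_nonneg (by positivity)]
          nlinarith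
        linarith
  · have hr1 : ‖z₁‖ = 1 := by linarith
    have hz : z₁ = cis α := by rw [hα, hr1]; simp
    have hα2 := abs_le.1 hα1
    set S := Ioc (α - R * δ) (α + R * δ) with hS
    have hSd : S ⊆ Ioc (-π) π := fun θ hθ => ⟨by linarith [hθ.1, hα2.1], by linarith [hθ.2, hα2.2]⟩
    have h1 := b.boundary_mass_le hSd measurableSet_Ioc (m := (4 * δ)⁻¹) ?_
    · rw [hS, Real.volume_Ioc, ← ENNReal.ofReal_mul (by positivity),
        ENNReal.ofReal_le_ofReal_iff hM] at h1
      have h2 : (4 * δ)⁻¹ * (α + R * δ - (α - R * δ)) = R / 2 := by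
        field_simp; ring
      rw [h2, hR] at h1
      linarith
    · intro θ hθ
      rw [← wF_inv]
      refine inv_anti₀ (wF_pos u _) ?_
      have habs : |θ - α| ≤ R * δ := abs_le.2 ⟨by linarith [hθ.1], by linarith [hθ.2]⟩
      have h3 := key (cis θ) (by simp [norm_cis])
        (by rw [hz]; exact (norm_cis_sub_le θ α).trans habs)
      have h4 : (conj z₁ * (cis θ - z₁)).re = Real.cos (θ - α) - 1 := by
        rw [hz, ← cis_neg, mul_sub, ← cis_add, ← cis_add, Complex.sub_re, cis_re, cis_re]
        simp [sub_eq_add_neg, add_comm]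
      rw [h4] at h3
      have h5 := Real.one_sub_sq_div_two_le_cos (x := θ - α)
      have h6 : (θ - α) ^ 2 ≤ (R * δ) ^ 2 := sq_le_sq' (by linarith [(abs_le.1 habs).1])
        (abs_le.1 habs).2
      have h7 : l * (1 - Real.cos (θ - α)) ≤ k * ((R * δ) ^ 2 / 2) := by
        refine mul_le_mul hlk (by linarith) (by linarith [Real.cos_le_one (θ - α)]) (by linarith)
      have h8 : k * ((R * δ) ^ 2 / 2) ≤ δ := by
        calc k * ((R * δ) ^ 2 / 2) = (k * R ^ 2 * δ) * δ / 2 := by ring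
          _ ≤ 2 * δ / 2 := by
            have := mul_le_mul_of_nonneg_right hkR hδ.le
            linarith
          _ = δ := by ring
      linarith

lemma slope_mul_inner_nonpos {z₁ : ℂ} {l : ℝ} (hl0 : 0 ≤ l)
    (hlz : l * (1 - ‖z₁‖) = 0) {z : ℂ} (hz : z ∈ Metric.closedBall (0:ℂ) 1) :
    l * (conj z₁ * (z - z₁)).re ≤ 0 := by
  have hz' := mem_closedBall_zero_iff.1 hz
  rcases mul_eq_zero.1 hlz with hl | hr
  · simp [hl]
  · have hr1 : ‖z₁‖ = 1 := by linarith
    refine mul_nonpos_of_nonneg_of_nonpos hl0 ?_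
    have h1 : (conj z₁ * z).re ≤ 1 := by
      refine (Complex.re_le_norm _).trans ?_
      rw [norm_mul, Complex.norm_conj, hr1, one_mul]; exact hz'
    have h2 : (conj z₁ * z₁).re = 1 := by
      rw [mul_comm, Complex.mul_conj, Complex.normSq_eq_norm_sq, hr1]; simp
    rw [mul_sub, Complex.sub_re, h2]
    linarith

/-- Lower bound for the profile on the closed disk. -/
lemma BubbleData.le_profile {k M : ℝ} {K h u : ℂ → ℝ} {z₁ : ℂ} {δ : ℝ}
    (b : BubbleData k M K h u z₁ δ) {l τ c : ℝ} (hl0 : 0 ≤ l)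
    (hlz : l * (1 - ‖z₁‖) = 0) (hc0 : 0 ≤ c) (hc : 8 * c ≤ τ) (hc1 : 2 * c ≤ 1) {z : ℂ}
    (hz : z ∈ Metric.closedBall (0:ℂ) 1) :
    c * (δ + ‖z - z₁‖) ^ 2 / δ ≤ profile δ l τ z₁ z := by
  have hδ := b.pos
  have h1 := slope_mul_inner_nonpos hl0 hlz hz
  set d := ‖z - z₁‖
  rw [profile, div_le_iff₀ hδ]
  have h2 : (δ - l * (conj z₁ * (z - z₁)).re + τ / (4 * δ) * d ^ 2) * δ
      = δ ^ 2 + (-(l * (conj z₁ * (z - z₁)).re)) * δ + τ / 4 * d ^ 2 := by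
    field_simp; ring
  rw [h2]
  have h3 : 0 ≤ (-(l * (conj z₁ * (z - z₁)).re)) * δ := mul_nonneg (by linarith) hδ.le
  nlinarith [mul_nonneg hc0 (sq_nonneg (δ - d)), sq_nonneg d, sq_nonneg δ]

/-! ### Extraction of a sequence of blow-up data -/

lemma tendsto_of_tendstoUniformlyOn {E F : Type*} [TopologicalSpace E] [NormedAddCommGroup F]
    {f : ℕ → E → F} {g : E → F} {s : Set E}
    (hf : TendstoUniformlyOn f g atTop s) (hg : Continuous g) {x : ℕ → E} {a : E}
    (hx : Tendsto x atTop (𝓝 a)) (hxs : ∀ n, x n ∈ s) :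
    Tendsto (fun n => f n (x n)) atTop (𝓝 (g a)) := by
  have h1 : Tendsto (fun n => g (x n)) atTop (𝓝 (g a)) := (hg.tendsto a).comp hx
  rw [Metric.tendstoUniformlyOn_iff] at hf
  rw [Metric.tendsto_atTop] at h1 ⊢
  intro ε hε
  obtain ⟨N, hN⟩ := h1 (ε / 2) (by positivity)
  obtain ⟨N', hN'⟩ := eventually_atTop.1 (hf (ε / 2) (by positivity))
  refine ⟨max N N', fun n hn => ?_⟩
  have h2 := hN n (le_trans (le_max_left _ _) hn)
  have h3 := hN' n (le_trans (le_max_right _ _) hn) (x n) (hxs n)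
  rw [dist_comm] at h3
  linarith [dist_triangle (f n (x n)) (g (x n)) (g a)]

lemma TendstoC2On.tendsto {F : ℕ → ℂ → ℝ} {G : ℂ → ℝ} {s : Set ℂ} (hF : TendstoC2On F G s)
    (hG : ContDiff ℝ 2 G) {x : ℕ → ℂ} {a : ℂ} (hx : Tendsto x atTop (𝓝 a)) (hxs : ∀ n, x n ∈ s) :
    Tendsto (fun n => F n (x n)) atTop (𝓝 (G a)) := by
  have h1 := tendsto_of_tendstoUniformlyOn (hF 0 (by norm_num))
    (hG.continuous_iteratedFDeriv (m := 0) (by norm_num)) hx hxs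
  have h2 := ((ContinuousMultilinearMap.apply ℝ (fun _ : Fin 0 => ℂ) ℝ 0).continuous.tendsto _).comp
    h1
  simpa [Function.comp_def] using h2

lemma TendstoC2On.tendsto_fderiv {F : ℕ → ℂ → ℝ} {G : ℂ → ℝ} {s : Set ℂ} (hF : TendstoC2On F G s)
    (hG : ContDiff ℝ 2 G) {x : ℕ → ℂ} {a : ℂ} (hx : Tendsto x atTop (𝓝 a)) (hxs : ∀ n, x n ∈ s)
    {v : ℕ → ℂ} {v₀ : ℂ} (hv : Tendsto v atTop (𝓝 v₀)) :
    Tendsto (fun n => fderiv ℝ (F n) (x n) (v n)) atTop (𝓝 (fderiv ℝ G a v₀)) := by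
  have h1 := tendsto_of_tendstoUniformlyOn (hF 1 (by norm_num))
    (hG.continuous_iteratedFDeriv (m := 1) (by norm_num)) hx hxs
  have h3 : ∀ w : ℂ, Tendsto (fun n => fderiv ℝ (F n) (x n) w) atTop (𝓝 (fderiv ℝ G a w)) := by
    intro w
    have h2 := ((ContinuousMultilinearMap.apply ℝ (fun _ : Fin 1 => ℂ) ℝ
      (fun _ => w)).continuous.tendsto _).comp h1
    simpa [Function.comp_def, iteratedFDeriv_one_apply] using h2
  have h4 : ∀ (T : ℂ →L[ℝ] ℝ) (w : ℂ), T w = w.re * T 1 + w.im * T Complex.I := by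
    intro T w
    conv_lhs => rw [show w = w.re • (1:ℂ) + w.im • Complex.I by
      simp [Complex.re_add_im]]
    rw [map_add, map_smul, map_smul, smul_eq_mul, smul_eq_mul]
  simp only [h4 _ (v _), h4 _ v₀]
  exact (((Complex.continuous_re.tendsto _).comp hv).mul (h3 1)).add
    (((Complex.continuous_im.tendsto _).comp hv).mul (h3 Complex.I))

lemma TendstoC2On.exists_bound {F : ℕ → ℂ → ℝ} {G : ℂ → ℝ} {s : Set ℂ} (hF : TendstoC2On F G s)
    (hG : ContDiff ℝ 2 G) (hs : IsCompact s) :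
    ∃ k : ℝ, 1 ≤ k ∧ ∀ᶠ n in atTop, ∀ z ∈ s, |F n z| ≤ k ∧ ‖fderiv ℝ (F n) z‖ ≤ k ∧
      ‖fderiv ℝ (fderiv ℝ (F n)) z‖ ≤ k := by
  have key : ∀ i ≤ 2, ∃ k : ℝ, ∀ᶠ n in atTop, ∀ z ∈ s, ‖iteratedFDeriv ℝ i (F n) z‖ ≤ k := by
    intro i hi
    have hc : Continuous (iteratedFDeriv ℝ i G) :=
      hG.continuous_iteratedFDeriv (by exact_mod_cast hi)
    obtain ⟨k, hk⟩ := hs.exists_bound_of_continuousOn hc.continuousOn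
    refine ⟨k + 1, ?_⟩
    filter_upwards [Metric.tendstoUniformlyOn_iff.1 (hF i hi) 1 one_pos] with n hn z hz
    have h1 := hn z hz
    rw [dist_comm, dist_eq_norm] at h1
    linarith [hk z hz, norm_sub_norm_le (iteratedFDeriv ℝ i (F n) z) (iteratedFDeriv ℝ i G z)]
  obtain ⟨k0, h0⟩ := key 0 (by norm_num)
  obtain ⟨k1, h1⟩ := key 1 (by norm_num)
  obtain ⟨k2, h2⟩ := key 2 le_rfl
  refine ⟨max 1 (max k0 (max k1 k2)), le_max_left _ _, ?_⟩
  filter_upwards [h0, h1, h2] with n a0 a1 a2 z hz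
  have e1 : ‖iteratedFDeriv ℝ 1 (F n) z‖ = ‖fderiv ℝ (F n) z‖ := by
    rw [← norm_iteratedFDeriv_fderiv, norm_iteratedFDeriv_zero]
  have e2 : ‖iteratedFDeriv ℝ 2 (F n) z‖ = ‖fderiv ℝ (fderiv ℝ (F n)) z‖ := by
    rw [← norm_iteratedFDeriv_fderiv, ← norm_iteratedFDeriv_fderiv, norm_iteratedFDeriv_zero]
  have b0 := a0 z hz
  have b1 := a1 z hz
  have b2 := a2 z hz
  rw [norm_iteratedFDeriv_zero, Real.norm_eq_abs] at b0
  rw [e1] at b1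
  rw [e2] at b2
  exact ⟨b0.trans (by simp), b1.trans (by simp), b2.trans (by simp)⟩

/-- The tangential derivative along the circle, in the angular variable. -/
def angDeriv (h : ℂ → ℝ) (θ : ℝ) : ℝ := fderiv ℝ h (cis θ) (Complex.I * cis θ)

lemma hasDerivAt_comp_cis {h : ℂ → ℝ} (hh : ContDiff ℝ 2 h) (θ : ℝ) :
    HasDerivAt (fun θ => h (cis θ)) (angDeriv h θ) θ := by
  have h1 := (hh.differentiable (by norm_num) (cis θ)).hasFDerivAt.comp_hasDerivAt θ
    (hasDerivAt_cis θ)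
  exact h1

lemma hasDerivAt_angDeriv {h : ℂ → ℝ} (hh : ContDiff ℝ 2 h) (θ : ℝ) :
    HasDerivAt (angDeriv h) (fderiv ℝ (fderiv ℝ h) (cis θ) (Complex.I * cis θ) (Complex.I * cis θ) +
      fderiv ℝ h (cis θ) (Complex.I * (Complex.I * cis θ))) θ := by
  have hf : Differentiable ℝ (fderiv ℝ h) :=
    (hh.fderiv_right (m := 1) (by norm_num)).differentiable (by norm_num)
  have h1 := (hf (cis θ)).hasFDerivAt.comp_hasDerivAt θ (hasDerivAt_cis θ)
  have h2 : HasDerivAt (fun θ => Complex.I * cis θ) (Complex.I * (Complex.I * cis θ)) θ := by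
    have := (hasDerivAt_cis θ).const_mul Complex.I
    convert this using 1
  exact h1.clm_apply h2

lemma abs_angDeriv_sub_le {h : ℂ → ℝ} (hh : ContDiff ℝ 2 h) {k : ℝ}
    (h1 : ∀ z ∈ Metric.sphere (0:ℂ) 1, ‖fderiv ℝ h z‖ ≤ k)
    (h2 : ∀ z ∈ Metric.sphere (0:ℂ) 1, ‖fderiv ℝ (fderiv ℝ h) z‖ ≤ k) (θ φ : ℝ) :
    |angDeriv h θ - angDeriv h φ| ≤ 2 * k * |θ - φ| := by
  have := (convex_univ : Convex ℝ (univ : Set ℝ)).norm_image_sub_le_of_norm_hasDerivWithin_le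
    (f := angDeriv h) (C := 2 * k) (fun θ _ => (hasDerivAt_angDeriv hh θ).hasDerivWithinAt)
    (fun θ _ => ?_) (mem_univ φ) (mem_univ θ)
  · simpa using this
  · have hc : cis θ ∈ Metric.sphere (0:ℂ) 1 := by simp [norm_cis]
    have hn : ‖Complex.I * cis θ‖ = 1 := by simp [norm_cis]
    refine (norm_add_le _ _).trans ?_
    have a1 := (fderiv ℝ (fderiv ℝ h) (cis θ)).le_opNorm₂ (Complex.I * cis θ) (Complex.I * cis θ)
    have a2 := (fderiv ℝ h (cis θ)).le_opNorm (Complex.I * (Complex.I * cis θ))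
    rw [norm_mul _ (Complex.I * cis θ)] at a2
    simp only [hn, Complex.norm_I, mul_one] at a1 a2
    linarith [h1 _ hc, h2 _ hc]

lemma norm_pU_le {K : ℂ → ℝ} (hK : ContDiff ℝ 2 K) (z : ℂ) : ‖pU K z‖ ≤ ‖fderiv ℝ K z‖ := by
  have h1 := fderiv_eq_re_dz K z (conj (pU K z)) (hK.differentiable (by norm_num) z)
  have h2 := (fderiv ℝ K z).le_opNorm (conj (pU K z))
  change fderiv ℝ K z _ = 2 * (pU K z * _).re at h1
  rw [h1, Complex.mul_conj, Complex.normSq_eq_norm_sq, Complex.ofReal_re, Complex.norm_conj,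
    Real.norm_of_nonneg (by positivity)] at h2
  nlinarith [norm_nonneg (pU K z), norm_nonneg (fderiv ℝ K z)]

/-- A sequence of concentrating solutions together with its quantitative expansion. -/
structure BubbleSeq (k M c C : ℝ) (K h u : ℕ → ℂ → ℝ) (K₀ h₀ : ℂ → ℝ) (z₁ : ℕ → ℂ)
    (δ l η α : ℕ → ℝ) : Prop where
  data : ∀ n, BubbleData k M (K n) (h n) (u n) (z₁ n) (δ n)
  hK₀ : ContDiff ℝ 2 K₀
  hh₀ : ContDiff ℝ 2 h₀
  convK : TendstoC2On K K₀ unitClosedDisk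
  convh : TendstoC2On h h₀ unitCircle
  lip : ∀ n θ φ, |angDeriv (h n) θ - angDeriv (h n) φ| ≤ 2 * k * |θ - φ|
  hc : 0 < c
  hC : 0 < C
  hl0 : ∀ n, 0 ≤ l n
  hlk : ∀ n, l n ≤ k
  hlz : ∀ n, l n * (1 - ‖z₁ n‖) = 0
  hz : ∀ n, z₁ n = ‖z₁ n‖ * cis (α n)
  hη0 : ∀ n, 0 ≤ η n
  tau : ∀ n, 8 * c ≤ K n (z₁ n) + l n ^ 2
  approx : ∀ n, ∀ z ∈ Metric.closedBall (0:ℂ) 1,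
    |wF (u n) z - profile (δ n) (l n) (K n (z₁ n) + l n ^ 2) (z₁ n) z| ≤
      C * min (η n) (δ n + ‖z - z₁ n‖) * (δ n + ‖z - z₁ n‖) ^ 2 / δ n
  le_profile : ∀ n, ∀ z ∈ Metric.closedBall (0:ℂ) 1,
    c * (δ n + ‖z - z₁ n‖) ^ 2 / δ n ≤
      profile (δ n) (l n) (K n (z₁ n) + l n ^ 2) (z₁ n) z
  le_wF : ∀ n, ∀ z ∈ Metric.closedBall (0:ℂ) 1,
    c * (δ n + ‖z - z₁ n‖) ^ 2 / δ n ≤ wF (u n) z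
  lim_δ : Tendsto δ atTop (𝓝 0)
  lim_η : Tendsto η atTop (𝓝 0)
  lim_α : Tendsto α atTop (𝓝 0)
  lim_z : Tendsto z₁ atTop (𝓝 1)

section Existence

variable {u : ℕ → ℂ → ℝ}

lemma exists_argmin_wF {u : ℂ → ℝ} (hu : ContDiff ℝ 2 u) :
    ∃ z ∈ Metric.closedBall (0:ℂ) 1, ∀ x ∈ Metric.closedBall (0:ℂ) 1, wF u z ≤ wF u x :=
  (isCompact_closedBall (0:ℂ) 1).exists_isMinOn ⟨0, by simp⟩ (continuous_wF hu).continuousOn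

lemma tendsto_min_wF (hblow : BlowsUp u) {z₁ : ℕ → ℂ}
    (hz₁ : ∀ n, ∀ x ∈ Metric.closedBall (0:ℂ) 1, wF (u n) (z₁ n) ≤ wF (u n) x) :
    Tendsto (fun n => wF (u n) (z₁ n)) atTop (𝓝 0) := by
  rw [Metric.tendsto_atTop]
  intro ε hε
  obtain ⟨N, hN⟩ := eventually_atTop.1 (hblow (-2 * Real.log ε))
  refine ⟨N, fun n hn => ?_⟩
  obtain ⟨z, hz, h1⟩ := hN n hn
  rw [Real.dist_eq, sub_zero, abs_of_pos (wF_pos _ _)]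
  refine (hz₁ n z hz).trans_lt ?_
  rw [wF, ← Real.lt_log_iff_exp_lt hε]
  linarith

lemma tendsto_argmin (hblow : BlowsUp u)
    (hploc : TendstoLocallyUniformlyBotOn u (unitClosedDisk \ {(1 : ℂ)})) {z₁ : ℕ → ℂ}
    (hz : ∀ n, z₁ n ∈ Metric.closedBall (0:ℂ) 1)
    (hz₁ : ∀ n, ∀ x ∈ Metric.closedBall (0:ℂ) 1, wF (u n) (z₁ n) ≤ wF (u n) x) :
    Tendsto z₁ atTop (𝓝 1) := by
  rw [Metric.tendsto_atTop]
  intro ε hε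
  have h1 := hploc 0 (Metric.closedBall 0 1 \ Metric.ball 1 ε)
    ((isCompact_closedBall _ _).diff Metric.isOpen_ball)
    (fun x hx => ⟨hx.1, fun h => hx.2 (by rw [h]; exact Metric.mem_ball_self hε)⟩)
  obtain ⟨N, hN⟩ := eventually_atTop.1 (h1.and
    ((tendsto_min_wF hblow hz₁).eventually_lt_const one_pos))
  refine ⟨N, fun n hn => ?_⟩
  obtain ⟨h2, h3⟩ := hN n hn
  by_contra hcon
  have h4 := h2 (z₁ n) ⟨hz n, hcon⟩
  rw [wF, Real.exp_lt_one_iff] at h3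
  linarith

lemma eventually_exp_le (hploc : TendstoLocallyUniformlyBotOn u (unitClosedDisk \ {(1 : ℂ)}))
    {ε s : ℝ} (hε : 0 < ε) (hs : 0 < s) :
    ∀ᶠ n in atTop, ∀ z ∈ Metric.closedBall (0:ℂ) 1, ε ≤ ‖z - 1‖ → Real.exp (u n z / 2) ≤ s := by
  have h1 := hploc (2 * Real.log s) (Metric.closedBall 0 1 \ Metric.ball 1 ε)
    ((isCompact_closedBall _ _).diff Metric.isOpen_ball)
    (fun x hx => ⟨hx.1, fun h => hx.2 (by rw [h]; exact Metric.mem_ball_self hε)⟩)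
  filter_upwards [h1] with n hn z hz hzε
  have h2 := hn z ⟨hz, by simpa [dist_eq_norm] using hzε⟩
  rw [← Real.le_log_iff_exp_le hs]
  linarith

lemma tendsto_etaF {k M : ℝ} {K h : ℕ → ℂ → ℝ} {z₁ : ℕ → ℂ} {δ : ℕ → ℝ}
    (hploc : TendstoLocallyUniformlyBotOn u (unitClosedDisk \ {(1 : ℂ)}))
    (hb : ∀ᶠ n in atTop, BubbleData k M (K n) (h n) (u n) (z₁ n) (δ n))
    (hδ : Tendsto δ atTop (𝓝 0)) (hz : Tendsto z₁ atTop (𝓝 1)) {σ : ℝ} (hσ : 0 < σ) :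
    ∀ᶠ n in atTop, etaF (u n) (z₁ n) (δ n) ≤ ENNReal.ofReal σ := by
  obtain ⟨n₀, hn₀⟩ := hb.exists
  have hM := hn₀.hM
  have hk := hn₀.hk
  have hk0 : 0 < k := by linarith
  set A := 700 * k * (M + 60) with hA
  have hA0 : 0 < A := by positivity
  obtain ⟨ε, hε0, hε1, hεA⟩ : ∃ ε : ℝ, 0 < ε ∧ ε ≤ 1 ∧ 4 * A * ε ≤ σ := by
    refine ⟨min 1 (σ / (4 * A)), by positivity, min_le_left _ _, ?_⟩
    have := min_le_right 1 (σ / (4 * A))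
    rw [le_div_iff₀ (by positivity)] at this
    linarith
  set B := k * (80 / ε ^ 2 * M) with hB
  have hB0 : 0 ≤ B := by positivity
  obtain ⟨ρ, hρ0, hρ1, hρB⟩ : ∃ ρ : ℝ, 0 < ρ ∧ ρ ≤ ε / 2 ∧ (B + 1) * ρ ≤ σ / 40 := by
    refine ⟨min (ε / 2) (σ / 40 / (B + 1)), by positivity, min_le_left _ _, ?_⟩
    have := min_le_right (ε / 2) (σ / 40 / (B + 1))
    rw [le_div_iff₀ (by positivity)] at this
    linarith
  set D := k * ((32 + 8 / ε) * 12) + 4 with hD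
  have hD0 : 0 < D := by positivity
  obtain ⟨s, hs0, hs1, hsD⟩ : ∃ s : ℝ, 0 < s ∧ s ≤ 1 ∧ D * s ≤ σ / 40 := by
    refine ⟨min 1 (σ / 40 / D), by positivity, min_le_left _ _, ?_⟩
    have := min_le_right 1 (σ / 40 / D)
    rw [le_div_iff₀ (by positivity)] at this
    linarith
  have hz' : ∀ᶠ n in atTop, ‖z₁ n - 1‖ ≤ ε := by
    have := Metric.tendsto_atTop.1 hz ε hε0
    obtain ⟨N, hN⟩ := this
    filter_upwards [eventually_ge_atTop N] with n hn
    have := hN n hn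
    rw [dist_eq_norm] at this
    exact this.le
  filter_upwards [hb, hz', hδ.eventually_lt_const hε0, eventually_exp_le hploc hρ0 hs0]
    with n b h1 h2 h3
  have hδn := b.pos
  refine (b.etaF_le hε0 (by linarith) hρ0.le hρ1 hs0.le hs1 h1 h3).trans
    (ENNReal.ofReal_le_ofReal ?_)
  have e1 : k * (80 / ε ^ 2 * ρ * M + (32 + 8 / ε) * (12 * s)) + 4 * s = B * ρ + D * s := by
    rw [hB, hD]; ring
  rw [e1]
  have e2 : δ n / (2 * ε) + 4 ≤ 5 := by
    have : δ n / (2 * ε) ≤ 1 := by rw [div_le_one (by positivity)]; linarith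
    linarith
  have e3 : B * ρ + D * s ≤ σ / 20 := by nlinarith
  have e4 : (B * ρ + D * s) * (δ n / (2 * ε) + 4) ≤ σ / 20 * 5 := by
    refine mul_le_mul e3 e2 (by positivity) (by positivity)
  have e5 : A * (δ n + 2 * ε) ≤ 3 / 4 * σ := by nlinarith
  linarith

end Existence

/-- Existence of a concentrating sequence satisfying all the uniform estimates. -/
lemma exists_bubbleSeq {u Kn hn : ℕ → ℂ → ℝ} {K h : ℂ → ℝ}
    (hureg : ∀ n, ContDiff ℝ 2 (u n))
    (hKnreg : ∀ n, ContDiff ℝ 2 (Kn n)) (hKreg : ContDiff ℝ 2 K)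
    (hhnreg : ∀ n, ContDiff ℝ 2 (hn n)) (hhreg : ContDiff ℝ 2 h)
    (hKconv : TendstoC2On Kn K unitClosedDisk)
    (hhconv : TendstoC2On hn h unitCircle)
    (hsol : ∀ n, SolvesLiouville (Kn n) (hn n) (u n))
    (hblow : BlowsUp u) {M : ℝ} (hM : 0 ≤ M)
    (hmass : ∀ n, massMeasure (u n) univ ≤ ENNReal.ofReal M)
    (hploc : TendstoLocallyUniformlyBotOn u (unitClosedDisk \ {(1 : ℂ)})) :
    ∃ (k c C : ℝ) (K' h' u' : ℕ → ℂ → ℝ) (z₁ : ℕ → ℂ) (δ l η α : ℕ → ℝ),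
      BubbleSeq k M c C K' h' u' K h z₁ δ l η α := by
  obtain ⟨k₁, hk₁, hKb⟩ := hKconv.exists_bound hKreg (isCompact_closedBall _ _)
  obtain ⟨k₂, hk₂, hhb⟩ := hhconv.exists_bound hhreg (isCompact_sphere _ _)
  choose z₁ hz₁ hmin using fun n => exists_argmin_wF (hureg n)
  set k := max k₁ k₂ with hk
  set δ : ℕ → ℝ := fun n => wF (u n) (z₁ n) with hδ
  have hk1 : 1 ≤ k := hk₁.trans (le_max_left _ _)
  have hδlim : Tendsto δ atTop (𝓝 0) := tendsto_min_wF hblow hmin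
  have hzlim : Tendsto z₁ atTop (𝓝 1) := tendsto_argmin hblow hploc hz₁ hmin
  have hcis : ∀ θ, cis θ ∈ unitCircle := fun θ => by simp [unitCircle, norm_cis]
  have hb : ∀ᶠ n in atTop, BubbleData k M (Kn n) (hn n) (u n) (z₁ n) (δ n) := by
    filter_upwards [hKb, hhb] with n a1 a2
    refine ⟨hKnreg n, hhnreg n, hureg n, hsol n, hk1, hM, fun z hz => ?_, fun z hz => ?_,
      fun θ => ?_, fun θ => ?_, hmass n, hz₁ n, rfl, hmin n⟩
    · exact (a1 z hz).1.trans (le_max_left _ _)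
    · exact (norm_pU_le (hKnreg n) z).trans ((a1 z hz).2.1.trans (le_max_left _ _))
    · exact (a2 _ (hcis θ)).1.trans (le_max_right _ _)
    · have h1 := (fderiv ℝ (hn n) (cis θ)).le_opNorm (Complex.I * cis θ)
      rw [norm_mul, Complex.norm_I, norm_cis, mul_one, mul_one, Real.norm_eq_abs] at h1
      exact h1.trans ((a2 _ (hcis θ)).2.1.trans (le_max_right _ _))
  set η : ℕ → ℝ := fun n => (etaF (u n) (z₁ n) (δ n)).toReal with hη
  have hηev : ∀ σ > 0, ∀ᶠ n in atTop, etaF (u n) (z₁ n) (δ n) ≤ ENNReal.ofReal σ := fun σ hσ =>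
    tendsto_etaF hploc hb hδlim hzlim hσ
  have hηlim : Tendsto η atTop (𝓝 0) := by
    rw [Metric.tendsto_atTop]
    intro ε hε
    obtain ⟨N, hN⟩ := eventually_atTop.1 (hηev (ε / 2) (by positivity))
    refine ⟨N, fun n hn => ?_⟩
    rw [Real.dist_eq, sub_zero, abs_of_nonneg ENNReal.toReal_nonneg]
    have := ENNReal.toReal_le_of_le_ofReal (by positivity) (hN n hn)
    linarith
  set α : ℕ → ℝ := fun n => (z₁ n).arg with hα
  have hzα : ∀ n, z₁ n = ‖z₁ n‖ * cis (α n) := fun n =>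
    (Complex.norm_mul_exp_arg_mul_I (z₁ n)).symm
  have hαlim : Tendsto α atTop (𝓝 0) := by
    have := (Complex.continuousAt_arg (x := 1) (by simp)).tendsto.comp hzlim
    simpa [Function.comp_def] using this
  set C : ℝ := 10 ^ 9 * k ^ 4 * (M + 60) with hC
  have hC0 : 0 < C := by positivity
  set R : ℝ := 8 * (M + 1) with hR
  have hR8 : 8 ≤ R := by linarith
  set c : ℝ := 1 / (4 * R ^ 2) with hc
  have hc0 : 0 < c := by positivity
  have hc1 : 4 * c ≤ 1 := by
    rw [hc, mul_one_div, div_le_one (by positivity)]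
    nlinarith
  have small : ∀ᶠ n in atTop, R * δ n ≤ 1 ∧ k * R ^ 2 * δ n ≤ 2 ∧ 4096 * k * η n ≤ 1 ∧
      C * η n * (1 + R) ^ 2 ≤ 1 ∧ C * η n ≤ c ∧ |α n| ≤ 1 := by
    have e1 : ∀ a : ℝ, Tendsto (fun n => a * δ n) atTop (𝓝 0) := fun a => by
      simpa using hδlim.const_mul a
    have e2 : ∀ a : ℝ, Tendsto (fun n => a * η n) atTop (𝓝 0) := fun a => by
      simpa using hηlim.const_mul a
    have e3 : Tendsto (fun n => C * η n * (1 + R) ^ 2) atTop (𝓝 0) := by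
      simpa using (e2 C).mul_const ((1 + R) ^ 2)
    have e4 : Tendsto (fun n => |α n|) atTop (𝓝 0) := by simpa using hαlim.abs
    filter_upwards [(e1 R).eventually_le_const one_pos,
      (e1 (k * R ^ 2)).eventually_le_const two_pos, (e2 (4096 * k)).eventually_le_const one_pos,
      e3.eventually_le_const one_pos, (e2 C).eventually_le_const hc0,
      e4.eventually_le_const one_pos] with n a1 a2 a3 a4 a5 a6
    exact ⟨a1, a2, a3, a4, a5, a6⟩
  obtain ⟨N, hN⟩ := eventually_atTop.1
    (hb.and (small.and ((hηev 1 one_pos).and hhb)))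
  have hN' : ∀ n, _ := fun n => hN (n + N) (Nat.le_add_left _ _)
  choose l hl0 hlk hlg hlz _ using fun n => (hN' n).1.exists_slope
  have hη0 : ∀ n, 0 ≤ η n := fun n => ENNReal.toReal_nonneg
  have happ : ∀ n, ∀ z ∈ Metric.closedBall (0:ℂ) 1,
    |wF (u (n + N)) z -
        profile (δ (n + N)) (l n) (Kn (n + N) (z₁ (n + N)) + l n ^ 2) (z₁ (n + N)) z| ≤
      C * min (η (n + N)) (δ (n + N) + ‖z - z₁ (n + N)‖) * (δ (n + N) + ‖z - z₁ (n + N)‖) ^ 2 /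
        δ (n + N) := by
    intro n z hz
    obtain ⟨b, ⟨-, -, s3, -, -, -⟩, h1, -⟩ := hN' n
    refine b.expansion (hl0 n) (hlk n) (hlg n) (hlz n) ?_ s3 (hη0 _) hz
    rw [hη]
    rw [ENNReal.ofReal_toReal (h1.trans_lt ENNReal.ofReal_lt_top).ne]
  have happ' : ∀ n, ∀ z ∈ Metric.closedBall (0:ℂ) 1,
    |wF (u (n + N)) z -
        profile (δ (n + N)) (l n) (Kn (n + N) (z₁ (n + N)) + l n ^ 2) (z₁ (n + N)) z| ≤
      C * η (n + N) * (δ (n + N) + ‖z - z₁ (n + N)‖) ^ 2 / δ (n + N) := by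
    intro n z hz
    have hδ0 := (hN' n).1.pos
    refine (happ n z hz).trans ?_
    have := min_le_left (η (n + N)) (δ (n + N) + ‖z - z₁ (n + N)‖)
    gcongr
  have htau : ∀ n, 16 * c ≤ Kn (n + N) (z₁ (n + N)) + l n ^ 2 := by
    intro n
    obtain ⟨b, ⟨s1, s2, s3, s4, s5, s6⟩, h1, -⟩ := hN' n
    have := b.le_tau (hlk n) (hlz n) (hzα _) s6 rfl s1 s2 s4 (happ' n)
      (mul_nonneg hC0.le (hη0 _))
    refine le_trans (le_of_eq ?_) this
    change 16 * c = 4 / R ^ 2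
    rw [hc]
    field_simp
    norm_num
  have hlow : ∀ n, ∀ z ∈ Metric.closedBall (0:ℂ) 1,
      2 * c * (δ (n + N) + ‖z - z₁ (n + N)‖) ^ 2 / δ (n + N) ≤
        profile (δ (n + N)) (l n) (Kn (n + N) (z₁ (n + N)) + l n ^ 2) (z₁ (n + N)) z := by
    intro n z hz
    exact (hN' n).1.le_profile (hl0 n) (hlz n) (by positivity)
      (by linarith [htau n]) (by linarith) hz
  have hshift : ∀ {β : Type} {f : ℕ → β} {F : Filter β}, Tendsto f atTop F →
      Tendsto (fun n => f (n + N)) atTop F := fun hf => hf.comp (tendsto_add_atTop_nat N)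
  refine ⟨k, c, C, fun n => Kn (n + N), fun n => hn (n + N), fun n => u (n + N),
    fun n => z₁ (n + N), fun n => δ (n + N), l, fun n => η (n + N), fun n => α (n + N),
    fun n => (hN' n).1, hKreg, hhreg, fun i hi s hs => (tendsto_add_atTop_nat N).eventually (hKconv i hi s hs),
    fun i hi s hs => (tendsto_add_atTop_nat N).eventually (hhconv i hi s hs), fun n θ φ => ?_,
    hc0, hC0, hl0, hlk, hlz, fun n => hzα _, fun n => hη0 _,
    fun n => by linarith [htau n], happ, fun n z hz => ?_, fun n z hz => ?_,
    hshift hδlim, hshift hηlim, hshift hαlim, hshift hzlim⟩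
  · have h2 := (hN' n).2.2.2
    exact abs_angDeriv_sub_le (hhnreg _) (fun z hz => (h2 z hz).2.1.trans (le_max_right _ _))
      (fun z hz => (h2 z hz).2.2.trans (le_max_right _ _)) θ φ
  · refine le_trans ?_ (hlow n z hz)
    have hδ0 := (hN' n).1.pos
    gcongr
    linarith
  · have hδ0 := (hN' n).1.pos
    have e1 := hlow n z hz
    have e2 := (abs_le.1 (happ' n z hz)).1
    have e3 : C * η (n + N) * (δ (n + N) + ‖z - z₁ (n + N)‖) ^ 2 / δ (n + N) ≤
        c * (δ (n + N) + ‖z - z₁ (n + N)‖) ^ 2 / δ (n + N) := by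
      have := (hN' n).2.1.2.2.2.2.1
      gcongr
    have e4 : 2 * c * (δ (n + N) + ‖z - z₁ (n + N)‖) ^ 2 / δ (n + N) =
        2 * (c * (δ (n + N) + ‖z - z₁ (n + N)‖) ^ 2 / δ (n + N)) := by ring
    linarith

/-! ### Model integrals -/

lemma add_norm_rpow_eq {E : Type*} [NormedAddCommGroup E] [NormedSpace ℝ E] {δ : ℝ} (hδ : 0 < δ)
    (s : ℝ) (a x : E) :
    (δ + ‖x - a‖) ^ (-s) = δ ^ (-s) * (1 + ‖δ⁻¹ • (x - a)‖) ^ (-s) := by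
  rw [← Real.mul_rpow hδ.le (by positivity), norm_smul, Real.norm_eq_abs,
    abs_of_pos (inv_pos.2 hδ)]
  congr 1
  field_simp

section Scaling

variable {E : Type*} [NormedAddCommGroup E] [NormedSpace ℝ E] [FiniteDimensional ℝ E]
  [MeasurableSpace E] [BorelSpace E] (ν : Measure E) [ν.IsAddHaarMeasure]

lemma integrable_add_norm_rpow {δ s : ℝ} (hδ : 0 < δ) (hs : Module.finrank ℝ E < s) (a : E) :
    Integrable (fun x => (δ + ‖x - a‖) ^ (-s)) ν := by
  simp_rw [add_norm_rpow_eq hδ]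
  exact (((integrable_one_add_norm (μ := ν) hs).comp_smul (inv_ne_zero hδ.ne')).comp_sub_right
    a).const_mul _

lemma integral_add_norm_rpow {δ : ℝ} (hδ : 0 < δ) (s : ℝ) (a : E) :
    ∫ x, (δ + ‖x - a‖) ^ (-s) ∂ν =
      δ ^ (Module.finrank ℝ E - s) * ∫ x : E, (1 + ‖x‖) ^ (-s) ∂ν := by
  simp_rw [add_norm_rpow_eq hδ]
  rw [integral_const_mul, integral_sub_right_eq_self (fun x => (1 + ‖δ⁻¹ • x‖) ^ (-s)) a,
    Measure.integral_comp_smul ν (fun x => (1 + ‖x‖) ^ (-s)), smul_eq_mul, ← mul_assoc]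
  congr 1
  rw [inv_pow, inv_inv, abs_of_pos (pow_pos hδ _), ← Real.rpow_natCast, ← Real.rpow_add hδ]
  congr 1
  ring

end Scaling

/-- Mass of an integrable power of the distance to a point of the plane. -/
lemma exists_integral_disk_le (s : ℝ) (hs : 2 < s) :
    ∃ B : ℝ, 0 < B ∧ ∀ δ : ℝ, 0 < δ → ∀ (a : ℂ) (f : ℂ → ℂ) (c : ℝ), 0 ≤ c →
      (∀ z ∈ Metric.ball (0:ℂ) 1, ‖f z‖ ≤ c * (δ + ‖z - a‖) ^ (-s)) →
      ‖∫ z in Metric.ball (0:ℂ) 1, f z‖ ≤ c * (δ ^ (2 - s) * B) := by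
  have h0 : 0 ≤ ∫ x : ℂ, (1 + ‖x‖) ^ (-s) := integral_nonneg fun x => by positivity
  refine ⟨(∫ x : ℂ, (1 + ‖x‖) ^ (-s)) + 1, by positivity, fun δ hδ a f c hc hf => ?_⟩
  have hi := (integrable_add_norm_rpow (E := ℂ) volume hδ (s := s) (by simpa using hs) a).const_mul c
  calc ‖∫ z in Metric.ball (0:ℂ) 1, f z‖
      ≤ ∫ z in Metric.ball (0:ℂ) 1, c * (δ + ‖z - a‖) ^ (-s) :=
        norm_integral_le_of_norm_le hi.integrableOn
          ((ae_restrict_iff' Metric.isOpen_ball.measurableSet).2 (ae_of_all _ hf))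
    _ ≤ ∫ z, c * (δ + ‖z - a‖) ^ (-s) :=
        setIntegral_le_integral hi (ae_of_all _ fun z => by positivity)
    _ = c * (δ ^ (2 - s) * ∫ x : ℂ, (1 + ‖x‖) ^ (-s)) := by
        rw [integral_const_mul, integral_add_norm_rpow volume hδ]; simp
    _ ≤ _ := by
      have : 0 < δ ^ (2 - s) := by positivity
      gcongr; linarith

/-- Mass of an integrable power of the angle. -/
lemma exists_integral_angle_le (s : ℝ) (hs : 1 < s) :
    ∃ B : ℝ, 0 < B ∧ ∀ δ : ℝ, 0 < δ → ∀ (f : ℝ → ℝ) (c : ℝ), 0 ≤ c →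
      (∀ φ, |φ| ≤ π → ‖f φ‖ ≤ c * (δ + |φ|) ^ (-s)) →
      ‖∫ φ in (-π)..π, f φ‖ ≤ c * (δ ^ (1 - s) * B) := by
  have h0 : 0 ≤ ∫ x : ℝ, (1 + ‖x‖) ^ (-s) := integral_nonneg fun x => by positivity
  refine ⟨(∫ x : ℝ, (1 + ‖x‖) ^ (-s)) + 1, by positivity, fun δ hδ f c hc hf => ?_⟩
  have hi := (integrable_add_norm_rpow (E := ℝ) volume hδ (s := s) (by simpa using hs) 0).const_mul c
  rw [intervalIntegral.integral_of_le (by linarith [Real.pi_pos])]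
  calc ‖∫ z in Ioc (-π) π, f z‖
      ≤ ∫ z in Ioc (-π) π, c * (δ + ‖z - 0‖) ^ (-s) :=
        norm_integral_le_of_norm_le hi.integrableOn
          ((ae_restrict_iff' measurableSet_Ioc).2 (ae_of_all _ fun φ hφ => by
            simpa using hf φ (abs_le.2 ⟨hφ.1.le, hφ.2⟩)))
    _ ≤ ∫ z, c * (δ + ‖z - 0‖) ^ (-s) :=
        setIntegral_le_integral hi (ae_of_all _ fun z => by positivity)
    _ = c * (δ ^ (1 - s) * ∫ x : ℝ, (1 + ‖x‖) ^ (-s)) := by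
        rw [integral_const_mul, integral_add_norm_rpow volume hδ]; simp
    _ ≤ _ := by
      have : 0 < δ ^ (1 - s) := by positivity
      gcongr; linarith

/-- The value at `z` of a rotationally symmetric quadratic polynomial about a point on the ray
through `e`. -/
def mdl (p₀ p₁ b : ℝ) (e z : ℂ) : ℝ := p₀ + p₁ * ‖z‖ ^ 2 - 2 * b * (conj e * z).re

lemma contDiff_mdl (p₀ p₁ b : ℝ) (e : ℂ) {n : WithTop ℕ∞} : ContDiff ℝ n (mdl p₀ p₁ b e) := by
  unfold mdl
  have h1 : ContDiff ℝ n fun z : ℂ => ‖z‖ ^ 2 := contDiff_norm_sq ℝ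
  have h2 : ContDiff ℝ n fun z : ℂ => (conj e * z).re :=
    Complex.reCLM.contDiff.comp (contDiff_const.mul contDiff_id)
  fun_prop

lemma hasW_mdl (p₀ p₁ b : ℝ) (e z : ℂ) :
    HasW (fun z => (mdl p₀ p₁ b e z : ℂ)) (p₁ * conj z - b * conj e) (p₁ * z - b * e) z := by
  have h : (fun z => (mdl p₀ p₁ b e z : ℂ)) =
      fun z => (p₀ : ℂ) + (p₁ : ℂ) * (z * conj z) - ((b * conj e) * z + (b * e) * conj z) := by
    ext z
    simp only [mdl]
    push_cast
    rw [Complex.mul_conj', Complex.re_eq_add_conj]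
    simp only [map_mul, Complex.conj_conj]
    ring
  rw [h]
  refine (((hasW_const _ z).add (((hasW_id z).mul (hasW_conj z)).const_mul _)).sub
    (((hasW_id z).const_mul _).add ((hasW_conj z).const_mul _))).congr ?_ ?_ <;> ring

lemma mdl_cis (p₀ p₁ b α θ : ℝ) :
    mdl p₀ p₁ b (cis α) (cis θ) = p₀ + p₁ - 2 * b * Real.cos (θ - α) := by
  rw [mdl, norm_cis, ← cis_neg, ← cis_add, cis_re, show -α + θ = θ - α by ring]
  ring

lemma integral_periodic_shift {F : Type*} [NormedAddCommGroup F] [NormedSpace ℝ F] {f : ℝ → F}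
    (hf : Function.Periodic f (2 * π)) (α : ℝ) :
    ∫ θ in (-π)..π, f θ = ∫ φ in (-π)..π, f (α + φ) := by
  rw [intervalIntegral.integral_comp_add_left]
  have := hf.intervalIntegral_add_eq (-π) (α - π)
  rw [show -π + 2 * π = π by ring, show α - π + 2 * π = α + π by ring] at this
  rw [this, sub_eq_add_neg]

lemma integral_odd {f : ℝ → ℝ} (hf : ∀ φ, f (-φ) = -f φ) (a : ℝ) : ∫ φ in (-a)..a, f φ = 0 := by
  have h := intervalIntegral.integral_comp_neg (a := -a) (b := a) f
  simp only [hf, neg_neg] at h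
  rw [intervalIntegral.integral_neg] at h
  linarith

lemma periodic_comp_cis {F : Type*} (f : ℂ → F) : Function.Periodic (fun θ => f (cis θ)) (2 * π) :=
  fun θ => by simp only [cis_add_two_pi]

lemma HasW.inv {F : ℂ → ℂ} {a b z : ℂ} (h : HasW F a b z) (h0 : F z ≠ 0) :
    HasW (fun z => (F z)⁻¹) (-((F z) ^ 2)⁻¹ * a) (-((F z) ^ 2)⁻¹ * b) z :=
  h.comp_holo (hasDerivAt_inv h0)

section Model

variable {p₀ p₁ b α : ℝ}

lemma isOpen_mdl_pos : IsOpen {z | 0 < mdl p₀ p₁ b (cis α) z} :=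
  isOpen_lt continuous_const (contDiff_mdl p₀ p₁ b (cis α) (n := 0)).continuous

/-- The Gauss--Bonnet identity of the model. -/
lemma mdl_gauss_bonnet (hP : ∀ z ∈ Metric.closedBall (0:ℂ) 1, 0 < mdl p₀ p₁ b (cis α) z) :
    4 * (p₀ * p₁ - b ^ 2) * (∫ z in Metric.ball (0:ℂ) 1, (mdl p₀ p₁ b (cis α) z ^ 2)⁻¹) +
      (p₀ - p₁) * (∫ θ in (-π)..π, (mdl p₀ p₁ b (cis α) (cis θ))⁻¹) = 2 * π := by
  set P := mdl p₀ p₁ b (cis α) with hPdef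
  have hF : ContDiffOn ℝ 1 (fun z => (p₁ * conj z - b * conj (cis α)) * (P z : ℂ)⁻¹)
      {z | 0 < P z} := by
    have h1 : ContDiffOn ℝ 1 (fun z => (P z : ℂ)) {z | 0 < P z} :=
      (contDiff_ofReal_comp (contDiff_mdl _ _ _ _)).contDiffOn
    have h2 : ContDiff ℝ 1 (fun z : ℂ => p₁ * conj z - b * conj (cis α)) :=
      (contDiff_const.mul Complex.conjCLE.contDiff).sub contDiff_const
    exact h2.contDiffOn.mul (h1.inv fun z hz => by exact_mod_cast (ne_of_gt hz))
  have hD := integral_disk_dzb isOpen_mdl_pos (fun z hz => hP z hz) hF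
  have hint : ∀ z ∈ Metric.ball (0:ℂ) 1,
      dzb (fun z => (p₁ * conj z - b * conj (cis α)) * (P z : ℂ)⁻¹) z =
        (((p₀ * p₁ - b ^ 2) * (P z ^ 2)⁻¹ : ℝ) : ℂ) := by
    intro z hz
    have hz0 : (P z : ℂ) ≠ 0 := by
      exact_mod_cast (hP z (Metric.ball_subset_closedBall hz)).ne'
    have h := ((((hasW_conj z).const_mul (p₁:ℂ)).sub (hasW_const (b * conj (cis α)) z)).mul
      ((hasW_mdl p₀ p₁ b (cis α) z).inv hz0)).dzb_eq
    rw [← hPdef] at h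
    rw [h]
    have hPz : (P z : ℂ) = p₀ + p₁ * (z * conj z) - (b * conj (cis α) * z + b * cis α * conj z) := by
      rw [hPdef, mdl, Complex.mul_conj']
      push_cast
      rw [Complex.re_eq_add_conj]
      simp only [map_mul, Complex.conj_conj]
      ring
    push_cast
    generalize (P z : ℂ) = X at hPz hz0 ⊢
    have hX : X⁻¹ = X * (X ^ 2)⁻¹ := by field_simp
    rw [hX]
    generalize (X ^ 2)⁻¹ = Y
    rw [hPz]
    linear_combination (-(b:ℂ) ^ 2 * Y) * cis_mul_conj α
  rw [setIntegral_congr_fun Metric.isOpen_ball.measurableSet hint, integral_complex_ofReal] at hD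
  have hb : ∀ θ, (1 / 2 * (cis θ * ((p₁ * conj (cis θ) - b * conj (cis α)) *
      (P (cis θ) : ℂ)⁻¹))).re = 1 / 4 - (p₀ - p₁) / 4 * (P (cis θ))⁻¹ := by
    intro θ
    have hpos := hP (cis θ) (by simp [norm_cis])
    have : 1 / 2 * (cis θ * ((p₁ * conj (cis θ) - b * conj (cis α)) * (P (cis θ) : ℂ)⁻¹))
        = ((1 / 2 * (P (cis θ))⁻¹ : ℝ) : ℂ) * (p₁ - b * cis (θ - α)) := by
      rw [sub_eq_add_neg θ, cis_add, cis_neg]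
      push_cast
      linear_combination (1 / 2 * (P (cis θ) : ℂ)⁻¹ * p₁) * cis_mul_conj θ
    rw [this, Complex.re_ofReal_mul]
    simp only [Complex.sub_re, Complex.ofReal_re, Complex.re_ofReal_mul, cis_re]
    have hc := mdl_cis p₀ p₁ b α θ
    rw [← hPdef] at hc
    field_simp
    linarith
  have hcont : Continuous fun θ => (P (cis θ))⁻¹ :=
    ((contDiff_mdl p₀ p₁ b (cis α) (n := 0)).continuous.comp continuous_cis).inv₀
      fun θ => (hP (cis θ) (by simp [norm_cis])).ne'
  have hcontc : Continuous fun θ => (1 / 2 * (cis θ * ((p₁ * conj (cis θ) - b * conj (cis α)) *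
      (P (cis θ) : ℂ)⁻¹))) := by
    have h3 : Continuous fun θ => (P (cis θ) : ℂ)⁻¹ := by
      simpa [Function.comp_def] using Complex.continuous_ofReal.comp hcont
    have := continuous_cis
    fun_prop
  have hre := congrArg Complex.re hD
  rw [Complex.ofReal_re] at hre
  have h4 := Complex.reCLM.intervalIntegral_comp_comm (μ := volume)
    (hcontc.intervalIntegrable (-π) π)
  simp only [Complex.reCLM_apply] at h4
  rw [← h4] at hre
  simp_rw [hb] at hre
  rw [intervalIntegral.integral_sub (by simp)
    ((hcont.const_mul _).intervalIntegrable _ _), intervalIntegral.integral_const_mul,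
    intervalIntegral.integral_const, integral_const_mul, smul_eq_mul] at hre
  linarith

/-- The Kazdan--Warner integral of the model. -/
lemma mdl_kazdan_warner (hP : ∀ z ∈ Metric.closedBall (0:ℂ) 1, 0 < mdl p₀ p₁ b (cis α) z)
    {S : ℝ} (hb : 0 < b) (hS : 0 < S) (hA : 2 * b < p₀ + p₁) (hS2 : S ^ 2 = (p₀ + p₁) ^ 2 - 4 * b ^ 2)
    (hSh : 0 < p₀ - p₁ + S) :
    ∫ z in Metric.ball (0:ℂ) 1, (1 - (conj (cis α) * z) ^ 2) * ((mdl p₀ p₁ b (cis α) z : ℂ) ^ 2)⁻¹ =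
      ((1 / (p₀ - p₁ + S) * ∫ φ in (-π)..π, 2 * Real.sin φ ^ 2 *
        (p₀ + p₁ - 2 * b * Real.cos φ)⁻¹ : ℝ) : ℂ) := by
  set P := mdl p₀ p₁ b (cis α) with hPdef
  set e := cis α with he
  have hee : e * conj e = 1 := cis_mul_conj α
  set ρ : ℝ := 2 * b / (p₀ + p₁ + S) with hρ
  have hsum : 0 < p₀ + p₁ + S := by linarith
  have hbρ : 2 * (b * ρ) = p₀ + p₁ - S := by
    rw [hρ]; field_simp; linarith
  have hρ2 : ρ * (p₀ + p₁ + S) = 2 * b := by rw [hρ]; field_simp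
  have hρ0 : 0 < ρ := by rw [hρ]; positivity
  have hρ1 : ρ < 1 := by rw [hρ, div_lt_one (by linarith)]; linarith
  set D : ℝ := (p₀ - p₁ + S) / 2 with hD0
  have hDpos : 0 < D := by rw [hD0]; linarith
  have hd1 : p₀ - ρ * b = D := by rw [hD0]; linarith
  have hd2 : b - ρ * p₁ = ρ * D := by rw [hD0]; linarith
  have hq : ∀ z ∈ Metric.closedBall (0:ℂ) 1, 1 - ρ * (conj e * z) ≠ 0 := by
    intro z hz h0
    have h1 : ‖(ρ:ℂ) * (conj e * z)‖ = 1 := by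
      rw [← sub_eq_zero.1 h0]; simp
    rw [norm_mul, norm_mul, RCLike.norm_conj, he, norm_cis, one_mul, Complex.norm_real,
      Real.norm_of_nonneg hρ0.le] at h1
    have := mem_closedBall_zero_iff.1 hz
    nlinarith
  set V : Set ℂ := {z | 0 < P z} ∩ {z | 1 - ρ * (conj e * z) ≠ 0} with hV
  have hVo : IsOpen V := isOpen_mdl_pos.inter
    (isOpen_ne_fun (by fun_prop) continuous_const)
  have hF : ContDiffOn ℝ 1 (fun z => ((1 - (conj e * z) ^ 2) * (conj z - ρ * conj e)) *
      ((P z : ℂ)⁻¹ * (1 - ρ * (conj e * z))⁻¹)) V := by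
    have h1 : ContDiffOn ℝ 1 (fun z => (P z : ℂ)) V :=
      (contDiff_ofReal_comp (contDiff_mdl _ _ _ _)).contDiffOn
    have h2 : ContDiff ℝ 1 (fun z : ℂ => (1 - (conj e * z) ^ 2) * (conj z - ρ * conj e)) := by
      have : ContDiff ℝ 1 fun z : ℂ => conj z := Complex.conjCLE.contDiff
      fun_prop
    have h3 : ContDiff ℝ 1 (fun z : ℂ => 1 - ρ * (conj e * z)) := by fun_prop
    exact h2.contDiffOn.mul ((h1.inv fun z hz => by exact_mod_cast (ne_of_gt hz.1)).mul
      (h3.contDiffOn.inv fun z hz => hz.2))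
  have hD := integral_disk_dzb hVo (fun z hz => ⟨hP z hz, hq z hz⟩) hF
  have hint : ∀ z ∈ Metric.ball (0:ℂ) 1,
      dzb (fun z => ((1 - (conj e * z) ^ 2) * (conj z - ρ * conj e)) *
      ((P z : ℂ)⁻¹ * (1 - ρ * (conj e * z))⁻¹)) z =
        D * ((1 - (conj e * z) ^ 2) * ((P z : ℂ) ^ 2)⁻¹) := by
    intro z hz
    have hz' := Metric.ball_subset_closedBall hz
    have hz0 : (P z : ℂ) ≠ 0 := by exact_mod_cast (hP z hz').ne'
    have hq0 := hq z hz'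
    have h1 : HasW (fun z : ℂ => 1 - ρ * (conj e * z)) (-(ρ * conj e)) 0 z :=
      ((hasW_const 1 z).sub (((hasW_id z).const_mul (conj e)).const_mul (ρ:ℂ))).congr
        (by ring) (by ring)
    have h2 : HasW (fun z : ℂ => 1 - (conj e * z) ^ 2) (-2 * conj e ^ 2 * z) 0 z := by
      have := (hasW_const 1 z).sub (((hasW_id z).const_mul (conj e)).mul
        ((hasW_id z).const_mul (conj e)))
      simp only [← sq] at this
      exact this.congr (by ring) (by ring)
    have h := ((h2.mul (((hasW_conj z).sub (hasW_const (ρ * conj e) z)))).mul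
      (((hasW_mdl p₀ p₁ b (cis α) z).inv hz0).mul (h1.inv hq0))).dzb_eq
    rw [← he, ← hPdef] at h
    rw [h]
    have hPz : (P z : ℂ) = p₀ + p₁ * (z * conj z) - (b * conj e * z + b * e * conj z) := by
      rw [hPdef, mdl, Complex.mul_conj']
      push_cast
      rw [Complex.re_eq_add_conj]
      simp only [map_mul, Complex.conj_conj]
      ring
    have hd1' : (p₀:ℂ) - ρ * b = D := by exact_mod_cast hd1
    have hd2' : (b:ℂ) - ρ * p₁ = ρ * D := by exact_mod_cast hd2
    have key : (P z : ℂ) - (conj z - ρ * conj e) * (p₁ * z - b * e) =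
        D * (1 - ρ * (conj e * z)) := by
      rw [hPz]
      linear_combination hd1' - conj e * z * hd2' - ρ * b * hee
    have hX : (P z : ℂ)⁻¹ = P z * ((P z : ℂ) ^ 2)⁻¹ := by field_simp
    have hY : (1 - ρ * (conj e * z)) * (1 - ρ * (conj e * z))⁻¹ = 1 := mul_inv_cancel₀ hq0
    rw [hX]
    generalize ((P z : ℂ) ^ 2)⁻¹ = Y at *
    generalize (1 - ρ * (conj e * z))⁻¹ = T at *
    linear_combination ((1 - (conj e * z) ^ 2) * Y * T) * key +
      (D * (1 - (conj e * z) ^ 2) * Y) * hY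
  rw [setIntegral_congr_fun Metric.isOpen_ball.measurableSet hint, integral_const_mul] at hD
  have hbd : ∀ θ, 1 / 2 * (cis θ * (((1 - (conj e * cis θ) ^ 2) * (conj (cis θ) - ρ * conj e)) *
      ((P (cis θ) : ℂ)⁻¹ * (1 - ρ * (conj e * cis θ))⁻¹))) =
      1 / 2 * ((1 - cis (θ - α) ^ 2) * (P (cis θ) : ℂ)⁻¹) := by
    intro θ
    have hq0 := hq (cis θ) (by simp [norm_cis])
    have hY : (1 - ρ * (conj e * cis θ)) * (1 - ρ * (conj e * cis θ))⁻¹ = 1 := mul_inv_cancel₀ hq0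
    have hc : cis (θ - α) = conj e * cis θ := by
      rw [sub_eq_add_neg θ, cis_add, cis_neg, mul_comm]
    rw [hc]
    have h3 := cis_mul_conj θ
    generalize (1 - ρ * (conj e * cis θ))⁻¹ = T at *
    linear_combination (1 / 2 * ((1 - (conj e * cis θ) ^ 2) * (P (cis θ) : ℂ)⁻¹)) * hY +
      (1 / 2 * ((1 - (conj e * cis θ) ^ 2) * (P (cis θ) : ℂ)⁻¹)) * T * h3
  simp_rw [hbd] at hD
  have hper : Function.Periodic (fun θ => 1 / 2 * ((1 - cis (θ - α) ^ 2) * (P (cis θ) : ℂ)⁻¹))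
      (2 * π) := by
    intro θ
    simp only [cis_add_two_pi, show θ + 2 * π - α = θ - α + 2 * π by ring]
  rw [integral_periodic_shift hper α] at hD
  have hsplit : ∀ φ, 1 / 2 * ((1 - cis (α + φ - α) ^ 2) * (P (cis (α + φ)) : ℂ)⁻¹) =
      ((1 / 2 * (2 * Real.sin φ ^ 2 * (p₀ + p₁ - 2 * b * Real.cos φ)⁻¹) : ℝ) : ℂ) -
      ((Real.sin φ * Real.cos φ * (p₀ + p₁ - 2 * b * Real.cos φ)⁻¹ : ℝ) : ℂ) * Complex.I := by
    intro φ
    rw [hPdef, he, mdl_cis, show α + φ - α = φ by ring, cis_eq]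
    have h3 : (Real.cos φ : ℂ) ^ 2 + (Real.sin φ : ℂ) ^ 2 = 1 := by
      exact_mod_cast Real.cos_sq_add_sin_sq φ
    push_cast at h3 ⊢
    linear_combination (-1 / 2 * (p₀ + p₁ - 2 * b * Complex.cos φ : ℂ)⁻¹) * h3 -
      (1 / 2 * Complex.sin φ ^ 2 * (p₀ + p₁ - 2 * b * Complex.cos φ : ℂ)⁻¹) * Complex.I_sq
  simp_rw [hsplit] at hD
  have hpos : ∀ φ, 0 < p₀ + p₁ - 2 * b * Real.cos φ := fun φ => by
    nlinarith [Real.cos_le_one φ]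
  have hcont : Continuous fun φ => (p₀ + p₁ - 2 * b * Real.cos φ)⁻¹ :=
    Continuous.inv₀ (by fun_prop) fun φ => (hpos φ).ne'
  have hc1 : Continuous fun φ => ((1 / 2 * (2 * Real.sin φ ^ 2 *
      (p₀ + p₁ - 2 * b * Real.cos φ)⁻¹) : ℝ) : ℂ) := by fun_prop
  have hc2 : Continuous fun φ => ((Real.sin φ * Real.cos φ *
      (p₀ + p₁ - 2 * b * Real.cos φ)⁻¹ : ℝ) : ℂ) := by fun_prop
  have hc3 : Continuous fun φ => ((Real.sin φ * Real.cos φ *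
      (p₀ + p₁ - 2 * b * Real.cos φ)⁻¹ : ℝ) : ℂ) * Complex.I := hc2.mul continuous_const
  rw [intervalIntegral.integral_sub (hc1.intervalIntegrable _ _)
    (hc3.intervalIntegrable _ _), intervalIntegral.integral_mul_const,
    intervalIntegral.integral_ofReal, intervalIntegral.integral_ofReal,
    integral_odd (f := fun φ => Real.sin φ * Real.cos φ * (p₀ + p₁ - 2 * b * Real.cos φ)⁻¹)
      (fun φ => by simp), intervalIntegral.integral_const_mul] at hD
  have hDc : (D : ℂ) ≠ 0 := by exact_mod_cast hDpos.ne'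
  apply mul_left_cancel₀ hDc
  rw [hD, ← Complex.ofReal_mul]
  simp only [Complex.ofReal_zero, zero_mul, sub_zero]
  congr 1
  rw [hD0]
  field_simp

end Model

/-! ### Comparison of a blow-up sequence with its profile -/

lemma abs_inv_sub_inv_le {w p m ε : ℝ} (hm : 0 < m) (hw : m ≤ w) (hp : m ≤ p)
    (h : |w - p| ≤ ε) : |w⁻¹ - p⁻¹| ≤ ε / m ^ 2 := by
  have hw0 := hm.trans_le hw
  have hp0 := hm.trans_le hp
  rw [inv_sub_inv hw0.ne' hp0.ne', abs_div, abs_of_pos (mul_pos hw0 hp0), abs_sub_comm]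
  exact div_le_div₀ ((abs_nonneg _).trans h) h (by positivity)
    (by rw [sq]; exact mul_le_mul hw hp hm.le hw0.le)

lemma abs_inv_sq_sub_inv_sq_le {w p m ε : ℝ} (hm : 0 < m) (hw : m ≤ w) (hp : m ≤ p)
    (h : |w - p| ≤ ε) : |(w ^ 2)⁻¹ - (p ^ 2)⁻¹| ≤ 2 * ε / m ^ 3 := by
  have hw0 := hm.trans_le hw
  have hp0 := hm.trans_le hp
  have h1 := abs_inv_sub_inv_le hm hw hp h
  have h2 : w⁻¹ ≤ m⁻¹ := inv_anti₀ hm hw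
  have h3 : p⁻¹ ≤ m⁻¹ := inv_anti₀ hm hp
  have e : (w ^ 2)⁻¹ - (p ^ 2)⁻¹ = (w⁻¹ - p⁻¹) * (w⁻¹ + p⁻¹) := by
    rw [← inv_pow, ← inv_pow]; ring
  have h4 : 0 < w⁻¹ + p⁻¹ := by positivity
  rw [e, abs_mul, abs_of_pos h4]
  calc |w⁻¹ - p⁻¹| * (w⁻¹ + p⁻¹) ≤ ε / m ^ 2 * (2 * m⁻¹) := by
        apply mul_le_mul h1 (by linarith) h4.le ((abs_nonneg _).trans h1)
    _ = 2 * ε / m ^ 3 := by field_simp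

namespace BubbleSeq

variable {k M c C : ℝ} {K h u : ℕ → ℂ → ℝ} {K₀ h₀ : ℂ → ℝ} {z₁ : ℕ → ℂ} {δ l η α : ℕ → ℝ}

/-- Leading coefficient of the model. -/
def p₁ (_ : BubbleSeq k M c C K h u K₀ h₀ z₁ δ l η α) (n : ℕ) : ℝ :=
  (K n (z₁ n) + l n ^ 2) / (4 * δ n)

/-- Slope coefficient of the model. -/
def b (B : BubbleSeq k M c C K h u K₀ h₀ z₁ δ l η α) (n : ℕ) : ℝ := l n / 2 + B.p₁ n * ‖z₁ n‖

/-- Constant coefficient of the model. -/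
def p₀ (B : BubbleSeq k M c C K h u K₀ h₀ z₁ δ l η α) (n : ℕ) : ℝ :=
  δ n + l n + B.p₁ n * ‖z₁ n‖ ^ 2

/-- The model as a function on the plane. -/
def P (B : BubbleSeq k M c C K h u K₀ h₀ z₁ δ l η α) (n : ℕ) : ℂ → ℝ :=
  mdl (B.p₀ n) (B.p₁ n) (B.b n) (cis (α n))

/-- Regularized distance to the center. -/
def D (_ : BubbleSeq k M c C K h u K₀ h₀ z₁ δ l η α) (n : ℕ) (z : ℂ) : ℝ := δ n + ‖z - z₁ n‖

/-- Minimum of the model on the circle. -/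
def A (B : BubbleSeq k M c C K h u K₀ h₀ z₁ δ l η α) (n : ℕ) : ℝ := B.p₀ n + B.p₁ n - 2 * B.b n

variable (B : BubbleSeq k M c C K h u K₀ h₀ z₁ δ l η α)
include B

lemma pos (n : ℕ) : 0 < δ n := (B.data n).pos

lemma D_pos (n : ℕ) (z : ℂ) : 0 < B.D n z := add_pos_of_pos_of_nonneg (B.pos n) (norm_nonneg _)

lemma norm_z₁_le (n : ℕ) : ‖z₁ n‖ ≤ 1 := mem_closedBall_zero_iff.1 (B.data n).hz₁

lemma profile_eq (n : ℕ) (z : ℂ) :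
    profile (δ n) (l n) (K n (z₁ n) + l n ^ 2) (z₁ n) z = B.P n z := by
  have h1 := B.hz n
  have h2 := B.hlz n
  have h3 : ‖z - z₁ n‖ ^ 2 = ‖z‖ ^ 2 + ‖z₁ n‖ ^ 2 - 2 * (conj (z₁ n) * z).re := by
    rw [← Complex.normSq_eq_norm_sq, ← Complex.normSq_eq_norm_sq, ← Complex.normSq_eq_norm_sq,
      Complex.normSq_sub, mul_comm z]
  have h4 : (conj (z₁ n) * z).re = ‖z₁ n‖ * (conj (cis (α n)) * z).re := by
    conv_lhs => rw [h1]
    rw [map_mul, Complex.conj_ofReal, mul_assoc, Complex.re_ofReal_mul]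
  have h5 : (conj (z₁ n) * (z - z₁ n)).re = (conj (z₁ n) * z).re - ‖z₁ n‖ ^ 2 := by
    rw [mul_sub, Complex.sub_re, mul_comm (conj (z₁ n)) (z₁ n), Complex.mul_conj']
    norm_cast
  rw [profile, h5, h3, h4, P, mdl, p₀, b, p₁]
  linear_combination ((conj (cis (α n)) * z).re - 1 - ‖z₁ n‖) * h2

lemma le_P (n : ℕ) {z : ℂ} (hz : z ∈ Metric.closedBall (0:ℂ) 1) :
    c * B.D n z ^ 2 / δ n ≤ B.P n z := by
  rw [← B.profile_eq]; exact B.le_profile n z hz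

lemma le_w (n : ℕ) {z : ℂ} (hz : z ∈ Metric.closedBall (0:ℂ) 1) :
    c * B.D n z ^ 2 / δ n ≤ wF (u n) z := B.le_wF n z hz

lemma lower_pos (n : ℕ) (z : ℂ) : 0 < c * B.D n z ^ 2 / δ n := by
  have := B.D_pos n z
  have := B.pos n
  have := B.hc
  positivity

lemma P_pos (n : ℕ) {z : ℂ} (hz : z ∈ Metric.closedBall (0:ℂ) 1) : 0 < B.P n z :=
  (B.lower_pos n z).trans_le (B.le_P n hz)

lemma min_nonneg (n : ℕ) (z : ℂ) : 0 ≤ min (η n) (B.D n z) := le_min (B.hη0 n) (B.D_pos n z).le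

lemma abs_inv_sub (n : ℕ) {z : ℂ} (hz : z ∈ Metric.closedBall (0:ℂ) 1) :
    |(wF (u n) z)⁻¹ - (B.P n z)⁻¹| ≤
      C / c ^ 2 * (min (η n) (B.D n z) * δ n / B.D n z ^ 2) := by
  have h1 := B.approx n z hz
  rw [B.profile_eq] at h1
  refine (abs_inv_sub_inv_le (B.lower_pos n z) (B.le_w n hz) (B.le_P n hz) h1).trans_eq ?_
  have := B.D_pos n z
  have := B.pos n
  have := B.hc
  simp only [D] at *
  field_simp

lemma abs_inv_sq_sub (n : ℕ) {z : ℂ} (hz : z ∈ Metric.closedBall (0:ℂ) 1) :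
    |(wF (u n) z ^ 2)⁻¹ - (B.P n z ^ 2)⁻¹| ≤
      2 * C / c ^ 3 * (min (η n) (B.D n z) * δ n ^ 2 / B.D n z ^ 4) := by
  have h1 := B.approx n z hz
  rw [B.profile_eq] at h1
  refine (abs_inv_sq_sub_inv_sq_le (B.lower_pos n z) (B.le_w n hz) (B.le_P n hz) h1).trans_eq ?_
  have := B.D_pos n z
  have := B.pos n
  have := B.hc
  simp only [D] at *
  field_simp

lemma inv_P_le (n : ℕ) {z : ℂ} (hz : z ∈ Metric.closedBall (0:ℂ) 1) :
    (B.P n z)⁻¹ ≤ δ n / (c * B.D n z ^ 2) := by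
  refine (inv_anti₀ (B.lower_pos n z) (B.le_P n hz)).trans_eq (inv_div _ _)

lemma inv_w_le (n : ℕ) {z : ℂ} (hz : z ∈ Metric.closedBall (0:ℂ) 1) :
    (wF (u n) z)⁻¹ ≤ δ n / (c * B.D n z ^ 2) := by
  refine (inv_anti₀ (B.lower_pos n z) (B.le_w n hz)).trans_eq (inv_div _ _)

lemma inv_P_sq_le (n : ℕ) {z : ℂ} (hz : z ∈ Metric.closedBall (0:ℂ) 1) :
    (B.P n z ^ 2)⁻¹ ≤ δ n ^ 2 / (c ^ 2 * B.D n z ^ 4) := by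
  rw [← inv_pow]
  refine (pow_le_pow_left₀ (inv_nonneg.2 (B.P_pos n hz).le) (B.inv_P_le n hz) 2).trans_eq ?_
  rw [div_pow]; ring

lemma D_cis_ge (n : ℕ) {φ : ℝ} (hφ : |φ| ≤ π) : (δ n + |φ|) / 4 ≤ B.D n (cis (α n + φ)) := by
  have h1 := norm_cis_sub_le_two_mul (B.norm_z₁_le n) (B.hz n) (α n + φ)
  have h2 := norm_cis_sub_cis_ge (θ := α n + φ) (α := α n) (by simpa using hφ)
  have h3 := B.pos n
  have h4 : |φ| / 2 ≤ 2 / π * |φ| := by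
    rw [div_mul_eq_mul_div, div_le_div_iff₀ two_pos Real.pi_pos]
    nlinarith [Real.pi_le_four, abs_nonneg φ]
  simp only [add_sub_cancel_left] at h2
  rw [D]
  linarith

lemma le_p₁ (n : ℕ) : 2 * c / δ n ≤ B.p₁ n := by
  have := B.tau n
  have := B.pos n
  rw [p₁, div_le_div_iff₀ (by positivity) (by positivity)]
  nlinarith

lemma p₁_pos (n : ℕ) : 0 < B.p₁ n :=
  (div_pos (mul_pos two_pos B.hc) (B.pos n)).trans_le (B.le_p₁ n)

lemma abs_K_le (n : ℕ) : |K n (z₁ n)| ≤ k := (B.data n).hKb _ (B.data n).hz₁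

lemma p₁_mul_le (n : ℕ) : B.p₁ n * δ n ≤ k ^ 2 := by
  have h0 := B.pos n
  have h1 := (abs_le.1 (B.abs_K_le n)).2
  have h2 := (B.data n).hk
  have h3 : l n ^ 2 ≤ k ^ 2 := pow_le_pow_left₀ (B.hl0 n) (B.hlk n) 2
  have : B.p₁ n * δ n = (K n (z₁ n) + l n ^ 2) / 4 := by rw [p₁]; field_simp
  rw [this]
  nlinarith

lemma disc_eq (n : ℕ) : 4 * (B.p₀ n * B.p₁ n - B.b n ^ 2) = K n (z₁ n) := by
  have h0 := B.pos n
  have h1 : 4 * (B.p₁ n * δ n) = K n (z₁ n) + l n ^ 2 := by rw [p₁]; field_simp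
  have h2 := B.hlz n
  rw [p₀, b]
  linear_combination h1 + 4 * B.p₁ n * h2

lemma A_eq (n : ℕ) : B.A n = δ n + B.p₁ n * (1 - ‖z₁ n‖) ^ 2 := by
  rw [A, p₀, b]; ring

lemma le_A (n : ℕ) : δ n ≤ B.A n := by
  rw [A_eq]; nlinarith [mul_nonneg (B.p₁_pos n).le (sq_nonneg (1 - ‖z₁ n‖))]

lemma A_pos (n : ℕ) : 0 < B.A n := (B.pos n).trans_le (B.le_A n)

lemma P_cis (n : ℕ) (φ : ℝ) :
    B.P n (cis (α n + φ)) = B.A n + 2 * B.b n * (1 - Real.cos φ) := by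
  rw [P, mdl_cis, A]; ring_nf

lemma eventually_b : ∀ᶠ n in atTop, c / δ n ≤ B.b n := by
  have h : Tendsto (fun n => ‖z₁ n‖) atTop (𝓝 1) := by simpa using B.lim_z.norm
  filter_upwards [h.eventually (lt_mem_nhds (by norm_num : (1 / 2 : ℝ) < 1))] with n hn
  have h1 := B.le_p₁ n
  have h2 := B.hl0 n
  have h3 := B.p₁_pos n
  have h4 : 2 * c / δ n = 2 * (c / δ n) := by ring
  rw [b]
  nlinarith

/-- Product of the extreme values of the model on the circle. -/
lemma A_mul (n : ℕ) : B.A n * (B.A n + 4 * B.b n) = (B.p₀ n - B.p₁ n) ^ 2 + K n (z₁ n) := by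
  rw [← B.disc_eq, A]; ring

lemma eventually_A_mul : ∀ᶠ n in atTop, 4 * c ≤ B.A n * (B.A n + 4 * B.b n) := by
  filter_upwards [B.eventually_b] with n hn
  have h1 := B.le_A n
  have h2 := B.A_pos n
  have h0 := B.pos n
  rw [div_le_iff₀ h0] at hn
  have hb : 0 < B.b n := by
    by_contra hneg
    have := B.hc
    nlinarith
  nlinarith [mul_le_mul_of_nonneg_right h1 hb.le, sq_nonneg (B.A n)]

end BubbleSeq

lemma cis_mem_closedBall (θ : ℝ) : cis θ ∈ Metric.closedBall (0:ℂ) 1 := by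
  simp [norm_cis]

lemma rpow_neg_three_half {x : ℝ} (hx : 0 < x) : x ^ (-(3 / 2) : ℝ) = (x * √x)⁻¹ := by
  rw [Real.rpow_neg hx.le, Real.sqrt_eq_rpow, ← Real.rpow_one_add' hx.le (by norm_num)]
  norm_num

namespace BubbleSeq

variable {k M c C : ℝ} {K h u : ℕ → ℂ → ℝ} {K₀ h₀ : ℂ → ℝ} {z₁ : ℕ → ℂ} {δ l η α : ℕ → ℝ}
variable (B : BubbleSeq k M c C K h u K₀ h₀ z₁ δ l η α)
include B

lemma continuous_P (n : ℕ) : Continuous (B.P n) := (contDiff_mdl _ _ _ _ (n := 0)).continuous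

lemma integrableOn_P_sq_inv (n : ℕ) :
    IntegrableOn (fun z => (B.P n z ^ 2)⁻¹) (Metric.ball (0:ℂ) 1) := by
  have : ContinuousOn (fun z => (B.P n z ^ 2)⁻¹) (Metric.closedBall (0:ℂ) 1) :=
    ((B.continuous_P n).pow 2).continuousOn.inv₀ fun z hz => (pow_pos (B.P_pos n hz) 2).ne'
  exact (this.integrableOn_compact (isCompact_closedBall 0 1)).mono_set
    Metric.ball_subset_closedBall

lemma continuous_P_cis_inv (n : ℕ) : Continuous fun φ => (B.P n (cis (α n + φ)))⁻¹ := by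
  have := (B.continuous_P n).comp (continuous_cis.comp (continuous_const.add continuous_id : Continuous fun φ => α n + φ))
  exact this.inv₀ fun φ => (B.P_pos n (cis_mem_closedBall _)).ne'

lemma continuous_w_cis_inv (n : ℕ) : Continuous fun φ => (wF (u n) (cis (α n + φ)))⁻¹ := by
  have := (continuous_wF (B.data n).hu).comp (continuous_cis.comp (continuous_const.add continuous_id : Continuous fun φ => α n + φ))
  exact this.inv₀ fun φ => (wF_pos _ _).ne'

lemma continuous_h_cis (n : ℕ) : Continuous fun φ => h n (cis (α n + φ)) :=
  (B.data n).hh.continuous.comp (continuous_cis.comp (continuous_const.add continuous_id))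

lemma abs_fderiv_K_le (n : ℕ) {z : ℂ} (hz : z ∈ Metric.closedBall (0:ℂ) 1) :
    ‖fderiv ℝ (K n) z‖ ≤ 2 * k := by
  have hk := (B.data n).hk
  refine ContinuousLinearMap.opNorm_le_bound _ (by linarith) fun v => ?_
  rw [fderiv_eq_re_dz _ _ _ ((B.data n).hK.differentiable (by norm_num) z), Real.norm_eq_abs,
    abs_mul, abs_two, mul_assoc]
  have h1 := Complex.abs_re_le_norm (dz (fun z => (K n z : ℂ)) z * v)
  rw [norm_mul] at h1
  have h2 := mul_le_mul_of_nonneg_right ((B.data n).hKd z hz) (norm_nonneg v)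
  rw [pU] at h2
  linarith

lemma abs_K_sub_le (n : ℕ) {z : ℂ} (hz : z ∈ Metric.closedBall (0:ℂ) 1) :
    |K n z - K n (z₁ n)| ≤ 2 * k * ‖z - z₁ n‖ :=
  (convex_closedBall (0:ℂ) 1).norm_image_sub_le_of_norm_fderiv_le (𝕜 := ℝ)
    (fun x _ => (B.data n).hK.differentiable (by norm_num) x)
    (fun _ hx => B.abs_fderiv_K_le n hx) (B.data n).hz₁ hz

lemma abs_h_sub_le (n : ℕ) (φ : ℝ) : |h n (cis (α n + φ)) - h n (cis (α n))| ≤ k * |φ| := by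
  have := convex_univ.norm_image_sub_le_of_norm_hasDerivWithin_le (𝕜 := ℝ)
    (f := fun θ => h n (cis θ)) (C := k)
    (fun θ _ => (hasDerivAt_comp_cis (B.data n).hh θ).hasDerivWithinAt)
    (fun θ _ => (B.data n).hhd θ) (mem_univ (α n)) (mem_univ (α n + φ))
  simpa using this

lemma gauss_bonnet_sub (n : ℕ) :
    (B.p₀ n - B.p₁ n - h n (cis (α n))) * (∫ φ in (-π)..π, (B.P n (cis (α n + φ)))⁻¹) =
      (∫ z in Metric.ball (0:ℂ) 1,
        (K n z * (wF (u n) z ^ 2)⁻¹ - K n (z₁ n) * (B.P n z ^ 2)⁻¹)) +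
      ∫ φ in (-π)..π, (h n (cis (α n + φ)) * (wF (u n) (cis (α n + φ)))⁻¹ -
        h n (cis (α n)) * (B.P n (cis (α n + φ)))⁻¹) := by
  have h1 := gauss_bonnet (B.data n).hu (B.data n).hh (B.data n).hs
  have h2 := mdl_gauss_bonnet (fun z hz => B.P_pos n hz)
  have hi : IntegrableOn (fun z => K n z * Real.exp (u n z)) (Metric.ball (0:ℂ) 1) :=
    (((B.data n).hK.continuous.mul (Real.continuous_exp.comp (B.data n).hu.continuous)).continuousOn
      |>.integrableOn_compact (isCompact_closedBall 0 1)).mono_set Metric.ball_subset_closedBall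
  rw [integral_periodic_shift (periodic_comp_cis fun z => h n z * Real.exp (u n z / 2)) (α n)] at h1
  rw [B.disc_eq, integral_periodic_shift (periodic_comp_cis fun z => (mdl (B.p₀ n) (B.p₁ n) (B.b n) (cis (α n)) z)⁻¹) (α n)] at h2
  simp_rw [← inv_pow (wF (u n) _), wF_inv_sq, wF_inv]
  have hw : Continuous fun φ => h n (cis (α n + φ)) * Real.exp (u n (cis (α n + φ)) / 2) := by
    have := B.continuous_w_cis_inv n
    simp_rw [wF_inv] at this
    exact (B.continuous_h_cis n).mul this
  have hP : Continuous fun φ => h n (cis (α n)) * (B.P n (cis (α n + φ)))⁻¹ :=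
    continuous_const.mul (B.continuous_P_cis_inv n)
  rw [integral_sub hi ((B.integrableOn_P_sq_inv n).const_mul _),
    intervalIntegral.integral_sub (hw.intervalIntegrable _ _)
      (hP.intervalIntegrable _ _),
    integral_const_mul, intervalIntegral.integral_const_mul]
  change K n (z₁ n) * (∫ z in Metric.ball (0:ℂ) 1, (B.P n z ^ 2)⁻¹) +
    (B.p₀ n - B.p₁ n) * (∫ φ in (-π)..π, (B.P n (cis (α n + φ)))⁻¹) = 2 * π at h2
  linarith

lemma rpow_neg_three (n : ℕ) (z : ℂ) : (δ n + ‖z - z₁ n‖) ^ (-3 : ℝ) = (B.D n z ^ 3)⁻¹ := by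
  change B.D n z ^ (-3 : ℝ) = _
  rw [Real.rpow_neg (B.D_pos n z).le]
  norm_cast

lemma area_error_le (n : ℕ) {z : ℂ} (hz : z ∈ Metric.closedBall (0:ℂ) 1) :
    |K n z * (wF (u n) z ^ 2)⁻¹ - K n (z₁ n) * (B.P n z ^ 2)⁻¹| ≤
      (2 * k * C / c ^ 3 * η n * δ n + 2 * k / c ^ 2 * δ n ^ 2) * (B.D n z ^ 3)⁻¹ := by
  have hδ := B.pos n
  have hD := B.D_pos n z
  have hc := B.hc
  have hC := B.hC
  have hk : 0 < k := by linarith [(B.data n).hk]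
  have hη := B.hη0 n
  have hDδ : δ n ≤ B.D n z := le_add_of_nonneg_right (norm_nonneg _)
  have hDd : ‖z - z₁ n‖ ≤ B.D n z := le_add_of_nonneg_left hδ.le
  have h1 : |K n z * ((wF (u n) z ^ 2)⁻¹ - (B.P n z ^ 2)⁻¹)| ≤
      2 * k * C / c ^ 3 * η n * δ n * (B.D n z ^ 3)⁻¹ := by
    rw [abs_mul]
    calc _ ≤ k * (2 * C / c ^ 3 * (η n * δ n * B.D n z / B.D n z ^ 4)) := by
          refine mul_le_mul ((B.data n).hKb z hz) ((B.abs_inv_sq_sub n hz).trans ?_)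
            (abs_nonneg _) hk.le
          gcongr 2 * C / c ^ 3 * (?_ / B.D n z ^ 4)
          rw [sq, ← mul_assoc]
          gcongr
          exact min_le_left _ _
      _ = _ := by field_simp
  have h2 : |(K n z - K n (z₁ n)) * (B.P n z ^ 2)⁻¹| ≤
      2 * k / c ^ 2 * δ n ^ 2 * (B.D n z ^ 3)⁻¹ := by
    rw [abs_mul, abs_of_nonneg (inv_nonneg.2 (sq_nonneg (B.P n z)))]
    calc _ ≤ (2 * k * B.D n z) * (δ n ^ 2 / (c ^ 2 * B.D n z ^ 4)) := by
          refine mul_le_mul ((B.abs_K_sub_le n hz).trans ?_) (B.inv_P_sq_le n hz)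
            (by positivity) (by positivity)
          gcongr
      _ = _ := by field_simp
  rw [add_mul]
  refine le_trans (le_of_eq ?_) ((abs_add_le _ _).trans (add_le_add h1 h2))
  congr 1
  ring

lemma bdry_error_le (n : ℕ) {φ : ℝ} (hφ : |φ| ≤ π) :
    |h n (cis (α n + φ)) * (wF (u n) (cis (α n + φ)))⁻¹ -
        h n (cis (α n)) * (B.P n (cis (α n + φ)))⁻¹| ≤
      (16 * k * C / c ^ 2 * η n * √(δ n) + 32 * k / c * δ n) *
        ((δ n + |φ|) * √(δ n + |φ|))⁻¹ := by
  have hδ := B.pos n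
  have hD := B.D_pos n (cis (α n + φ))
  have hc := B.hc
  have hC := B.hC
  have hk : 0 < k := by linarith [(B.data n).hk]
  have hη := B.hη0 n
  have hDE := B.D_cis_ge n hφ
  set E := δ n + |φ| with hE
  have hE0 : 0 < E := by positivity
  have hmem := cis_mem_closedBall (α n + φ)
  have hD2 : (B.D n (cis (α n + φ)) ^ 2)⁻¹ ≤ 16 * (E ^ 2)⁻¹ := by
    rw [← div_eq_mul_inv, inv_le_comm₀ (by positivity) (by positivity), inv_div]
    nlinarith
  have hs1 : √(δ n) ≤ √E := Real.sqrt_le_sqrt (by linarith [abs_nonneg φ])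
  have hs2 : √|φ| ≤ √E := Real.sqrt_le_sqrt (by linarith)
  have hsE : 0 < √E := Real.sqrt_pos.2 hE0
  have hEE : √E * √E = E := Real.mul_self_sqrt hE0.le
  have hδδ : √(δ n) * √(δ n) = δ n := Real.mul_self_sqrt hδ.le
  have hφφ : √|φ| * √|φ| = |φ| := Real.mul_self_sqrt (abs_nonneg φ)
  have hφ2 : √|φ| ≤ 2 := by
    rw [Real.sqrt_le_left two_pos.le]; linarith [Real.pi_le_four]
  have e2 : (E * √E)⁻¹ = √E * (E ^ 2)⁻¹ := by
    rw [← div_eq_mul_inv, eq_div_iff (by positivity)]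
    field_simp
    nlinarith
  have h1 : |h n (cis (α n + φ)) * ((wF (u n) (cis (α n + φ)))⁻¹ - (B.P n (cis (α n + φ)))⁻¹)| ≤
      16 * k * C / c ^ 2 * η n * √(δ n) * (E * √E)⁻¹ := by
    rw [abs_mul]
    calc _ ≤ k * (C / c ^ 2 * (η n * δ n * (16 * (E ^ 2)⁻¹))) := by
          refine mul_le_mul ((B.data n).hhb _) ((B.abs_inv_sub n hmem).trans ?_)
            (abs_nonneg _) hk.le
          rw [div_eq_mul_inv _ (B.D n _ ^ 2)]
          gcongr C / c ^ 2 * (?_ * δ n * ?_)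
          exact min_le_left _ _
      _ = k * (C / c ^ 2 * (η n * (√(δ n) * √(δ n)) * (16 * (E ^ 2)⁻¹))) := by rw [hδδ]
      _ ≤ k * (C / c ^ 2 * (η n * (√(δ n) * √E) * (16 * (E ^ 2)⁻¹))) := by gcongr
      _ = _ := by rw [e2]; ring
  have h2 : |(h n (cis (α n + φ)) - h n (cis (α n))) * (B.P n (cis (α n + φ)))⁻¹| ≤
      32 * k / c * δ n * (E * √E)⁻¹ := by
    rw [abs_mul, abs_of_pos (inv_pos.2 (B.P_pos n hmem))]
    calc _ ≤ (k * |φ|) * (δ n / c * (16 * (E ^ 2)⁻¹)) := by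
          refine mul_le_mul (B.abs_h_sub_le n φ) ((B.inv_P_le n hmem).trans ?_)
            (inv_nonneg.2 (B.P_pos n hmem).le) (by positivity)
          rw [div_mul_eq_div_mul_one_div, one_div]
          gcongr
      _ = (k * (√|φ| * √|φ|)) * (δ n / c * (16 * (E ^ 2)⁻¹)) := by rw [hφφ]
      _ ≤ (k * (2 * √E)) * (δ n / c * (16 * (E ^ 2)⁻¹)) := by gcongr
      _ = _ := by rw [e2]; ring
  rw [add_mul]
  refine le_trans (le_of_eq ?_) ((abs_add_le _ _).trans (add_le_add h1 h2))
  congr 1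
  ring

lemma tendsto_gauss_bonnet :
    Tendsto (fun n => (B.p₀ n - B.p₁ n - h n (cis (α n))) *
      (∫ φ in (-π)..π, (B.P n (cis (α n + φ)))⁻¹)) atTop (𝓝 0) := by
  obtain ⟨B₁, hB₁, h1⟩ := exists_integral_disk_le 3 (by norm_num)
  obtain ⟨B₂, hB₂, h2⟩ := exists_integral_angle_le (3 / 2) (by norm_num)
  have hc := B.hc
  have hC := B.hC
  have hk : 0 < k := by linarith [(B.data 0).hk]
  have hlim : Tendsto (fun n => (2 * k * C / c ^ 3 * η n + 2 * k / c ^ 2 * δ n) * B₁ +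
      (16 * k * C / c ^ 2 * η n + 32 * k / c * √(δ n)) * B₂) atTop (𝓝 0) := by
    have hs : Tendsto (fun n => √(δ n)) atTop (𝓝 0) := by
      simpa [Function.comp_def] using (Real.continuous_sqrt.tendsto 0).comp B.lim_δ
    have := ((((B.lim_η.const_mul (2 * k * C / c ^ 3)).add
      (B.lim_δ.const_mul (2 * k / c ^ 2))).mul_const B₁).add
      (((B.lim_η.const_mul (16 * k * C / c ^ 2)).add (hs.const_mul (32 * k / c))).mul_const B₂))
    simpa using this
  refine squeeze_zero_norm (fun n => ?_) hlim
  have hδ := B.pos n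
  have hη := B.hη0 n
  rw [B.gauss_bonnet_sub n]
  refine (norm_add_le _ _).trans (add_le_add ?_ ?_)
  · have := h1 (δ n) hδ (z₁ n)
      (fun z => ((K n z * (wF (u n) z ^ 2)⁻¹ - K n (z₁ n) * (B.P n z ^ 2)⁻¹ : ℝ) : ℂ))
      (2 * k * C / c ^ 3 * η n * δ n + 2 * k / c ^ 2 * δ n ^ 2) (by positivity) (fun z hz => by
        rw [Complex.norm_real, B.rpow_neg_three]
        exact B.area_error_le n (Metric.ball_subset_closedBall hz))
    rw [integral_complex_ofReal, Complex.norm_real] at this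
    refine this.trans_eq ?_
    have e : δ n ^ (2 - 3 : ℝ) = (δ n)⁻¹ := by
      rw [show (2 - 3 : ℝ) = -1 by norm_num, Real.rpow_neg_one]
    rw [e]
    field_simp
  · have := h2 (δ n) hδ _ (16 * k * C / c ^ 2 * η n * √(δ n) + 32 * k / c * δ n)
      (by positivity) (fun φ hφ => by
        rw [rpow_neg_three_half (by positivity)]
        exact B.bdry_error_le n hφ)
    refine this.trans_eq ?_
    have e : δ n ^ (1 - 3 / 2 : ℝ) = (√(δ n))⁻¹ := by
      rw [show (1 - 3 / 2 : ℝ) = -(1 / 2) by norm_num, Real.rpow_neg hδ.le, Real.sqrt_eq_rpow]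
    have hδδ : √(δ n) * √(δ n) = δ n := Real.mul_self_sqrt hδ.le
    have hs : 0 < √(δ n) := Real.sqrt_pos.2 hδ
    rw [e]
    conv_lhs => rw [← hδδ]
    rw [Real.sqrt_mul_self hs.le]
    field_simp

end BubbleSeq

namespace BubbleSeq

variable {k M c C : ℝ} {K h u : ℕ → ℂ → ℝ} {K₀ h₀ : ℂ → ℝ} {z₁ : ℕ → ℂ} {δ l η α : ℕ → ℝ}

/-- Square root of the product of the extreme values of the model on the circle. -/
def S (B : BubbleSeq k M c C K h u K₀ h₀ z₁ δ l η α) (n : ℕ) : ℝ := √(B.A n * (B.A n + 4 * B.b n))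

variable (B : BubbleSeq k M c C K h u K₀ h₀ z₁ δ l η α)
include B

lemma eventually_b_pos : ∀ᶠ n in atTop, 0 < B.b n := by
  filter_upwards [B.eventually_b] with n hn
  exact (div_pos B.hc (B.pos n)).trans_le hn

lemma eventually_S_sq : ∀ᶠ n in atTop, B.S n ^ 2 = (B.p₀ n - B.p₁ n) ^ 2 + K n (z₁ n) ∧
    4 * c ≤ B.S n ^ 2 ∧ 0 < B.S n := by
  filter_upwards [B.eventually_A_mul] with n hn
  have hc := B.hc
  have h0 : 0 < B.A n * (B.A n + 4 * B.b n) := by linarith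
  rw [S, Real.sq_sqrt h0.le]
  exact ⟨B.A_mul n, hn, Real.sqrt_pos.2 h0⟩

lemma eventually_integral_ge : ∀ᶠ n in atTop,
    2 / B.S n ≤ ∫ φ in (-π)..π, (B.P n (cis (α n + φ)))⁻¹ := by
  filter_upwards [B.eventually_b_pos, B.eventually_S_sq] with n hb hS
  have hA := B.A_pos n
  have hSp := hS.2.2
  have hS2 : B.S n ^ 2 = B.A n * (B.A n + 4 * B.b n) := by rw [hS.1, B.A_mul]
  have hcont := B.continuous_P_cis_inv n
  set ω : ℝ := min π √(B.A n / B.b n) with hω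
  have hω0 : 0 < ω := lt_min Real.pi_pos (Real.sqrt_pos.2 (div_pos hA hb))
  have hωπ : ω ≤ π := min_le_left _ _
  have hω2 : B.b n * ω ^ 2 ≤ B.A n := by
    have h1 : ω ^ 2 ≤ B.A n / B.b n := by
      rw [← Real.sq_sqrt (div_pos hA hb).le]
      exact pow_le_pow_left₀ hω0.le (min_le_right _ _) 2
    rw [le_div_iff₀ hb] at h1
    linarith
  have h1 : ∫ φ in (-ω)..ω, (B.P n (cis (α n + φ)))⁻¹ ≤
      ∫ φ in (-π)..π, (B.P n (cis (α n + φ)))⁻¹ :=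
    intervalIntegral.integral_mono_interval (by linarith) (by linarith) hωπ
      (ae_of_all _ fun φ => inv_nonneg.2 (B.P_pos n (cis_mem_closedBall _)).le)
      (hcont.intervalIntegrable _ _)
  have h2 : ∫ φ in (-ω)..ω, (2 * B.A n)⁻¹ ≤ ∫ φ in (-ω)..ω, (B.P n (cis (α n + φ)))⁻¹ := by
    refine intervalIntegral.integral_mono_on (by linarith) (by simp)
      (hcont.intervalIntegrable _ _) fun φ hφ => ?_
    refine inv_anti₀ (B.P_pos n (cis_mem_closedBall _)) ?_
    rw [B.P_cis]
    have h3 := Real.one_sub_sq_div_two_le_cos (x := φ)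
    have h4 : φ ^ 2 ≤ ω ^ 2 := sq_le_sq' hφ.1 hφ.2
    nlinarith [mul_le_mul_of_nonneg_left h4 hb.le]
  refine le_trans ?_ (h2.trans h1)
  rw [intervalIntegral.integral_const, smul_eq_mul, ← div_eq_mul_inv,
    div_le_div_iff₀ hSp (by positivity)]
  have hAS : B.A n ≤ B.S n := by
    refine le_of_sq_le_sq ?_ hSp.le
    rw [hS2]; nlinarith
  rcases min_choice π √(B.A n / B.b n) with hm | hm
  · rw [← hω] at hm
    rw [hm]
    nlinarith [Real.pi_gt_three]
  · rw [← hω] at hm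
    have h5 : ω ^ 2 * B.b n = B.A n := by
      rw [hm, Real.sq_sqrt (div_pos hA hb).le]; field_simp
    have h6 : 2 * B.A n ≤ ω * B.S n := by
      refine le_of_sq_le_sq ?_ (by positivity)
      rw [mul_pow, mul_pow ω, hS2]
      nlinarith [mul_pos (mul_pos hω0 hω0) (mul_pos hA hA)]
    linarith

lemma tendsto_cis_α : Tendsto (fun n => cis (α n)) atTop (𝓝 1) := by
  have := (continuous_cis.tendsto 0).comp B.lim_α
  simpa [Function.comp_def, cis] using this

lemma tendsto_h : Tendsto (fun n => h n (cis (α n))) atTop (𝓝 (h₀ 1)) :=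
  B.convh.tendsto B.hh₀ B.tendsto_cis_α fun n => by simp [unitCircle, norm_cis]

lemma tendsto_K : Tendsto (fun n => K n (z₁ n)) atTop (𝓝 (K₀ 1)) :=
  B.convK.tendsto B.hK₀ B.lim_z fun n => (B.data n).hz₁

lemma eventually_abs_sub_le : ∃ ε : ℕ → ℝ, Tendsto ε atTop (𝓝 0) ∧ ∀ᶠ n in atTop,
    |B.p₀ n - B.p₁ n - h n (cis (α n))| ≤ ε n * B.S n ∧ 0 ≤ ε n := by
  have hlim := B.tendsto_gauss_bonnet.norm
  rw [norm_zero] at hlim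
  refine ⟨_, hlim, ?_⟩
  filter_upwards [B.eventually_integral_ge, B.eventually_S_sq] with n hI hS
  refine ⟨?_, norm_nonneg _⟩
  have hSp := hS.2.2
  rw [norm_mul, Real.norm_eq_abs]
  have h1 : 1 ≤ ‖∫ φ in (-π)..π, (B.P n (cis (α n + φ)))⁻¹‖ * B.S n := by
    have := mul_le_mul_of_nonneg_right (hI.trans (le_abs_self _)) hSp.le
    rw [div_mul_cancel₀ _ hSp.ne'] at this
    rw [Real.norm_eq_abs]
    linarith
  nlinarith [mul_le_mul_of_nonneg_left h1 (abs_nonneg (B.p₀ n - B.p₁ n - h n (cis (α n))))]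

lemma eventually_S_le : ∀ᶠ n in atTop, B.S n ≤ 2 * k := by
  obtain ⟨ε, hε, hb⟩ := B.eventually_abs_sub_le
  filter_upwards [hb, B.eventually_S_sq, hε.eventually (gt_mem_nhds (by norm_num : (0:ℝ) < 1 / 4))]
    with n h1 hS h2
  have hk := (B.data n).hk
  have hSp := hS.2.2
  have hh := abs_le.1 ((B.data n).hhb (α n))
  have hK := (abs_le.1 (B.abs_K_le n)).2
  have h3 : |B.p₀ n - B.p₁ n| ≤ k + B.S n / 4 := by
    have h4 := abs_le.1 h1.1
    have h5 : ε n * B.S n ≤ B.S n / 4 := by nlinarith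
    rw [abs_le]
    constructor <;> linarith
  have h6 : (B.p₀ n - B.p₁ n) ^ 2 ≤ (k + B.S n / 4) ^ 2 := by
    rw [← sq_abs]; exact pow_le_pow_left₀ (abs_nonneg _) h3 2
  by_contra hneg
  push Not at hneg
  nlinarith

lemma tendsto_slope : Tendsto (fun n => B.p₀ n - B.p₁ n) atTop (𝓝 (h₀ 1)) := by
  obtain ⟨ε, hε, hb⟩ := B.eventually_abs_sub_le
  have h1 : Tendsto (fun n => B.p₀ n - B.p₁ n - h n (cis (α n))) atTop (𝓝 0) := by
    refine squeeze_zero_norm' ?_ (by simpa using hε.mul_const (2 * k))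
    filter_upwards [hb, B.eventually_S_le] with n h1 h2
    exact h1.1.trans (mul_le_mul_of_nonneg_left h2 h1.2)
  simpa using h1.add B.tendsto_h

lemma tendsto_S : Tendsto B.S atTop (𝓝 √(h₀ 1 ^ 2 + K₀ 1)) := by
  have h1 := (Real.continuous_sqrt.tendsto _).comp ((B.tendsto_slope.pow 2).add B.tendsto_K)
  refine h1.congr' ?_
  filter_upwards [B.eventually_S_sq] with n hS
  simp only [Function.comp_apply]
  rw [← hS.1, Real.sqrt_sq hS.2.2.le]

lemma eventually_add_ge : ∃ κ : ℝ, 0 < κ ∧ ∀ᶠ n in atTop, κ ≤ B.p₀ n - B.p₁ n + B.S n := by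
  have hc := B.hc
  have hk : 0 < k := by linarith [(B.data 0).hk]
  refine ⟨min (2 * √c) (2 * c / k), by positivity, ?_⟩
  filter_upwards [B.eventually_S_sq, B.eventually_S_le] with n hS hSk
  rcases le_or_gt 0 (B.p₀ n - B.p₁ n) with h0 | h0
  · refine (min_le_left _ _).trans ?_
    have : 2 * √c ≤ B.S n := by
      refine le_of_sq_le_sq ?_ hS.2.2.le
      rw [mul_pow, Real.sq_sqrt hc.le]; linarith [hS.2.1]
    linarith
  · refine (min_le_right _ _).trans ?_
    have hl : l n = 0 := by
      by_contra hl
      have hr : ‖z₁ n‖ = 1 := by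
        have := (mul_eq_zero.1 (B.hlz n)).resolve_left hl
        linarith
      have := B.pos n
      have := B.hl0 n
      rw [p₀, hr] at h0
      linarith
    have hK : 8 * c ≤ K n (z₁ n) := by simpa [hl] using B.tau n
    rw [div_le_iff₀ hk]
    have h1 : (B.p₀ n - B.p₁ n + B.S n) * (B.S n - (B.p₀ n - B.p₁ n)) = K n (z₁ n) := by
      linear_combination hS.1
    have h2 : -(B.p₀ n - B.p₁ n) ≤ B.S n := by
      refine le_of_sq_le_sq ?_ hS.2.2.le
      rw [hS.1]; linarith [neg_sq (B.p₀ n - B.p₁ n)]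
    have h3 : 0 ≤ B.p₀ n - B.p₁ n + B.S n := by linarith
    nlinarith [mul_le_mul_of_nonneg_left (by linarith : B.S n - (B.p₀ n - B.p₁ n) ≤ 4 * k) h3]

lemma phi_pos : 0 < h₀ 1 + √(h₀ 1 ^ 2 + K₀ 1) := by
  obtain ⟨κ, hκ, h1⟩ := B.eventually_add_ge
  exact hκ.trans_le (ge_of_tendsto (B.tendsto_slope.add B.tendsto_S) h1)

lemma eventually_A_le : ∀ᶠ n in atTop, B.A n ≤ k ^ 2 / c * δ n := by
  filter_upwards [B.eventually_b, B.eventually_S_sq, B.eventually_S_le] with n hb hS hSk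
  have hc := B.hc
  have hδ := B.pos n
  have hA := B.A_pos n
  have h1 : B.S n ^ 2 = B.A n * (B.A n + 4 * B.b n) := by rw [hS.1, B.A_mul]
  have h2 : B.S n ^ 2 ≤ (2 * k) ^ 2 := pow_le_pow_left₀ hS.2.2.le hSk 2
  have h3 : B.A n * (c / δ n) ≤ B.A n * B.b n := mul_le_mul_of_nonneg_left hb hA.le
  have h4 : B.A n * (c / δ n) ≤ k ^ 2 := by nlinarith
  rw [mul_div_assoc', div_le_iff₀ hδ] at h4
  rw [div_mul_eq_mul_div, le_div_iff₀ hc]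
  exact h4

lemma eventually_gap_le : ∀ᶠ n in atTop, 1 - ‖z₁ n‖ ≤ k / c * δ n := by
  filter_upwards [B.eventually_A_le] with n hA
  have hc := B.hc
  have hδ := B.pos n
  have hk : 0 < k := by linarith [(B.data 0).hk]
  rw [B.A_eq] at hA
  have h1 := mul_le_mul_of_nonneg_right (B.le_p₁ n) (sq_nonneg (1 - ‖z₁ n‖))
  have h2 : 2 * c / δ n * (1 - ‖z₁ n‖) ^ 2 ≤ k ^ 2 / c * δ n := by linarith
  refine le_of_sq_le_sq ?_ (by positivity)
  rw [mul_pow, div_pow]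
  rw [div_mul_eq_mul_div, div_le_iff₀ hδ] at h2
  have h3 : (1 - ‖z₁ n‖) ^ 2 ≤ (k ^ 2 / c * δ n * δ n) / (2 * c) := by
    rw [le_div_iff₀ (by positivity)]; linarith
  refine h3.trans ?_
  rw [div_le_iff₀ (by positivity)]
  have e : k ^ 2 / c ^ 2 * δ n ^ 2 * (2 * c) = 2 * (k ^ 2 / c * δ n * δ n) := by field_simp
  rw [e]
  have : 0 ≤ k ^ 2 / c * δ n * δ n := by positivity
  linarith

end BubbleSeq

/-! ### The Pohozaev identity in the limit -/

lemma TendstoC2On.eventually_fderiv_sub_le {F : ℕ → ℂ → ℝ} {G : ℂ → ℝ} {s : Set ℂ}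
    (hF : TendstoC2On F G s) {ε : ℝ} (hε : 0 < ε) :
    ∀ᶠ n in atTop, ∀ z ∈ s, ∀ v, |fderiv ℝ (F n) z v - fderiv ℝ G z v| ≤ ε * ‖v‖ := by
  filter_upwards [Metric.tendstoUniformlyOn_iff.1 (hF 1 (by norm_num)) ε hε] with n hn z hz v
  have h1 := hn z hz
  rw [dist_comm, dist_eq_norm] at h1
  have h2 := (iteratedFDeriv ℝ 1 (F n) z - iteratedFDeriv ℝ 1 G z).le_opNorm (fun _ => v)
  rw [sub_apply, iteratedFDeriv_one_apply, iteratedFDeriv_one_apply] at h2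
  simp only [Fin.prod_univ_one, Real.norm_eq_abs] at h2
  exact h2.trans (mul_le_mul_of_nonneg_right h1.le (norm_nonneg _))

lemma exists_fderiv_lipschitz {G : ℂ → ℝ} (hG : ContDiff ℝ 2 G) :
    ∃ L : ℝ, 0 < L ∧ ∀ z ∈ Metric.closedBall (0:ℂ) 1, ∀ v,
      |fderiv ℝ G z v - fderiv ℝ G 1 v| ≤ L * ‖z - 1‖ * ‖v‖ := by
  have hf : ContDiff ℝ 1 (fderiv ℝ G) := hG.fderiv_right (m := 1) (by norm_num)
  obtain ⟨L, hL⟩ := (isCompact_closedBall (0:ℂ) 1).exists_bound_of_continuousOn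
    (hf.continuous_fderiv (by norm_num)).continuousOn
  refine ⟨max L 1, by positivity, fun z hz v => ?_⟩
  have h1 := (convex_closedBall (0:ℂ) 1).norm_image_sub_le_of_norm_fderiv_le (𝕜 := ℝ)
    (fun x _ => hf.differentiable (by norm_num) x)
    (fun x hx => (hL x hx).trans (le_max_left L 1)) (by simp : (1:ℂ) ∈ _) hz
  have h2 := (fderiv ℝ G z - fderiv ℝ G 1).le_opNorm v
  exact h2.trans (mul_le_mul_of_nonneg_right h1 (norm_nonneg _))

lemma rpow_neg_five_half {x : ℝ} (hx : 0 < x) : x ^ (-(5 / 2) : ℝ) = (x ^ 2 * √x)⁻¹ := by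
  rw [Real.rpow_neg hx.le, Real.sqrt_eq_rpow, ← Real.rpow_natCast, ← Real.rpow_add hx]
  norm_num

namespace BubbleSeq

variable {k M c C : ℝ} {K h u : ℕ → ℂ → ℝ} {K₀ h₀ : ℂ → ℝ} {z₁ : ℕ → ℂ} {δ l η α : ℕ → ℝ}
  (B : BubbleSeq k M c C K h u K₀ h₀ z₁ δ l η α)

/-- The conformal field fixing `±cis (α n)`, relative to `cis (α n)`. -/
def field (_ : BubbleSeq k M c C K h u K₀ h₀ z₁ δ l η α) (n : ℕ) (z : ℂ) : ℂ :=
  1 - (conj (cis (α n)) * z) ^ 2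

include B

lemma cis_mul_field (n : ℕ) (z : ℂ) :
    cis (α n) * B.field n z = cis (α n) - conj (cis (α n)) * z ^ 2 := by
  have := cis_mul_conj (α n)
  rw [field]
  linear_combination (-conj (cis (α n)) * z ^ 2) * this

lemma continuous_field (n : ℕ) : Continuous (B.field n) := by
  unfold field; fun_prop

lemma norm_field_le : ∀ᶠ n in atTop, ∀ z ∈ Metric.closedBall (0:ℂ) 1,
    ‖cis (α n) * B.field n z‖ ≤ 2 * (1 + k / c) * B.D n z := by
  filter_upwards [B.eventually_gap_le] with n hg z hz
  have hk : 0 < k := by linarith [(B.data n).hk]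
  have hc := B.hc
  have h0 := cis_mul_conj (α n)
  have e : cis (α n) * B.field n z = (cis (α n) - z) * (1 + conj (cis (α n)) * z) := by
    rw [B.cis_mul_field]; linear_combination -z * h0
  have h1 : ‖1 + conj (cis (α n)) * z‖ ≤ 2 := by
    refine (norm_add_le _ _).trans ?_
    rw [norm_mul, Complex.norm_conj, norm_cis, norm_one]
    linarith [mem_closedBall_zero_iff.1 hz]
  have h2 : ‖cis (α n) - z₁ n‖ = 1 - ‖z₁ n‖ := by
    have h3 : cis (α n) - z₁ n = ((1 - ‖z₁ n‖ : ℝ) : ℂ) * cis (α n) := by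
      conv_lhs => rw [B.hz n]
      push_cast; ring
    rw [h3, norm_mul, norm_cis, Complex.norm_real, Real.norm_of_nonneg, mul_one]
    linarith [B.norm_z₁_le n]
  have h4 : ‖cis (α n) - z‖ ≤ (1 + k / c) * B.D n z := by
    have h5 := norm_sub_le_norm_sub_add_norm_sub (cis (α n)) (z₁ n) z
    rw [norm_sub_rev (z₁ n) z, h2] at h5
    have h6 := B.pos n
    have h7 : k / c * δ n ≤ k / c * B.D n z := by
      gcongr; exact le_add_of_nonneg_right (norm_nonneg _)
    have h8 : ‖z - z₁ n‖ ≤ B.D n z := le_add_of_nonneg_left h6.le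
    linarith
  rw [e, norm_mul]
  nlinarith [norm_nonneg (cis (α n) - z)]

lemma field_error_le : ∃ a : ℝ, 0 < a ∧ ∀ ε > 0, ∀ᶠ n in atTop, ∀ z ∈ Metric.closedBall (0:ℂ) 1,
    |B.p₁ n * (fderiv ℝ (K n) z (cis (α n) * B.field n z) * (wF (u n) z ^ 2)⁻¹ -
      fderiv ℝ K₀ 1 (cis (α n) * B.field n z) * (B.P n z ^ 2)⁻¹)| ≤
      a * (η n + ε + ‖z₁ n - 1‖ + √(δ n)) * √(δ n) * (B.D n z ^ 2 * √(B.D n z))⁻¹ := by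
  obtain ⟨L, hL, hLip⟩ := exists_fderiv_lipschitz B.hK₀
  have hk : 0 < k := by linarith [(B.data 0).hk]
  have hc := B.hc
  have hC := B.hC
  refine ⟨k ^ 2 * (2 * (1 + k / c)) * (2 * k * (2 * C / c ^ 3) + (1 + 2 * L) / c ^ 2),
    by positivity, fun ε hε => ?_⟩
  filter_upwards [B.norm_field_le, B.convK.eventually_fderiv_sub_le hε,
    B.lim_δ.eventually (gt_mem_nhds (by norm_num : (0:ℝ) < 2))] with n hf hK hδ2 z hz
  have hδ := B.pos n
  have hD := B.D_pos n z
  have hη := B.hη0 n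
  have hDδ : δ n ≤ B.D n z := le_add_of_nonneg_right (norm_nonneg _)
  have hDd : ‖z - z₁ n‖ ≤ B.D n z := le_add_of_nonneg_left hδ.le
  have hp := B.p₁_pos n
  have hpk := B.p₁_mul_le n
  set v := cis (α n) * B.field n z with hv
  set E := B.D n z with hE
  set X := (E ^ 2 * √E)⁻¹ with hX
  set F := 2 * (1 + k / c) with hF
  have hF0 : 0 < F := by positivity
  have hfv : ‖v‖ ≤ F * E := hf z hz
  have hsE : 0 < √E := Real.sqrt_pos.2 hD
  have hEE : √E * √E = E := Real.mul_self_sqrt hD.le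
  have hδδ : √(δ n) * √(δ n) = δ n := Real.mul_self_sqrt hδ.le
  have hss : √(δ n) ≤ √E := Real.sqrt_le_sqrt hDδ
  have hX0 : 0 < X := by positivity
  have hE4 : E ≤ 4 := by
    have h1 := norm_sub_le z (z₁ n)
    have h2 := mem_closedBall_zero_iff.1 hz
    have h3 := B.norm_z₁_le n
    have h4 : E = δ n + ‖z - z₁ n‖ := rfl
    linarith
  have hsE2 : √E ≤ 2 := by rw [Real.sqrt_le_left two_pos.le]; linarith
  have e3 : δ n * (E ^ 3)⁻¹ ≤ √(δ n) * X := by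
    have : (E ^ 3)⁻¹ = (√E)⁻¹ * X := by
      rw [hX, ← mul_inv]; congr 1; rw [show √E * (E ^ 2 * √E) = √E * √E * E ^ 2 by ring, hEE]; ring
    rw [this, ← mul_assoc]
    gcongr
    rw [← div_eq_mul_inv, div_le_iff₀ hsE]
    nlinarith [Real.sqrt_nonneg (δ n)]
  have e2 : (E ^ 2)⁻¹ ≤ 2 * X := by
    have : (E ^ 2)⁻¹ = √E * X := by rw [hX]; field_simp
    rw [this]; gcongr
  have h1 : |B.p₁ n * (fderiv ℝ (K n) z v * ((wF (u n) z ^ 2)⁻¹ - (B.P n z ^ 2)⁻¹))| ≤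
      k ^ 2 * F * (2 * k * (2 * C / c ^ 3)) * η n * √(δ n) * X := by
    rw [abs_mul, abs_mul, abs_of_pos hp]
    have hA : |fderiv ℝ (K n) z v| ≤ 2 * k * (F * E) :=
      ((fderiv ℝ (K n) z).le_opNorm v).trans
        (mul_le_mul (B.abs_fderiv_K_le n hz) hfv (norm_nonneg _) (by positivity))
    calc _ ≤ B.p₁ n * ((2 * k * (F * E)) * (2 * C / c ^ 3 * (η n * δ n ^ 2 / E ^ 4))) := by
          gcongr
          refine (B.abs_inv_sq_sub n hz).trans ?_
          rw [← hE]
          gcongr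
          exact min_le_left _ _
      _ = (B.p₁ n * δ n) * (F * (2 * k * (2 * C / c ^ 3)) * η n * (δ n * (E ^ 3)⁻¹)) := by
          field_simp
      _ ≤ k ^ 2 * (F * (2 * k * (2 * C / c ^ 3)) * η n * (√(δ n) * X)) := by gcongr
      _ = _ := by ring
  have h2 : |B.p₁ n * ((fderiv ℝ (K n) z v - fderiv ℝ K₀ 1 v) * (B.P n z ^ 2)⁻¹)| ≤
      k ^ 2 * F * ((1 + 2 * L) / c ^ 2) * (ε + ‖z₁ n - 1‖ + √(δ n)) * √(δ n) * X := by
    rw [abs_mul, abs_mul, abs_of_pos hp, abs_of_nonneg (inv_nonneg.2 (sq_nonneg (B.P n z)))]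
    have hz1 : ‖z - 1‖ ≤ E + ‖z₁ n - 1‖ :=
      (norm_sub_le_norm_sub_add_norm_sub z (z₁ n) 1).trans (by linarith)
    have hA : |fderiv ℝ (K n) z v - fderiv ℝ K₀ 1 v| ≤
        (ε + L * (E + ‖z₁ n - 1‖)) * (F * E) := by
      refine (abs_sub_le _ (fderiv ℝ K₀ z v) _).trans ?_
      refine (add_le_add (hK z hz v) (hLip z hz v)).trans ?_
      rw [← add_mul]
      gcongr
    calc _ ≤ B.p₁ n * (((ε + L * (E + ‖z₁ n - 1‖)) * (F * E)) * (δ n ^ 2 / (c ^ 2 * E ^ 4))) := by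
          gcongr
          exact B.inv_P_sq_le n hz
      _ = (B.p₁ n * δ n) * (F / c ^ 2 * ((ε + L * ‖z₁ n - 1‖) * (δ n * (E ^ 3)⁻¹) +
            L * ((√(δ n) * √(δ n)) * (E ^ 2)⁻¹))) := by
          rw [hδδ]
          field_simp
          ring
      _ ≤ k ^ 2 * (F / c ^ 2 * ((ε + L * ‖z₁ n - 1‖) * (√(δ n) * X) +
            L * ((√(δ n) * √(δ n)) * (2 * X)))) := by gcongr
      _ = k ^ 2 * F / c ^ 2 * (ε + L * ‖z₁ n - 1‖ + 2 * L * √(δ n)) * √(δ n) * X := by ring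
      _ ≤ k ^ 2 * F / c ^ 2 * ((1 + 2 * L) * (ε + ‖z₁ n - 1‖ + √(δ n))) * √(δ n) * X := by
          gcongr
          nlinarith [mul_pos hL hε, mul_nonneg hL.le (norm_nonneg (z₁ n - 1)),
            Real.sqrt_nonneg (δ n), norm_nonneg (z₁ n - 1)]
      _ = _ := by ring
  have e : B.p₁ n * (fderiv ℝ (K n) z v * (wF (u n) z ^ 2)⁻¹ -
      fderiv ℝ K₀ 1 v * (B.P n z ^ 2)⁻¹) =
      B.p₁ n * (fderiv ℝ (K n) z v * ((wF (u n) z ^ 2)⁻¹ - (B.P n z ^ 2)⁻¹)) +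
      B.p₁ n * ((fderiv ℝ (K n) z v - fderiv ℝ K₀ 1 v) * (B.P n z ^ 2)⁻¹) := by ring
  rw [e]
  refine (abs_add_le _ _).trans ((add_le_add h1 h2).trans ?_)
  have hn := norm_nonneg (z₁ n - 1)
  have hs := Real.sqrt_nonneg (δ n)
  have i1 : η n ≤ η n + ε + ‖z₁ n - 1‖ + √(δ n) := by linarith
  have i2 : ε + ‖z₁ n - 1‖ + √(δ n) ≤ η n + ε + ‖z₁ n - 1‖ + √(δ n) := by linarith
  calc _ ≤ k ^ 2 * F * (2 * k * (2 * C / c ^ 3)) * (η n + ε + ‖z₁ n - 1‖ + √(δ n)) * √(δ n) * X +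
      k ^ 2 * F * ((1 + 2 * L) / c ^ 2) * (η n + ε + ‖z₁ n - 1‖ + √(δ n)) * √(δ n) * X := by
        gcongr
    _ = _ := by ring

lemma tendsto_field_error :
    Tendsto (fun n => B.p₁ n * ((∫ z in Metric.ball (0:ℂ) 1,
        fderiv ℝ (K n) z (cis (α n) * B.field n z) * (wF (u n) z ^ 2)⁻¹) -
      fderiv ℝ K₀ 1 (cis (α n) * ∫ z in Metric.ball (0:ℂ) 1,
        B.field n z * ((B.P n z : ℂ) ^ 2)⁻¹))) atTop (𝓝 0) := by
  obtain ⟨a, ha, hA⟩ := B.field_error_le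
  obtain ⟨B₁, hB₁, h1⟩ := exists_integral_disk_le (5 / 2) (by norm_num)
  have hs : Tendsto (fun n => √(δ n)) atTop (𝓝 0) := by
    simpa [Function.comp_def] using (Real.continuous_sqrt.tendsto 0).comp B.lim_δ
  have hz : Tendsto (fun n => ‖z₁ n - 1‖) atTop (𝓝 0) := by
    simpa using (B.lim_z.sub_const 1).norm
  have hlim := (B.lim_η.add hz).add hs
  rw [Metric.tendsto_nhds]
  intro ε hε
  set ε' := ε / (4 * (a * B₁)) with hε'
  have hε'0 : 0 < ε' := by positivity
  have hlt : ∀ᶠ n in atTop, η n + ‖z₁ n - 1‖ + √(δ n) < ε' :=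
    hlim.eventually (gt_mem_nhds (by simpa using hε'0))
  filter_upwards [hA ε' hε'0, hlt] with n hn hlt
  have hδ := B.pos n
  have hη := B.hη0 n
  have hs0 : 0 < √(δ n) := Real.sqrt_pos.2 hδ
  have hfc := B.continuous_field n
  have hvc : Continuous fun z => cis (α n) * B.field n z := continuous_const.mul hfc
  have i1 : IntegrableOn (fun z => fderiv ℝ (K n) z (cis (α n) * B.field n z) *
      (wF (u n) z ^ 2)⁻¹) (Metric.ball (0:ℂ) 1) := by
    have hc : Continuous fun z => fderiv ℝ (K n) z (cis (α n) * B.field n z) *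
      (wF (u n) z ^ 2)⁻¹ :=
      ((((B.data n).hK.continuous_fderiv (by norm_num)).clm_apply hvc)).mul
        (((continuous_wF (B.data n).hu).pow 2).inv₀ fun z => (pow_pos (wF_pos _ _) 2).ne')
    exact (hc.continuousOn.integrableOn_compact (isCompact_closedBall 0 1)).mono_set
      Metric.ball_subset_closedBall
  have hPc : ContinuousOn (fun z => (B.P n z ^ 2)⁻¹) (Metric.closedBall (0:ℂ) 1) :=
    ((B.continuous_P n).pow 2).continuousOn.inv₀ fun z hz => (pow_pos (B.P_pos n hz) 2).ne'
  have i2 : IntegrableOn (fun z => fderiv ℝ K₀ 1 (cis (α n) * B.field n z) *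
      (B.P n z ^ 2)⁻¹) (Metric.ball (0:ℂ) 1) :=
    ((((fderiv ℝ K₀ 1).continuous.comp hvc).continuousOn.mul hPc).integrableOn_compact
      (isCompact_closedBall 0 1)).mono_set Metric.ball_subset_closedBall
  have i3 : IntegrableOn (fun z => cis (α n) * (B.field n z * ((B.P n z : ℂ) ^ 2)⁻¹))
      (Metric.ball (0:ℂ) 1) := by
    have hc : ContinuousOn (fun z => cis (α n) * (B.field n z * ((B.P n z : ℂ) ^ 2)⁻¹))
        (Metric.closedBall (0:ℂ) 1) := by
      refine continuousOn_const.mul (hfc.continuousOn.mul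
        ((Complex.continuous_ofReal.comp (B.continuous_P n)).pow 2 |>.continuousOn.inv₀ ?_))
      intro z hz
      exact pow_ne_zero _ (Complex.ofReal_ne_zero.2 (B.P_pos n hz).ne')
    exact (hc.integrableOn_compact (isCompact_closedBall 0 1)).mono_set
      Metric.ball_subset_closedBall
  have e1 : fderiv ℝ K₀ 1 (cis (α n) * ∫ z in Metric.ball (0:ℂ) 1,
        B.field n z * ((B.P n z : ℂ) ^ 2)⁻¹) =
      ∫ z in Metric.ball (0:ℂ) 1, fderiv ℝ K₀ 1 (cis (α n) * B.field n z) * (B.P n z ^ 2)⁻¹ := by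
    rw [← integral_const_mul, ← ContinuousLinearMap.integral_comp_comm _ i3]
    refine integral_congr_ae (ae_of_all _ fun z => ?_)
    have : cis (α n) * (B.field n z * ((B.P n z : ℂ) ^ 2)⁻¹) =
        ((B.P n z ^ 2)⁻¹ : ℝ) • (cis (α n) * B.field n z) := by
      rw [Complex.real_smul]; push_cast; ring
    simp only [this, map_smul, smul_eq_mul]
    ring
  rw [e1, ← integral_sub i1 i2, ← integral_const_mul, dist_zero_right]
  have h2 := h1 (δ n) hδ (z₁ n) (fun z => ((B.p₁ n * (fderiv ℝ (K n) z (cis (α n) * B.field n z) *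
      (wF (u n) z ^ 2)⁻¹ - fderiv ℝ K₀ 1 (cis (α n) * B.field n z) * (B.P n z ^ 2)⁻¹) : ℝ) : ℂ))
    (a * (η n + ε' + ‖z₁ n - 1‖ + √(δ n)) * √(δ n)) (by positivity) (fun z hz => by
      rw [Complex.norm_real]
      change _ ≤ _ * B.D n z ^ (-(5 / 2) : ℝ)
      rw [rpow_neg_five_half (B.D_pos n z)]
      exact hn z (Metric.ball_subset_closedBall hz))
  rw [integral_complex_ofReal, Complex.norm_real] at h2
  refine h2.trans_lt ?_
  have e : δ n ^ (2 - 5 / 2 : ℝ) = (√(δ n))⁻¹ := by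
    rw [show (2 - 5 / 2 : ℝ) = -(1 / 2) by norm_num, Real.rpow_neg hδ.le, Real.sqrt_eq_rpow]
  rw [e]
  have e2 : a * (η n + ε' + ‖z₁ n - 1‖ + √(δ n)) * √(δ n) * ((√(δ n))⁻¹ * B₁) =
      a * B₁ * (η n + ε' + ‖z₁ n - 1‖ + √(δ n)) := by field_simp
  rw [e2]
  have e3 : a * B₁ * (4 * ε') = ε := by rw [hε']; field_simp
  have : a * B₁ * (η n + ε' + ‖z₁ n - 1‖ + √(δ n)) < a * B₁ * (4 * ε') := by
    gcongr
    linarith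
  linarith

end BubbleSeq

lemma cos_lt_one {φ : ℝ} (h0 : φ ≠ 0) (h : φ ∈ Ioc (-π) π) : Real.cos φ < 1 := by
  refine lt_of_le_of_ne (Real.cos_le_one φ) fun h1 => h0 ?_
  exact (Real.cos_eq_one_iff_of_lt_of_lt (by linarith [h.1, Real.pi_pos])
    (by linarith [h.2, Real.pi_pos])).1 h1

namespace BubbleSeq

variable {k M c C : ℝ} {K h u : ℕ → ℂ → ℝ} {K₀ h₀ : ℂ → ℝ} {z₁ : ℕ → ℂ} {δ l η α : ℕ → ℝ}
  (B : BubbleSeq k M c C K h u K₀ h₀ z₁ δ l η α)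
include B

lemma inv_p₁_le (n : ℕ) : (B.p₁ n)⁻¹ ≤ δ n / (2 * c) := by
  have hδ := B.pos n
  have hc := B.hc
  refine (inv_anti₀ (by positivity) (B.le_p₁ n)).trans_eq (inv_div _ _)

lemma tendsto_inv_p₁ : Tendsto (fun n => (B.p₁ n)⁻¹) atTop (𝓝 0) :=
  squeeze_zero (fun n => (inv_pos.2 (B.p₁_pos n)).le) B.inv_p₁_le
    (by simpa using B.lim_δ.div_const (2 * c))

lemma tendsto_b_div : Tendsto (fun n => B.b n * (B.p₁ n)⁻¹) atTop (𝓝 1) := by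
  have h1 : Tendsto (fun n => l n / 2 * (B.p₁ n)⁻¹) atTop (𝓝 0) := by
    refine squeeze_zero (fun n => mul_nonneg (by linarith [B.hl0 n])
      (inv_pos.2 (B.p₁_pos n)).le) (fun n => mul_le_mul_of_nonneg_right ?_
      (inv_pos.2 (B.p₁_pos n)).le) (by simpa using B.tendsto_inv_p₁.const_mul (k / 2))
    linarith [B.hlk n]
  have h2 := h1.add B.lim_z.norm
  rw [norm_one, zero_add] at h2
  refine h2.congr fun n => ?_
  have := (B.p₁_pos n).ne'
  rw [b]; field_simp

lemma tendsto_A_div : Tendsto (fun n => B.A n * (B.p₁ n)⁻¹) atTop (𝓝 0) := by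
  refine squeeze_zero' (Eventually.of_forall fun n =>
    mul_nonneg (B.A_pos n).le (inv_pos.2 (B.p₁_pos n)).le) ?_
    (by simpa using (B.lim_δ.const_mul (k ^ 2 / c)).mul B.tendsto_inv_p₁)
  filter_upwards [B.eventually_A_le] with n hA
  exact mul_le_mul_of_nonneg_right hA (inv_pos.2 (B.p₁_pos n)).le

lemma tendsto_p₁_mul_inv {φ : ℝ} (hφ : Real.cos φ < 1) :
    Tendsto (fun n => B.p₁ n * (B.A n + 2 * B.b n * (1 - Real.cos φ))⁻¹) atTop
      (𝓝 (2 * (1 - Real.cos φ))⁻¹) := by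
  have h1 := B.tendsto_A_div.add ((B.tendsto_b_div.const_mul 2).mul_const (1 - Real.cos φ))
  have h2 := h1.inv₀ (by simp; linarith)
  rw [zero_add, mul_one] at h2
  refine h2.congr fun n => ?_
  have := (B.p₁_pos n).ne'
  rw [show B.A n * (B.p₁ n)⁻¹ + 2 * (B.b n * (B.p₁ n)⁻¹) * (1 - Real.cos φ) =
    (B.A n + 2 * B.b n * (1 - Real.cos φ)) * (B.p₁ n)⁻¹ by ring, mul_inv, inv_inv, mul_comm]

lemma tendsto_integral_sin_sq : Tendsto (fun n => B.p₁ n * ∫ φ in (-π)..π,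
    2 * Real.sin φ ^ 2 * (B.p₀ n + B.p₁ n - 2 * B.b n * Real.cos φ)⁻¹) atTop (𝓝 (2 * π)) := by
  have e : ∀ n φ, B.p₀ n + B.p₁ n - 2 * B.b n * Real.cos φ =
      B.A n + 2 * B.b n * (1 - Real.cos φ) := fun n φ => by rw [A]; ring
  simp_rw [e, ← intervalIntegral.integral_const_mul]
  have hI : ∫ φ in (-π)..π, (1 + Real.cos φ) = 2 * π := by
    rw [intervalIntegral.integral_add (by simp) (Real.continuous_cos.intervalIntegrable _ _)]
    simp; ring
  rw [← hI]
  refine intervalIntegral.tendsto_integral_filter_of_dominated_convergence (fun _ => 8) ?_ ?_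
    (by simp) ?_
  · filter_upwards [B.eventually_b_pos] with n hb
    have hA := B.A_pos n
    refine Continuous.aestronglyMeasurable ?_
    refine continuous_const.mul ((by fun_prop : Continuous fun φ => 2 * Real.sin φ ^ 2).mul
      ((by fun_prop : Continuous fun φ => B.A n + 2 * B.b n * (1 - Real.cos φ)).inv₀ fun φ => ?_))
    have := mul_nonneg hb.le (sub_nonneg.2 (Real.cos_le_one φ))
    linarith
  · filter_upwards [B.eventually_b_pos, B.tendsto_b_div.eventually (lt_mem_nhds
      (by norm_num : (1:ℝ) / 2 < 1))] with n hb hb2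
    refine ae_of_all _ fun φ _ => ?_
    have hA := B.A_pos n
    have hp := B.p₁_pos n
    have hcs := sub_nonneg.2 (Real.cos_le_one φ)
    have hbc := mul_nonneg hb.le hcs
    have hpos : 0 < B.A n + 2 * B.b n * (1 - Real.cos φ) := by linarith
    rw [Real.norm_of_nonneg (by positivity)]
    rw [← div_eq_mul_inv, lt_div_iff₀ hp] at hb2
    rw [← mul_assoc, ← div_eq_mul_inv, div_le_iff₀ hpos]
    have hs : Real.sin φ ^ 2 ≤ 2 * (1 - Real.cos φ) := by
      nlinarith [Real.sin_sq_add_cos_sq φ]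
    have h3 : B.p₁ n * Real.sin φ ^ 2 ≤ 2 * B.b n * (2 * (1 - Real.cos φ)) :=
      mul_le_mul (by linarith) hs (sq_nonneg _) (by linarith)
    linarith
  · filter_upwards [Measure.ae_ne volume 0] with φ h0 hφ
    rw [uIoc_of_le (by linarith [Real.pi_pos])] at hφ
    have hc := cos_lt_one h0 hφ
    have := (B.tendsto_p₁_mul_inv hc).const_mul (2 * Real.sin φ ^ 2)
    have e2 : 2 * Real.sin φ ^ 2 * (2 * (1 - Real.cos φ))⁻¹ = 1 + Real.cos φ := by
      have h2 : 1 - Real.cos φ ≠ 0 := by linarith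
      field_simp
      nlinarith [Real.sin_sq_add_cos_sq φ]
    rw [e2] at this
    refine this.congr fun n => by ring

lemma eventually_integral_field : ∀ᶠ n in atTop, ∫ z in Metric.ball (0:ℂ) 1,
      B.field n z * ((B.P n z : ℂ) ^ 2)⁻¹ = ((1 / (B.p₀ n - B.p₁ n + B.S n) *
        ∫ φ in (-π)..π, 2 * Real.sin φ ^ 2 *
          (B.p₀ n + B.p₁ n - 2 * B.b n * Real.cos φ)⁻¹ : ℝ) : ℂ) := by
  obtain ⟨κ, hκ, h1⟩ := B.eventually_add_ge
  filter_upwards [h1, B.eventually_b_pos, B.eventually_S_sq] with n hn hb hS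
  have hA := B.A_pos n
  refine mdl_kazdan_warner (fun z hz => B.P_pos n hz) hb hS.2.2 ?_ ?_ (hκ.trans_le hn)
  · rw [A] at hA; linarith
  · rw [S, Real.sq_sqrt (by positivity), A]; ring

lemma tendsto_area_side : Tendsto (fun n => B.p₁ n * ∫ z in Metric.ball (0:ℂ) 1,
      Real.exp (u n z) * fderiv ℝ (K n) z (cis (α n) - conj (cis (α n)) * z ^ 2)) atTop
      (𝓝 (2 * π * fderiv ℝ K₀ 1 1 / (h₀ 1 + √(h₀ 1 ^ 2 + K₀ 1)))) := by
  have h1 := B.tendsto_field_error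
  have hΦ := B.phi_pos
  have h2 : Tendsto (fun n => B.p₁ n * fderiv ℝ K₀ 1 (cis (α n) * ∫ z in Metric.ball (0:ℂ) 1,
        B.field n z * ((B.P n z : ℂ) ^ 2)⁻¹)) atTop
      (𝓝 (2 * π * fderiv ℝ K₀ 1 1 / (h₀ 1 + √(h₀ 1 ^ 2 + K₀ 1)))) := by
    have h3 := ((fderiv ℝ K₀ 1).continuous.tendsto 1).comp B.tendsto_cis_α
    have h4 := ((B.tendsto_slope.add B.tendsto_S).inv₀ hΦ.ne').mul B.tendsto_integral_sin_sq
    have h5 := h4.mul h3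
    rw [show 2 * π * fderiv ℝ K₀ 1 1 / (h₀ 1 + √(h₀ 1 ^ 2 + K₀ 1)) =
      (h₀ 1 + √(h₀ 1 ^ 2 + K₀ 1))⁻¹ * (2 * π) * fderiv ℝ K₀ 1 1 by ring]
    refine h5.congr' ?_
    filter_upwards [B.eventually_integral_field] with n hn
    rw [hn, mul_comm (cis (α n)), ← Complex.real_smul, map_smul, smul_eq_mul, Function.comp_apply]
    ring
  have h6 := h1.add h2
  rw [zero_add] at h6
  refine h6.congr fun n => ?_
  rw [mul_sub, sub_add_cancel]
  congr 1
  refine integral_congr_ae (ae_of_all _ fun z => ?_)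
  simp only
  rw [B.cis_mul_field, ← inv_pow (wF (u n) _), wF_inv_sq, mul_comm]

end BubbleSeq

lemma continuous_angDeriv {h : ℂ → ℝ} (hh : ContDiff ℝ 2 h) : Continuous (angDeriv h) :=
  continuous_iff_continuousAt.2 fun θ => (hasDerivAt_angDeriv hh θ).continuousAt

namespace BubbleSeq

variable {k M c C : ℝ} {K h u : ℕ → ℂ → ℝ} {K₀ h₀ : ℂ → ℝ} {z₁ : ℕ → ℂ} {δ l η α : ℕ → ℝ}
  (B : BubbleSeq k M c C K h u K₀ h₀ z₁ δ l η α)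
include B

lemma abs_w_sub_le (n : ℕ) {z : ℂ} (hz : z ∈ Metric.closedBall (0:ℂ) 1) :
    |B.p₁ n * ((wF (u n) z)⁻¹ - (B.P n z)⁻¹)| ≤
      k ^ 2 * (C / c ^ 2) * (min (η n) (B.D n z) * (B.D n z ^ 2)⁻¹) := by
  have hδ := B.pos n
  have hD := B.D_pos n z
  have hc := B.hc
  have hC := B.hC
  have hp := B.p₁_pos n
  have hm := B.min_nonneg n z
  rw [abs_mul, abs_of_pos hp]
  calc _ ≤ B.p₁ n * (C / c ^ 2 * (min (η n) (B.D n z) * δ n / B.D n z ^ 2)) := by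
        gcongr; exact B.abs_inv_sub n hz
    _ = (B.p₁ n * δ n) * (C / c ^ 2) * (min (η n) (B.D n z) * (B.D n z ^ 2)⁻¹) := by
        rw [div_eq_mul_inv _ (B.D n _ ^ 2)]; ring
    _ ≤ _ := by gcongr; exact B.p₁_mul_le n

lemma abs_le_D (n : ℕ) {φ : ℝ} (hφ : |φ| ≤ π) : |φ| ≤ 4 * B.D n (cis (α n + φ)) := by
  linarith [B.D_cis_ge n hφ, B.pos n]

lemma tendsto_w_sub {φ : ℝ} (hφ : |φ| ≤ π) (h0 : φ ≠ 0) :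
    Tendsto (fun n => B.p₁ n * ((wF (u n) (cis (α n + φ)))⁻¹ - (B.P n (cis (α n + φ)))⁻¹))
      atTop (𝓝 0) := by
  have hc := B.hc
  have hC := B.hC
  have hφ0 : 0 < |φ| := abs_pos.2 h0
  refine squeeze_zero_norm (a := fun n => k ^ 2 * (C / c ^ 2) * (η n * ((|φ| / 4) ^ 2)⁻¹))
    (fun n => (B.abs_w_sub_le n (cis_mem_closedBall _)).trans ?_) ?_
  · have hη := B.hη0 n
    have hD := B.abs_le_D n hφ
    have hD' := B.D_pos n (cis (α n + φ))
    gcongr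
    · exact min_le_left _ _
    · linarith
  · have := (B.lim_η.mul_const ((|φ| / 4) ^ 2)⁻¹).const_mul (k ^ 2 * (C / c ^ 2))
    rwa [zero_mul, mul_zero] at this

lemma tendsto_p₁_mul_w_inv {φ : ℝ} (hφ : φ ∈ Ioc (-π) π) (h0 : φ ≠ 0) :
    Tendsto (fun n => B.p₁ n * (wF (u n) (cis (α n + φ)))⁻¹) atTop
      (𝓝 (2 * (1 - Real.cos φ))⁻¹) := by
  have h1 := (B.tendsto_w_sub (abs_le.2 ⟨hφ.1.le, hφ.2⟩) h0).add
    (B.tendsto_p₁_mul_inv (cos_lt_one h0 hφ))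
  rw [zero_add] at h1
  refine h1.congr fun n => ?_
  rw [← B.P_cis]; ring

lemma tendsto_angDeriv (φ : ℝ) :
    Tendsto (fun n => angDeriv (h n) (α n + φ)) atTop (𝓝 (angDeriv h₀ φ)) := by
  have h1 : Tendsto (fun n => cis (α n + φ)) atTop (𝓝 (cis φ)) := by
    have := (continuous_cis.tendsto (0 + φ)).comp (B.lim_α.add_const φ)
    simpa [Function.comp_def] using this
  exact B.convh.tendsto_fderiv B.hh₀ h1 (fun n => by simp [unitCircle, norm_cis])
    (h1.const_mul Complex.I)

lemma continuous_angDeriv_shift (n : ℕ) : Continuous fun φ => angDeriv (h n) (α n + φ) :=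
  (continuous_angDeriv (B.data n).hh).comp (continuous_const.add continuous_id)

lemma tendsto_integral_angDeriv_sub :
    Tendsto (fun n => ∫ φ in (-π)..π, (angDeriv (h n) (α n + φ) - angDeriv (h n) (α n)) *
      Real.sin φ * (B.p₁ n * (wF (u n) (cis (α n + φ)))⁻¹)) atTop
      (𝓝 (∫ φ in (-π)..π, (angDeriv h₀ φ - angDeriv h₀ 0) * Real.sin φ *
        (2 * (1 - Real.cos φ))⁻¹)) := by
  have hc := B.hc
  have hk : 0 < k := by linarith [(B.data 0).hk]
  refine intervalIntegral.tendsto_integral_filter_of_dominated_convergence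
    (fun _ => 2 * k * (k ^ 2 * (16 / c))) ?_ ?_ (by simp) ?_
  · refine Eventually.of_forall fun n => Continuous.aestronglyMeasurable ?_
    exact (((B.continuous_angDeriv_shift n).sub continuous_const).mul Real.continuous_sin).mul
      (continuous_const.mul (B.continuous_w_cis_inv n))
  · refine Eventually.of_forall fun n => ae_of_all _ fun φ hφ => ?_
    rw [uIoc_of_le (by linarith [Real.pi_pos])] at hφ
    have hφ' : |φ| ≤ π := abs_le.2 ⟨hφ.1.le, hφ.2⟩
    have hδ := B.pos n
    have hD := B.D_pos n (cis (α n + φ))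
    have hp := B.p₁_pos n
    have hD2 : |φ| ^ 2 ≤ 16 * B.D n (cis (α n + φ)) ^ 2 := by
      have := B.abs_le_D n hφ'
      nlinarith [abs_nonneg φ]
    have h1 := B.lip n (α n + φ) (α n)
    rw [add_sub_cancel_left] at h1
    have h2 : |B.p₁ n * (wF (u n) (cis (α n + φ)))⁻¹| ≤
        k ^ 2 * (c * B.D n (cis (α n + φ)) ^ 2)⁻¹ := by
      rw [abs_of_pos (mul_pos hp (inv_pos.2 (wF_pos _ _)))]
      calc _ ≤ B.p₁ n * (δ n / (c * B.D n (cis (α n + φ)) ^ 2)) := by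
            gcongr; exact B.inv_w_le n (cis_mem_closedBall _)
        _ = (B.p₁ n * δ n) * (c * B.D n (cis (α n + φ)) ^ 2)⁻¹ := by
            rw [div_eq_mul_inv]; ring
        _ ≤ _ := by gcongr; exact B.p₁_mul_le n
    rw [norm_mul, norm_mul]
    calc _ ≤ 2 * k * |φ| * |φ| * (k ^ 2 * (c * B.D n (cis (α n + φ)) ^ 2)⁻¹) := by
          gcongr
          · exact h1
          · exact Real.abs_sin_le_abs
          · exact h2
      _ = 2 * k * (k ^ 2 * (|φ| ^ 2 / (c * B.D n (cis (α n + φ)) ^ 2))) := by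
          rw [div_eq_mul_inv]; ring
      _ ≤ _ := by
          gcongr 2 * k * (k ^ 2 * ?_)
          rw [div_le_div_iff₀ (by positivity) hc]
          nlinarith
  · filter_upwards [Measure.ae_ne volume 0] with φ h0 hφ
    rw [uIoc_of_le (by linarith [Real.pi_pos])] at hφ
    have h1 := B.tendsto_angDeriv 0
    simp only [add_zero] at h1
    exact (((B.tendsto_angDeriv φ).sub h1).mul_const _).mul (B.tendsto_p₁_mul_w_inv hφ h0)

lemma tendsto_integral_w_sub :
    Tendsto (fun n => ∫ φ in (-π)..π, Real.sin φ *
      (B.p₁ n * ((wF (u n) (cis (α n + φ)))⁻¹ - (B.P n (cis (α n + φ)))⁻¹))) atTop (𝓝 0) := by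
  have hc := B.hc
  have hC := B.hC
  have hk : 0 < k := by linarith [(B.data 0).hk]
  have h0 : (0:ℝ) = ∫ φ in (-π)..π, (0:ℝ) := by simp
  rw [h0]
  refine intervalIntegral.tendsto_integral_filter_of_dominated_convergence
    (fun _ => k ^ 2 * (C / c ^ 2) * 4) ?_ ?_ (by simp) ?_
  · refine Eventually.of_forall fun n => Continuous.aestronglyMeasurable ?_
    exact Real.continuous_sin.mul (continuous_const.mul
      ((B.continuous_w_cis_inv n).sub (B.continuous_P_cis_inv n)))
  · refine Eventually.of_forall fun n => ae_of_all _ fun φ hφ => ?_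
    rw [uIoc_of_le (by linarith [Real.pi_pos])] at hφ
    have hD := B.D_pos n (cis (α n + φ))
    have hφD := B.abs_le_D n (abs_le.2 ⟨hφ.1.le, hφ.2⟩)
    have hm := B.min_nonneg n (cis (α n + φ))
    rw [norm_mul]
    calc _ ≤ (4 * B.D n (cis (α n + φ))) * (k ^ 2 * (C / c ^ 2) *
          (B.D n (cis (α n + φ)) * (B.D n (cis (α n + φ)) ^ 2)⁻¹)) := by
          gcongr
          · exact Real.abs_sin_le_abs.trans hφD
          · refine (B.abs_w_sub_le n (cis_mem_closedBall _)).trans ?_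
            gcongr
            exact min_le_right _ _
      _ = _ := by field_simp
  · filter_upwards [Measure.ae_ne volume 0] with φ h0 hφ
    rw [uIoc_of_le (by linarith [Real.pi_pos])] at hφ
    simpa using (B.tendsto_w_sub (abs_le.2 ⟨hφ.1.le, hφ.2⟩) h0).const_mul (Real.sin φ)

lemma integral_sin_mul_P_inv (n : ℕ) :
    ∫ φ in (-π)..π, Real.sin φ * (B.P n (cis (α n + φ)))⁻¹ = 0 :=
  integral_odd (fun φ => by rw [B.P_cis, B.P_cis, Real.cos_neg, Real.sin_neg, neg_mul]) π

lemma tendsto_boundary_side : Tendsto (fun n => B.p₁ n * ∫ θ in (-π)..π,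
      Real.exp (u n (cis θ) / 2) * fderiv ℝ (h n) (cis θ) (Complex.I * cis θ) *
        Real.sin (θ - α n)) atTop
      (𝓝 (∫ φ in (-π)..π, (angDeriv h₀ φ - angDeriv h₀ 0) * Real.sin φ *
        (2 * (1 - Real.cos φ))⁻¹)) := by
  have h1 := B.tendsto_angDeriv 0
  simp only [add_zero] at h1
  have h2 := B.tendsto_integral_angDeriv_sub.add (h1.mul B.tendsto_integral_w_sub)
  rw [mul_zero, add_zero] at h2
  refine h2.congr fun n => ?_
  have hper : Function.Periodic (fun θ => Real.exp (u n (cis θ) / 2) *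
      fderiv ℝ (h n) (cis θ) (Complex.I * cis θ) * Real.sin (θ - α n)) (2 * π) := fun θ => by
    simp only [cis_add_two_pi]
    rw [show θ + 2 * π - α n = θ - α n + 2 * π by ring, Real.sin_add_two_pi]
  have hw := B.continuous_w_cis_inv n
  have hP := B.continuous_P_cis_inv n
  have hg := B.continuous_angDeriv_shift n
  have c1 : Continuous fun φ => (angDeriv (h n) (α n + φ) - angDeriv (h n) (α n)) *
      Real.sin φ * (B.p₁ n * (wF (u n) (cis (α n + φ)))⁻¹) :=
    ((hg.sub continuous_const).mul Real.continuous_sin).mul (continuous_const.mul hw)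
  have c2 : Continuous fun φ => angDeriv (h n) (α n) * (Real.sin φ *
      (B.p₁ n * ((wF (u n) (cis (α n + φ)))⁻¹ - (B.P n (cis (α n + φ)))⁻¹))) :=
    continuous_const.mul (Real.continuous_sin.mul (continuous_const.mul (hw.sub hP)))
  have c3 : Continuous fun φ => angDeriv (h n) (α n) * B.p₁ n *
      (Real.sin φ * (B.P n (cis (α n + φ)))⁻¹) :=
    continuous_const.mul (Real.continuous_sin.mul hP)
  have h3 : ∫ φ in (-π)..π, angDeriv (h n) (α n) * B.p₁ n *
      (Real.sin φ * (B.P n (cis (α n + φ)))⁻¹) = 0 := by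
    rw [intervalIntegral.integral_const_mul, B.integral_sin_mul_P_inv, mul_zero]
  have c12 := (c1.add c2 :)
  rw [integral_periodic_shift hper (α n), ← intervalIntegral.integral_const_mul,
    ← intervalIntegral.integral_const_mul, ← add_zero (_ + _), ← h3,
    ← intervalIntegral.integral_add (c1.intervalIntegrable _ _) (c2.intervalIntegrable _ _)]
  refine (intervalIntegral.integral_add (c12.intervalIntegrable _ _)
      (c3.intervalIntegrable _ _)).symm.trans ?_
  refine intervalIntegral.integral_congr fun φ _ => ?_
  simp only [Pi.add_apply, add_sub_cancel_left, ← wF_inv, angDeriv]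
  ring

theorem integral_angDeriv_eq : 2 * ∫ φ in (-π)..π, (angDeriv h₀ φ - angDeriv h₀ 0) * Real.sin φ *
    (2 * (1 - Real.cos φ))⁻¹ = π * fderiv ℝ K₀ 1 1 / (h₀ 1 + √(h₀ 1 ^ 2 + K₀ 1)) := by
  have h1 := B.tendsto_boundary_side.const_mul 4
  have h2 := tendsto_nhds_unique B.tendsto_area_side (h1.congr fun n => by
    rw [kazdan_warner (B.data n).hK (B.data n).hu (B.data n).hh (B.data n).hs (α n)]; ring)
  rw [show 2 * π * fderiv ℝ K₀ 1 1 / (h₀ 1 + √(h₀ 1 ^ 2 + K₀ 1)) =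
    2 * (π * fderiv ℝ K₀ 1 1 / (h₀ 1 + √(h₀ 1 ^ 2 + K₀ 1))) by ring] at h2
  linarith

end BubbleSeq

/-! ### Arc length on the circle -/

lemma lipschitzWith_cis : LipschitzWith 1 cis :=
  LipschitzWith.of_dist_le_mul fun θ α => by
    simpa [dist_eq_norm] using norm_cis_sub_le θ α

lemma le_norm_cis_sub_cis {r θ φ : ℝ} (hr : r ≤ 1) (h : |θ - φ| ≤ r) :
    (1 - r) * |θ - φ| ≤ ‖cis θ - cis φ‖ := by
  rw [norm_cis_sub_cis]
  set x := |(θ - φ) / 2| with hx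
  have hx0 : 0 ≤ x := abs_nonneg _
  have hx2 : |θ - φ| = 2 * x := by rw [hx, abs_div, abs_two]; ring
  have h1 : x ≤ r / 2 := by rw [hx2] at h; linarith
  have h2 : |Real.sin ((θ - φ) / 2)| = Real.sin x := by
    rw [hx]
    rcases abs_cases ((θ - φ) / 2) with ⟨h3, h4⟩ | ⟨h3, h4⟩
    · rw [h3, abs_of_nonneg]
      exact Real.sin_nonneg_of_nonneg_of_le_pi h4 (by linarith [Real.pi_gt_three])
    · rw [h3, Real.sin_neg, abs_of_nonpos]
      exact Real.sin_nonpos_of_nonpos_of_neg_pi_le h4.le (by linarith [Real.pi_gt_three])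
  rw [h2, hx2]
  rcases hx0.eq_or_lt with h0 | h0
  · simp [← h0]
  · have h3 := Real.sin_gt_sub_cube h0
    have h4 : x ^ 3 ≤ x * (2 * r) := by
      have : x ^ 2 ≤ 1 * r := by rw [sq]; exact mul_le_mul (by linarith) (by linarith) hx0 one_pos.le
      nlinarith
    nlinarith

lemma volume_le_hausdorffMeasure_image {r : ℝ} (hr : r < 1) {s : Set ℝ}
    (hs : s ⊆ Ioc (-π) π) (hd : ∀ x ∈ s, ∀ y ∈ s, |x - y| ≤ r) :
    volume s ≤ ENNReal.ofReal (1 - r)⁻¹ * (μH[1] : Measure ℂ) (cis '' s) := by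
  set g := Function.invFunOn cis (Ioc (-π) π)
  have hg : LeftInvOn g cis (Ioc (-π) π) := cis_injOn.leftInvOn_invFunOn
  have hL : LipschitzOnWith (1 - r)⁻¹.toNNReal g (cis '' s) := by
    refine LipschitzOnWith.of_dist_le_mul ?_
    rintro _ ⟨x, hx, rfl⟩ _ ⟨y, hy, rfl⟩
    have h0 : (0:ℝ) < 1 - r := by linarith
    rw [hg (hs hx), hg (hs hy), Real.coe_toNNReal _ (inv_pos.2 h0).le, Real.dist_eq, dist_eq_norm,
      inv_mul_eq_div, le_div_iff₀ h0, mul_comm]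
    exact le_norm_cis_sub_cis hr.le (hd x hx y hy)
  have h1 := hL.hausdorffMeasure_image_le (d := 1) zero_le_one
  rw [image_image, image_congr (fun x hx => hg (hs hx)), image_id', hausdorffMeasure_real,
    ENNReal.rpow_one] at h1
  exact h1

lemma hausdorffMeasure_cis_image {s : Set ℝ} (hm : MeasurableSet s) (hs : s ⊆ Ioc (-π) π) :
    (μH[1] : Measure ℂ) (cis '' s) = volume s := by
  have hle : (μH[1] : Measure ℂ) (cis '' s) ≤ volume s := by
    have := lipschitzWith_cis.hausdorffMeasure_image_le (d := 1) zero_le_one s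
    rwa [hausdorffMeasure_real, ENNReal.coe_one, ENNReal.one_rpow, one_mul] at this
  refine hle.antisymm ?_
  have hfin : volume s ≠ ⊤ := ((measure_mono hs).trans_lt (by simp)).ne
  have key : ∀ r ∈ Ioo (0:ℝ) 1,
      volume s ≤ ENNReal.ofReal (1 - r)⁻¹ * (μH[1] : Measure ℂ) (cis '' s) := by
    intro r hr
    set I : ℤ → Set ℝ := fun i => s ∩ Ioc (0 + i • r) (0 + (i + 1) • r) with hI
    have hIs : ∀ i, I i ⊆ s := fun i => inter_subset_left
    have hIm : ∀ i, MeasurableSet (I i) := fun i => hm.inter measurableSet_Ioc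
    have hU : ⋃ i, I i = s := by
      rw [← inter_iUnion, iUnion_Ioc_add_zsmul hr.1, inter_univ]
    have hd : Pairwise (Function.onFun Disjoint I) := fun i j hij =>
      (pairwise_disjoint_Ioc_add_zsmul 0 r hij).mono inter_subset_right inter_subset_right
    have hd' : Pairwise (Function.onFun Disjoint fun i => cis '' I i) := fun i j hij =>
      (hd hij).image (cis_injOn.mono hs) (hIs i) (hIs j)
    have hm' : ∀ i, MeasurableSet (cis '' I i) := fun i =>
      (hIm i).image_of_continuousOn_injOn continuous_cis.continuousOn
        (cis_injOn.mono ((hIs i).trans hs))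
    calc volume s = ∑' i, volume (I i) := by rw [← measure_iUnion hd hIm, hU]
      _ ≤ ∑' i, ENNReal.ofReal (1 - r)⁻¹ * (μH[1] : Measure ℂ) (cis '' I i) := by
          refine ENNReal.tsum_le_tsum fun i =>
            volume_le_hausdorffMeasure_image hr.2 ((hIs i).trans hs) ?_
          rintro x ⟨-, hx⟩ y ⟨-, hy⟩
          simp only [zero_add, add_smul, one_smul] at hx hy
          rw [abs_le]
          constructor <;> linarith [hx.1, hx.2, hy.1, hy.2]
      _ = ENNReal.ofReal (1 - r)⁻¹ * (μH[1] : Measure ℂ) (cis '' s) := by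
          rw [ENNReal.tsum_mul_left, ← measure_iUnion hd' hm', ← image_iUnion, hU]
  have hlim : Tendsto (fun r : ℝ => ENNReal.ofReal (1 - r)⁻¹ * (μH[1] : Measure ℂ) (cis '' s))
      (𝓝[>] 0) (𝓝 (1 * (μH[1] : Measure ℂ) (cis '' s))) := by
    refine ENNReal.Tendsto.mul_const ?_ (Or.inl one_ne_zero)
    have h1 : Tendsto (fun r : ℝ => (1 - r)⁻¹) (𝓝[>] 0) (𝓝 1) := by
      have : ContinuousAt (fun r : ℝ => (1 - r)⁻¹) 0 := by
        refine ContinuousAt.inv₀ (by fun_prop) (by norm_num)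
      have h2 := this.tendsto
      simp only [sub_zero, inv_one] at h2
      exact h2.mono_left nhdsWithin_le_nhds
    simpa [Function.comp_def] using (ENNReal.continuous_ofReal.tendsto 1).comp h1
  rw [one_mul] at hlim
  refine ge_of_tendsto hlim ?_
  filter_upwards [Ioo_mem_nhdsGT (zero_lt_one' ℝ)] with r hr using key r hr

lemma unitCircle_eq : unitCircle = cis '' Ioc (-π) π := by
  ext z
  constructor
  · intro hz
    obtain ⟨θ, hθ, h⟩ := exists_polar z
    rw [mem_sphere_zero_iff_norm.1 hz, Complex.ofReal_one, one_mul] at h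
    exact ⟨θ, hθ, h.symm⟩
  · rintro ⟨θ, -, rfl⟩
    simp [unitCircle, norm_cis]

lemma arcMeasure_restrict : arcMeasure.restrict unitCircle = circMeas := by
  ext s hs
  rw [circMeas, Measure.map_apply measurable_cis hs, Measure.restrict_apply hs,
    Measure.restrict_apply (measurable_cis hs), unitCircle_eq, ← image_preimage_inter,
    arcMeasure, hausdorffMeasure_cis_image ((measurable_cis hs).inter measurableSet_Ioc)
      inter_subset_right]

lemma massMeasure_univ_le {u : ℂ → ℝ} (hu : Continuous u) {C : ℝ}
    (h : (∫ z in unitDisk, Real.exp (u z)) +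
      (∫ z in unitCircle, Real.exp (u z / 2) ∂arcMeasure) ≤ C) :
    massMeasure u univ ≤ ENNReal.ofReal C := by
  have i1 : IntegrableOn (fun z => Real.exp (u z)) (Metric.ball (0:ℂ) 1) :=
    ((Real.continuous_exp.comp hu).continuousOn.integrableOn_compact
      (isCompact_closedBall 0 1)).mono_set Metric.ball_subset_closedBall
  have hc : Continuous fun θ => Real.exp (u (cis θ) / 2) :=
    Real.continuous_exp.comp ((hu.comp continuous_cis).div_const 2)
  have hc' : Continuous fun z => Real.exp (u z / 2) := Real.continuous_exp.comp (hu.div_const 2)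
  have i2 : IntegrableOn (fun θ => Real.exp (u (cis θ) / 2)) (Ioc (-π) π) :=
    (hc.continuousOn.integrableOn_compact isCompact_Icc).mono_set Ioc_subset_Icc_self
  have e2 : ∫ z in unitCircle, Real.exp (u z / 2) ∂arcMeasure =
      ∫ θ in Ioc (-π) π, Real.exp (u (cis θ) / 2) := by
    rw [arcMeasure_restrict, circMeas, integral_map measurable_cis.aemeasurable
      hc'.aestronglyMeasurable]
  rw [e2, unitDisk] at h
  rw [← lintegral_one, lintegral_massMeasure hu measurable_const]
  simp only [mul_one]
  refine le_trans (le_of_eq ?_) (ENNReal.ofReal_le_ofReal h)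
  rw [ENNReal.ofReal_add (integral_nonneg fun z => (Real.exp_pos _).le)
    (integral_nonneg fun z => (Real.exp_pos _).le),
    ofReal_integral_eq_lintegral_ofReal i1 (ae_of_all _ fun z => (Real.exp_pos _).le),
    ofReal_integral_eq_lintegral_ofReal i2 (ae_of_all _ fun z => (Real.exp_pos _).le)]

/-! ### The principal value -/

/-- Half the cotangent of the half angle. -/
def halfCot (φ : ℝ) : ℝ := Real.sin φ * (2 * (1 - Real.cos φ))⁻¹

lemma halfCot_neg (φ : ℝ) : halfCot (-φ) = -halfCot φ := by
  simp [halfCot]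

lemma halfCot_pi : halfCot π = 0 := by simp [halfCot]

lemma measurable_halfCot : Measurable halfCot := by unfold halfCot; fun_prop

lemma hasDerivAt_halfCot {φ : ℝ} (h : Real.cos φ < 1) :
    HasDerivAt halfCot (-(2 * (1 - Real.cos φ))⁻¹) φ := by
  have h1 : HasDerivAt (fun φ => 2 * (1 - Real.cos φ)) (2 * Real.sin φ) φ := by
    simpa using ((Real.hasDerivAt_cos φ).const_sub 1).const_mul 2
  have h0 : 1 - Real.cos φ ≠ 0 := by linarith
  have h2 := (Real.hasDerivAt_sin φ).mul (h1.inv (mul_ne_zero two_ne_zero h0))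
  refine h2.congr_deriv ?_
  simp only [Pi.inv_apply]
  field_simp
  nlinarith [Real.sin_sq_add_cos_sq φ]

lemma abs_halfCot_mul_le {φ : ℝ} (h : |φ| ≤ π) : |φ| * |halfCot φ| ≤ π ^ 2 / 4 := by
  rcases eq_or_ne φ 0 with rfl | h0
  · simp; positivity
  have h1 := Real.cos_le_one_sub_mul_cos_sq h
  have hφ : 0 < φ ^ 2 := by positivity
  have h2 : 2 / π ^ 2 * φ ^ 2 ≤ 1 - Real.cos φ := by linarith
  have h3 : 0 < 2 / π ^ 2 * φ ^ 2 := by positivity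
  rw [halfCot, abs_mul, abs_of_pos (inv_pos.2 (by linarith : 0 < 2 * (1 - Real.cos φ)))]
  calc _ ≤ |φ| * (|φ| * (2 * (2 / π ^ 2 * φ ^ 2))⁻¹) := by
        have h4 : (2 * (1 - Real.cos φ))⁻¹ ≤ (2 * (2 / π ^ 2 * φ ^ 2))⁻¹ :=
          inv_anti₀ (by positivity) (by linarith)
        exact mul_le_mul_of_nonneg_left (mul_le_mul Real.abs_sin_le_abs h4
          (inv_pos.2 (by linarith)).le (abs_nonneg _)) (abs_nonneg _)
    _ = |φ| ^ 2 * (2 * (2 / π ^ 2 * φ ^ 2))⁻¹ := by ring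
    _ = π ^ 2 / 4 := by rw [sq_abs]; field_simp; norm_num

lemma exists_angDeriv_lipschitz {h : ℂ → ℝ} (hh : ContDiff ℝ 2 h) :
    ∃ L : ℝ, 0 ≤ L ∧ ∀ θ φ, |angDeriv h θ - angDeriv h φ| ≤ L * |θ - φ| := by
  obtain ⟨k₁, h1⟩ := (isCompact_sphere (0:ℂ) 1).exists_bound_of_continuousOn
    (hh.continuous_fderiv (by norm_num)).continuousOn
  obtain ⟨k₂, h2⟩ := (isCompact_sphere (0:ℂ) 1).exists_bound_of_continuousOn
    ((hh.fderiv_right (m := 1) (by norm_num)).continuous_fderiv (by norm_num)).continuousOn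
  refine ⟨2 * max (max k₁ k₂) 0, by positivity, abs_angDeriv_sub_le hh
    (fun z hz => (h1 z hz).trans ?_) (fun z hz => (h2 z hz).trans ?_)⟩
  · exact (le_max_left k₁ k₂).trans (le_max_left _ _)
  · exact (le_max_right k₁ k₂).trans (le_max_left _ _)

section

variable {h : ℂ → ℝ} (hh : ContDiff ℝ 2 h)
include hh

lemma intervalIntegrable_angDeriv_mul_halfCot :
    IntervalIntegrable (fun φ => (angDeriv h φ - angDeriv h 0) * halfCot φ) volume (-π) π := by
  obtain ⟨L, hL, h1⟩ := exists_angDeriv_lipschitz hh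
  have hm : Measurable fun φ => (angDeriv h φ - angDeriv h 0) * halfCot φ :=
    ((continuous_angDeriv hh).measurable.sub_const _).mul measurable_halfCot
  refine IntervalIntegrable.mono_fun' (g := fun _ => L * (π ^ 2 / 4)) (by simp)
    hm.aestronglyMeasurable ?_
  filter_upwards [ae_restrict_mem measurableSet_uIoc] with φ hφ
  rw [uIoc_of_le (by linarith [Real.pi_pos])] at hφ
  have h2 := h1 φ 0
  rw [sub_zero] at h2
  have h3 := abs_halfCot_mul_le (abs_le.2 ⟨hφ.1.le, hφ.2⟩)
  rw [norm_mul]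
  calc _ ≤ L * |φ| * |halfCot φ| := mul_le_mul_of_nonneg_right h2 (abs_nonneg _)
    _ = L * (|φ| * |halfCot φ|) := by ring
    _ ≤ _ := by gcongr

lemma integral_angDeriv_mul_halfCot :
    IntervalIntegrable (fun φ => (angDeriv h φ - angDeriv h (-φ)) * halfCot φ) volume 0 π ∧
    ∫ φ in (-π)..π, (angDeriv h φ - angDeriv h 0) * halfCot φ =
      ∫ φ in (0:ℝ)..π, (angDeriv h φ - angDeriv h (-φ)) * halfCot φ := by
  have hi := intervalIntegrable_angDeriv_mul_halfCot hh
  have hπ := Real.pi_pos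
  have i1 : IntervalIntegrable (fun φ => (angDeriv h φ - angDeriv h 0) * halfCot φ) volume 0 π :=
    hi.mono_set (uIcc_subset_uIcc (by rw [uIcc_of_le] <;> [constructor; skip] <;> linarith)
      right_mem_uIcc)
  have i2 : IntervalIntegrable (fun φ => (angDeriv h φ - angDeriv h 0) * halfCot φ) volume (-π) 0 :=
    hi.mono_set (uIcc_subset_uIcc left_mem_uIcc
      (by rw [uIcc_of_le] <;> [constructor; skip] <;> linarith))
  have i3 : IntervalIntegrable (fun φ => (angDeriv h (-φ) - angDeriv h 0) * halfCot (-φ))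
      volume 0 π := by
    have := (IntervalIntegrable.iff_comp_neg).1 i2
    rw [neg_neg, neg_zero] at this
    exact this.symm
  have e : ∀ φ, (angDeriv h φ - angDeriv h (-φ)) * halfCot φ =
      (angDeriv h φ - angDeriv h 0) * halfCot φ +
        (angDeriv h (-φ) - angDeriv h 0) * halfCot (-φ) := fun φ => by rw [halfCot_neg]; ring
  simp_rw [e]
  refine ⟨i1.add i3, ?_⟩
  rw [intervalIntegral.integral_add i1 i3, ← intervalIntegral.integral_add_adjacent_intervals i2 i1,
    intervalIntegral.integral_comp_neg (fun φ => (angDeriv h φ - angDeriv h 0) * halfCot φ),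
    neg_zero, add_comm]

lemma hasDerivAt_even_part (φ : ℝ) :
    HasDerivAt (fun φ => h (cis φ) + h (cis (-φ)) - 2 * h 1) (angDeriv h φ - angDeriv h (-φ)) φ := by
  have h2 := (hasDerivAt_comp_cis hh (-φ)).comp φ (hasDerivAt_neg φ)
  have h3 := ((hasDerivAt_comp_cis hh φ).add h2).sub_const (2 * h 1)
  refine h3.congr_deriv ?_
  ring

lemma integral_even_part {t : ℝ} (ht : 0 < t) (htπ : t ≤ π) :
    ∫ φ in t..π, (h (cis φ) + h (cis (-φ)) - 2 * h 1) * (-(2 * (1 - Real.cos φ))⁻¹) =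
      -((h (cis t) + h (cis (-t)) - 2 * h 1) * halfCot t) -
        ∫ φ in t..π, (angDeriv h φ - angDeriv h (-φ)) * halfCot φ := by
  have hcos : ∀ φ ∈ uIcc t π, Real.cos φ < 1 := fun φ hφ => by
    rw [uIcc_of_le htπ] at hφ
    exact cos_lt_one (by linarith [hφ.1]) ⟨by linarith [hφ.1, Real.pi_pos], hφ.2⟩
  have hc := continuous_angDeriv hh
  rw [intervalIntegral.integral_mul_deriv_eq_deriv_mul
    (u := fun φ => h (cis φ) + h (cis (-φ)) - 2 * h 1) (v := halfCot)
    (u' := fun φ => angDeriv h φ - angDeriv h (-φ))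
    (fun φ _ => hasDerivAt_even_part hh φ)
    (fun φ hφ => hasDerivAt_halfCot (hcos φ hφ))
    ((hc.sub (hc.comp continuous_neg)).intervalIntegrable _ _)]
  · rw [halfCot_pi, mul_zero, zero_sub]
  · refine ContinuousOn.intervalIntegrable fun φ hφ => ContinuousAt.continuousWithinAt ?_
    have := hcos φ hφ
    exact (ContinuousAt.inv₀ (by fun_prop) (by linarith)).neg

lemma tendsto_even_part_mul_halfCot :
    Tendsto (fun t => (h (cis t) + h (cis (-t)) - 2 * h 1) * halfCot t) (𝓝[>] 0) (𝓝 0) := by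
  obtain ⟨L, hL, h1⟩ := exists_angDeriv_lipschitz hh
  refine squeeze_zero_norm' (a := fun t => 2 * L * t * (π ^ 2 / 4)) ?_ ?_
  · filter_upwards [Ioo_mem_nhdsGT Real.pi_pos] with t ht
    have h2 := (convex_Icc 0 t).norm_image_sub_le_of_norm_hasDerivWithin_le
      (f := fun φ => h (cis φ) + h (cis (-φ)) - 2 * h 1) (C := 2 * L * t)
      (fun φ _ => (hasDerivAt_even_part hh φ).hasDerivWithinAt)
      (fun φ hφ => by
        refine (h1 φ (-φ)).trans ?_
        rw [sub_neg_eq_add, abs_of_nonneg (by linarith [hφ.1])]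
        nlinarith [hφ.2])
      (left_mem_Icc.2 ht.1.le) (right_mem_Icc.2 ht.1.le)
    have h3 : h (cis 0) + h (cis (-0)) - 2 * h 1 = 0 := by simp [cis]; ring
    rw [h3, sub_zero, sub_zero, Real.norm_of_nonneg ht.1.le] at h2
    have h4 := abs_halfCot_mul_le (φ := t) (by rw [abs_of_pos ht.1]; exact ht.2.le)
    rw [abs_of_pos ht.1] at h4
    have ht0 := ht.1
    rw [norm_mul]
    calc _ ≤ 2 * L * t * t * |halfCot t| := mul_le_mul_of_nonneg_right h2 (abs_nonneg _)
      _ = 2 * L * t * (t * |halfCot t|) := by ring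
      _ ≤ _ := by gcongr
  · have : Tendsto (fun t : ℝ => 2 * L * t * (π ^ 2 / 4)) (𝓝 0) (𝓝 (2 * L * 0 * (π ^ 2 / 4))) :=
      Continuous.tendsto (by fun_prop) 0
    rw [mul_zero, zero_mul] at this
    exact this.mono_left nhdsWithin_le_nhds

lemma tendsto_integral_even_part :
    Tendsto (fun t => ∫ φ in t..π,
        (h (cis φ) + h (cis (-φ)) - 2 * h 1) * (-(2 * (1 - Real.cos φ))⁻¹)) (𝓝[>] 0)
      (𝓝 (-∫ φ in (-π)..π, (angDeriv h φ - angDeriv h 0) * halfCot φ)) := by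
  obtain ⟨hi, he⟩ := integral_angDeriv_mul_halfCot hh
  rw [he]
  have h1 := (intervalIntegral.continuousOn_primitive_interval_left
    ((intervalIntegrable_iff').1 hi)) 0 left_mem_uIcc
  have h2 : Tendsto (fun t => ∫ φ in t..π, (angDeriv h φ - angDeriv h (-φ)) * halfCot φ) (𝓝[>] 0)
      (𝓝 (∫ φ in (0:ℝ)..π, (angDeriv h φ - angDeriv h (-φ)) * halfCot φ)) := by
    refine h1.mono_left (nhdsWithin_le_of_mem ?_)
    filter_upwards [Ioo_mem_nhdsGT Real.pi_pos] with t ht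
    rw [uIcc_of_le Real.pi_pos.le]
    exact Ioo_subset_Icc_self ht
  have h3 := (tendsto_even_part_mul_halfCot hh).neg.sub h2
  rw [neg_zero, zero_sub] at h3
  refine h3.congr' ?_
  filter_upwards [Ioo_mem_nhdsGT Real.pi_pos] with t ht
  rw [integral_even_part hh ht.1 ht.2.le]

lemma setIntegral_circle_sdiff_ball {ε : ℝ} (hε : ε ∈ Ioo (0:ℝ) 2) :
    ∫ z in unitCircle \ Metric.ball 1 ε, (h 1 - h z) / (2 * (1 - z.re)) ∂arcMeasure =
      ∫ φ in (2 * Real.arcsin (ε / 2))..π,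
        (h (cis φ) + h (cis (-φ)) - 2 * h 1) * (-(2 * (1 - Real.cos φ))⁻¹) := by
  set t := 2 * Real.arcsin (ε / 2) with ht
  have hεm : ε / 2 ∈ Icc (-1:ℝ) 1 := ⟨by linarith [hε.1], by linarith [hε.2]⟩
  have ht0 : 0 < t := by
    have := Real.arcsin_pos.2 (half_pos hε.1); linarith
  have htπ : t ≤ π := by linarith [Real.arcsin_le_pi_div_two (ε / 2)]
  have hset : cis ⁻¹' (Metric.ball 1 ε)ᶜ ∩ Ioc (-π) π = Ioc (-π) (-t) ∪ Icc t π := by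
    have key : ∀ θ ∈ Ioc (-π) π, cis θ ∈ (Metric.ball 1 ε)ᶜ ↔ t ≤ |θ| := by
      intro θ hθ
      have hθ' : |θ| ≤ π := abs_le.2 ⟨hθ.1.le, hθ.2⟩
      have e1 : |Real.sin ((θ - 0) / 2)| = Real.sin (|θ| / 2) := by
        rw [sub_zero]
        rcases abs_cases θ with ⟨h3, h4⟩ | ⟨h3, h4⟩
        · rw [h3, abs_of_nonneg]
          exact Real.sin_nonneg_of_nonneg_of_le_pi (by linarith) (by linarith [hθ.2])
        · rw [h3, neg_div, Real.sin_neg, abs_of_nonpos]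
          exact Real.sin_nonpos_of_nonpos_of_neg_pi_le (by linarith) (by linarith [hθ.1])
      have e0 : (1:ℂ) = cis 0 := by simp [cis]
      rw [mem_compl_iff, Metric.mem_ball, not_lt, dist_eq_norm, e0, norm_cis_sub_cis, e1, ht]
      have := Real.arcsin_le_iff_le_sin hεm (y := |θ| / 2)
        ⟨by linarith [abs_nonneg θ, Real.pi_pos], by linarith⟩
      constructor
      · intro h5
        have := this.2 (by linarith)
        linarith
      · intro h5
        have := this.1 (by linarith)
        linarith
    ext θ
    constructor
    · rintro ⟨h1, h2⟩
      rcases le_abs'.1 ((key θ h2).1 h1) with h3 | h3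
      · exact Or.inl ⟨h2.1, h3⟩
      · exact Or.inr ⟨h3, h2.2⟩
    · rintro (h1 | h1)
      · have h2 : θ ∈ Ioc (-π) π := ⟨h1.1, by linarith [h1.2]⟩
        exact ⟨(key θ h2).2 (le_abs'.2 (Or.inl h1.2)), h2⟩
      · have h2 : θ ∈ Ioc (-π) π := ⟨by linarith [h1.1, Real.pi_pos], h1.2⟩
        exact ⟨(key θ h2).2 (le_abs'.2 (Or.inr h1.1)), h2⟩
  have hmeas : Measurable fun z : ℂ => (h 1 - h z) / (2 * (1 - z.re)) := by
    have := hh.continuous.measurable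
    fun_prop
  set f : ℝ → ℝ := fun φ => (h 1 - h (cis φ)) / (2 * (1 - Real.cos φ)) with hf
  have hcont : ∀ φ, Real.cos φ < 1 → ContinuousAt f φ := fun φ hφ => by
    have h1 := hh.continuous.comp continuous_cis
    exact (continuousAt_const.sub h1.continuousAt).div (by fun_prop) (by linarith)
  have i1 : IntervalIntegrable f volume (-π) (-t) := by
    refine ContinuousOn.intervalIntegrable fun φ hφ => (hcont φ ?_).continuousWithinAt
    rw [uIcc_of_le (by linarith)] at hφ
    rw [← Real.cos_neg]
    exact cos_lt_one (by linarith [hφ.2]) ⟨by linarith [hφ.2, Real.pi_pos], by linarith [hφ.1]⟩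
  have i2 : IntervalIntegrable f volume t π := by
    refine ContinuousOn.intervalIntegrable fun φ hφ => (hcont φ ?_).continuousWithinAt
    rw [uIcc_of_le htπ] at hφ
    exact cos_lt_one (by linarith [hφ.1]) ⟨by linarith [hφ.1, Real.pi_pos], hφ.2⟩
  have i3 : IntervalIntegrable (fun φ => f (-φ)) volume t π := by
    have := (IntervalIntegrable.iff_comp_neg).1 i1
    rw [neg_neg, neg_neg] at this
    exact this.symm
  rw [sdiff_eq, inter_comm, ← Measure.restrict_restrict Metric.isOpen_ball.measurableSet.compl,
    arcMeasure_restrict, circMeas, setIntegral_map Metric.isOpen_ball.measurableSet.compl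
      hmeas.aestronglyMeasurable measurable_cis.aemeasurable,
    Measure.restrict_restrict (measurable_cis Metric.isOpen_ball.measurableSet.compl), hset]
  simp_rw [cis_re]
  have hdisj : Disjoint (Ioc (-π) (-t)) (Icc t π) := by
    rw [disjoint_left]
    intro φ h1 h2
    linarith [h1.2, h2.1]
  rw [setIntegral_union hdisj measurableSet_Icc
      ((intervalIntegrable_iff_integrableOn_Ioc_of_le (by linarith)).1 i1)
      ((intervalIntegrable_iff_integrableOn_Icc_of_le htπ).1 i2),
    integral_Icc_eq_integral_Ioc, ← intervalIntegral.integral_of_le (by linarith),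
    ← intervalIntegral.integral_of_le htπ, ← intervalIntegral.integral_comp_neg f,
    ← intervalIntegral.integral_add i3 i2]
  refine intervalIntegral.integral_congr fun φ _ => ?_
  simp only [hf, Real.cos_neg]
  ring

lemma tendsto_principal_value :
    Tendsto (fun ε => ∫ z in unitCircle \ Metric.ball 1 ε,
        (h 1 - h z) / (2 * (1 - z.re)) ∂arcMeasure) (𝓝[>] 0)
      (𝓝 (-∫ φ in (-π)..π, (angDeriv h φ - angDeriv h 0) * halfCot φ)) := by
  have h1 : Tendsto (fun ε : ℝ => 2 * Real.arcsin (ε / 2)) (𝓝[>] 0) (𝓝[>] 0) := by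
    refine tendsto_nhdsWithin_iff.2 ⟨?_, ?_⟩
    · have : Continuous fun ε : ℝ => 2 * Real.arcsin (ε / 2) :=
        continuous_const.mul (Real.continuous_arcsin.comp (continuous_id.div_const 2))
      have h2 := this.tendsto 0
      simp only [zero_div, Real.arcsin_zero, mul_zero] at h2
      exact h2.mono_left nhdsWithin_le_nhds
    · filter_upwards [self_mem_nhdsWithin] with ε hε
      exact mul_pos two_pos (Real.arcsin_pos.2 (half_pos hε))
  refine ((tendsto_integral_even_part hh).comp h1).congr' ?_
  filter_upwards [Ioo_mem_nhdsGT (zero_lt_two' ℝ)] with ε hε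
  rw [setIntegral_circle_sdiff_ball hh hε, Function.comp_apply]

end

/-- second blow-up condition at `p = (1,0)`: the principal value
`p.v. ∫_{∂𝔻} (h(p) - h(z))/(2(1-x)) dσ(z)` exists and equals
`-(π/2) K_x(p)/Φ(p)`, i.e. `2(-Δ)^{1/2} h(p) + K_x(p)/Φ(p) = 0`. -/
theorem blowup_normal_condition
    (u Kn hn : ℕ → ℂ → ℝ) (K h : ℂ → ℝ)
    (hureg : ∀ n, ContDiff ℝ 2 (u n))
    (hKnreg : ∀ n, ContDiff ℝ 2 (Kn n)) (hKreg : ContDiff ℝ 2 K)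
    (hhnreg : ∀ n, ContDiff ℝ 2 (hn n)) (hhreg : ContDiff ℝ 2 h)
    (hKconv : TendstoC2On Kn K unitClosedDisk)
    (hhconv : TendstoC2On hn h unitCircle)
    (hsol : ∀ n, SolvesLiouville (Kn n) (hn n) (u n))
    (hblow : BlowsUp u)
    (C₀ : ℝ) (hmass : MassBound u C₀)
    (hploc : TendstoLocallyUniformlyBotOn u (unitClosedDisk \ {(1 : ℂ)})) :
    Filter.Tendsto
      (fun ε : ℝ =>
        ∫ z in unitCircle \ Metric.ball 1 ε,
          (h 1 - h z) / (2 * (1 - z.re)) ∂arcMeasure)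
      (nhdsWithin 0 (Set.Ioi 0))
      (nhds (-(Real.pi / 2) * dirDeriv 1 K 1 /
        (h 1 + Real.sqrt ((h 1) ^ 2 + K 1)))) := by
  obtain ⟨k, c, C, K', h', u', z₁, δ, l, η, α, B⟩ :=
    exists_bubbleSeq hureg hKnreg hKreg hhnreg hhreg hKconv hhconv hsol hblow
      (le_max_right C₀ 0)
      (fun n => massMeasure_univ_le (hureg n).continuous ((hmass n).trans (le_max_left _ _))) hploc
  convert tendsto_principal_value hhreg using 2
  have key := B.integral_angDeriv_eq
  simp only [mul_assoc (angDeriv h _ - angDeriv h 0)] at key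
  change 2 * ∫ φ in (-π)..π, (angDeriv h φ - angDeriv h 0) * halfCot φ = _ at key
  simp only [dirDeriv]
  linear_combination (1 / 2) * key
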